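/- Let 1 < c < 1193/889. There exist a constant C > 0 and N₀ > 0 such that for every real N ≥ N₀, setting X = (1/2)(2N/5)^{1/c} and ε = (log X)^{−2}, the weighted count B₄(N) = Σ (log p₁)(log p₂)(log p₃)(log p₄), taken over all quadruples of primes p₁, p₂, p₃, p₄ with X < pᵢ ≤ 2X for each i and |p₁^c + p₂^c + p₃^c + p₄^c − N| < ε, satisfies B₄(N) ≥ C · X^{4−c} · (log X)^{−2}. -/

import Mathlib

attribute [local instance] Classical.propDecidable

/-- The set of primes `p` with `X < p ≤ 2X`. -/
noncomputable def primesIn (X : ℝ) : Finset ℕ :=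
  (Finset.range (Nat.floor (2 * X) + 1)).filter
    (fun p => Nat.Prime p ∧ X < (p : ℝ) ∧ (p : ℝ) ≤ 2 * X)

/-- The weighted count
`B₄(N) = Σ (log p₁)(log p₂)(log p₃)(log p₄)` over quadruples of primes
`p₁,p₂,p₃,p₄ ∈ (X, 2X]` with `|p₁^c + p₂^c + p₃^c + p₄^c − N| < ε`. -/
noncomputable def B₄ (c X ε N : ℝ) : ℝ :=
  ∑ p₁ ∈ primesIn X, ∑ p₂ ∈ primesIn X, ∑ p₃ ∈ primesIn X, ∑ p₄ ∈ primesIn X,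
    if |(p₁ : ℝ) ^ c + (p₂ : ℝ) ^ c + (p₃ : ℝ) ^ c + (p₄ : ℝ) ^ c - N| < ε then
      Real.log p₁ * Real.log p₂ * Real.log p₃ * Real.log p₄
    else 0

/-- The additive character `t ↦ exp (2 π i t)`. -/
noncomputable def ee (t : ℝ) : ℂ := Complex.exp (2 * Real.pi * t * Complex.I)

lemma ee_add (s t : ℝ) : ee (s + t) = ee s * ee t := by
  simp only [ee, ← Complex.exp_add]
  congr 1
  push_cast
  ring

lemma one_le_log_of_three_le {X : ℝ} (hX : 3 ≤ X) : 1 ≤ Real.log X := by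
  rw [Real.le_log_iff_exp_le (by linarith)]
  linarith [Real.exp_one_lt_d9]

lemma norm_ee (t : ℝ) : ‖ee t‖ = 1 := by
  have : (2 * Real.pi * t * Complex.I : ℂ) = ((2 * Real.pi * t : ℝ) : ℂ) * Complex.I := by
    push_cast
    ring
  rw [ee, this, Complex.norm_exp_ofReal_mul_I]

lemma conj_ee (t : ℝ) : (starRingEnd ℂ) (ee t) = ee (-t) := by
  rw [ee, ← Complex.exp_conj, ee]
  congr 1
  simp only [map_mul, Complex.conj_ofReal, Complex.conj_I, map_ofNat]
  push_cast
  ring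

lemma ee_eq (t : ℝ) :
    ee t = Real.cos (2 * Real.pi * t) + Real.sin (2 * Real.pi * t) * Complex.I := by
  rw [ee, show (2 * Real.pi * t * Complex.I : ℂ) = ((2 * Real.pi * t : ℝ) : ℂ) * Complex.I by
    push_cast; ring, Complex.exp_mul_I]
  simp

lemma ee_intCast (k : ℤ) : ee k = 1 := by
  rw [ee, Complex.exp_eq_one_iff]
  exact ⟨k, by push_cast; ring⟩

lemma ee_sub_int (t : ℝ) (k : ℤ) : ee (t - k) = ee t := by
  have := ee_add (t - k) k
  rw [sub_add_cancel, ee_intCast, mul_one] at this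
  exact this.symm

lemma continuous_ee : Continuous ee := by
  unfold ee
  fun_prop

lemma norm_sum_ee_neg {ι : Type*} (s : Finset ι) (f : ι → ℝ) :
    ‖∑ i ∈ s, ee (-f i)‖ = ‖∑ i ∈ s, ee (f i)‖ := by
  rw [← Complex.norm_conj (∑ i ∈ s, ee (f i)), map_sum]
  simp [conj_ee]

/-- The inverse of `ee δ - 1` in terms of the cotangent. -/
lemma inv_ee_sub_one {δ : ℝ} (h : Real.sin (Real.pi * δ) ≠ 0) :
    (ee δ - 1) * (-1 / 2 - (Real.cos (Real.pi * δ) / (2 * Real.sin (Real.pi * δ)) : ℝ)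
      * Complex.I) = 1 := by
  rw [ee_eq, show 2 * Real.pi * δ = 2 * (Real.pi * δ) by ring, Real.cos_two_mul, Real.sin_two_mul]
  set s := Real.sin (Real.pi * δ)
  set k := Real.cos (Real.pi * δ)
  have hsk : s ^ 2 + k ^ 2 = 1 := Real.sin_sq_add_cos_sq _
  have hsk' : (s : ℂ) ^ 2 + (k : ℂ) ^ 2 = 1 := by exact_mod_cast hsk
  have hs : (s : ℂ) ≠ 0 := by exact_mod_cast h
  push_cast
  field_simp
  linear_combination (-2 * k * Complex.I) * hsk' - (2 * (s : ℂ) * k ^ 2) * Complex.I_sq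

lemma two_mul_le_sin_pi_mul {θ x : ℝ} (h1 : θ ≤ x) (h2 : x ≤ 1 - θ) (h0 : 0 < θ) :
    2 * θ ≤ Real.sin (Real.pi * x) := by
  have hpi := Real.pi_pos
  rcases le_total x (1 / 2) with hx | hx
  · have := Real.mul_le_sin (x := Real.pi * x) (by nlinarith) (by nlinarith)
    have h3 : 2 / Real.pi * (Real.pi * x) = 2 * x := by field_simp
    linarith
  · have := Real.mul_le_sin (x := Real.pi * (1 - x)) (by nlinarith) (by nlinarith)
    have h3 : 2 / Real.pi * (Real.pi * (1 - x)) = 2 * (1 - x) := by field_simp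
    rw [show Real.pi * (1 - x) = Real.pi - Real.pi * x by ring, Real.sin_pi_sub] at this
    rw [show Real.pi - Real.pi * x = Real.pi * (1 - x) by ring, h3] at this
    linarith

/-- The Kusmin–Landau inequality. -/
lemma kusmin_landau_zero (f : ℕ → ℝ) (N : ℕ) (θ : ℝ) (hθ : 0 < θ)
    (hlo : ∀ n < N, θ ≤ f (n + 1) - f n) (hhi : ∀ n < N, f (n + 1) - f n ≤ 1 - θ)
    (hmono : ∀ n, n + 1 < N → f (n + 1) - f n ≤ f (n + 2) - f (n + 1)) :
    ‖∑ n ∈ Finset.range N, ee (f n)‖ ≤ 2 / θ := by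
  rcases Nat.eq_zero_or_pos N with rfl | hN
  · simpa using by positivity
  set δ : ℕ → ℝ := fun n => f (n + 1) - f n with hδ
  set b : ℕ → ℝ := fun n =>
    Real.cos (Real.pi * δ n) / (2 * Real.sin (Real.pi * δ n)) with hb
  have hsin : ∀ n < N, 2 * θ ≤ Real.sin (Real.pi * δ n) := fun n hn =>
    two_mul_le_sin_pi_mul (hlo n hn) (hhi n hn) hθ
  have hbb : ∀ n < N, |b n| ≤ 1 / (4 * θ) := by
    intro n hn
    have h1 := hsin n hn
    rw [hb, abs_div, abs_of_pos (a := 2 * _) (by linarith)]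
    rw [div_le_div_iff₀ (by linarith) (by linarith)]
    have := Real.abs_cos_le_one (Real.pi * δ n)
    nlinarith
  have hbm : ∀ n, n + 1 < N → b (n + 1) ≤ b n := by
    intro n hn
    have h1 := hsin n (by omega)
    have h2 := hsin (n + 1) hn
    simp only [hb]
    rw [div_le_div_iff₀ (by linarith) (by linarith)]
    have h3 : 0 ≤ Real.sin (Real.pi * δ (n + 1) - Real.pi * δ n) := by
      apply Real.sin_nonneg_of_nonneg_of_le_pi
      · have := hmono n hn
        have hpi := Real.pi_pos
        simp only [hδ]
        nlinarith
      · have h4 := hlo n (by omega)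
        have h5 := hhi (n + 1) hn
        have hpi := Real.pi_pos
        simp only [hδ]
        nlinarith
    rw [Real.sin_sub] at h3
    nlinarith
  have key : ∀ m, m < N → ‖(∑ n ∈ Finset.range (m + 1), ee (f n)) -
      ee (f (m + 1)) * (-1 / 2 - (b m : ℝ) * Complex.I)‖ ≤ 1 / 2 + |b 0| + (b 0 - b m) := by
    intro m
    induction m with
    | zero =>
      intro h0
      have h := inv_ee_sub_one (δ := δ 0) (by have := hsin 0 h0; intro h; rw [h] at this; linarith)
      have hf : ee (f 1) = ee (f 0) * ee (δ 0) := by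
        rw [← ee_add]; congr 1; simp [hδ]
      have : (∑ n ∈ Finset.range (0 + 1), ee (f n)) - ee (f (0 + 1)) *
          (-1 / 2 - (b 0 : ℝ) * Complex.I) = - (ee (f 0) * (-1 / 2 - (b 0 : ℝ) * Complex.I)) := by
        simp only [zero_add, Finset.sum_range_one]
        rw [hf]
        linear_combination (-ee (f 0)) * h
      rw [this, norm_neg, norm_mul, norm_ee, one_mul]
      refine (norm_sub_le _ _).trans ?_
      simp
    | succ m ih =>
      intro hm
      have ih := ih (by omega)
      have h := inv_ee_sub_one (δ := δ (m + 1))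
        (by have := hsin (m + 1) hm; intro h; rw [h] at this; linarith)
      have hf : ee (f (m + 2)) = ee (f (m + 1)) * ee (δ (m + 1)) := by
        rw [← ee_add]; congr 1; simp [hδ]
      have : (∑ n ∈ Finset.range (m + 1 + 1), ee (f n)) - ee (f (m + 1 + 1)) *
          (-1 / 2 - (b (m + 1) : ℝ) * Complex.I) =
          ((∑ n ∈ Finset.range (m + 1), ee (f n)) -
            ee (f (m + 1)) * (-1 / 2 - (b m : ℝ) * Complex.I)) +
          ee (f (m + 1)) * ((b (m + 1) - b m : ℝ) * Complex.I) := by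
        rw [Finset.sum_range_succ _ (m + 1), show m + 1 + 1 = m + 2 from rfl, hf]
        push_cast
        linear_combination (-ee (f (m + 1))) * h
      rw [this]
      refine (norm_add_le _ _).trans ?_
      rw [norm_mul, norm_ee, one_mul, norm_mul, Complex.norm_I, mul_one, Complex.norm_real,
        Real.norm_eq_abs, abs_sub_comm, abs_of_nonneg (sub_nonneg.2 (hbm m hm))]
      linarith
  obtain ⟨m, rfl⟩ : ∃ m, N = m + 1 := ⟨N - 1, by omega⟩
  have h1 := key m (by omega)
  have h2 : ‖ee (f (m + 1)) * (-1 / 2 - (b m : ℝ) * Complex.I)‖ ≤ 1 / 2 + |b m| := by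
    rw [norm_mul, norm_ee, one_mul]
    refine (norm_sub_le _ _).trans ?_
    simp
  have h3 := norm_le_norm_sub_add (∑ n ∈ Finset.range (m + 1), ee (f n))
    (ee (f (m + 1)) * (-1 / 2 - (b m : ℝ) * Complex.I))
  have h4 := hbb 0 (by omega)
  have h5 := hbb m (by omega)
  have h6 : θ ≤ 1 / 2 := by
    have := hlo 0 hN
    have := hhi 0 hN
    linarith
  have hb1 := le_abs_self (b 0)
  have hb2 := neg_abs_le (b m)
  have h7 : 1 ≤ 2 * (1 / (4 * θ)) := by
    rw [show 2 * (1 / (4 * θ)) = 1 / (2 * θ) by field_simp; norm_num, le_div_iff₀ (by linarith)]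
    linarith
  have h8 : 2 / θ = 8 * (1 / (4 * θ)) := by field_simp; norm_num
  rw [h8]
  have hb3 := le_abs_self (b m)
  linarith

/-- Kusmin–Landau on a general interval, with increments in `[ν + θ, ν + 1 - θ]`. -/
lemma kusmin_landau (f : ℕ → ℝ) (a b : ℕ) (ν : ℤ) (θ : ℝ) (hθ : 0 < θ)
    (hlo : ∀ n, a ≤ n → n < b → ν + θ ≤ f (n + 1) - f n)
    (hhi : ∀ n, a ≤ n → n < b → f (n + 1) - f n ≤ ν + 1 - θ)
    (hmono : ∀ n, a ≤ n → n + 1 < b → f (n + 1) - f n ≤ f (n + 2) - f (n + 1)) :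
    ‖∑ n ∈ Finset.Ico a b, ee (f n)‖ ≤ 2 / θ := by
  rw [Finset.sum_Ico_eq_sum_range]
  have h := kusmin_landau_zero (fun n => f (a + n) - ((ν * n : ℤ) : ℝ)) (b - a) θ hθ
    (fun n hn => by
      have := hlo (a + n) (by omega) (by omega)
      push_cast
      rw [← add_assoc a n 1]
      linarith)
    (fun n hn => by
      have := hhi (a + n) (by omega) (by omega)
      push_cast
      rw [← add_assoc a n 1]
      linarith)
    (fun n hn => by
      have := hmono (a + n) (by omega) (by omega)
      push_cast
      rw [← add_assoc a n 1, ← add_assoc a n 2]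
      linarith)
  simpa only [ee_sub_int] using h

lemma growth_of_increments (δ : ℕ → ℝ) (N : ℕ) (l : ℝ)
    (h : ∀ n, n + 1 < N → l ≤ δ (n + 1) - δ n) (m n : ℕ) (hmn : m ≤ n) (hn : n < N) :
    l * (n - m : ℝ) ≤ δ n - δ m := by
  induction n, hmn using Nat.le_induction with
  | base => simp
  | succ n hmn ih =>
    have := ih (by omega)
    have := h n hn
    push_cast
    linarith

lemma card_window_le (δ : ℕ → ℝ) (N : ℕ) (l : ℝ) (hl : 0 < l)
    (h : ∀ n, n + 1 < N → l ≤ δ (n + 1) - δ n) (u v : ℝ) (huv : u ≤ v) :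
    (((Finset.range N).filter (fun n => u ≤ δ n ∧ δ n ≤ v)).card : ℝ) ≤ (v - u) / l + 1 := by
  set S := (Finset.range N).filter (fun n => u ≤ δ n ∧ δ n ≤ v) with hS
  rcases S.eq_empty_or_nonempty with h0 | h0
  · rw [h0]
    have : 0 ≤ (v - u) / l := div_nonneg (by linarith) hl.le
    simp
    linarith
  · have h1 := S.min'_mem h0
    have h2 := S.max'_mem h0
    set a := S.min' h0
    set b := S.max' h0
    have hab : a ≤ b := S.min'_le_max' h0
    have hsub : S ⊆ Finset.Icc a b := fun x hx =>
      Finset.mem_Icc.2 ⟨S.min'_le x hx, S.le_max' x hx⟩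
    have hc := Finset.card_le_card hsub
    rw [Nat.card_Icc] at hc
    have hc' : (S.card : ℝ) ≤ (b - a : ℝ) + 1 := by
      have : S.card + a ≤ b + 1 := by omega
      have : (S.card : ℝ) + a ≤ b + 1 := by exact_mod_cast this
      linarith
    rw [hS, Finset.mem_filter, Finset.mem_range] at h1 h2
    have := growth_of_increments δ N l h a b hab h2.1
    have h3 : (b - a : ℝ) ≤ (v - u) / l := by
      rw [le_div_iff₀ hl]
      linarith [h1.2.1, h2.2.2]
    linarith

lemma norm_sum_ee_le_card {ι : Type*} (s : Finset ι) (f : ι → ℝ) :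
    ‖∑ i ∈ s, ee (f i)‖ ≤ s.card := by
  refine (norm_sum_le _ _).trans ?_
  simp [norm_ee]

lemma norm_sum_window_le (f : ℕ → ℝ) (N : ℕ) (l : ℝ) (hl : 0 < l)
    (h : ∀ n, n + 1 < N → l ≤ (f (n + 2) - f (n + 1)) - (f (n + 1) - f n)) (ν : ℤ) (θ : ℝ)
    (hθ : 0 < θ) :
    ‖∑ n ∈ (Finset.range N).filter (fun n => ν + θ ≤ f (n + 1) - f n ∧
      f (n + 1) - f n ≤ ν + 1 - θ), ee (f n)‖ ≤ 2 / θ := by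
  set S := (Finset.range N).filter (fun n => ν + θ ≤ f (n + 1) - f n ∧
      f (n + 1) - f n ≤ ν + 1 - θ) with hS
  rcases S.eq_empty_or_nonempty with h0 | h0
  · rw [h0]
    simpa using by positivity
  · have h1 := S.min'_mem h0
    have h2 := S.max'_mem h0
    set a := S.min' h0
    set b := S.max' h0
    rw [hS, Finset.mem_filter, Finset.mem_range] at h1 h2
    have hmono : ∀ m n, m ≤ n → n < N → f (m + 1) - f m ≤ f (n + 1) - f n := by
      intro m n hmn hn
      have := growth_of_increments (fun n => f (n + 1) - f n) N l h m n hmn hn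
      have h4 : (0 : ℝ) ≤ n - m := by
        have : (m : ℝ) ≤ n := by exact_mod_cast hmn
        linarith
      have := mul_nonneg hl.le h4
      linarith
    have heq : S = Finset.Ico a (b + 1) := by
      ext x
      constructor
      · intro hx
        have := S.min'_le x hx
        have := S.le_max' x hx
        exact Finset.mem_Ico.2 ⟨by assumption, by omega⟩
      · intro hx
        rw [Finset.mem_Ico] at hx
        rw [hS, Finset.mem_filter, Finset.mem_range]
        refine ⟨by omega, ?_, ?_⟩
        · exact h1.2.1.trans (hmono a x hx.1 (by omega))
        · exact (hmono x b (by omega) h2.1).trans h2.2.2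
    rw [heq]
    refine kusmin_landau f a (b + 1) ν θ hθ ?_ ?_ ?_
    · intro n hn hb
      exact h1.2.1.trans (hmono a n hn (by omega))
    · intro n hn hb
      exact (hmono n b (by omega) h2.1).trans h2.2.2
    · intro n hn hb
      exact hmono n (n + 1) (by omega) (by omega)

/-- Van der Corput's second-difference test. -/
lemma second_difference_test (f : ℕ → ℝ) (N : ℕ) (l h : ℝ) (hl : 0 < l) (hl1 : l ≤ 1)
    (hh : 1 ≤ h)
    (hlo : ∀ n, n + 1 < N → l ≤ (f (n + 2) - f (n + 1)) - (f (n + 1) - f n))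
    (hhi : ∀ n, n + 1 < N → (f (n + 2) - f (n + 1)) - (f (n + 1) - f n) ≤ h * l) :
    ‖∑ n ∈ Finset.range N, ee (f n)‖ ≤ 8 * (h * Real.sqrt l * N + 2 / Real.sqrt l) := by
  rcases Nat.eq_zero_or_pos N with rfl | hN
  · simpa using by positivity
  set δ : ℕ → ℝ := fun n => f (n + 1) - f n with hδ
  have hs : 0 < Real.sqrt l := Real.sqrt_pos.2 hl
  have hss : Real.sqrt l * Real.sqrt l = l := Real.mul_self_sqrt hl.le
  have hs1 : Real.sqrt l ≤ 1 := Real.sqrt_le_one.2 hl1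
  set r := Real.sqrt l with hr
  have hmono : ∀ m n, m ≤ n → n < N → δ m ≤ δ n := by
    intro m n hmn hn
    have := growth_of_increments δ N l hlo m n hmn hn
    have h4 : (0 : ℝ) ≤ n - m := by
      have : (m : ℝ) ≤ n := by exact_mod_cast hmn
      linarith
    have := mul_nonneg hl.le h4
    linarith
  have hup : δ (N - 1) - δ 0 ≤ h * l * N := by
    have := growth_of_increments (fun n => - δ n) N (-(h * l)) (fun n hn => by
      have := hhi n hn
      simp only [hδ]
      linarith) 0 (N - 1) (by omega) (by omega)
    have h5 : ((N - 1 : ℕ) : ℝ) ≤ N := by exact_mod_cast Nat.sub_le _ _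
    have : 0 ≤ h * l := by positivity
    push_cast at *
    nlinarith
  have hmaps : ∀ n ∈ Finset.range N, ⌊δ n⌋ ∈ Finset.Icc ⌊δ 0⌋ ⌊δ (N - 1)⌋ := by
    intro n hn
    rw [Finset.mem_range] at hn
    exact Finset.mem_Icc.2 ⟨Int.floor_le_floor (hmono 0 n (by omega) hn),
      Int.floor_le_floor (hmono n (N - 1) (by omega) (by omega))⟩
  rw [← Finset.sum_fiberwise_of_maps_to hmaps]
  have hcell : ∀ k : ℤ, ‖∑ n ∈ (Finset.range N).filter (fun n => ⌊δ n⌋ = k), ee (f n)‖ ≤ 8 / r := by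
    intro k
    set F := (Finset.range N).filter (fun n => ⌊δ n⌋ = k) with hF
    set W := (Finset.range N).filter (fun n => k + r / 2 ≤ f (n + 1) - f n ∧
      f (n + 1) - f n ≤ k + 1 - r / 2) with hW
    have hWF : W ⊆ F := by
      intro n hn
      rw [hW, Finset.mem_filter] at hn
      rw [hF, Finset.mem_filter]
      refine ⟨hn.1, Int.floor_eq_iff.2 ⟨?_, ?_⟩⟩
      · simp only [hδ]; linarith [hn.2.1]
      · simp only [hδ]; linarith [hn.2.2]
    rw [← Finset.sum_sdiff hWF]
    have hrest : (((F \ W).card : ℕ) : ℝ) ≤ 2 * (r / 2 / l + 1) := by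
      have hsub : F \ W ⊆ ((Finset.range N).filter (fun n => (k : ℝ) ≤ δ n ∧ δ n ≤ k + r / 2)) ∪
          ((Finset.range N).filter (fun n => (k : ℝ) + 1 - r / 2 ≤ δ n ∧ δ n ≤ k + 1)) := by
        intro n hn
        rw [Finset.mem_sdiff, hF, hW, Finset.mem_filter, Finset.mem_filter, Int.floor_eq_iff] at hn
        obtain ⟨⟨h1, h2, h3⟩, h4⟩ := hn
        rw [Finset.mem_union, Finset.mem_filter, Finset.mem_filter]
        by_cases h5 : δ n ≤ k + r / 2
        · exact Or.inl ⟨h1, h2, h5⟩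
        · refine Or.inr ⟨h1, ?_, h3.le⟩
          by_contra h6
          exact h4 ⟨h1, (not_le.1 h5).le, (not_le.1 h6).le⟩
      have h1 := Finset.card_le_card hsub
      have h2 := Finset.card_union_le
        ((Finset.range N).filter (fun n => (k : ℝ) ≤ δ n ∧ δ n ≤ k + r / 2))
          ((Finset.range N).filter (fun n => (k : ℝ) + 1 - r / 2 ≤ δ n ∧ δ n ≤ k + 1))
      have h3 := card_window_le δ N l hl hlo k (k + r / 2) (by linarith)
      have h4 := card_window_le δ N l hl hlo (k + 1 - r / 2) (k + 1) (by linarith)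
      have h5 : ((F \ W).card : ℝ) ≤
        ((Finset.range N).filter (fun n => (k : ℝ) ≤ δ n ∧ δ n ≤ k + r / 2)).card +
          ((Finset.range N).filter (fun n => (k : ℝ) + 1 - r / 2 ≤ δ n ∧ δ n ≤ k + 1)).card := by
        exact_mod_cast h1.trans h2
      rw [add_sub_cancel_left] at h3
      rw [sub_sub_cancel] at h4
      linarith
    have hWb := norm_sum_window_le f N l hl hlo k (r / 2) (by linarith)
    have h1 := norm_sum_ee_le_card (F \ W) f
    refine (norm_add_le _ _).trans ?_
    have e1 : r / 2 / l = 1 / 2 * (1 / r) := by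
      rw [← hss]; field_simp
    have e2 : 2 / (r / 2) = 4 * (1 / r) := by field_simp; norm_num
    have e3 : 8 / r = 8 * (1 / r) := by field_simp
    have e4 : 1 ≤ 1 / r := by rw [le_div_iff₀ hs]; linarith
    rw [e1] at hrest
    rw [e2] at hWb
    rw [e3]
    linarith
  refine (norm_sum_le_of_le _ (fun k _ => hcell k)).trans ?_
  rw [Finset.sum_const, nsmul_eq_mul, Int.card_Icc]
  have hcard : ((⌊δ (N - 1)⌋ + 1 - ⌊δ 0⌋).toNat : ℝ) ≤ h * l * N + 2 := by
    have h1 : (0 : ℤ) ≤ ⌊δ (N - 1)⌋ + 1 - ⌊δ 0⌋ := by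
      have := Int.floor_le_floor (hmono 0 (N - 1) (by omega) (by omega))
      omega
    have h2 : ((⌊δ (N - 1)⌋ + 1 - ⌊δ 0⌋).toNat : ℝ) = ((⌊δ (N - 1)⌋ + 1 - ⌊δ 0⌋ : ℤ) : ℝ) := by
      exact_mod_cast Int.toNat_of_nonneg h1
    rw [h2]
    push_cast
    have := Int.floor_le (δ (N - 1))
    have := Int.lt_floor_add_one (δ 0)
    linarith
  have : 8 * (h * r * N + 2 / r) = (h * l * N + 2) * (8 / r) := by
    rw [← hss]; field_simp
  rw [this]
  gcongr

lemma second_difference_mem (f f' f'' : ℝ → ℝ) (x lo hi : ℝ)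
    (h1 : ∀ y ∈ Set.Icc x (x + 2), HasDerivAt f (f' y) y)
    (h2 : ∀ y ∈ Set.Icc x (x + 2), HasDerivAt f' (f'' y) y)
    (hlo : ∀ y ∈ Set.Icc x (x + 2), lo ≤ f'' y) (hhi : ∀ y ∈ Set.Icc x (x + 2), f'' y ≤ hi) :
    lo ≤ (f (x + 2) - f (x + 1)) - (f (x + 1) - f x) ∧
      (f (x + 2) - f (x + 1)) - (f (x + 1) - f x) ≤ hi := by
  have hg : ∀ y ∈ Set.Icc x (x + 1),
      HasDerivAt (fun y => f (y + 1) - f y) (f' (y + 1) - f' y) y := by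
    intro y hy
    refine HasDerivAt.sub ?_ (h1 y ⟨hy.1, by linarith [hy.2]⟩)
    exact (h1 (y + 1) ⟨by linarith [hy.1], by linarith [hy.2]⟩).comp_add_const y 1
  obtain ⟨ξ, hξ, hξ'⟩ := exists_hasDerivAt_eq_slope (fun y => f (y + 1) - f y)
    (fun y => f' (y + 1) - f' y) (show x < x + 1 by linarith)
    (fun y hy => (hg y hy).continuousAt.continuousWithinAt)
    (fun y hy => hg y (Set.Ioo_subset_Icc_self hy))
  obtain ⟨η, hη, hη'⟩ := exists_hasDerivAt_eq_slope f' f'' (show ξ < ξ + 1 by linarith)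
    (fun y hy => (h2 y ⟨by linarith [hy.1, hξ.1], by
      linarith [hy.2, hξ.2]⟩).continuousAt.continuousWithinAt)
    (fun y hy => h2 y ⟨by linarith [hy.1, hξ.1], by linarith [hy.2, hξ.2]⟩)
  have hm : η ∈ Set.Icc x (x + 2) := ⟨by linarith [hη.1, hξ.1], by linarith [hη.2, hξ.2]⟩
  have e : (f (x + 2) - f (x + 1)) - (f (x + 1) - f x) = f'' η := by
    rw [hη']
    simp only [add_sub_cancel_left, div_one] at *
    rw [hξ', show x + 1 + 1 = x + 2 by ring]
  rw [e]
  exact ⟨hlo η hm, hhi η hm⟩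

/-- Van der Corput's second derivative test. -/
lemma van_der_corput (f f' f'' : ℝ → ℝ) (a b : ℕ) (hab : a ≤ b) (l h : ℝ) (hl : 0 < l) (hh : 1 ≤ h)
    (h1 : ∀ y ∈ Set.Icc (a + 1 : ℝ) (b + 1), HasDerivAt f (f' y) y)
    (h2 : ∀ y ∈ Set.Icc (a + 1 : ℝ) (b + 1), HasDerivAt f' (f'' y) y)
    (hlo : ∀ y ∈ Set.Icc (a + 1 : ℝ) (b + 1), l ≤ f'' y)
    (hhi : ∀ y ∈ Set.Icc (a + 1 : ℝ) (b + 1), f'' y ≤ h * l) :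
    ‖∑ n ∈ Finset.Ioc a b, ee (f n)‖ ≤ 8 * (h * Real.sqrt l * (b - a) + 2 / Real.sqrt l) := by
  have hba : (a : ℝ) ≤ b := by exact_mod_cast hab
  rcases le_total l 1 with hl1 | hl1
  · have hI : Finset.Ioc a b = Finset.Ico (a + 1) (b + 1) := by
      ext x; simp only [Finset.mem_Ioc, Finset.mem_Ico]; omega
    rw [hI, Finset.sum_Ico_eq_sum_range]
    have key : ∀ n : ℕ, n + 1 < b + 1 - (a + 1) → _ := fun n hn =>
      second_difference_mem f f' f'' (a + 1 + n : ℝ) l (h * l)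
        (fun y hy => h1 y ⟨by
          have := hy.1; have : (0:ℝ) ≤ n := n.cast_nonneg; linarith, by
          have := hy.2
          have : (a : ℝ) + n + 2 ≤ b := by exact_mod_cast (by omega : a + n + 2 ≤ b)
          linarith⟩)
        (fun y hy => h2 y ⟨by
          have := hy.1; have : (0:ℝ) ≤ n := n.cast_nonneg; linarith, by
          have := hy.2
          have : (a : ℝ) + n + 2 ≤ b := by exact_mod_cast (by omega : a + n + 2 ≤ b)
          linarith⟩)
        (fun y hy => hlo y ⟨by
          have := hy.1; have : (0:ℝ) ≤ n := n.cast_nonneg; linarith, by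
          have := hy.2
          have : (a : ℝ) + n + 2 ≤ b := by exact_mod_cast (by omega : a + n + 2 ≤ b)
          linarith⟩)
        (fun y hy => hhi y ⟨by
          have := hy.1; have : (0:ℝ) ≤ n := n.cast_nonneg; linarith, by
          have := hy.2
          have : (a : ℝ) + n + 2 ≤ b := by exact_mod_cast (by omega : a + n + 2 ≤ b)
          linarith⟩)
    have := second_difference_test (fun n => f (a + 1 + n : ℝ)) (b + 1 - (a + 1)) l h hl hl1 hh
      (fun n hn => by
        have := (key n hn).1
        push_cast
        simpa only [← add_assoc] using this)
      (fun n hn => by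
        have := (key n hn).2
        push_cast
        simpa only [← add_assoc] using this)
    have hc : ((b + 1 - (a + 1) : ℕ) : ℝ) = b - a := by
      rw [Nat.add_sub_add_right, Nat.cast_sub hab]
    rw [hc] at this
    push_cast
    simpa only [Nat.add_sub_add_right] using this
  · refine (norm_sum_ee_le_card _ _).trans ?_
    rw [Nat.card_Ioc, Nat.cast_sub hab]
    have : 1 ≤ Real.sqrt l := Real.one_le_sqrt.2 hl1
    have h3 : 0 ≤ 2 / Real.sqrt l := by positivity
    have h4 : 1 ≤ h * Real.sqrt l := by nlinarith
    nlinarith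

lemma rpow_near {c a x M t : ℝ} (hM : 0 < M) (h1 : M ≤ x) (h2 : x ≤ t * M) (hc : c ≤ a) (ha : 0 ≤ a)
    (hc0 : -a ≤ c) :
    t ^ (-a) * M ^ c ≤ x ^ c ∧ x ^ c ≤ t ^ a * M ^ c := by
  have hx : 0 < x := by linarith
  have ht : 1 ≤ t := by
    by_contra h
    nlinarith [not_le.1 h]
  have e : x ^ c = (x / M) ^ c * M ^ c := by
    rw [Real.div_rpow hx.le hM.le]
    field_simp
  have h3 : 1 ≤ x / M := by rwa [le_div_iff₀ hM, one_mul]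
  have h4 : x / M ≤ t := by rwa [div_le_iff₀ hM]
  have hMc : 0 < M ^ c := Real.rpow_pos_of_pos hM c
  rw [e]
  constructor
  · gcongr
    calc t ^ (-a) ≤ (x / M) ^ (-a) :=
          Real.rpow_le_rpow_of_nonpos (by linarith) h4 (by linarith)
      _ ≤ (x / M) ^ c := Real.rpow_le_rpow_of_exponent_le h3 hc0
  · gcongr
    calc (x / M) ^ c ≤ (x / M) ^ a := Real.rpow_le_rpow_of_exponent_le h3 hc
      _ ≤ t ^ a := Real.rpow_le_rpow (by linarith) h4 ha

lemma vdc_power_pos {c : ℝ} (hc1 : 1 < c) (hc2 : c < 2) : ∃ C : ℝ, 0 < C ∧ ∀ (M α : ℝ) (a b : ℕ),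
    1 ≤ M → 0 < α → a ≤ b → M ≤ a + 1 → (b : ℝ) ≤ 2 * M →
    ‖∑ n ∈ Finset.Ioc a b, ee (α * (n : ℝ) ^ c)‖ ≤
      C * (Real.sqrt (α * M ^ c) + M / Real.sqrt (α * M ^ c)) := by
  set w := c * (c - 1) with hw
  have hw0 : 0 < w := mul_pos (by linarith) (by linarith)
  set κ := w * 3 ^ (-2 : ℝ) with hκ
  have hκ0 : 0 < κ := by positivity
  set h := (3 : ℝ) ^ (2 : ℝ) * 3 ^ (2 : ℝ) with hh
  refine ⟨8 * (h * Real.sqrt κ * 2 + 2 / Real.sqrt κ), by positivity, ?_⟩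
  intro M α a b hM hα hab hMa hbM
  set P := α * M ^ c with hP
  have hM0 : 0 < M := by linarith
  have hMc : M ^ (c - 2) = M ^ c / M ^ 2 := by
    rw [Real.rpow_sub hM0]; norm_num
  have hP0 : 0 < P := by positivity
  have hs : 0 < Real.sqrt P := Real.sqrt_pos.2 hP0
  have hsκ : 0 < Real.sqrt κ := Real.sqrt_pos.2 hκ0
  have hsqrt : Real.sqrt (κ * P / M ^ 2) = Real.sqrt κ * Real.sqrt P / M := by
    rw [Real.sqrt_div (by positivity), Real.sqrt_mul hκ0.le, Real.sqrt_sq hM0.le]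
  have key := van_der_corput (fun x => α * x ^ c) (fun x => α * (c * x ^ (c - 1)))
    (fun x => α * (c * ((c - 1) * x ^ (c - 1 - 1)))) a b hab (κ * P / M ^ 2) h (by positivity)
    (by rw [hh]; norm_num)
    (fun y hy => (Real.hasDerivAt_rpow_const (Or.inl (by linarith [hy.1]))).const_mul α)
    (fun y hy => ((Real.hasDerivAt_rpow_const (Or.inl (by linarith [hy.1]))).const_mul c).const_mul α)
    (fun y hy => by
      have := (rpow_near (c := c - 2) (a := 2) (t := 3) hM0 (hMa.trans hy.1)
        (by linarith [hy.2]) (by linarith) (by norm_num) (by linarith)).1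
      rw [hMc] at this
      rw [show c - 1 - 1 = c - 2 by ring, show α * (c * ((c - 1) * y ^ (c - 2))) =
        α * w * y ^ (c - 2) by rw [hw]; ring, show κ * P / M ^ 2 =
        α * w * (3 ^ (-2 : ℝ) * (M ^ c / M ^ 2)) by rw [hκ, hP]; ring]
      gcongr)
    (fun y hy => by
      have := (rpow_near (c := c - 2) (a := 2) (t := 3) hM0 (hMa.trans hy.1)
        (by linarith [hy.2]) (by linarith) (by norm_num) (by linarith)).2
      rw [hMc] at this
      have e3 : (3 : ℝ) ^ (2 : ℝ) * 3 ^ (-2 : ℝ) = 1 := by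
        rw [← Real.rpow_add (by norm_num)]; norm_num
      rw [show c - 1 - 1 = c - 2 by ring, show α * (c * ((c - 1) * y ^ (c - 2))) =
        α * w * y ^ (c - 2) by rw [hw]; ring, show h * (κ * P / M ^ 2) =
        α * w * (3 ^ (2 : ℝ) * (M ^ c / M ^ 2)) by
          rw [hκ, hP, hh]; linear_combination (3 ^ (2:ℝ) * w * α * M ^ c / M ^ 2) * e3]
      gcongr)
  refine key.trans ?_
  rw [hsqrt, mul_assoc 8]
  have hb : (b : ℝ) - a ≤ 2 * M := by linarith [(Nat.cast_nonneg a : (0:ℝ) ≤ a)]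
  have hh0 : 0 < h := by positivity
  have h1 : h * (Real.sqrt κ * Real.sqrt P / M) * (b - a) ≤ h * Real.sqrt κ * 2 * Real.sqrt P := by
    calc h * (Real.sqrt κ * Real.sqrt P / M) * (b - a)
        ≤ h * (Real.sqrt κ * Real.sqrt P / M) * (2 * M) := by gcongr
      _ = h * Real.sqrt κ * 2 * Real.sqrt P := by field_simp
  have h2 : 2 / (Real.sqrt κ * Real.sqrt P / M) = 2 / Real.sqrt κ * (M / Real.sqrt P) := by
    field_simp
  rw [h2]
  have h3 : 0 ≤ h * Real.sqrt κ * 2 * (M / Real.sqrt P) := by positivity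
  have h4 : 0 ≤ 2 / Real.sqrt κ * Real.sqrt P := by positivity
  nlinarith

/-- The bound `∑ e(α n^c) ≪ P^{1/2} + M P^{-1/2}` over subintervals of `[M, 2M]`,
where `P = |α| M^c`. -/
lemma vdc_power {c : ℝ} (hc1 : 1 < c) (hc2 : c < 2) : ∃ C : ℝ, 0 < C ∧ ∀ (M α : ℝ) (a b : ℕ),
    1 ≤ M → α ≠ 0 → a ≤ b → M ≤ a + 1 → (b : ℝ) ≤ 2 * M →
    ‖∑ n ∈ Finset.Ioc a b, ee (α * (n : ℝ) ^ c)‖ ≤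
      C * (Real.sqrt (|α| * M ^ c) + M / Real.sqrt (|α| * M ^ c)) := by
  obtain ⟨C, hC, h⟩ := vdc_power_pos hc1 hc2
  refine ⟨C, hC, fun M α a b hM hα hab hMa hbM => ?_⟩
  rcases lt_or_gt_of_ne hα with h0 | h0
  · have := h M (-α) a b hM (by linarith) hab hMa hbM
    simp only [neg_mul] at this
    rw [norm_sum_ee_neg] at this
    rw [abs_of_neg h0]
    simpa using this
  · rw [abs_of_pos h0]
    exact h M α a b hM h0 hab hMa hbM

lemma kusmin_landau_power_pos {c : ℝ} (hc1 : 1 < c) (hc2 : c < 3 / 2) (X u : ℝ) (a b : ℕ)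
    (hX : 1 ≤ X) (hu : 0 < u) (huX : u ≤ X ^ (1 - c) / 8) (hMa : X ≤ a + 1)
    (hbM : (b : ℝ) ≤ 2 * X) :
    ‖∑ n ∈ Finset.Ioc a b, ee (u * (n : ℝ) ^ c)‖ ≤ 2 * X ^ (1 - c) / u := by
  have hX0 : 0 < X := by linarith
  have hI : Finset.Ioc a b = Finset.Ico (a + 1) (b + 1) := by
    ext x; simp only [Finset.mem_Ioc, Finset.mem_Ico]; omega
  have hXc : 0 < X ^ (c - 1) := Real.rpow_pos_of_pos hX0 _
  have hXX : X ^ (1 - c) = 1 / X ^ (c - 1) := by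
    rw [show 1 - c = -(c - 1) by ring, Real.rpow_neg hX0.le, one_div]
  have huX' : u * X ^ (c - 1) ≤ 1 / 8 := by
    rw [hXX, div_div, le_div_iff₀ (by positivity)] at huX
    linarith
  have hder : ∀ y : ℝ, 0 < y → HasDerivAt (fun x => u * x ^ c) (u * (c * y ^ (c - 1))) y :=
    fun y hy => (Real.hasDerivAt_rpow_const (Or.inl hy.ne')).const_mul u
  have hder2 : ∀ y : ℝ, 0 < y → HasDerivAt (fun x => u * (c * x ^ (c - 1)))
      (u * (c * ((c - 1) * y ^ (c - 1 - 1)))) y :=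
    fun y hy => ((Real.hasDerivAt_rpow_const (Or.inl hy.ne')).const_mul c).const_mul u
  have hinc : ∀ n : ℕ, a + 1 ≤ n → n < b + 1 →
      u * X ^ (c - 1) ≤ u * ((n + 1 : ℕ) : ℝ) ^ c - u * (n : ℝ) ^ c ∧
      u * ((n + 1 : ℕ) : ℝ) ^ c - u * (n : ℝ) ^ c ≤ 1 - u * X ^ (c - 1) := by
    intro n hn1 hn2
    have hn1' : (a : ℝ) + 1 ≤ n := by exact_mod_cast hn1
    have hn2' : (n : ℝ) ≤ b := by exact_mod_cast Nat.lt_succ_iff.1 hn2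
    have hn0 : (0 : ℝ) < n := by linarith
    obtain ⟨ξ, hξ, hξ'⟩ := exists_hasDerivAt_eq_slope (fun x => u * x ^ c)
      (fun y => u * (c * y ^ (c - 1))) (show (n : ℝ) < n + 1 by linarith)
      (fun y hy => (hder y (by linarith [hy.1])).continuousAt.continuousWithinAt)
      (fun y hy => hder y (by linarith [hy.1]))
    simp only [add_sub_cancel_left, div_one] at hξ'
    push_cast
    rw [← hξ']
    have h3 := rpow_near (c := c - 1) (a := 1 / 2) (t := 3) (x := ξ) hX0 (by linarith [hξ.1])
      (by linarith [hξ.2]) (by linarith) (by norm_num) (by linarith)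
    have hlow : X ^ (c - 1) ≤ ξ ^ (c - 1) :=
      Real.rpow_le_rpow hX0.le (by linarith [hξ.1]) (by linarith)
    have h32 : (3 : ℝ) ^ (1 / 2 : ℝ) ≤ 2 := by
      rw [← Real.sqrt_eq_rpow, Real.sqrt_le_left (by norm_num)]
      norm_num
    constructor
    · have : X ^ (c - 1) ≤ c * ξ ^ (c - 1) := by nlinarith
      gcongr
    · have h4 : ξ ^ (c - 1) ≤ 2 * X ^ (c - 1) := h3.2.trans (by gcongr)
      have h5 : c * ξ ^ (c - 1) ≤ 3 / 2 * (2 * X ^ (c - 1)) :=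
        mul_le_mul hc2.le h4 (hXc.le.trans hlow) (by norm_num)
      have h6 : u * (c * ξ ^ (c - 1)) ≤ u * (3 / 2 * (2 * X ^ (c - 1))) := by gcongr
      linarith
  rw [hI]
  refine (kusmin_landau (fun n => u * (n : ℝ) ^ c) (a + 1) (b + 1) 0 (u * X ^ (c - 1))
    (by positivity) ?_ ?_ ?_).trans (le_of_eq ?_)
  · intro n h1 h2
    simpa using (hinc n h1 h2).1
  · intro n h1 h2
    simpa using (hinc n h1 h2).2
  · intro n h1 h2
    have hn1' : (a : ℝ) + 1 ≤ n := by exact_mod_cast h1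
    have hn0 : (0 : ℝ) < n := by linarith
    have := (second_difference_mem (fun x => u * x ^ c) (fun y => u * (c * y ^ (c - 1)))
      (fun y => u * (c * ((c - 1) * y ^ (c - 1 - 1)))) n 0 (u * (c * ((c - 1) *
        (n : ℝ) ^ (c - 1 - 1))))
      (fun y hy => hder y (by linarith [hy.1])) (fun y hy => hder2 y (by linarith [hy.1]))
      (fun y hy => by
        have : 0 < y := by linarith [hy.1]
        have : 0 ≤ c - 1 := by linarith
        positivity)
      (fun y hy => by
        have : 0 ≤ c - 1 := by linarith
        have := Real.rpow_le_rpow_of_nonpos hn0 hy.1 (show c - 1 - 1 ≤ 0 by linarith)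
        gcongr)).1
    push_cast
    linarith
  · rw [hXX]
    field_simp

lemma kusmin_landau_power {c : ℝ} (hc1 : 1 < c) (hc2 : c < 3 / 2) (X u : ℝ) (a b : ℕ)
    (hX : 1 ≤ X) (hu : u ≠ 0) (huX : |u| ≤ X ^ (1 - c) / 8) (hMa : X ≤ a + 1)
    (hbM : (b : ℝ) ≤ 2 * X) :
    ‖∑ n ∈ Finset.Ioc a b, ee (u * (n : ℝ) ^ c)‖ ≤ 2 * X ^ (1 - c) / |u| := by
  rcases lt_or_gt_of_ne hu with h0 | h0
  · rw [abs_of_neg h0] at *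
    have := kusmin_landau_power_pos hc1 hc2 X (-u) a b hX (by linarith) huX hMa hbM
    simp only [neg_mul] at this
    rwa [norm_sum_ee_neg] at this
  · rw [abs_of_pos h0] at *
    exact kusmin_landau_power_pos hc1 hc2 X u a b hX h0 huX hMa hbM

open ArithmeticFunction in
lemma sum_Ioc_convolution (f g : ArithmeticFunction ℝ) (F : ℕ → ℂ) (X₀ t : ℕ) :
    ∑ n ∈ Finset.Ioc X₀ t, ((f * g) n : ℂ) * F n =
      ∑ m ∈ Finset.Ioc 0 t, ∑ k ∈ Finset.Ioc (X₀ / m) (t / m),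
        (f m : ℂ) * (g k : ℂ) * F (m * k) := by
  have h1 : ∀ n ∈ Finset.Ioc X₀ t, ((f * g) n : ℂ) * F n =
      ∑ x ∈ Finset.Ioc 0 t ×ˢ Finset.Ioc 0 t with x.1 * x.2 = n,
        (f x.1 : ℂ) * (g x.2 : ℂ) * F (x.1 * x.2) := by
    intro n hn
    rw [Finset.mem_Ioc] at hn
    rw [mul_apply, Nat.divisorsAntidiagonal_eq_prod_filter_of_le (by omega) hn.2]
    push_cast
    rw [Finset.sum_mul]
    refine Finset.sum_congr rfl fun x hx => ?_
    rw [(Finset.mem_filter.1 hx).2]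
  rw [Finset.sum_congr rfl h1]
  simp only [Finset.sum_filter]
  rw [Finset.sum_comm, Finset.sum_product]
  refine Finset.sum_congr rfl fun m hm => ?_
  rw [Finset.mem_Ioc] at hm
  have h2 : Finset.Ioc (X₀ / m) (t / m) = (Finset.Ioc 0 t).filter
      (fun k => X₀ < m * k ∧ m * k ≤ t) := by
    ext k
    simp only [Finset.mem_Ioc, Finset.mem_filter]
    rw [Nat.div_lt_iff_lt_mul hm.1, Nat.le_div_iff_mul_le hm.1, mul_comm k m]
    constructor
    · rintro ⟨h3, h4⟩
      have : 0 < k := by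
        rcases Nat.eq_zero_or_pos k with rfl | h
        · simp at h3
        · exact h
      have : k ≤ m * k := Nat.le_mul_of_pos_left k hm.1
      exact ⟨⟨by omega, by omega⟩, h3, h4⟩
    · rintro ⟨_, h⟩
      exact h
  rw [h2, Finset.sum_filter]
  refine Finset.sum_congr rfl fun k hk => ?_
  simp [Finset.sum_ite_eq, Finset.mem_Ioc]

/-- Abel summation with a weight of bounded variation. -/
lemma norm_sum_mul_le_of_partial (z : ℕ → ℂ) (w : ℕ → ℝ) (a b : ℕ) (h : a ≤ b) (B : ℝ)
    (hB : ∀ t, a ≤ t → t ≤ b → ‖∑ n ∈ Finset.Ioc a t, z n‖ ≤ B) :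
    ‖∑ n ∈ Finset.Ioc a b, (w n : ℂ) * z n‖ ≤
      (|w b| + ∑ n ∈ Finset.Ioc a b, |w n - w (n - 1)|) * B := by
  have key : ∀ t, a ≤ t → t ≤ b → ∑ n ∈ Finset.Ioc a t, (w n : ℂ) * z n =
      w t * ∑ n ∈ Finset.Ioc a t, z n -
        ∑ n ∈ Finset.Ioc a t, ((w n - w (n - 1) : ℝ) : ℂ) * ∑ k ∈ Finset.Ioc a (n - 1), z k := by
    intro t ht
    induction t, ht using Nat.le_induction with
    | base => simp
    | succ t ht ih =>
      intro htb
      rw [Finset.sum_Ioc_succ_top (by omega), Finset.sum_Ioc_succ_top (by omega),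
        Finset.sum_Ioc_succ_top (by omega), ih (by omega)]
      simp only [Nat.add_sub_cancel]
      push_cast
      ring
  rw [key b h le_rfl]
  refine (norm_sub_le _ _).trans ?_
  rw [norm_mul, Complex.norm_real, Real.norm_eq_abs, add_mul]
  refine add_le_add (mul_le_mul_of_nonneg_left (hB b h le_rfl) (abs_nonneg _)) ?_
  refine (norm_sum_le _ _).trans ?_
  rw [Finset.sum_mul]
  refine Finset.sum_le_sum fun n hn => ?_
  rw [Finset.mem_Ioc] at hn
  rw [norm_mul, Complex.norm_real, Real.norm_eq_abs]
  exact mul_le_mul_of_nonneg_left (hB (n - 1) (by omega) (by omega)) (abs_nonneg _)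

lemma norm_sum_log_mul_le (z : ℕ → ℂ) (a b : ℕ) (hab : a ≤ b) (B : ℝ)
    (hB : ∀ t, a ≤ t → t ≤ b → ‖∑ n ∈ Finset.Ioc a t, z n‖ ≤ B) :
    ‖∑ n ∈ Finset.Ioc a b, (Real.log n : ℂ) * z n‖ ≤ 2 * Real.log b * B := by
  have hB0 : 0 ≤ B := (norm_nonneg _).trans (hB a le_rfl hab)
  refine (norm_sum_mul_le_of_partial z (fun n => Real.log n) a b hab B hB).trans ?_
  gcongr
  have hlog : ∀ n : ℕ, 0 ≤ Real.log n := fun n => Real.log_natCast_nonneg n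
  rw [abs_of_nonneg (hlog b)]
  have : ∀ t, a ≤ t → ∑ n ∈ Finset.Ioc a t, |Real.log n - Real.log ((n - 1 : ℕ) : ℝ)| =
      Real.log t - Real.log a := by
    intro t ht
    induction t, ht using Nat.le_induction with
    | base => simp
    | succ t ht ih =>
      rw [Finset.sum_Ioc_succ_top (by omega), ih, abs_of_nonneg]
      · simp
      · simp only [Nat.add_sub_cancel, sub_nonneg]
        rcases Nat.eq_zero_or_pos t with rfl | h
        · simp
        · exact Real.log_le_log (by exact_mod_cast h) (by push_cast; linarith)
  rw [this b hab]
  linarith [hlog a]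

/-- Restriction of an arithmetic function to `n ≤ U`. -/
noncomputable def truncLE (f : ArithmeticFunction ℝ) (U : ℕ) : ArithmeticFunction ℝ :=
  ⟨fun n => if n ≤ U then f n else 0, by simp⟩

/-- Restriction of an arithmetic function to `n > U`. -/
noncomputable def truncGT (f : ArithmeticFunction ℝ) (U : ℕ) : ArithmeticFunction ℝ :=
  ⟨fun n => if n ≤ U then 0 else f n, by simp⟩

lemma truncLE_apply (f : ArithmeticFunction ℝ) (U n : ℕ) :
    truncLE f U n = if n ≤ U then f n else 0 := rfl

lemma truncGT_apply (f : ArithmeticFunction ℝ) (U n : ℕ) :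
    truncGT f U n = if n ≤ U then 0 else f n := rfl

lemma truncLE_add_truncGT (f : ArithmeticFunction ℝ) (U : ℕ) : truncLE f U + truncGT f U = f := by
  ext n
  rw [ArithmeticFunction.add_apply, truncLE_apply, truncGT_apply]
  split_ifs <;> simp

open ArithmeticFunction in
/-- Vaughan's identity. -/
lemma vaughan_identity (U V : ℕ) :
    vonMangoldt = truncLE vonMangoldt V + truncLE (moebius : ArithmeticFunction ℝ) U * log
      - (truncLE (moebius : ArithmeticFunction ℝ) U * truncLE vonMangoldt V) * (zeta : ArithmeticFunction ℝ)
      + (truncGT (moebius : ArithmeticFunction ℝ) U * (zeta : ArithmeticFunction ℝ))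
        * truncGT vonMangoldt V := by
  have h1 := truncLE_add_truncGT vonMangoldt V
  have h2 := truncLE_add_truncGT (moebius : ArithmeticFunction ℝ) U
  have h3 : (moebius : ArithmeticFunction ℝ) * (zeta : ArithmeticFunction ℝ) = 1 := coe_moebius_mul_coe_zeta
  have h4 : vonMangoldt * (zeta : ArithmeticFunction ℝ) = log := vonMangoldt_mul_zeta
  set a := truncLE vonMangoldt V
  set b := truncGT vonMangoldt V
  set p := truncLE (moebius : ArithmeticFunction ℝ) U
  set q := truncGT (moebius : ArithmeticFunction ℝ) U
  rw [← h4]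
  nth_rewrite 1 [← h1]
  have : b = (p + q) * (zeta : ArithmeticFunction ℝ) * b := by rw [h2, h3, one_mul]
  nth_rewrite 1 [this]
  have h5 : vonMangoldt = a + b := h1.symm
  rw [h5]
  ring

lemma sum_Ioc_inv_le (M : ℕ) : ∑ n ∈ Finset.Ioc 0 M, (1 / n : ℝ) ≤ 1 + Real.log M := by
  have h := harmonic_le_one_add_log M
  rw [harmonic_eq_sum_Icc] at h
  push_cast at h
  simpa [Finset.Icc_add_one_left_eq_Ioc, ← Finset.Icc_succ_left_eq_Ioc] using h

lemma sum_multiples_inv_le (M g : ℕ) (hg : 0 < g) :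
    ∑ d ∈ Finset.Ioc 0 M, (if g ∣ d then (1 / d : ℝ) else 0) ≤
      1 / g * ∑ n ∈ Finset.Ioc 0 M, (1 / n : ℝ) := by
  rw [← Finset.sum_filter]
  have hsub : (Finset.Ioc 0 M).filter (fun d => g ∣ d) ⊆
      (Finset.Ioc 0 M).image (fun k => g * k) := by
    intro d hd
    rw [Finset.mem_filter, Finset.mem_Ioc] at hd
    obtain ⟨⟨h1, h2⟩, k, rfl⟩ := hd
    refine Finset.mem_image.2 ⟨k, Finset.mem_Ioc.2 ⟨Nat.pos_of_mul_pos_left h1, ?_⟩, rfl⟩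
    exact (Nat.le_mul_of_pos_left k hg).trans h2
  refine (Finset.sum_le_sum_of_subset_of_nonneg hsub (fun _ _ _ => by positivity)).trans ?_
  rw [Finset.sum_image (fun a _ b _ hab => Nat.eq_of_mul_eq_mul_left hg hab), Finset.mul_sum]
  refine le_of_eq (Finset.sum_congr rfl fun k _ => ?_)
  push_cast
  rw [one_div_mul_one_div]

lemma sum_card_divisors_sq_le (M : ℕ) :
    ∑ m ∈ Finset.Ioc 0 M, ((m.divisors.card : ℝ)) ^ 2 ≤ M * (1 + Real.log M) ^ 3 := by
  set I := Finset.Ioc 0 M with hI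
  set H := ∑ n ∈ I, (1 / n : ℝ) with hH
  have hH0 : 0 ≤ H := Finset.sum_nonneg fun _ _ => by positivity
  have h1 : ∀ m ∈ I, ((m.divisors.card : ℝ)) ^ 2 =
      ∑ d ∈ I, ∑ e ∈ I, if d ∣ m ∧ e ∣ m then (1 : ℝ) else 0 := by
    intro m hm
    rw [hI, Finset.mem_Ioc] at hm
    have : (m.divisors.card : ℝ) = ∑ d ∈ I, if d ∣ m then (1 : ℝ) else 0 := by
      rw [← Finset.sum_filter, Finset.sum_const, nsmul_eq_mul, mul_one]
      congr 2
      ext d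
      simp only [Nat.mem_divisors, Finset.mem_filter, hI, Finset.mem_Ioc]
      constructor
      · rintro ⟨h, h0⟩
        exact ⟨⟨Nat.pos_of_dvd_of_pos h hm.1, (Nat.le_of_dvd hm.1 h).trans hm.2⟩, h⟩
      · rintro ⟨_, h⟩
        exact ⟨h, by omega⟩
    rw [sq, this, Finset.sum_mul_sum]
    refine Finset.sum_congr rfl fun d _ => Finset.sum_congr rfl fun e _ => ?_
    by_cases h3 : d ∣ m <;> by_cases h4 : e ∣ m <;> simp [h3, h4]
  rw [Finset.sum_congr rfl h1]
  have h2 : ∑ m ∈ I, ∑ d ∈ I, ∑ e ∈ I, (if d ∣ m ∧ e ∣ m then (1 : ℝ) else 0) =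
      ∑ d ∈ I, ∑ e ∈ I, ∑ m ∈ I, (if d ∣ m ∧ e ∣ m then (1 : ℝ) else 0) := by
    rw [Finset.sum_comm]
    refine Finset.sum_congr rfl fun d _ => Finset.sum_comm
  rw [h2]
  have h3 : ∀ d ∈ I, ∀ e ∈ I, ∑ m ∈ I, (if d ∣ m ∧ e ∣ m then (1 : ℝ) else 0) ≤
      M * ∑ g ∈ I, g * ((if g ∣ d then (1 / d : ℝ) else 0) * (if g ∣ e then (1 / e : ℝ) else 0)) := by
    intro d hd e he
    have hd' := hd
    rw [hI, Finset.mem_Ioc] at hd he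
    have hg : Nat.gcd d e ∈ I := by
      rw [hI, Finset.mem_Ioc]
      exact ⟨Nat.gcd_pos_of_pos_left _ hd.1, (Nat.gcd_le_left _ hd.1).trans hd.2⟩
    have h4 : (Nat.gcd d e : ℝ) * (1 / d * (1 / e)) ≤ ∑ g ∈ I, g *
        ((if g ∣ d then (1 / d : ℝ) else 0) * (if g ∣ e then (1 / e : ℝ) else 0)) := by
      have := Finset.single_le_sum (f := fun g : ℕ => (g : ℝ) *
        ((if g ∣ d then (1 / d : ℝ) else 0) * (if g ∣ e then (1 / e : ℝ) else 0)))
        (fun g _ => by positivity) hg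
      simpa [Nat.gcd_dvd_left, Nat.gcd_dvd_right] using this
    refine le_trans ?_ (mul_le_mul_of_nonneg_left h4 (Nat.cast_nonneg M))
    rw [← Finset.sum_filter, Finset.sum_const, nsmul_eq_mul, mul_one]
    have h5 : I.filter (fun m => d ∣ m ∧ e ∣ m) = I.filter (fun m => Nat.lcm d e ∣ m) := by
      ext m
      simp [Nat.lcm_dvd_iff]
    rw [h5, hI, Nat.Ioc_filter_dvd_card_eq_div]
    have h6 : (Nat.gcd d e : ℝ) * Nat.lcm d e = d * e := by exact_mod_cast Nat.gcd_mul_lcm d e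
    have hd0 : (0 : ℝ) < d := by exact_mod_cast hd.1
    have he0 : (0 : ℝ) < e := by exact_mod_cast he.1
    have hl0 : (0 : ℝ) < Nat.lcm d e := by exact_mod_cast Nat.lcm_pos hd.1 he.1
    have h7 : (Nat.gcd d e : ℝ) * (1 / d * (1 / e)) = 1 / Nat.lcm d e := by
      field_simp
      linarith
    rw [h7, mul_one_div]
    exact Nat.cast_div_le
  refine (Finset.sum_le_sum fun d hd => Finset.sum_le_sum fun e he => h3 d hd e he).trans ?_
  have h4 : ∑ d ∈ I, ∑ e ∈ I, (M : ℝ) * ∑ g ∈ I, g *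
      ((if g ∣ d then (1 / d : ℝ) else 0) * (if g ∣ e then (1 / e : ℝ) else 0)) =
      M * ∑ g ∈ I, g * ((∑ d ∈ I, if g ∣ d then (1 / d : ℝ) else 0) *
        (∑ d ∈ I, if g ∣ d then (1 / d : ℝ) else 0)) := by
    simp_rw [← Finset.mul_sum]
    congr 1
    have : ∀ d ∈ I, ∑ e ∈ I, ∑ g ∈ I, (g : ℝ) *
      ((if g ∣ d then (1 / d : ℝ) else 0) * (if g ∣ e then (1 / e : ℝ) else 0)) =
      ∑ g ∈ I, ∑ e ∈ I, (g : ℝ) *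
      ((if g ∣ d then (1 / d : ℝ) else 0) * (if g ∣ e then (1 / e : ℝ) else 0)) :=
      fun d _ => Finset.sum_comm
    rw [Finset.sum_congr rfl this, Finset.sum_comm]
    refine Finset.sum_congr rfl fun g _ => ?_
    rw [Finset.sum_mul_sum, Finset.mul_sum]
    refine Finset.sum_congr rfl fun d _ => ?_
    rw [Finset.mul_sum]
  rw [h4]
  refine mul_le_mul_of_nonneg_left ?_ (Nat.cast_nonneg M)
  have h5 : ∀ g ∈ I, (g : ℝ) * ((∑ d ∈ I, if g ∣ d then (1 / d : ℝ) else 0) *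
        (∑ d ∈ I, if g ∣ d then (1 / d : ℝ) else 0)) ≤ 1 / g * H ^ 2 := by
    intro g hg
    rw [hI, Finset.mem_Ioc] at hg
    have h6 := sum_multiples_inv_le M g hg.1
    have hg0 : (0 : ℝ) < g := by exact_mod_cast hg.1
    have h7 : 0 ≤ ∑ d ∈ I, if g ∣ d then (1 / d : ℝ) else 0 :=
      Finset.sum_nonneg fun _ _ => by positivity
    calc _ ≤ (g : ℝ) * ((1 / g * H) * (1 / g * H)) := by gcongr
      _ = 1 / g * H ^ 2 := by field_simp
  refine (Finset.sum_le_sum h5).trans ?_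
  rw [← Finset.sum_mul]
  have h8 : H ≤ 1 + Real.log M := sum_Ioc_inv_le M
  calc H * H ^ 2 = H ^ 3 := by ring
    _ ≤ _ := by gcongr

/-- Schur's test for a symmetric nonnegative kernel. -/
lemma schur_symm {ι : Type*} (S : Finset ι) (b : ι → ℝ) (w : ι → ι → ℝ)
    (hw : ∀ i j, 0 ≤ w i j) (hs : ∀ i j, w i j = w j i) :
    ∑ i ∈ S, ∑ j ∈ S, b i * b j * w i j ≤ ∑ i ∈ S, b i ^ 2 * ∑ j ∈ S, w i j := by
  have h1 : ∑ i ∈ S, ∑ j ∈ S, b i * b j * w i j ≤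
      ∑ i ∈ S, ∑ j ∈ S, (b i ^ 2 * w i j / 2 + b j ^ 2 * w j i / 2) := by
    refine Finset.sum_le_sum fun i _ => Finset.sum_le_sum fun j _ => ?_
    rw [hs j i]
    nlinarith [mul_nonneg (sq_nonneg (b i - b j)) (hw i j)]
  refine h1.trans (le_of_eq ?_)
  simp only [Finset.sum_add_distrib]
  rw [Finset.sum_comm (f := fun i j => b j ^ 2 * w j i / 2), ← two_mul, Finset.mul_sum]
  refine Finset.sum_congr rfl fun i _ => ?_
  rw [Finset.mul_sum, Finset.mul_sum]
  refine Finset.sum_congr rfl fun j _ => ?_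
  ring

lemma sum_normSq_le_schur {ι κ : Type*} (S : Finset ι) (R : Finset κ) (b : ι → ℝ)
    (u : ι → κ → ℂ) (w : ι → ι → ℝ) (hs : ∀ i j, w i j = w j i)
    (hw : ∀ i j, ‖∑ m ∈ R, u i m * (starRingEnd ℂ) (u j m)‖ ≤ w i j) :
    ∑ m ∈ R, ‖∑ i ∈ S, (b i : ℂ) * u i m‖ ^ 2 ≤ ∑ i ∈ S, b i ^ 2 * ∑ j ∈ S, w i j := by
  have h0 : ∀ i j, 0 ≤ w i j := fun i j => (norm_nonneg _).trans (hw i j)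
  have h1 : ((∑ m ∈ R, ‖∑ i ∈ S, (b i : ℂ) * u i m‖ ^ 2 : ℝ) : ℂ) =
      ∑ i ∈ S, ∑ j ∈ S, (b i : ℂ) * b j * ∑ m ∈ R, u i m * (starRingEnd ℂ) (u j m) := by
    push_cast
    have : ∀ m ∈ R, ((‖∑ i ∈ S, (b i : ℂ) * u i m‖ : ℝ) : ℂ) ^ 2 =
        ∑ i ∈ S, ∑ j ∈ S, (b i : ℂ) * b j * (u i m * (starRingEnd ℂ) (u j m)) := by
      intro m _
      rw [← Complex.mul_conj', map_sum, Finset.sum_mul_sum]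
      refine Finset.sum_congr rfl fun i _ => Finset.sum_congr rfl fun j _ => ?_
      rw [map_mul, Complex.conj_ofReal]
      ring
    rw [Finset.sum_congr rfl this, Finset.sum_comm]
    refine Finset.sum_congr rfl fun i _ => ?_
    rw [Finset.sum_comm]
    refine Finset.sum_congr rfl fun j _ => ?_
    rw [Finset.mul_sum]
  have h2 : ∑ m ∈ R, ‖∑ i ∈ S, (b i : ℂ) * u i m‖ ^ 2 ≤
      ∑ i ∈ S, ∑ j ∈ S, |b i| * |b j| * w i j := by
    have h3 : ∑ m ∈ R, ‖∑ i ∈ S, (b i : ℂ) * u i m‖ ^ 2 =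
        ‖((∑ m ∈ R, ‖∑ i ∈ S, (b i : ℂ) * u i m‖ ^ 2 : ℝ) : ℂ)‖ := by
      rw [Complex.norm_real, Real.norm_of_nonneg]
      exact Finset.sum_nonneg fun _ _ => sq_nonneg _
    rw [h3, h1]
    refine norm_sum_le_of_le _ fun i _ => norm_sum_le_of_le _ fun j _ => ?_
    rw [norm_mul, norm_mul, Complex.norm_real, Complex.norm_real, Real.norm_eq_abs,
      Real.norm_eq_abs]
    exact mul_le_mul_of_nonneg_left (hw i j) (by positivity)
  refine h2.trans ((schur_symm S (fun i => |b i|) w h0 hs).trans (le_of_eq ?_))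
  simp only [sq_abs]

lemma sum_dist_le (S : Finset ℕ) (k Q : ℕ) (hS : ∀ j ∈ S, Nat.dist k j ≤ Q) (F : ℕ → ℝ)
    (hF : ∀ j, 0 ≤ F j) :
    ∑ j ∈ S.filter (fun j => j ≠ k), F (Nat.dist k j) ≤ 2 * ∑ i ∈ Finset.Ioc 0 Q, F i := by
  have hsplit : S.filter (fun j => j ≠ k) =
      S.filter (fun j => j < k) ∪ S.filter (fun j => k < j) := by
    ext j
    simp only [Finset.mem_filter, Finset.mem_union]
    constructor
    · rintro ⟨h1, h2⟩
      rcases lt_or_gt_of_ne h2 with h | h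
      · exact Or.inl ⟨h1, h⟩
      · exact Or.inr ⟨h1, h⟩
    · rintro (⟨h1, h2⟩ | ⟨h1, h2⟩)
      · exact ⟨h1, by omega⟩
      · exact ⟨h1, by omega⟩
  rw [hsplit, Finset.sum_union (by
    rw [Finset.disjoint_filter]
    intro j _ h1 h2
    omega), two_mul]
  refine add_le_add ?_ ?_
  all_goals
    rw [← Finset.sum_image (f := F) (g := fun j => Nat.dist k j)]
    · refine Finset.sum_le_sum_of_subset_of_nonneg ?_ (fun i _ _ => hF i)
      intro i hi
      rw [Finset.mem_image] at hi
      obtain ⟨j, hj, rfl⟩ := hi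
      rw [Finset.mem_filter] at hj
      refine Finset.mem_Ioc.2 ⟨?_, hS j hj.1⟩
      simp only [Nat.dist]
      omega
    · intro i hi j hj hij
      simp only [Finset.coe_filter, Set.mem_ofPred_eq] at hi hj
      simp only [Nat.dist] at hij
      omega

lemma sum_inv_sqrt_le (Q : ℕ) : ∑ j ∈ Finset.Ioc 0 Q, 1 / Real.sqrt j ≤ 2 * Real.sqrt Q := by
  induction Q with
  | zero => simp
  | succ Q ih =>
    rw [Finset.sum_Ioc_succ_top (by omega)]
    have h1 : 0 < Real.sqrt ((Q + 1 : ℕ) : ℝ) := Real.sqrt_pos.2 (by positivity)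
    have h2 : 0 ≤ Real.sqrt Q := Real.sqrt_nonneg _
    have h3 : Real.sqrt ((Q + 1 : ℕ) : ℝ) ^ 2 = Q + 1 := by
      rw [Real.sq_sqrt (by positivity)]; push_cast; ring
    have h4 : Real.sqrt Q ^ 2 = Q := Real.sq_sqrt (by positivity)
    have : 1 / Real.sqrt ((Q + 1 : ℕ) : ℝ) ≤ 2 * (Real.sqrt ((Q + 1 : ℕ) : ℝ) - Real.sqrt Q) := by
      rw [div_le_iff₀ h1]
      nlinarith [sq_nonneg (Real.sqrt ((Q + 1 : ℕ) : ℝ) - Real.sqrt Q)]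
    linarith

lemma exists_rpow_sub_rpow_eq (c : ℝ) {x y : ℝ} (hx : 0 < x) (h : x < y) :
    ∃ ξ ∈ Set.Ioo x y, y ^ c - x ^ c = c * ξ ^ (c - 1) * (y - x) := by
  obtain ⟨ξ, hξ, hξ'⟩ := exists_hasDerivAt_eq_slope (fun x : ℝ => x ^ c)
      (fun y => c * y ^ (c - 1)) h
      (fun z hz => (Real.hasDerivAt_rpow_const
        (Or.inl (by linarith [hz.1]))).continuousAt.continuousWithinAt)
      (fun z hz => Real.hasDerivAt_rpow_const (Or.inl (by linarith [hz.1])))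
  rw [eq_div_iff (by linarith)] at hξ'
  exact ⟨ξ, hξ, hξ'.symm⟩

lemma rpow_sub_rpow_lower {c : ℝ} (hc : 1 < c) {N x y : ℝ} (hN : 0 < N) (hx : N ≤ x) (hxy : x ≤ y) :
    N ^ (c - 1) * (y - x) ≤ y ^ c - x ^ c := by
  rcases hxy.eq_or_lt with rfl | h
  · simp
  obtain ⟨ξ, hξ, hξ'⟩ := exists_rpow_sub_rpow_eq c (by linarith) h
  rw [hξ']
  have h1 : N ^ (c - 1) ≤ ξ ^ (c - 1) :=
    Real.rpow_le_rpow hN.le (by linarith [hξ.1]) (by linarith)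
  have h2 : 0 < N ^ (c - 1) := Real.rpow_pos_of_pos hN _
  have h3 : N ^ (c - 1) ≤ c * ξ ^ (c - 1) := by nlinarith
  nlinarith

lemma rpow_sub_rpow_upper {c : ℝ} (hc : 1 < c) {x y : ℝ} (hx : 0 < x) (hxy : x ≤ y) :
    y ^ c - x ^ c ≤ c * y ^ (c - 1) * (y - x) := by
  rcases hxy.eq_or_lt with rfl | h
  · simp
  obtain ⟨ξ, hξ, hξ'⟩ := exists_rpow_sub_rpow_eq c (by linarith) h
  rw [hξ']
  have h1 : ξ ^ (c - 1) ≤ y ^ (c - 1) :=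
    Real.rpow_le_rpow (by linarith [hξ.1]) hξ.2.le (by linarith)
  have : 0 < y - x := by linarith
  gcongr

/-- Correlation of two columns of the bilinear form: an off-diagonal exponential sum. -/
lemma norm_correlation_le {c : ℝ} (hc1 : 1 < c) (hc2 : c < 2) : ∃ C : ℝ, 0 < C ∧
    ∀ (x : ℝ) (M N X₀ t k₁ k₂ : ℕ), x ≠ 0 → 1 ≤ M → 1 ≤ N → N ≤ k₁ → k₁ < 2 * N →
    N ≤ k₂ → k₂ < 2 * N → k₁ ≠ k₂ →
    ‖∑ m ∈ (Finset.Ico M (2 * M)).filter (fun m => (X₀ < m * k₁ ∧ m * k₁ ≤ t) ∧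
      (X₀ < m * k₂ ∧ m * k₂ ≤ t)), ee (x * ((k₁ : ℝ) ^ c - (k₂ : ℝ) ^ c) * (m : ℝ) ^ c)‖ ≤
    C * (Real.sqrt (|x| * (M * N : ℝ) ^ c / N) * Real.sqrt (Nat.dist k₁ k₂) +
      M / Real.sqrt (|x| * (M * N : ℝ) ^ c / N) * (1 / Real.sqrt (Nat.dist k₁ k₂))) := by
  obtain ⟨C, hC, h⟩ := vdc_power hc1 hc2
  refine ⟨C * 4, by positivity, ?_⟩
  intro x M N X₀ t k₁ k₂ hx hM hN h1 h1' h2 h2' hne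
  set D : ℝ := ((Nat.dist k₁ k₂ : ℕ) : ℝ) with hD
  have hN0 : (0 : ℝ) < N := by exact_mod_cast hN
  have hM0 : (0 : ℝ) < M := by exact_mod_cast hM
  have hD0 : 0 < D := by
    rw [hD]
    exact_mod_cast Nat.dist_pos_of_ne hne
  have hDabs : D = |(k₁ : ℝ) - k₂| := by
    rw [hD]
    rcases le_total k₁ k₂ with hk | hk
    · rw [Nat.dist_eq_sub_of_le hk, abs_of_nonpos (sub_nonpos.2 (by exact_mod_cast hk)),
        Nat.cast_sub hk]
      ring
    · rw [Nat.dist_eq_sub_of_le_right hk, abs_of_nonneg (sub_nonneg.2 (by exact_mod_cast hk)),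
        Nat.cast_sub hk]
  have hdiff : (N : ℝ) ^ (c - 1) * D ≤ |(k₁ : ℝ) ^ c - (k₂ : ℝ) ^ c| ∧
      |(k₁ : ℝ) ^ c - (k₂ : ℝ) ^ c| ≤ 4 * (N : ℝ) ^ (c - 1) * D := by
    have main : ∀ a b : ℕ, N ≤ a → a ≤ b → b < 2 * N →
        (N : ℝ) ^ (c - 1) * |(a : ℝ) - b| ≤ |(a : ℝ) ^ c - (b : ℝ) ^ c| ∧
        |(a : ℝ) ^ c - (b : ℝ) ^ c| ≤ 4 * (N : ℝ) ^ (c - 1) * |(a : ℝ) - b| := by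
      intro a b ha hab hb
      have ha' : (N : ℝ) ≤ a := by exact_mod_cast ha
      have hab' : (a : ℝ) ≤ b := by exact_mod_cast hab
      have hb' : (b : ℝ) ≤ 2 * N := by exact_mod_cast hb.le
      have e1 := rpow_sub_rpow_lower hc1 hN0 ha' hab'
      have e2 := rpow_sub_rpow_upper hc1 (hN0.trans_le ha') hab'
      have e3 : (0 : ℝ) ≤ (N : ℝ) ^ (c - 1) := by positivity
      rw [abs_sub_comm (a : ℝ), abs_of_nonneg (sub_nonneg.2 hab'), abs_sub_comm ((a : ℝ) ^ c),
        abs_of_nonneg (a := (b : ℝ) ^ c - (a : ℝ) ^ c) (by nlinarith [sub_nonneg.2 hab'])]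
      refine ⟨e1, e2.trans ?_⟩
      have e4 : (b : ℝ) ^ (c - 1) ≤ 2 * (N : ℝ) ^ (c - 1) := by
        calc (b : ℝ) ^ (c - 1) ≤ (2 * N : ℝ) ^ (c - 1) :=
              Real.rpow_le_rpow (by linarith) hb' (by linarith)
          _ = 2 ^ (c - 1) * (N : ℝ) ^ (c - 1) := Real.mul_rpow (by norm_num) hN0.le
          _ ≤ 2 ^ (1 : ℝ) * (N : ℝ) ^ (c - 1) := by
              gcongr
              · norm_num
              · linarith
          _ = _ := by norm_num
      have e5 : c * (b : ℝ) ^ (c - 1) ≤ 2 * (2 * (N : ℝ) ^ (c - 1)) :=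
        mul_le_mul hc2.le e4 (by positivity) (by norm_num)
      have : 0 ≤ (b : ℝ) - a := sub_nonneg.2 hab'
      nlinarith
    rw [hDabs]
    rcases le_total k₁ k₂ with hk | hk
    · exact main k₁ k₂ h1 hk h2'
    · rw [abs_sub_comm (k₁ : ℝ), abs_sub_comm ((k₁ : ℝ) ^ c)]
      exact main k₂ k₁ h2 hk h1'
  set α := x * ((k₁ : ℝ) ^ c - (k₂ : ℝ) ^ c) with hα
  have hNc : 0 < (N : ℝ) ^ (c - 1) := Real.rpow_pos_of_pos hN0 _
  have hα0 : α ≠ 0 := by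
    refine mul_ne_zero hx fun h0 => ?_
    rw [h0, abs_zero] at hdiff
    have := mul_pos hNc hD0
    linarith [hdiff.1]
  have hx0 : 0 < |x| := abs_pos.2 hx
  set Z := |x| * (M * N : ℝ) ^ c / N with hZ
  have hZ0 : 0 < Z := by positivity
  have hZe : Z = |x| * (M : ℝ) ^ c * (N : ℝ) ^ (c - 1) := by
    rw [hZ, Real.mul_rpow hM0.le hN0.le, Real.rpow_sub hN0, Real.rpow_one]
    ring
  have hP1 : Z * D ≤ |α| * (M : ℝ) ^ c := by
    rw [hα, abs_mul, hZe]
    have := mul_le_mul_of_nonneg_left hdiff.1 (show 0 ≤ |x| * (M : ℝ) ^ c by positivity)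
    linarith
  have hP2 : |α| * (M : ℝ) ^ c ≤ 4 * (Z * D) := by
    rw [hα, abs_mul, hZe]
    have := mul_le_mul_of_nonneg_left hdiff.2 (show 0 ≤ |x| * (M : ℝ) ^ c by positivity)
    linarith
  have hs1 : Real.sqrt Z * Real.sqrt D ≤ Real.sqrt (|α| * (M : ℝ) ^ c) := by
    rw [← Real.sqrt_mul hZ0.le]
    exact Real.sqrt_le_sqrt hP1
  have hs2 : Real.sqrt (|α| * (M : ℝ) ^ c) ≤ 2 * (Real.sqrt Z * Real.sqrt D) := by
    rw [← Real.sqrt_mul hZ0.le, show (2 : ℝ) = Real.sqrt 4 by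
      rw [show (4 : ℝ) = 2 ^ 2 by norm_num, Real.sqrt_sq (by norm_num)],
      ← Real.sqrt_mul (by norm_num)]
    exact Real.sqrt_le_sqrt hP2
  have hsZ : 0 < Real.sqrt Z := Real.sqrt_pos.2 hZ0
  have hsD : 0 < Real.sqrt D := Real.sqrt_pos.2 hD0
  set a := max (M - 1) (max (X₀ / k₁) (X₀ / k₂)) with ha
  set b := min (2 * M - 1) (min (t / k₁) (t / k₂)) with hb
  have hset : (Finset.Ico M (2 * M)).filter (fun m => (X₀ < m * k₁ ∧ m * k₁ ≤ t) ∧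
      (X₀ < m * k₂ ∧ m * k₂ ≤ t)) = Finset.Ioc a b := by
    ext m
    have hk1 : 0 < k₁ := by omega
    have hk2 : 0 < k₂ := by omega
    simp only [Finset.mem_filter, Finset.mem_Ico, Finset.mem_Ioc, ha, hb, max_lt_iff, le_min_iff]
    rw [Nat.div_lt_iff_lt_mul hk1, Nat.div_lt_iff_lt_mul hk2, Nat.le_div_iff_mul_le hk1,
      Nat.le_div_iff_mul_le hk2]
    constructor
    · rintro ⟨⟨q1, q2⟩, ⟨q3, q4⟩, q5, q6⟩
      exact ⟨⟨by omega, q3, q5⟩, by omega, q4, q6⟩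
    · rintro ⟨⟨q1, q2, q3⟩, q4, q5, q6⟩
      exact ⟨⟨by omega, by omega⟩, ⟨q2, q5⟩, q3, q6⟩
  rw [hset]
  have hfin : C * (Real.sqrt (|α| * (M : ℝ) ^ c) + M / Real.sqrt (|α| * (M : ℝ) ^ c)) ≤
      C * 4 * (Real.sqrt Z * Real.sqrt D + M / Real.sqrt Z * (1 / Real.sqrt D)) := by
    have e1 : M / Real.sqrt Z * (1 / Real.sqrt D) = M / (Real.sqrt Z * Real.sqrt D) := by
      field_simp
    have e2 : M / Real.sqrt (|α| * (M : ℝ) ^ c) ≤ M / (Real.sqrt Z * Real.sqrt D) := by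
      gcongr
    have e3 : 0 < M / (Real.sqrt Z * Real.sqrt D) := by positivity
    have e4 : 0 < Real.sqrt Z * Real.sqrt D := by positivity
    rw [e1, mul_assoc]
    gcongr
    linarith
  refine le_trans ?_ hfin
  rcases le_or_gt a b with hab | hab
  · refine h M α a b (by exact_mod_cast hM) hα0 hab ?_ ?_
    · have : M ≤ a + 1 := by omega
      exact_mod_cast this
    · have : b ≤ 2 * M := by omega
      exact_mod_cast this
  · rw [Finset.Ioc_eq_empty (by omega)]
    simp
    positivity

/-- Bilinear estimate with the short variable restricted to a set of diameter at most `Q`. -/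
lemma bilinear_block {c : ℝ} (hc1 : 1 < c) (hc2 : c < 2) : ∃ C : ℝ, 0 < C ∧
    ∀ (x : ℝ) (M N X₀ t Q : ℕ) (S : Finset ℕ) (f g : ℕ → ℝ), x ≠ 0 → 1 ≤ M → 1 ≤ N → 1 ≤ Q →
    S ⊆ Finset.Ico N (2 * N) → (∀ i ∈ S, ∀ j ∈ S, Nat.dist i j ≤ Q) →
    ‖∑ m ∈ Finset.Ico M (2 * M), ∑ k ∈ S, (f m : ℂ) * (g k : ℂ) *
      (if X₀ < m * k ∧ m * k ≤ t then ee (x * ((m * k : ℕ) : ℝ) ^ c) else 0)‖ ^ 2 ≤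
    (∑ m ∈ Finset.Ico M (2 * M), f m ^ 2) * ((∑ k ∈ S, g k ^ 2) *
      (M + C * (Q * Real.sqrt (|x| * (M * N : ℝ) ^ c * Q / N) +
        M * Real.sqrt (N * Q / (|x| * (M * N : ℝ) ^ c))))) := by
  obtain ⟨C, hC, h⟩ := norm_correlation_le hc1 hc2
  refine ⟨4 * C, by positivity, ?_⟩
  intro x M N X₀ t Q S f g hx hM hN hQ hS hSQ
  set u : ℕ → ℕ → ℂ := fun k m =>
    if X₀ < m * k ∧ m * k ≤ t then ee (x * ((m * k : ℕ) : ℝ) ^ c) else 0 with hu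
  have hN0 : (0 : ℝ) < N := by exact_mod_cast hN
  have hM0 : (0 : ℝ) < M := by exact_mod_cast hM
  have hQ0 : (0 : ℝ) < Q := by exact_mod_cast hQ
  have hx0 : 0 < |x| := abs_pos.2 hx
  set Z := |x| * (M * N : ℝ) ^ c / N with hZ
  have hZ0 : 0 < Z := by positivity
  have hsZ : 0 < Real.sqrt Z := Real.sqrt_pos.2 hZ0
  set F : ℕ → ℝ := fun j => C * (Real.sqrt Z * Real.sqrt j + M / Real.sqrt Z * (1 / Real.sqrt j))
    with hF
  have hF0 : ∀ j, 0 ≤ F j := fun j => by positivity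
  set v : S → S → ℝ := fun i j =>
    if (i : ℕ) = j then (M : ℝ) else F (Nat.dist i j) with hv
  have hmem : ∀ i : S, N ≤ (i : ℕ) ∧ (i : ℕ) < 2 * N := fun i => Finset.mem_Ico.1 (hS i.2)
  have step1 : ‖∑ m ∈ Finset.Ico M (2 * M), ∑ k ∈ S, (f m : ℂ) * (g k : ℂ) * u k m‖ ^ 2 ≤
      (∑ m ∈ Finset.Ico M (2 * M), f m ^ 2) *
        ∑ m ∈ Finset.Ico M (2 * M), ‖∑ i : S, (g i : ℂ) * u i m‖ ^ 2 := by
    have e1 : ∀ m ∈ Finset.Ico M (2 * M), ∑ k ∈ S, (f m : ℂ) * (g k : ℂ) * u k m =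
        (f m : ℂ) * ∑ i : S, (g i : ℂ) * u i m := by
      intro m _
      rw [Finset.mul_sum, ← Finset.sum_coe_sort S]
      exact Finset.sum_congr rfl fun i _ => by ring
    rw [Finset.sum_congr rfl e1]
    have e2 : ‖∑ m ∈ Finset.Ico M (2 * M), (f m : ℂ) * ∑ i : S, (g i : ℂ) * u i m‖ ≤
        ∑ m ∈ Finset.Ico M (2 * M), |f m| * ‖∑ i : S, (g i : ℂ) * u i m‖ := by
      refine norm_sum_le_of_le _ fun m _ => ?_
      rw [norm_mul, Complex.norm_real, Real.norm_eq_abs]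
    refine (pow_le_pow_left₀ (norm_nonneg _) e2 2).trans ?_
    refine (Finset.sum_mul_sq_le_sq_mul_sq _ _ _).trans (le_of_eq ?_)
    simp only [sq_abs]
  refine step1.trans ?_
  refine mul_le_mul_of_nonneg_left ?_ (Finset.sum_nonneg fun _ _ => sq_nonneg _)
  have step2 := sum_normSq_le_schur (Finset.univ : Finset S) (Finset.Ico M (2 * M))
    (fun i => g i) (fun i m => u i m) v (fun i j => by
      simp only [hv, Nat.dist_comm (i : ℕ) j, eq_comm (a := (i : ℕ))]) (fun i j => by
      by_cases hij : (i : ℕ) = j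
      · simp only [hv, if_pos hij]
        refine (norm_sum_le_of_le _ (f := fun m => u i m * (starRingEnd ℂ) (u j m))
          (n := fun _ => (1 : ℝ)) fun m _ => ?_).trans ?_
        · simp only [hu]
          rw [norm_mul, Complex.norm_conj]
          split_ifs <;> simp [norm_ee]
        · simp only [Finset.sum_const, Nat.card_Ico, nsmul_eq_mul, mul_one]
          rw [show 2 * M - M = M by omega]
      · simp only [hv, if_neg hij]
        have := h x M N X₀ t i j hx hM hN (hmem i).1 (hmem i).2 (hmem j).1 (hmem j).2 hij
        refine le_trans (le_of_eq ?_) this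
        rw [Finset.sum_filter]
        congr 1
        refine Finset.sum_congr rfl fun m _ => ?_
        simp only [hu]
        by_cases q1 : X₀ < m * (i : ℕ) ∧ m * (i : ℕ) ≤ t
        · by_cases q2 : X₀ < m * (j : ℕ) ∧ m * (j : ℕ) ≤ t
          · rw [if_pos q1, if_pos q2, if_pos ⟨q1, q2⟩, conj_ee, ← ee_add]
            congr 1
            push_cast
            rw [Real.mul_rpow (by positivity) (by positivity),
              Real.mul_rpow (by positivity) (by positivity)]
            ring
          · have q3 : ¬ ((X₀ < m * (i : ℕ) ∧ m * (i : ℕ) ≤ t) ∧ X₀ < m * (j : ℕ) ∧ m * (j : ℕ) ≤ t) :=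
              fun q => q2 q.2
            rw [if_neg q2, if_neg q3, map_zero, mul_zero]
        · have q3 : ¬ ((X₀ < m * (i : ℕ) ∧ m * (i : ℕ) ≤ t) ∧ X₀ < m * (j : ℕ) ∧ m * (j : ℕ) ≤ t) :=
            fun q => q1 q.1
          rw [if_neg q1, if_neg q3, zero_mul])
  refine step2.trans ?_
  rw [← Finset.sum_coe_sort S, Finset.sum_mul]
  refine Finset.sum_le_sum fun i _ => mul_le_mul_of_nonneg_left ?_ (sq_nonneg _)
  have hrow : ∑ j : S, v i j = ∑ j ∈ S, if (i : ℕ) = j then (M : ℝ) else F (Nat.dist i j) := by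
    rw [← Finset.sum_coe_sort S]
  rw [hrow, Finset.sum_ite, Finset.sum_const, nsmul_eq_mul]
  have hc1' : ((S.filter (fun j => (i : ℕ) = j)).card : ℝ) * M ≤ M := by
    have : (S.filter (fun j => (i : ℕ) = j)).card ≤ 1 := by
      rw [Finset.card_le_one]
      intro p hp q hq
      rw [← (Finset.mem_filter.1 hp).2, ← (Finset.mem_filter.1 hq).2]
    have : ((S.filter (fun j => (i : ℕ) = j)).card : ℝ) ≤ 1 := by exact_mod_cast this
    nlinarith
  refine add_le_add hc1' ?_
  have hoff := sum_dist_le S i Q (fun j hj => hSQ i i.2 j hj) F hF0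
  have hfe : S.filter (fun j => ¬ (i : ℕ) = j) = S.filter (fun j => j ≠ (i : ℕ)) := by
    ext j
    simp [eq_comm]
  rw [hfe]
  refine hoff.trans ?_
  have hsum : ∑ j ∈ Finset.Ioc 0 Q, F j ≤
      C * (Real.sqrt Z * (Q * Real.sqrt Q) + M / Real.sqrt Z * (2 * Real.sqrt Q)) := by
    simp only [hF]
    rw [← Finset.mul_sum, Finset.sum_add_distrib, ← Finset.mul_sum, ← Finset.mul_sum]
    have e1 : ∑ j ∈ Finset.Ioc 0 Q, Real.sqrt j ≤ Q * Real.sqrt Q := by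
      refine (Finset.sum_le_sum (g := fun _ => Real.sqrt Q) fun j hj => ?_).trans ?_
      · exact Real.sqrt_le_sqrt (by exact_mod_cast (Finset.mem_Ioc.1 hj).2)
      · simp
    have e2 := sum_inv_sqrt_le Q
    gcongr
  have hZ1 : Real.sqrt (|x| * (M * N : ℝ) ^ c * Q / N) = Real.sqrt Z * Real.sqrt Q := by
    rw [← Real.sqrt_mul hZ0.le]
    congr 1
    rw [hZ]; ring
  have hZ2 : Real.sqrt (N * Q / (|x| * (M * N : ℝ) ^ c)) = Real.sqrt Q / Real.sqrt Z := by
    rw [← Real.sqrt_div hQ0.le]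
    congr 1
    rw [hZ]; field_simp
  rw [hZ1, hZ2]
  have e3 : 0 < M / Real.sqrt Z * Real.sqrt Q := by positivity
  have e4 : 0 < Q * (Real.sqrt Z * Real.sqrt Q) := by positivity
  have e5 : M * (Real.sqrt Q / Real.sqrt Z) = M / Real.sqrt Z * Real.sqrt Q := by ring
  rw [e5]
  nlinarith

lemma bilinear_split {c : ℝ} (hc1 : 1 < c) (hc2 : c < 2) : ∃ C : ℝ, 0 < C ∧
    ∀ (x : ℝ) (M N X₀ t Q : ℕ) (f g : ℕ → ℝ), x ≠ 0 → 1 ≤ M → 1 ≤ N → 1 ≤ Q →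
    ‖∑ m ∈ Finset.Ico M (2 * M), ∑ k ∈ Finset.Ico N (2 * N), (f m : ℂ) * (g k : ℂ) *
      (if X₀ < m * k ∧ m * k ≤ t then ee (x * ((m * k : ℕ) : ℝ) ^ c) else 0)‖ ^ 2 ≤
    ((N / Q + 1 : ℕ) : ℝ) *
    ((∑ m ∈ Finset.Ico M (2 * M), f m ^ 2) * ((∑ k ∈ Finset.Ico N (2 * N), g k ^ 2) *
      (M + C * (Q * Real.sqrt (|x| * (M * N : ℝ) ^ c * Q / N) +
        M * Real.sqrt (N * Q / (|x| * (M * N : ℝ) ^ c)))))) := by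
  obtain ⟨C, hC, h⟩ := bilinear_block hc1 hc2
  refine ⟨C, hC, ?_⟩
  intro x M N X₀ t Q f g hx hM hN hQ
  set E := M + C * (Q * Real.sqrt (|x| * (M * N : ℝ) ^ c * Q / N) +
        M * Real.sqrt (N * Q / (|x| * (M * N : ℝ) ^ c))) with hE
  set S : ℕ → Finset ℕ := fun i => (Finset.Ico N (2 * N)).filter (fun k => (k - N) / Q = i) with hS
  have hmaps : ∀ k ∈ Finset.Ico N (2 * N), (k - N) / Q ∈ Finset.range (N / Q + 1) := by
    intro k hk
    rw [Finset.mem_Ico] at hk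
    rw [Finset.mem_range, Nat.lt_succ_iff]
    exact Nat.div_le_div_right (by omega)
  have hsplit : ∀ F : ℕ → ℂ, ∑ k ∈ Finset.Ico N (2 * N), F k =
      ∑ i ∈ Finset.range (N / Q + 1), ∑ k ∈ S i, F k := fun F =>
    (Finset.sum_fiberwise_of_maps_to hmaps F).symm
  have hg : ∑ k ∈ Finset.Ico N (2 * N), g k ^ 2 =
      ∑ i ∈ Finset.range (N / Q + 1), ∑ k ∈ S i, g k ^ 2 :=
    (Finset.sum_fiberwise_of_maps_to hmaps _).symm
  rw [hg]
  simp only [hsplit]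
  rw [Finset.sum_comm]
  refine (pow_le_pow_left₀ (norm_nonneg _) (norm_sum_le _ _) 2).trans ?_
  refine sq_sum_le_card_mul_sum_sq.trans ?_
  rw [Finset.card_range]
  refine mul_le_mul_of_nonneg_left ?_ (Nat.cast_nonneg _)
  rw [Finset.sum_mul (Finset.range (N / Q + 1)), Finset.mul_sum (Finset.range (N / Q + 1))]
  refine Finset.sum_le_sum fun i _ => ?_
  refine h x M N X₀ t Q (S i) f g hx hM hN hQ (Finset.filter_subset _ _) ?_
  intro p hp q hq
  simp only [hS, Finset.mem_filter, Finset.mem_Ico] at hp hq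
  have e1 := Nat.div_add_mod (p - N) Q
  have e2 := Nat.div_add_mod (q - N) Q
  have e3 := Nat.mod_lt (p - N) hQ
  have e4 := Nat.mod_lt (q - N) hQ
  rw [hp.2] at e1
  rw [hq.2] at e2
  simp only [Nat.dist]
  omega

set_option maxHeartbeats 1000000 in
lemma bilinear_dyadic_of_le {c : ℝ} (hc1 : 1 < c) (hc2 : c < 2) : ∃ C : ℝ, 0 < C ∧
    ∀ (θ x Λ : ℝ) (M N X₀ t : ℕ) (f g : ℕ → ℝ), 1 ≤ θ → x ≠ 0 → 1 ≤ M → 1 ≤ N → N ≤ M →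
    θ ^ 2 ≤ 4 * N → (M * N : ℝ) ≤ 2 * θ ^ 20 → θ ^ 20 ≤ 4 * (M * N) →
    |x| * (θ ^ 20) ^ c ≤ θ ^ 27 →
    ∑ m ∈ Finset.Ico M (2 * M), f m ^ 2 ≤ Λ * M → ∑ k ∈ Finset.Ico N (2 * N), g k ^ 2 ≤ Λ * N →
    ‖∑ m ∈ Finset.Ico M (2 * M), ∑ k ∈ Finset.Ico N (2 * N), (f m : ℂ) * (g k : ℂ) *
      (if X₀ < m * k ∧ m * k ≤ t then ee (x * ((m * k : ℕ) : ℝ) ^ c) else 0)‖ ^ 2 ≤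
    C * Λ ^ 2 * (θ ^ 20) ^ 2 * (1 / θ + 1 / Real.sqrt (|x| * (θ ^ 20) ^ c)) := by
  obtain ⟨C, hC, h⟩ := bilinear_split hc1 hc2
  refine ⟨2 * 4 * (12 + C * (12 + 5)), by positivity, ?_⟩
  intro θ x Λ M N X₀ t f g hθ hx hM hN hNM h1 h2 h3 hY hf hg
  have hN0 : (0 : ℝ) < N := by exact_mod_cast hN
  have hM0 : (0 : ℝ) < M := by exact_mod_cast hM
  have hN1 : (1 : ℝ) ≤ N := by exact_mod_cast hN
  have hNM' : (N : ℝ) ≤ M := by exact_mod_cast hNM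
  have hx0 : 0 < |x| := abs_pos.2 hx
  have hθ0 : 0 < θ := by linarith
  set Y := |x| * (θ ^ 20) ^ c with hYd
  set Z := |x| * (M * N : ℝ) ^ c with hZd
  have hY0 : 0 < Y := by positivity
  have hZ0 : 0 < Z := by positivity
  have h2c : (2 : ℝ) ^ c ≤ 4 := by
    calc (2 : ℝ) ^ c ≤ 2 ^ (2 : ℝ) := Real.rpow_le_rpow_of_exponent_le (by norm_num) hc2.le
      _ = 4 := by norm_num
  have h4c : (4 : ℝ) ^ c ≤ 16 := by
    calc (4 : ℝ) ^ c ≤ 4 ^ (2 : ℝ) := Real.rpow_le_rpow_of_exponent_le (by norm_num) hc2.le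
      _ = 16 := by norm_num
  have hZ1 : Z ≤ 4 * Y := by
    have : (M * N : ℝ) ^ c ≤ (2 * θ ^ 20) ^ c := Real.rpow_le_rpow (by positivity) h2 (by linarith)
    rw [Real.mul_rpow (x := 2) (y := θ ^ 20) (by norm_num) (by positivity)] at this
    have e : (M * N : ℝ) ^ c ≤ 4 * (θ ^ 20) ^ c := this.trans (by gcongr)
    rw [hZd, hYd]
    nlinarith
  have hZ2 : Y ≤ 16 * Z := by
    have : (θ ^ 20) ^ c ≤ (4 * (M * N) : ℝ) ^ c := Real.rpow_le_rpow (by positivity) h3 (by linarith)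
    rw [Real.mul_rpow (x := 4) (y := (M * N : ℝ)) (by norm_num) (by positivity)] at this
    have e : (θ ^ 20) ^ c ≤ 16 * (M * N : ℝ) ^ c := this.trans (by gcongr)
    rw [hZd, hYd]
    nlinarith
  have hMlow : θ ^ 10 ≤ 2 * M := by
    refine (pow_le_pow_iff_left₀ (by positivity) (by positivity) two_ne_zero).1 ?_
    nlinarith
  set R := θ ^ 18 * M / Z with hR
  have hR0 : 0 < R := by positivity
  have hRlow : θ ≤ 8 * R := by
    rw [hR, mul_div_assoc', le_div_iff₀ hZ0]
    calc θ * Z ≤ θ * (4 * θ ^ 27) := by gcongr; linarith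
      _ = 4 * θ ^ 18 * θ ^ 10 := by ring
      _ ≤ 4 * θ ^ 18 * (2 * M) := by gcongr
      _ = _ := by ring
  set Q := min N ⌈R⌉₊ with hQ
  have hceil : 1 ≤ ⌈R⌉₊ := Nat.one_le_ceil_iff.2 hR0
  have hQ1 : 1 ≤ Q := le_min hN hceil
  have hQ0 : (0 : ℝ) < Q := by exact_mod_cast hQ1
  have hQN : (Q : ℝ) ≤ N := by exact_mod_cast min_le_left _ _
  have hQR : (Q : ℝ) ≤ 9 * R := by
    have e1 : (Q : ℝ) ≤ ⌈R⌉₊ := by exact_mod_cast min_le_right _ _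
    have e2 := Nat.ceil_lt_add_one hR0.le
    linarith
  have hQinv : ∀ w : ℝ, 0 < w → w / Q ≤ w / N + w / R := by
    intro w hw
    rcases min_choice N ⌈R⌉₊ with e | e
    · rw [hQ, e]
      have : 0 < w / R := by positivity
      linarith
    · rw [hQ, e]
      have e1 : w / (⌈R⌉₊ : ℝ) ≤ w / R := by
        gcongr
        exact Nat.le_ceil R
      have : 0 < w / N := by positivity
      linarith
  have hmain := h x M N X₀ t Q f g hx hM hN hQ1
  refine hmain.trans ?_
  have hΛM : 0 ≤ Λ * M := (Finset.sum_nonneg fun _ _ => sq_nonneg _).trans hf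
  have hΛ0 : 0 ≤ Λ := nonneg_of_mul_nonneg_left hΛM hM0
  have hcount : ((N / Q + 1 : ℕ) : ℝ) ≤ 2 * (N / Q) := by
    push_cast
    have e1 : ((N / Q : ℕ) : ℝ) ≤ N / Q := Nat.cast_div_le
    have e2 : (1 : ℝ) ≤ N / Q := by rw [le_div_iff₀ hQ0]; linarith
    linarith
  set E1 := Real.sqrt (Z * Q / N) with hE1
  set E2 := Real.sqrt (N * Q / Z) with hE2
  have hE1b : E1 ≤ 12 * M / θ := by
    rw [hE1]
    refine Real.sqrt_le_iff.2 ⟨by positivity, ?_⟩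
    calc Z * Q / N ≤ Z * (9 * R) / N := by gcongr
      _ = 9 * θ ^ 18 * M / N := by rw [hR]; field_simp
      _ ≤ (12 * M / θ) ^ 2 := by
          rw [div_pow, div_le_div_iff₀ hN0 (by positivity)]
          have : θ ^ 20 * M ≤ 4 * (M * N) * M := by gcongr
          nlinarith
  have hE2b : E2 ≤ Q * (4 / Real.sqrt Y + 1 / θ) := by
    rw [hE2]
    have e0 : 0 < Real.sqrt Y := Real.sqrt_pos.2 hY0
    refine Real.sqrt_le_iff.2 ⟨by positivity, ?_⟩
    have e1 : N * Q / Z = Q ^ 2 * ((N / Z) / Q) := by field_simp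
    rw [e1, mul_pow]
    gcongr
    refine (hQinv _ (by positivity)).trans ?_
    have e2 : (N : ℝ) / Z / N = 1 / Z := by field_simp
    have e3 : (N : ℝ) / Z / R = N / (θ ^ 18 * M) := by rw [hR]; field_simp
    have e4 : 1 / Z ≤ 16 / Y := by
      rw [div_le_div_iff₀ hZ0 hY0]; linarith
    have e5 : (N : ℝ) / (θ ^ 18 * M) ≤ (1 / θ) ^ 2 := by
      rw [div_pow, div_le_div_iff₀ (by positivity) (by positivity)]
      have : θ ^ 2 ≤ θ ^ 18 := pow_le_pow_right₀ hθ (by norm_num)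
      have : (N : ℝ) * θ ^ 2 ≤ M * θ ^ 18 := by gcongr
      linarith
    have e6 : (4 / Real.sqrt Y) ^ 2 = 16 / Y := by
      rw [div_pow, Real.sq_sqrt hY0.le]; norm_num
    have e7 : 0 ≤ 2 * (4 / Real.sqrt Y) * (1 / θ) := by positivity
    rw [e2, e3, add_sq, e6]
    linarith
  have hNQ : (1 : ℝ) / Q ≤ 12 / θ := by
    refine (hQinv 1 one_pos).trans ?_
    have e1 : (1 : ℝ) / N ≤ 4 / θ := by
      rw [div_le_div_iff₀ hN0 hθ0]
      nlinarith
    have e2 : 1 / R ≤ 8 / θ := by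
      rw [div_le_div_iff₀ hR0 hθ0]; linarith
    have e3 : 12 / θ = 4 / θ + 8 / θ := by ring
    linarith
  have e0 : 0 < Real.sqrt Y := Real.sqrt_pos.2 hY0
  have hF0 : 0 ≤ ∑ m ∈ Finset.Ico M (2 * M), f m ^ 2 := Finset.sum_nonneg fun _ _ => sq_nonneg _
  have hG0 : 0 ≤ ∑ k ∈ Finset.Ico N (2 * N), g k ^ 2 := Finset.sum_nonneg fun _ _ => sq_nonneg _
  have hE10 : 0 ≤ E1 := Real.sqrt_nonneg _
  have hE20 : 0 ≤ E2 := Real.sqrt_nonneg _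
  have hQ' : (0 : ℝ) ≤ Q := hQ0.le
  generalize (∑ m ∈ Finset.Ico M (2 * M), f m ^ 2) = F at *
  generalize (∑ k ∈ Finset.Ico N (2 * N), g k ^ 2) = G at *
  clear_value E1 E2 Y Z
  generalize (Q : ℝ) = q at *
  clear h hmain
  generalize ((N / Q + 1 : ℕ) : ℝ) = r at *
  calc r * (F * (G * (M + C * (q * E1 + M * E2))))
      ≤ 2 * (N / q) * ((Λ * M) * ((Λ * N) * (M + C * (q * (12 * M / θ) +
          M * (q * (4 / Real.sqrt Y + 1 / θ)))))) := by gcongr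
    _ = 2 * Λ ^ 2 * (M * N) ^ 2 * (1 / q + C * (12 / θ + (4 / Real.sqrt Y + 1 / θ))) := by
        field_simp
    _ ≤ 2 * Λ ^ 2 * (2 * θ ^ 20) ^ 2 *
        (12 / θ + C * (12 / θ + (4 / Real.sqrt Y + 1 / θ))) := by gcongr
    _ ≤ 2 * Λ ^ 2 * (2 * θ ^ 20) ^ 2 *
        ((12 + C * (12 + 5)) * (1 / θ + 1 / Real.sqrt Y)) := by
        gcongr
        have : 0 < 1 / θ := by positivity
        have : 0 < 1 / Real.sqrt Y := by positivity
        have e8 : 12 / θ = 12 * (1 / θ) := by ring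
        have e9 : 4 / Real.sqrt Y = 4 * (1 / Real.sqrt Y) := by ring
        rw [e8, e9]
        nlinarith [mul_pos hC (show 0 < 1 / θ by positivity), mul_pos hC (show 0 < 1 / Real.sqrt Y by positivity)]
    _ = _ := by ring

/-- Bilinear estimate over dyadic boxes, for `X = θ ^ 20` and `|x| X ^ c ≤ X ^ 1.35`. -/
lemma bilinear_dyadic {c : ℝ} (hc1 : 1 < c) (hc2 : c < 2) : ∃ C : ℝ, 0 < C ∧
    ∀ (θ x Λ : ℝ) (M N X₀ t : ℕ) (f g : ℕ → ℝ), 1 ≤ θ → x ≠ 0 → 1 ≤ M → 1 ≤ N →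
    θ ^ 2 ≤ 4 * M → θ ^ 2 ≤ 4 * N → (M * N : ℝ) ≤ 2 * θ ^ 20 → θ ^ 20 ≤ 4 * (M * N) →
    |x| * (θ ^ 20) ^ c ≤ θ ^ 27 →
    ∑ m ∈ Finset.Ico M (2 * M), f m ^ 2 ≤ Λ * M → ∑ k ∈ Finset.Ico N (2 * N), g k ^ 2 ≤ Λ * N →
    ‖∑ m ∈ Finset.Ico M (2 * M), ∑ k ∈ Finset.Ico N (2 * N), (f m : ℂ) * (g k : ℂ) *
      (if X₀ < m * k ∧ m * k ≤ t then ee (x * ((m * k : ℕ) : ℝ) ^ c) else 0)‖ ^ 2 ≤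
    C * Λ ^ 2 * (θ ^ 20) ^ 2 * (1 / θ + 1 / Real.sqrt (|x| * (θ ^ 20) ^ c)) := by
  obtain ⟨C, hC, h⟩ := bilinear_dyadic_of_le hc1 hc2
  refine ⟨C, hC, ?_⟩
  intro θ x Λ M N X₀ t f g hθ hx hM hN hM1 hN1 h2 h3 hY hf hg
  rcases le_total N M with hNM | hNM
  · exact h θ x Λ M N X₀ t f g hθ hx hM hN hNM hN1 h2 h3 hY hf hg
  · have := h θ x Λ N M X₀ t g f hθ hx hN hM hNM hM1 (by linarith) (by linarith) hY hg hf
    refine le_trans (le_of_eq ?_) this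
    rw [Finset.sum_comm]
    congr 2
    refine Finset.sum_congr rfl fun m _ => Finset.sum_congr rfl fun k _ => ?_
    rw [mul_comm m k, mul_comm (f k : ℂ)]

lemma vdc_multiples {c : ℝ} (hc1 : 1 < c) (hc2 : c < 2) : ∃ C : ℝ, 0 < C ∧
    ∀ (X x : ℝ) (m b : ℕ), x ≠ 0 → 1 ≤ m → (m : ℝ) ≤ X → ⌊X⌋₊ / m ≤ b → (b : ℝ) ≤ 2 * X / m →
    ‖∑ k ∈ Finset.Ioc (⌊X⌋₊ / m) b, ee (x * ((m * k : ℕ) : ℝ) ^ c)‖ ≤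
      C * (Real.sqrt (|x| * X ^ c) + X / m / Real.sqrt (|x| * X ^ c)) := by
  obtain ⟨C, hC, h⟩ := vdc_power hc1 hc2
  refine ⟨C, hC, ?_⟩
  intro X x m b hx hm hmX hab hb
  have hm0 : (0 : ℝ) < m := by exact_mod_cast hm
  have hX : 0 < X := hm0.trans_le hmX
  have hmc : (0 : ℝ) < (m : ℝ) ^ c := by positivity
  have key := h (X / m) (x * (m : ℝ) ^ c) (⌊X⌋₊ / m) b ((one_le_div hm0).2 hmX)
    (mul_ne_zero hx hmc.ne') hab ?_ (by rw [mul_div_assoc] at hb; exact hb)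
  · have e1 : |x * (m : ℝ) ^ c| * (X / m) ^ c = |x| * X ^ c := by
      rw [abs_mul, abs_of_pos hmc, Real.div_rpow hX.le hm0.le]
      field_simp
    rw [e1] at key
    refine le_trans (le_of_eq ?_) key
    congr 1
    refine Finset.sum_congr rfl fun k _ => ?_
    rw [Nat.cast_mul, Real.mul_rpow hm0.le (Nat.cast_nonneg _), mul_assoc]
  · rw [← Nat.floor_div_natCast]
    exact (Nat.lt_floor_add_one _).le

/-- Type I estimate. -/
lemma type_one_sum {c : ℝ} (hc1 : 1 < c) (hc2 : c < 2) : ∃ C : ℝ, 0 < C ∧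
    ∀ (X x A W : ℝ) (t D : ℕ) (f g : ArithmeticFunction ℝ), 1 ≤ X → x ≠ 0 → ⌊X⌋₊ ≤ t →
    (t : ℝ) ≤ 2 * X → (D : ℝ) ≤ X → 0 ≤ A → 0 ≤ W → (∀ m, |f m| ≤ A) → (∀ m, D < m → f m = 0) →
    (∀ (z : ℕ → ℂ) (a b : ℕ) (B : ℝ), a ≤ b → b ≤ t → 0 ≤ B →
      (∀ s, a ≤ s → s ≤ b → ‖∑ n ∈ Finset.Ioc a s, z n‖ ≤ B) →
      ‖∑ n ∈ Finset.Ioc a b, (g n : ℂ) * z n‖ ≤ W * B) →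
    ‖∑ n ∈ Finset.Ioc ⌊X⌋₊ t, ((f * g) n : ℂ) * ee (x * (n : ℝ) ^ c)‖ ≤
      C * A * W * (D * Real.sqrt (|x| * X ^ c) +
        X * (1 + Real.log D) / Real.sqrt (|x| * X ^ c)) := by
  obtain ⟨C, hC, h⟩ := vdc_multiples hc1 hc2
  refine ⟨C, hC, ?_⟩
  intro X x A W t D f g hX hx hXt ht hD hA hW hf hfD hg
  rw [sum_Ioc_convolution f g (fun n => ee (x * (n : ℝ) ^ c))]
  set Y := |x| * X ^ c with hY
  have hx0 : 0 < |x| := abs_pos.2 hx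
  have hY0 : 0 < Y := by positivity
  have hsub : ∑ m ∈ Finset.Ioc 0 t, ∑ k ∈ Finset.Ioc (⌊X⌋₊ / m) (t / m),
        (f m : ℂ) * (g k : ℂ) * ee (x * ((m * k : ℕ) : ℝ) ^ c) =
      ∑ m ∈ (Finset.Ioc 0 t).filter (· ≤ D), ∑ k ∈ Finset.Ioc (⌊X⌋₊ / m) (t / m),
        (f m : ℂ) * (g k : ℂ) * ee (x * ((m * k : ℕ) : ℝ) ^ c) := by
    rw [Finset.sum_filter]
    refine Finset.sum_congr rfl fun m _ => ?_
    split_ifs with hm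
    · rfl
    · rw [hfD m (not_le.1 hm)]
      simp
  rw [hsub]
  have hbound : ∀ m ∈ (Finset.Ioc 0 t).filter (· ≤ D),
      ‖∑ k ∈ Finset.Ioc (⌊X⌋₊ / m) (t / m),
        (f m : ℂ) * (g k : ℂ) * ee (x * ((m * k : ℕ) : ℝ) ^ c)‖ ≤
      C * A * W * (Real.sqrt Y + X / Real.sqrt Y * (1 / m)) := by
    intro m hm
    simp only [Finset.mem_filter, Finset.mem_Ioc] at hm
    have hm1 : 1 ≤ m := hm.1.1
    have hm0 : (0 : ℝ) < m := by exact_mod_cast hm1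
    have hmX : (m : ℝ) ≤ X := le_trans (by exact_mod_cast hm.2) hD
    simp only [mul_assoc]
    rw [← Finset.mul_sum, norm_mul, Complex.norm_real, Real.norm_eq_abs]
    have key := hg (fun k => ee (x * ((m * k : ℕ) : ℝ) ^ c)) (⌊X⌋₊ / m) (t / m)
      (C * (Real.sqrt Y + X / m / Real.sqrt Y)) (Nat.div_le_div_right hXt)
      (Nat.div_le_self _ _) (by positivity) (by
        intro s hs hst
        refine h X x m s hx hm1 hmX hs ?_
        rw [le_div_iff₀ hm0]
        have : s * m ≤ t := (Nat.le_div_iff_mul_le hm1).1 hst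
        calc (s : ℝ) * m = ((s * m : ℕ) : ℝ) := by push_cast; ring
          _ ≤ t := by exact_mod_cast this
          _ ≤ _ := ht)
    calc |f m| * _ ≤ A * (W * (C * (Real.sqrt Y + X / m / Real.sqrt Y))) :=
          mul_le_mul (hf m) key (norm_nonneg _) hA
      _ = _ := by ring
  refine (norm_sum_le_of_le _ hbound).trans ?_
  rw [← Finset.mul_sum, Finset.sum_add_distrib, ← Finset.mul_sum, Finset.sum_const, nsmul_eq_mul]
  have hsubset : (Finset.Ioc 0 t).filter (· ≤ D) ⊆ Finset.Ioc 0 D := by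
    intro m hm
    simp only [Finset.mem_filter, Finset.mem_Ioc] at hm ⊢
    exact ⟨hm.1.1, hm.2⟩
  have hcard : (((Finset.Ioc 0 t).filter (· ≤ D)).card : ℝ) ≤ D := by
    have := Finset.card_le_card hsubset
    rw [Nat.card_Ioc, Nat.sub_zero] at this
    exact_mod_cast this
  have hinv : ∑ m ∈ (Finset.Ioc 0 t).filter (· ≤ D), (1 / m : ℝ) ≤ 1 + Real.log D :=
    (Finset.sum_le_sum_of_subset_of_nonneg hsubset fun _ _ _ => by positivity).trans
      (sum_Ioc_inv_le D)
  have e : X * (1 + Real.log D) / Real.sqrt Y = X / Real.sqrt Y * (1 + Real.log D) := by ring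
  rw [e]
  have : 0 ≤ X / Real.sqrt Y := by positivity
  gcongr

lemma sum_Ico_dyadic (F : ℕ → ℂ) (J : ℕ) :
    ∑ n ∈ Finset.Ico 1 (2 ^ J), F n =
      ∑ i ∈ Finset.range J, ∑ n ∈ Finset.Ico (2 ^ i) (2 * 2 ^ i), F n := by
  induction J with
  | zero => simp
  | succ J ih =>
    rw [Finset.sum_range_succ, ← ih, pow_succ', Finset.sum_Ico_consecutive _ Nat.one_le_two_pow (by omega)]

/-- Type II estimate with `X = θ ^ 20`. -/
lemma type_two_sum {c : ℝ} (hc1 : 1 < c) (hc2 : c < 2) : ∃ C : ℝ, 0 < C ∧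
    ∀ (θ x Λ : ℝ) (t J U : ℕ) (f g : ArithmeticFunction ℝ), 1 ≤ θ → x ≠ 0 → t < 2 ^ J →
    (t : ℝ) ≤ 2 * θ ^ 20 → θ ^ 2 ≤ U + 1 → |x| * (θ ^ 20) ^ c ≤ θ ^ 27 → 0 ≤ Λ →
    (∀ m, m ≤ U → f m = 0) → (∀ m, m ≤ U → g m = 0) →
    (∀ M, 1 ≤ M → M ≤ t → ∑ m ∈ Finset.Ico M (2 * M), f m ^ 2 ≤ Λ * M) →
    (∀ M, 1 ≤ M → M ≤ t → ∑ m ∈ Finset.Ico M (2 * M), g m ^ 2 ≤ Λ * M) →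
    ‖∑ n ∈ Finset.Ioc ⌊θ ^ 20⌋₊ t, ((f * g) n : ℂ) * ee (x * (n : ℝ) ^ c)‖ ≤
      C * J ^ 2 * Λ * θ ^ 20 *
        Real.sqrt (1 / θ + 1 / Real.sqrt (|x| * (θ ^ 20) ^ c)) := by
  obtain ⟨C, hC, h⟩ := bilinear_dyadic hc1 hc2
  refine ⟨Real.sqrt C, Real.sqrt_pos.2 hC, ?_⟩
  intro θ x Λ t J U f g hθ hx htJ ht hU hY hΛ hfU hgU hf hg
  rw [sum_Ioc_convolution f g (fun n => ee (x * (n : ℝ) ^ c))]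
  set X₀ := ⌊θ ^ 20⌋₊ with hX₀
  set F : ℕ → ℕ → ℂ := fun m k => (f m : ℂ) * (g k : ℂ) *
      (if X₀ < m * k ∧ m * k ≤ t then ee (x * ((m * k : ℕ) : ℝ) ^ c) else 0) with hF
  set E := Real.sqrt C * Λ * θ ^ 20 *
        Real.sqrt (1 / θ + 1 / Real.sqrt (|x| * (θ ^ 20) ^ c)) with hE
  have hE0 : 0 ≤ E := by positivity
  have e1 : ∑ m ∈ Finset.Ioc 0 t, ∑ k ∈ Finset.Ioc (X₀ / m) (t / m),
        (f m : ℂ) * (g k : ℂ) * ee (x * ((m * k : ℕ) : ℝ) ^ c) =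
      ∑ m ∈ Finset.Ico 1 (2 ^ J), ∑ k ∈ Finset.Ico 1 (2 ^ J), F m k := by
    have hs : Finset.Ioc 0 t ⊆ Finset.Ico 1 (2 ^ J) := by
      intro m hm
      simp only [Finset.mem_Ioc, Finset.mem_Ico] at hm ⊢
      omega
    have e2 : ∑ m ∈ Finset.Ioc 0 t, ∑ k ∈ Finset.Ico 1 (2 ^ J), F m k =
        ∑ m ∈ Finset.Ico 1 (2 ^ J), ∑ k ∈ Finset.Ico 1 (2 ^ J), F m k := by
      refine Finset.sum_subset hs ?_
      intro m hm hm'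
      refine Finset.sum_eq_zero fun k hk => ?_
      simp only [Finset.mem_Ioc, Finset.mem_Ico] at hm hm' hk
      have : m ≤ m * k := Nat.le_mul_of_pos_right m hk.1
      rw [hF]
      simp only
      rw [if_neg (by omega), mul_zero]
    rw [← e2]
    refine Finset.sum_congr rfl fun m hm => ?_
    rw [Finset.mem_Ioc] at hm
    have e3 : Finset.Ioc (X₀ / m) (t / m) ⊆ Finset.Ico 1 (2 ^ J) := by
      intro k hk
      simp only [Finset.mem_Ioc, Finset.mem_Ico] at hk ⊢
      have : t / m ≤ t := Nat.div_le_self _ _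
      generalize X₀ / m = q at hk
      omega
    rw [← Finset.sum_subset e3]
    · refine Finset.sum_congr rfl fun k hk => ?_
      rw [Finset.mem_Ioc, Nat.div_lt_iff_lt_mul hm.1, Nat.le_div_iff_mul_le hm.1, mul_comm k] at hk
      rw [hF]
      simp only
      rw [if_pos hk]
    · intro k _ hk
      rw [Finset.mem_Ioc, Nat.div_lt_iff_lt_mul hm.1, Nat.le_div_iff_mul_le hm.1, mul_comm k] at hk
      rw [hF]
      simp only
      rw [if_neg hk, mul_zero]
  have e4 : ∑ m ∈ Finset.Ico 1 (2 ^ J), ∑ k ∈ Finset.Ico 1 (2 ^ J), F m k =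
      ∑ i ∈ Finset.range J, ∑ j ∈ Finset.range J,
        ∑ m ∈ Finset.Ico (2 ^ i) (2 * 2 ^ i), ∑ k ∈ Finset.Ico (2 ^ j) (2 * 2 ^ j), F m k := by
    rw [sum_Ico_dyadic (fun m => ∑ k ∈ Finset.Ico 1 (2 ^ J), F m k)]
    refine Finset.sum_congr rfl fun i _ => ?_
    rw [Finset.sum_comm (s := Finset.range J)]
    refine Finset.sum_congr rfl fun m _ => ?_
    rw [sum_Ico_dyadic]
  have hbox : ∀ M N : ℕ, 1 ≤ M → 1 ≤ N →
      ‖∑ m ∈ Finset.Ico M (2 * M), ∑ k ∈ Finset.Ico N (2 * N), F m k‖ ≤ E := by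
    intro M N hM hN
    by_cases hz : U + 1 < 2 * M ∧ U + 1 < 2 * N ∧ M * N ≤ t ∧ X₀ < 4 * (M * N)
    · obtain ⟨hz1, hz2, hz3, hz4⟩ := hz
      have hz1' : (U : ℝ) + 1 < 2 * M := by exact_mod_cast hz1
      have hz2' : (U : ℝ) + 1 < 2 * N := by exact_mod_cast hz2
      have hz3' : (M * N : ℝ) ≤ t := by exact_mod_cast hz3
      have hz4' : (X₀ : ℝ) + 1 ≤ 4 * (M * N) := by exact_mod_cast hz4
      have hM0 : (0 : ℝ) ≤ M := Nat.cast_nonneg _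
      have hN0 : (0 : ℝ) ≤ N := Nat.cast_nonneg _
      have key := h θ x Λ M N X₀ t f g hθ hx hM hN (by linarith) (by linarith) (hz3'.trans ht)
        ((Nat.lt_floor_add_one _).le.trans hz4') hY
        (hf M hM (le_trans (Nat.le_mul_of_pos_right M hN) hz3))
        (hg N hN (le_trans (Nat.le_mul_of_pos_left N hM) hz3))
      refine (Real.le_sqrt_of_sq_le key).trans (le_of_eq ?_)
      rw [Real.sqrt_mul (by positivity), Real.sqrt_mul (by positivity), Real.sqrt_mul (by positivity),
        Real.sqrt_sq hΛ, Real.sqrt_sq (by positivity)]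
    · refine le_trans (le_of_eq ?_) hE0
      rw [norm_eq_zero]
      refine Finset.sum_eq_zero fun m hm => Finset.sum_eq_zero fun k hk => ?_
      rw [Finset.mem_Ico] at hm hk
      rw [hF]
      simp only
      by_cases h1 : m ≤ U
      · rw [hfU m h1]; simp
      by_cases h2 : k ≤ U
      · rw [hgU k h2]; simp
      rw [if_neg, mul_zero]
      rintro ⟨h3, h4⟩
      apply hz
      refine ⟨by omega, by omega, (Nat.mul_le_mul hm.1 hk.1).trans h4, ?_⟩
      calc X₀ < m * k := h3
        _ ≤ (2 * M) * (2 * N) := Nat.mul_le_mul hm.2.le hk.2.le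
        _ = _ := by ring
  rw [e1, e4]
  calc _ ≤ ∑ i ∈ Finset.range J, ∑ j ∈ Finset.range J, E :=
        norm_sum_le_of_le _ fun i _ => norm_sum_le_of_le _ fun j _ =>
          hbox _ _ Nat.one_le_two_pow Nat.one_le_two_pow
    _ = J ^ 2 * E := by simp; ring
    _ = _ := by rw [hE]; ring

open ArithmeticFunction in
lemma norm_sum_zeta_mul_le (z : ℕ → ℂ) (a b : ℕ) (B : ℝ) (hab : a ≤ b)
    (hB : ∀ s, a ≤ s → s ≤ b → ‖∑ n ∈ Finset.Ioc a s, z n‖ ≤ B) :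
    ‖∑ n ∈ Finset.Ioc a b, (((zeta : ArithmeticFunction ℝ) n : ℝ) : ℂ) * z n‖ ≤ 1 * B := by
  rw [one_mul]
  refine le_trans (le_of_eq ?_) (hB b hab le_rfl)
  congr 1
  refine Finset.sum_congr rfl fun n hn => ?_
  rw [Finset.mem_Ioc] at hn
  rw [natCoe_apply, zeta_apply_ne (by omega)]
  simp

open ArithmeticFunction in
lemma abs_truncLE_moebius_le (U m : ℕ) : |truncLE (moebius : ArithmeticFunction ℝ) U m| ≤ 1 := by
  rw [truncLE_apply]
  split_ifs
  · rw [intCoe_apply, ← Int.cast_abs]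
    exact_mod_cast abs_moebius_le_one
  · simp

open ArithmeticFunction in
lemma abs_truncLE_mul_truncLE_le (U m : ℕ) :
    |(truncLE (moebius : ArithmeticFunction ℝ) U * truncLE vonMangoldt U) m| ≤ Real.log m := by
  rw [mul_apply]
  refine (Finset.abs_sum_le_sum_abs _ _).trans ?_
  have h1 : ∀ p ∈ m.divisorsAntidiagonal,
      |truncLE (moebius : ArithmeticFunction ℝ) U p.1 * truncLE vonMangoldt U p.2| ≤
        vonMangoldt p.2 := by
    intro p _
    rw [abs_mul]
    have : |truncLE vonMangoldt U p.2| ≤ vonMangoldt p.2 := by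
      rw [truncLE_apply]
      split_ifs
      · rw [abs_of_nonneg vonMangoldt_nonneg]
      · simp
    calc _ ≤ 1 * vonMangoldt p.2 :=
          mul_le_mul (abs_truncLE_moebius_le U _) this (abs_nonneg _) zero_le_one
      _ = _ := one_mul _
  refine (Finset.sum_le_sum h1).trans (le_of_eq ?_)
  rw [Nat.sum_divisorsAntidiagonal' (f := fun _ b => vonMangoldt b)]
  exact vonMangoldt_sum

open ArithmeticFunction in
lemma truncLE_mul_truncLE_eq_zero (U m : ℕ) (f g : ArithmeticFunction ℝ) (hm : U * U < m) :
    (truncLE f U * truncLE g U) m = 0 := by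
  rw [mul_apply]
  refine Finset.sum_eq_zero fun p hp => ?_
  rw [Nat.mem_divisorsAntidiagonal] at hp
  rw [truncLE_apply, truncLE_apply]
  by_cases h1 : p.1 ≤ U
  · by_cases h2 : p.2 ≤ U
    · have := Nat.mul_le_mul h1 h2
      omega
    · simp [h2]
  · simp [h1]

open ArithmeticFunction in
lemma abs_truncGT_mul_zeta_le (U m : ℕ) :
    |(truncGT (moebius : ArithmeticFunction ℝ) U * (zeta : ArithmeticFunction ℝ)) m| ≤
      m.divisors.card := by
  rw [coe_mul_zeta_apply]
  refine (Finset.abs_sum_le_sum_abs _ _).trans ?_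
  rw [Finset.card_eq_sum_ones, Nat.cast_sum]
  refine Finset.sum_le_sum fun i _ => ?_
  rw [truncGT_apply]
  split_ifs
  · simp
  · rw [intCoe_apply, ← Int.cast_abs]
    exact_mod_cast abs_moebius_le_one

open ArithmeticFunction in
lemma truncGT_mul_zeta_eq_zero (U m : ℕ) (f : ArithmeticFunction ℝ) (hm : m ≤ U) :
    (truncGT f U * (zeta : ArithmeticFunction ℝ)) m = 0 := by
  rw [coe_mul_zeta_apply]
  refine Finset.sum_eq_zero fun i hi => ?_
  rw [truncGT_apply, if_pos ((Nat.divisor_le hi).trans hm)]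

lemma sum_sq_Ico_le_of_abs_le_divisors (f : ℕ → ℝ) (hf : ∀ m, |f m| ≤ m.divisors.card) (M : ℕ) :
    ∑ m ∈ Finset.Ico M (2 * M), f m ^ 2 ≤ 2 * (1 + Real.log (2 * M)) ^ 3 * M := by
  have h1 : ∑ m ∈ Finset.Ico M (2 * M), f m ^ 2 ≤
      ∑ m ∈ Finset.Ioc 0 (2 * M), ((m.divisors.card : ℝ)) ^ 2 := by
    refine (Finset.sum_le_sum fun m _ => sq_le_sq' ?_ ?_).trans
      (Finset.sum_le_sum_of_subset_of_nonneg ?_ fun _ _ _ => sq_nonneg _)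
    · linarith [neg_abs_le (f m), hf m]
    · exact (le_abs_self _).trans (hf m)
    · intro m hm
      rw [Finset.mem_Ico] at hm
      rw [Finset.mem_Ioc]
      omega
  refine h1.trans ((sum_card_divisors_sq_le (2 * M)).trans (le_of_eq ?_))
  push_cast
  ring

open ArithmeticFunction in
lemma sum_sq_truncGT_vonMangoldt_le (U M : ℕ) :
    ∑ m ∈ Finset.Ico M (2 * M), truncGT vonMangoldt U m ^ 2 ≤ (Real.log (2 * M)) ^ 2 * M := by
  have h1 : ∀ m ∈ Finset.Ico M (2 * M), truncGT vonMangoldt U m ^ 2 ≤ (Real.log (2 * M)) ^ 2 := by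
    intro m hm
    rw [Finset.mem_Ico] at hm
    have hm0 : (0 : ℝ) < m := by exact_mod_cast (by omega : 0 < m)
    have h2 : Real.log m ≤ Real.log (2 * M) :=
      Real.log_le_log hm0 (by exact_mod_cast hm.2.le)
    rw [truncGT_apply]
    split_ifs
    · simpa using sq_nonneg (Real.log (2 * M))
    · exact pow_le_pow_left₀ vonMangoldt_nonneg (vonMangoldt_le_log.trans h2) 2
  refine (Finset.sum_le_sum h1).trans (le_of_eq ?_)
  rw [Finset.sum_const, Nat.card_Ico, nsmul_eq_mul]
  have : 2 * M - M = M := by omega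
  rw [this, mul_comm]

open ArithmeticFunction in
/-- Minor arc bound with `X = θ ^ 20`. -/
lemma vonMangoldt_sum_minor {c : ℝ} (hc1 : 1 < c) (hc2 : c < 2) : ∃ C : ℝ, 0 < C ∧
    ∀ (θ x : ℝ) (t : ℕ), 1 ≤ θ → x ≠ 0 → ⌊θ ^ 20⌋₊ ≤ t → (t : ℝ) ≤ 2 * θ ^ 20 →
    1 ≤ |x| * (θ ^ 20) ^ c → |x| * (θ ^ 20) ^ c ≤ θ ^ 27 →
    ‖∑ n ∈ Finset.Ioc ⌊θ ^ 20⌋₊ t, (vonMangoldt n : ℂ) * ee (x * (n : ℝ) ^ c)‖ ≤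
      C * (1 + Real.log (θ ^ 20)) ^ 5 * θ ^ 20 *
        (1 / Real.sqrt θ + 1 / Real.sqrt (Real.sqrt (|x| * (θ ^ 20) ^ c))) := by
  obtain ⟨C1, hC1, h1⟩ := type_one_sum hc1 hc2
  obtain ⟨C2, hC2, h2⟩ := type_two_sum hc1 hc2
  refine ⟨5 * C1 + C2 * 9 * 54, by positivity, ?_⟩
  intro θ x t hθ hx hXt ht hY1 hY2
  set X := θ ^ 20 with hX
  set Y := |x| * X ^ c with hYd
  set L := 1 + Real.log X with hL
  have hθ0 : 0 < θ := by linarith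
  have hX1 : 1 ≤ X := one_le_pow₀ hθ
  have hlogX : 0 ≤ Real.log X := Real.log_nonneg hX1
  have hL1 : 1 ≤ L := by linarith
  set U := ⌊θ ^ 2⌋₊ with hU
  have hUle : (U : ℝ) ≤ θ ^ 2 := Nat.floor_le (by positivity)
  have hUlt : θ ^ 2 ≤ U + 1 := (Nat.lt_floor_add_one _).le
  have hU1 : 1 ≤ U := Nat.le_floor (by rw [Nat.cast_one]; exact one_le_pow₀ hθ)
  have hlog2 : Real.log 2 < 0.7 := lt_trans Real.log_two_lt_d9 (by norm_num)
  have hlog2' : 0.69 < Real.log 2 := lt_trans (by norm_num) Real.log_two_gt_d9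
  have ht1 : 1 ≤ t := le_trans (Nat.le_floor (by simpa using hX1)) hXt
  have ht0 : (0 : ℝ) < t := by exact_mod_cast ht1
  have hlogt : Real.log t ≤ 2 * L := by
    have : Real.log t ≤ Real.log (2 * X) := Real.log_le_log ht0 ht
    rw [Real.log_mul (by norm_num) (by positivity)] at this
    linarith
  have hlog2t : ∀ M : ℕ, 1 ≤ M → M ≤ t → Real.log (2 * M) ≤ 2 * L ∧ 0 ≤ Real.log (2 * M) := by
    intro M hM hMt
    have hM0 : (1 : ℝ) ≤ M := by exact_mod_cast hM
    have e : (M : ℝ) ≤ t := by exact_mod_cast hMt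
    have : Real.log (2 * M) ≤ Real.log (2 * (2 * X)) := Real.log_le_log (by positivity) (by linarith)
    rw [Real.log_mul (y := 2 * X) (by norm_num) (by positivity), Real.log_mul (y := X) (by norm_num) (by positivity)] at this
    exact ⟨by linarith, Real.log_nonneg (by linarith)⟩
  set G := 1 / Real.sqrt θ + 1 / Real.sqrt (Real.sqrt Y) with hG
  have hsY1 : 1 ≤ Real.sqrt Y := Real.one_le_sqrt.2 hY1
  have hsY0 : 0 < Real.sqrt Y := by linarith
  have hssY0 : 0 < Real.sqrt (Real.sqrt Y) := Real.sqrt_pos.2 hsY0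
  have hsθ0 : 0 < Real.sqrt θ := Real.sqrt_pos.2 hθ0
  have hsmall : ∀ D : ℕ, 1 ≤ D → (D : ℝ) ≤ θ ^ 4 →
      D * Real.sqrt Y + X * (1 + Real.log D) / Real.sqrt Y ≤ X * L * G := by
    intro D hD1 hD
    have hD0 : (0 : ℝ) < D := by exact_mod_cast hD1
    have e1 : Real.sqrt Y ≤ θ ^ 14 / Real.sqrt θ := by
      rw [le_div_iff₀ hsθ0, ← Real.sqrt_mul (by positivity)]
      refine Real.sqrt_le_iff.2 ⟨by positivity, ?_⟩
      calc Y * θ ≤ θ ^ 27 * θ := by gcongr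
        _ = _ := by ring
    have e2 : D * Real.sqrt Y ≤ X * L * (1 / Real.sqrt θ) := by
      calc D * Real.sqrt Y ≤ θ ^ 4 * (θ ^ 14 / Real.sqrt θ) := by gcongr
        _ = θ ^ 18 * (1 / Real.sqrt θ) := by ring
        _ ≤ X * L * (1 / Real.sqrt θ) := by
          gcongr
          calc θ ^ 18 ≤ X := pow_le_pow_right₀ hθ (by norm_num)
            _ ≤ X * L := le_mul_of_one_le_right (by positivity) hL1
    have e3 : 1 + Real.log D ≤ L := by
      have : Real.log D ≤ Real.log X :=
        Real.log_le_log hD0 (hD.trans (pow_le_pow_right₀ hθ (by norm_num)))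
      linarith
    have e4 : X * (1 + Real.log D) / Real.sqrt Y ≤ X * L * (1 / Real.sqrt (Real.sqrt Y)) := by
      rw [mul_one_div]
      gcongr
      exact Real.sqrt_le_iff.2 ⟨by positivity, by nlinarith⟩
    have e5 : X * L * G = X * L * (1 / Real.sqrt θ) + X * L * (1 / Real.sqrt (Real.sqrt Y)) := by
      rw [hG]; ring
    linarith
  have hUU : ((U * U : ℕ) : ℝ) ≤ θ ^ 4 := by
    push_cast
    calc (U : ℝ) * U ≤ θ ^ 2 * θ ^ 2 := by gcongr
      _ = _ := by ring
  have hUU1 : 1 ≤ U * U := Nat.mul_pos hU1 hU1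
  have hU4 : (U : ℝ) ≤ θ ^ 4 := hUle.trans (pow_le_pow_right₀ hθ (by norm_num))
  have hθ4 : θ ^ 4 ≤ X := pow_le_pow_right₀ hθ (by norm_num)
  have hG0 : 0 ≤ G := by positivity
  have hI1 : ‖∑ n ∈ Finset.Ioc ⌊X⌋₊ t,
      (((truncLE (moebius : ArithmeticFunction ℝ) U * log) n : ℝ) : ℂ) * ee (x * (n : ℝ) ^ c)‖ ≤
      4 * C1 * L ^ 5 * X * G := by
    have := h1 X x 1 (4 * L) t U (truncLE (moebius : ArithmeticFunction ℝ) U) log hX1 hx hXt ht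
      (hU4.trans hθ4) zero_le_one (by positivity) (abs_truncLE_moebius_le U)
      (fun m hm => by rw [truncLE_apply, if_neg (not_le.2 hm)]) (by
        intro z a b B hab hbt hB0 hB
        simp only [log_apply]
        refine (norm_sum_log_mul_le z a b hab B hB).trans ?_
        have : Real.log b ≤ 2 * L := by
          rcases Nat.eq_zero_or_pos b with rfl | hb
          · simp; linarith
          · exact (Real.log_le_log (by exact_mod_cast hb) (by exact_mod_cast hbt)).trans hlogt
        exact mul_le_mul_of_nonneg_right (by linarith) hB0)
    refine this.trans ?_
    calc C1 * 1 * (4 * L) * (U * Real.sqrt Y + X * (1 + Real.log U) / Real.sqrt Y)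
        ≤ C1 * 1 * (4 * L) * (X * L * G) := by
          gcongr
          exact hsmall U hU1 hU4
      _ = 4 * C1 * L ^ 2 * X * G := by ring
      _ ≤ 4 * C1 * L ^ 5 * X * G := by
          gcongr
          norm_num
  have hI2 : ‖∑ n ∈ Finset.Ioc ⌊X⌋₊ t,
      ((((truncLE (moebius : ArithmeticFunction ℝ) U * truncLE vonMangoldt U) *
        (zeta : ArithmeticFunction ℝ)) n : ℝ) : ℂ) * ee (x * (n : ℝ) ^ c)‖ ≤
      C1 * L ^ 5 * X * G := by
    have := h1 X x L 1 t (U * U) (truncLE (moebius : ArithmeticFunction ℝ) U * truncLE vonMangoldt U)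
      (zeta : ArithmeticFunction ℝ) hX1 hx hXt ht
      (hUU.trans hθ4) (by linarith) zero_le_one (by
        intro m
        by_cases hm : U * U < m
        · rw [truncLE_mul_truncLE_eq_zero _ _ _ _ hm]
          simp; linarith
        · refine (abs_truncLE_mul_truncLE_le U m).trans ?_
          rcases Nat.eq_zero_or_pos m with rfl | hm0
          · simp; linarith
          · have e : (m : ℝ) ≤ X := le_trans (by exact_mod_cast not_lt.1 hm) (hUU.trans hθ4)
            have := Real.log_le_log (by exact_mod_cast hm0) e
            linarith)
      (fun m hm => truncLE_mul_truncLE_eq_zero _ _ _ _ hm) (by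
        intro z a b B hab hbt hB0 hB
        exact norm_sum_zeta_mul_le z a b B hab hB)
    refine this.trans ?_
    calc C1 * L * 1 * (((U * U : ℕ) : ℝ) * Real.sqrt Y + X * (1 + Real.log ((U * U : ℕ) : ℝ)) / Real.sqrt Y)
        ≤ C1 * L * 1 * (X * L * G) := by
          gcongr
          exact hsmall (U * U) hUU1 hUU
      _ = C1 * L ^ 2 * X * G := by ring
      _ ≤ C1 * L ^ 5 * X * G := by
          gcongr
          norm_num
  have hII : ‖∑ n ∈ Finset.Ioc ⌊X⌋₊ t,
      ((((truncGT (moebius : ArithmeticFunction ℝ) U * (zeta : ArithmeticFunction ℝ)) *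
        truncGT vonMangoldt U) n : ℝ) : ℂ) * ee (x * (n : ℝ) ^ c)‖ ≤
      C2 * 9 * 54 * L ^ 5 * X * G := by
    have hJ : ((Nat.log 2 t + 1 : ℕ) : ℝ) ≤ 3 * L := by
      have e1 : (2 : ℝ) ^ Nat.log 2 t ≤ t := by exact_mod_cast Nat.pow_log_le_self 2 (by omega)
      have e2 := Real.log_le_log (by positivity) e1
      rw [Real.log_pow] at e2
      push_cast
      have e3 : Real.log t ≤ 0.7 + Real.log X := by
        have : Real.log t ≤ Real.log (2 * X) := Real.log_le_log ht0 ht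
        rw [Real.log_mul (by norm_num) (by positivity)] at this
        linarith
      have e4 : (Nat.log 2 t : ℝ) * 0.69 ≤ Nat.log 2 t * Real.log 2 := by gcongr
      linarith
    have := h2 θ x (54 * L ^ 3) t (Nat.log 2 t + 1) U
      (truncGT (moebius : ArithmeticFunction ℝ) U * (zeta : ArithmeticFunction ℝ))
      (truncGT vonMangoldt U) hθ hx (Nat.lt_pow_succ_log_self one_lt_two t)
      ht hUlt hY2 (by positivity) (fun m hm => truncGT_mul_zeta_eq_zero U m moebius hm)
      (fun m hm => by rw [truncGT_apply, if_pos hm]) (by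
        intro M hM hMt
        refine (sum_sq_Ico_le_of_abs_le_divisors _ (abs_truncGT_mul_zeta_le U) M).trans ?_
        obtain ⟨e1, e2⟩ := hlog2t M hM hMt
        refine mul_le_mul_of_nonneg_right ?_ (Nat.cast_nonneg _)
        calc 2 * (1 + Real.log (2 * M)) ^ 3 ≤ 2 * (L + 2 * L) ^ 3 := by gcongr
          _ = 54 * L ^ 3 := by ring) (by
        intro M hM hMt
        refine (sum_sq_truncGT_vonMangoldt_le U M).trans ?_
        obtain ⟨e1, e2⟩ := hlog2t M hM hMt
        gcongr
        calc (Real.log (2 * M)) ^ 2 ≤ (2 * L) ^ 2 := by gcongr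
          _ = 4 * L ^ 2 := by ring
          _ ≤ 54 * L ^ 3 := by
            have : L ^ 2 ≤ L ^ 3 := pow_le_pow_right₀ hL1 (by norm_num)
            have : 0 ≤ L ^ 2 := by positivity
            linarith)
    refine this.trans ?_
    have e5 : Real.sqrt (1 / θ + 1 / Real.sqrt Y) ≤ G := by
      refine Real.sqrt_le_iff.2 ⟨hG0, ?_⟩
      rw [hG, add_sq, div_pow, div_pow, Real.sq_sqrt hθ0.le, Real.sq_sqrt hsY0.le, one_pow]
      have : 0 ≤ 2 * (1 / Real.sqrt θ) * (1 / Real.sqrt (Real.sqrt Y)) := by positivity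
      linarith
    calc C2 * ((Nat.log 2 t + 1 : ℕ) : ℝ) ^ 2 * (54 * L ^ 3) * X * Real.sqrt (1 / θ + 1 / Real.sqrt Y)
        ≤ C2 * (3 * L) ^ 2 * (54 * L ^ 3) * X * G := by gcongr
      _ = _ := by ring
  have hsplit : ∑ n ∈ Finset.Ioc ⌊X⌋₊ t, (vonMangoldt n : ℂ) * ee (x * (n : ℝ) ^ c) =
      ∑ n ∈ Finset.Ioc ⌊X⌋₊ t,
        (((truncLE (moebius : ArithmeticFunction ℝ) U * log) n : ℝ) : ℂ) * ee (x * (n : ℝ) ^ c) -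
      ∑ n ∈ Finset.Ioc ⌊X⌋₊ t,
        ((((truncLE (moebius : ArithmeticFunction ℝ) U * truncLE vonMangoldt U) *
        (zeta : ArithmeticFunction ℝ)) n : ℝ) : ℂ) * ee (x * (n : ℝ) ^ c) +
      ∑ n ∈ Finset.Ioc ⌊X⌋₊ t,
        ((((truncGT (moebius : ArithmeticFunction ℝ) U * (zeta : ArithmeticFunction ℝ)) *
        truncGT vonMangoldt U) n : ℝ) : ℂ) * ee (x * (n : ℝ) ^ c) := by
    rw [← Finset.sum_sub_distrib, ← Finset.sum_add_distrib]
    refine Finset.sum_congr rfl fun n hn => ?_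
    rw [Finset.mem_Ioc] at hn
    have hUX : U ≤ ⌊X⌋₊ := Nat.floor_le_floor (pow_le_pow_right₀ hθ (by norm_num))
    have e := DFunLike.congr_fun (vaughan_identity U U) n
    rw [ArithmeticFunction.add_apply, sub_eq_add_neg, ArithmeticFunction.add_apply, ArithmeticFunction.neg_apply, ArithmeticFunction.add_apply, truncLE_apply, if_neg (by omega), zero_add] at e
    rw [e]
    push_cast
    ring
  rw [hsplit]
  refine (norm_add_le _ _).trans ((add_le_add (norm_sub_le _ _) le_rfl).trans ?_)
  calc _ ≤ 4 * C1 * L ^ 5 * X * G + C1 * L ^ 5 * X * G + C2 * 9 * 54 * L ^ 5 * X * G := by gcongr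
    _ = _ := by ring

lemma half_le_norm_sum_ee (s : ℝ) (J : ℕ) (h : J * |s| ≤ 1 / 8) :
    (J : ℝ) / 2 ≤ ‖∑ j ∈ Finset.range J, ee (j * s)‖ := by
  have h1 : ∀ j ∈ Finset.range J, (1 / 2 : ℝ) ≤ (ee (j * s)).re := by
    intro j hj
    rw [Finset.mem_range] at hj
    have hj' : (j : ℝ) ≤ J := by exact_mod_cast hj.le
    have hre : (ee (j * s)).re = Real.cos (2 * Real.pi * (j * s)) := by
      rw [ee_eq, Complex.add_re, Complex.re_ofReal_mul, Complex.I_re, Complex.ofReal_re]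
      ring
    rw [hre, ← Real.cos_abs, ← Real.cos_pi_div_three]
    have e : |2 * Real.pi * (j * s)| ≤ Real.pi / 3 := by
      rw [abs_mul, abs_mul (j : ℝ), abs_of_pos (by positivity : 0 < 2 * Real.pi), Nat.abs_cast]
      have : (j : ℝ) * |s| ≤ 1 / 8 := le_trans (by gcongr) h
      nlinarith [Real.pi_pos]
    exact Real.cos_le_cos_of_nonneg_of_le_pi (abs_nonneg _) (by linarith [Real.pi_pos]) e
  calc (J : ℝ) / 2 = ∑ j ∈ Finset.range J, (1 / 2 : ℝ) := by simp; ring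
    _ ≤ ∑ j ∈ Finset.range J, (ee (j * s)).re := Finset.sum_le_sum h1
    _ = (∑ j ∈ Finset.range J, ee (j * s)).re := (Complex.re_sum _ _).symm
    _ ≤ _ := Complex.re_le_norm _

/-- The number of `n ∈ (a, b]` with `f n` close to an integer, for `f'' ≍ l`. -/
lemma card_near_integer_le (f f' f'' : ℝ → ℝ) (a b : ℕ) (hab : a ≤ b) (l h δ : ℝ) (hl : 0 < l)
    (hh : 1 ≤ h) (J : ℕ) (hJ : 1 ≤ J) (hJδ : J * δ ≤ 1 / 8)
    (h1 : ∀ y ∈ Set.Icc (a + 1 : ℝ) (b + 1), HasDerivAt f (f' y) y)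
    (h2 : ∀ y ∈ Set.Icc (a + 1 : ℝ) (b + 1), HasDerivAt f' (f'' y) y)
    (hlo : ∀ y ∈ Set.Icc (a + 1 : ℝ) (b + 1), l ≤ f'' y)
    (hhi : ∀ y ∈ Set.Icc (a + 1 : ℝ) (b + 1), f'' y ≤ h * l)
    (G : Finset ℕ) (hG : G ⊆ Finset.Ioc a b) (hGf : ∀ n ∈ G, ∃ k : ℤ, |f n - k| ≤ δ) :
    (G.card : ℝ) ≤ 4 * (b - a) / J + 64 * h * Real.sqrt (J * l) * (b - a) +
      256 / Real.sqrt (J * l) := by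
  have hJ0 : (0 : ℝ) < J := by exact_mod_cast hJ
  have hba : (0 : ℝ) ≤ b - a := sub_nonneg.2 (by exact_mod_cast hab)
  set F : ℕ → ℝ := fun d => 8 * (h * Real.sqrt (d * l) * (b - a) + 2 / Real.sqrt (d * l)) with hF
  have hF0 : ∀ d, 0 ≤ F d := fun d => by rw [hF]; positivity
  set w : ℕ → ℕ → ℝ := fun i j => if i = j then (b - a : ℝ) else F (Nat.dist i j) with hw
  have hlow : ∀ n ∈ G, (J : ℝ) ^ 2 / 4 ≤ ‖∑ j ∈ Finset.range J, ((1 : ℝ) : ℂ) * ee (j * f n)‖ ^ 2 := by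
    intro n hn
    obtain ⟨k, hk⟩ := hGf n hn
    have e1 := half_le_norm_sum_ee (f n - k) J (le_trans (by gcongr) hJδ)
    have e2 : ∑ j ∈ Finset.range J, ee (j * (f n - k)) =
        ∑ j ∈ Finset.range J, ((1 : ℝ) : ℂ) * ee (j * f n) := by
      refine Finset.sum_congr rfl fun j _ => ?_
      rw [Complex.ofReal_one, one_mul, ← ee_sub_int (j * f n) (j * k)]
      push_cast
      ring_nf
    rw [← e2]
    calc (J : ℝ) ^ 2 / 4 = ((J : ℝ) / 2) ^ 2 := by ring
      _ ≤ _ := by gcongr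
  have hvdc : ∀ i j : ℕ, j < i →
      ‖∑ n ∈ Finset.Ioc a b, ee (i * f n) * (starRingEnd ℂ) (ee (j * f n))‖ ≤ F (i - j) := by
    intro i j hij
    have hd : (0 : ℝ) < ((i - j : ℕ) : ℝ) := by exact_mod_cast Nat.sub_pos_of_lt hij
    have key := van_der_corput (fun y => ((i - j : ℕ) : ℝ) * f y) (fun y => ((i - j : ℕ) : ℝ) * f' y)
      (fun y => ((i - j : ℕ) : ℝ) * f'' y) a b hab (((i - j : ℕ) : ℝ) * l) h (by positivity) hh
      (fun y hy => (h1 y hy).const_mul _) (fun y hy => (h2 y hy).const_mul _)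
      (fun y hy => mul_le_mul_of_nonneg_left (hlo y hy) hd.le)
      (fun y hy => by nlinarith [hhi y hy])
    refine le_trans (le_of_eq ?_) key
    congr 1
    refine Finset.sum_congr rfl fun n _ => ?_
    rw [conj_ee, ← ee_add, Nat.cast_sub hij.le]
    congr 1
    ring
  have hcor : ∀ i j : ℕ, ‖∑ n ∈ Finset.Ioc a b, ee (i * f n) * (starRingEnd ℂ) (ee (j * f n))‖ ≤ w i j := by
    intro i j
    rw [hw]
    rcases lt_trichotomy i j with hij | hij | hij
    · simp only [if_neg hij.ne]
      rw [← Complex.norm_conj, map_sum, Nat.dist_eq_sub_of_le hij.le]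
      refine le_trans (le_of_eq ?_) (hvdc j i hij)
      congr 1
      refine Finset.sum_congr rfl fun n _ => ?_
      rw [map_mul, Complex.conj_conj, mul_comm]
    · simp only [if_pos hij]
      refine (norm_sum_le _ _).trans (le_of_eq ?_)
      simp only [norm_mul, Complex.norm_conj, norm_ee, mul_one, Finset.sum_const, Nat.card_Ioc,
        nsmul_eq_mul]
      rw [Nat.cast_sub hab]
    · simp only [if_neg hij.ne']
      rw [Nat.dist_eq_sub_of_le_right hij.le]
      exact hvdc i j hij
  have hschur := sum_normSq_le_schur (Finset.range J) (Finset.Ioc a b) (fun _ => (1 : ℝ))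
    (fun j n => ee (j * f n)) w (fun i j => by
      rw [hw]; simp only [eq_comm (a := i), Nat.dist_comm i]) hcor
  have hFsum : ∑ d ∈ Finset.Ioc 0 J, F d ≤
      8 * (h * (J * Real.sqrt (J * l)) * (b - a) + 4 * J / Real.sqrt (J * l)) := by
    have hFd : ∀ d ∈ Finset.Ioc 0 J, F d ≤
        8 * (h * Real.sqrt (J * l) * (b - a)) + 16 / Real.sqrt l * (1 / Real.sqrt d) := by
      intro d hd
      rw [Finset.mem_Ioc] at hd
      have e1 : (d : ℝ) ≤ J := by exact_mod_cast hd.2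
      have e2 : 2 / Real.sqrt (d * l) = 2 / Real.sqrt l * (1 / Real.sqrt d) := by
        rw [Real.sqrt_mul (Nat.cast_nonneg _)]
        ring
      have e3 : h * Real.sqrt (d * l) * (b - a) ≤ h * Real.sqrt (J * l) * (b - a) := by gcongr
      have e4 : 16 / Real.sqrt l * (1 / Real.sqrt d) = 8 * (2 / Real.sqrt l * (1 / Real.sqrt d)) := by
        ring
      rw [hF]
      simp only
      rw [e2, e4]
      linarith
    refine (Finset.sum_le_sum hFd).trans ?_
    rw [Finset.sum_add_distrib, Finset.sum_const, Nat.card_Ioc, nsmul_eq_mul,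
      Nat.sub_zero, ← Finset.mul_sum]
    have e5 := sum_inv_sqrt_le J
    have e6 : 16 / Real.sqrt l * (2 * Real.sqrt J) = 8 * (4 * J / Real.sqrt (J * l)) := by
      rw [Real.sqrt_mul hJ0.le]
      have : 0 < Real.sqrt J := Real.sqrt_pos.2 hJ0
      have : 0 < Real.sqrt l := Real.sqrt_pos.2 hl
      field_simp
      rw [Real.sq_sqrt hJ0.le]
      ring
    have e7 : 16 / Real.sqrt l * ∑ i ∈ Finset.Ioc 0 J, 1 / Real.sqrt i ≤
        16 / Real.sqrt l * (2 * Real.sqrt J) := by gcongr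
    linarith
  have hrow : ∀ i ∈ Finset.range J, ∑ j ∈ Finset.range J, w i j ≤
      (b - a) + 2 * (8 * (h * (J * Real.sqrt (J * l)) * (b - a) + 4 * J / Real.sqrt (J * l))) := by
    intro i hi
    rw [← Finset.add_sum_erase _ _ hi]
    refine add_le_add (by simp [hw]) ?_
    have e1 : ∑ j ∈ (Finset.range J).erase i, w i j =
        ∑ j ∈ (Finset.range J).filter (fun j => j ≠ i), F (Nat.dist i j) := by
      rw [Finset.filter_ne']
      refine Finset.sum_congr rfl fun j hj => ?_
      rw [hw]
      simp only
      rw [if_neg (Finset.ne_of_mem_erase hj).symm]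
    rw [e1]
    refine (sum_dist_le (Finset.range J) i J ?_ F hF0).trans (by linarith)
    intro j hj
    rw [Finset.mem_range] at hi hj
    simp only [Nat.dist]
    omega
  have hfinal : (G.card : ℝ) * (J ^ 2 / 4) ≤ J * ((b - a) +
      2 * (8 * (h * (J * Real.sqrt (J * l)) * (b - a) + 4 * J / Real.sqrt (J * l)))) := by
    calc (G.card : ℝ) * (J ^ 2 / 4) = ∑ n ∈ G, (J : ℝ) ^ 2 / 4 := by simp
      _ ≤ ∑ n ∈ G, ‖∑ j ∈ Finset.range J, ((1 : ℝ) : ℂ) * ee (j * f n)‖ ^ 2 :=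
          Finset.sum_le_sum hlow
      _ ≤ ∑ n ∈ Finset.Ioc a b, ‖∑ j ∈ Finset.range J, ((1 : ℝ) : ℂ) * ee (j * f n)‖ ^ 2 :=
          Finset.sum_le_sum_of_subset_of_nonneg hG fun _ _ _ => by positivity
      _ ≤ _ := hschur
      _ ≤ ∑ i ∈ Finset.range J, ((b - a) +
          2 * (8 * (h * (J * Real.sqrt (J * l)) * (b - a) + 4 * J / Real.sqrt (J * l)))) := by
          refine Finset.sum_le_sum fun i hi => ?_
          rw [one_pow, one_mul]
          exact hrow i hi
      _ = _ := by rw [Finset.sum_const, Finset.card_range, nsmul_eq_mul]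
  have hJ2 : (0 : ℝ) < J ^ 2 / 4 := by positivity
  rw [← le_div_iff₀ hJ2] at hfinal
  refine hfinal.trans (le_of_eq ?_)
  have : 0 < Real.sqrt (J * l) := Real.sqrt_pos.2 (by positivity)
  field_simp
  ring

/-- The integers in `(X, 2X]`. -/
noncomputable def dyad (X : ℝ) : Finset ℕ := Finset.Ioc ⌊X⌋₊ ⌊2 * X⌋₊

lemma mem_dyad {X : ℝ} (hX : 0 ≤ X) {n : ℕ} : n ∈ dyad X ↔ X < n ∧ (n : ℝ) ≤ 2 * X := by
  rw [dyad, Finset.mem_Ioc, Nat.floor_lt hX, Nat.le_floor_iff (by linarith)]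

lemma card_dyad_le {X : ℝ} (hX : 0 ≤ X) : ((dyad X).card : ℝ) ≤ 2 * X := by
  rw [dyad, Nat.card_Ioc]
  calc ((⌊2 * X⌋₊ - ⌊X⌋₊ : ℕ) : ℝ) ≤ (⌊2 * X⌋₊ : ℝ) := by exact_mod_cast Nat.sub_le _ _
    _ ≤ 2 * X := Nat.floor_le (by linarith)

/-- The number of pairs with `a ^ c - a' ^ c` within `1` of `v`. -/
noncomputable def pairCount (c X v : ℝ) : ℕ :=
  ((dyad X ×ˢ dyad X).filter (fun p : ℕ × ℕ => |(p.1 : ℝ) ^ c - (p.2 : ℝ) ^ c - v| ≤ 1)).card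

lemma abs_sub_mul_le_rpow_sub {c : ℝ} (hc : 1 < c) {N x y : ℝ} (hN : 0 < N) (hx : N ≤ x)
    (hy : N ≤ y) : N ^ (c - 1) * |x - y| ≤ |x ^ c - y ^ c| := by
  rcases le_total x y with h | h
  · rw [abs_sub_comm, abs_of_nonneg (sub_nonneg.2 h), abs_sub_comm]
    exact (rpow_sub_rpow_lower hc hN hx h).trans (le_abs_self _)
  · rw [abs_of_nonneg (sub_nonneg.2 h)]
    exact (rpow_sub_rpow_lower hc hN hy h).trans (le_abs_self _)

lemma card_rpow_near_le {c : ℝ} (hc : 1 < c) {X : ℝ} (hX : 1 ≤ X) (w : ℝ) :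
    ((dyad X).filter (fun n : ℕ => |(n : ℝ) ^ c - w| ≤ 1)).card ≤ 3 := by
  set S := (dyad X).filter (fun n : ℕ => |(n : ℝ) ^ c - w| ≤ 1) with hS
  rcases S.eq_empty_or_nonempty with h | h
  · simp [h]
  set m := S.min' h with hm
  have hmS : m ∈ S := S.min'_mem h
  have hsub : S ⊆ Finset.Icc m (m + 2) := by
    intro n hn
    have hmn : m ≤ n := S.min'_le n hn
    rw [Finset.mem_Icc]
    refine ⟨hmn, ?_⟩
    rw [hS, Finset.mem_filter, mem_dyad (by linarith)] at hn hmS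
    have e1 := abs_sub_mul_le_rpow_sub hc (by linarith : 0 < X) hn.1.1.le hmS.1.1.le
    have e2 : |(n : ℝ) ^ c - (m : ℝ) ^ c| ≤ 2 := by
      have := abs_sub_le ((n : ℝ) ^ c) w ((m : ℝ) ^ c)
      rw [abs_sub_comm w] at this
      linarith [hn.2, hmS.2]
    have e3 : 1 ≤ X ^ (c - 1) := Real.one_le_rpow hX (by linarith)
    have e4 : |(n : ℝ) - m| ≤ 2 := by
      have : 1 * |(n : ℝ) - m| ≤ X ^ (c - 1) * |(n : ℝ) - m| := by gcongr
      linarith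
    have e5 : (n : ℝ) ≤ m + 2 := by linarith [le_abs_self ((n : ℝ) - m)]
    exact_mod_cast e5
  refine (Finset.card_le_card hsub).trans (le_of_eq ?_)
  rw [Nat.card_Icc]
  omega

lemma pairCount_le_trivial {c : ℝ} (hc : 1 < c) {X : ℝ} (hX : 1 ≤ X) (v : ℝ) :
    (pairCount c X v : ℝ) ≤ 6 * X := by
  have h : pairCount c X v ≤ (dyad X).card * 3 := by
    rw [pairCount, Finset.card_filter, Finset.sum_product_right, ← smul_eq_mul]
    refine Finset.sum_le_card_nsmul _ _ _ fun n _ => ?_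
    rw [← Finset.card_filter]
    have := card_rpow_near_le hc hX ((n : ℝ) ^ c + v)
    simpa only [sub_sub] using this
  calc (pairCount c X v : ℝ) ≤ (dyad X).card * 3 := by exact_mod_cast h
    _ ≤ 2 * X * 3 := by gcongr; exact card_dyad_le (by linarith)
    _ = _ := by ring

lemma pairCount_neg (c X v : ℝ) : pairCount c X (-v) = pairCount c X v := by
  rw [pairCount, pairCount]
  refine Finset.card_bij (fun p _ => (p.2, p.1)) ?_ ?_ ?_
  · intro p hp
    simp only [Finset.mem_filter, Finset.mem_product] at hp ⊢
    refine ⟨⟨hp.1.2, hp.1.1⟩, ?_⟩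
    rw [abs_sub_comm]
    convert hp.2 using 2
    ring
  · intro p _ q _ h
    rw [Prod.mk.injEq] at h
    exact Prod.ext h.2 h.1
  · intro p hp
    simp only [Finset.mem_filter, Finset.mem_product] at hp ⊢
    refine ⟨(p.2, p.1), ⟨⟨hp.1.2, hp.1.1⟩, ?_⟩, rfl⟩
    rw [abs_sub_comm]
    convert hp.2 using 2
    ring

lemma hasDerivAt_shifted_root {c v y : ℝ} (hc : 1 < c) (hv : 0 < v) (hy : 0 < y) :
    HasDerivAt (fun y : ℝ => (y ^ c + v) ^ (1 / c)) (y ^ (c - 1) * (y ^ c + v) ^ (1 / c - 1)) y := by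
  have h0 : 0 < y ^ c + v := by positivity
  have h := ((Real.hasDerivAt_rpow_const (p := c) (Or.inl hy.ne')).add_const v).rpow_const
    (p := 1 / c) (Or.inl h0.ne')
  convert h using 1
  field_simp

lemma hasDerivAt_shifted_root_deriv {c v y : ℝ} (hv : 0 < v) (hc : 1 < c) (hy : 0 < y) :
    HasDerivAt (fun y : ℝ => y ^ (c - 1) * (y ^ c + v) ^ (1 / c - 1))
      ((c - 1) * v * (y ^ (c - 2) * (y ^ c + v) ^ (1 / c - 2))) y := by
  have h0 : 0 < y ^ c + v := by positivity
  have h := (Real.hasDerivAt_rpow_const (p := c - 1) (Or.inl hy.ne')).mul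
    (((Real.hasDerivAt_rpow_const (p := c) (Or.inl hy.ne')).add_const v).rpow_const
    (p := 1 / c - 1) (Or.inl h0.ne'))
  refine h.congr_deriv ?_
  have e1 : y ^ c = y * y * y ^ (c - 2) := by
    rw [← pow_two, ← Real.rpow_natCast, ← Real.rpow_add hy]
    congr 1
    push_cast
    ring
  have e2 : y ^ (c - 1) = y * y ^ (c - 2) := by
    rw [← Real.rpow_one_add' hy.le (by linarith)]
    congr 1
    ring
  have e3 : (y ^ c + v) ^ (1 / c - 1) = (y ^ c + v) * (y ^ c + v) ^ (1 / c - 2) := by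
    nth_rewrite 2 [← Real.rpow_one (y ^ c + v)]
    rw [← Real.rpow_add h0]
    congr 1
    ring
  have e4 : 1 / c - 1 - 1 = 1 / c - 2 := by ring
  have e5 : c - 1 - 1 = c - 2 := by ring
  rw [e4, e5, e3, e2]
  set A := (y ^ c + v) ^ (1 / c - 2)
  rw [e1]
  field_simp
  ring

lemma pairCount_le_of_pos {c : ℝ} (hc1 : 1 < c) (hc2 : c < 3 / 2) : ∃ C : ℝ, 0 < C ∧
    ∀ X v : ℝ, 1 ≤ X → 8 ≤ X ^ (c - 1) → X ^ (c - 1 + 1 / 5) ≤ v →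
    (pairCount c X v : ℝ) ≤ C * (X ^ (2 - c) + X ^ (c / 2) + X ^ (7 / 5 - c / 2)) := by
  set κ : ℝ := (c - 1) / 588 with hκ
  have hκ0 : 0 < κ := by rw [hκ]; linarith [div_pos (sub_pos.2 hc1) (by norm_num : (0:ℝ) < 588)]
  refine ⟨3 * (128 + 128 * 588 + 256 / Real.sqrt (κ / 16)), by positivity, ?_⟩
  intro X v hX hX8 hv
  have hX0 : 0 < X := by linarith
  have hv0 : 0 < v := lt_of_lt_of_le (by positivity) hv
  have hRHS : 0 ≤ 3 * (128 + 128 * 588 + 256 / Real.sqrt (κ / 16)) *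
      (X ^ (2 - c) + X ^ (c / 2) + X ^ (7 / 5 - c / 2)) := by positivity
  have hpow : ∀ t : ℝ, 1 ≤ t → t ^ c ≤ t ^ 2 := fun t ht => by
    rw [← Real.rpow_natCast]
    exact Real.rpow_le_rpow_of_exponent_le ht (by push_cast; linarith)
  by_cases hv5 : 5 * X ^ c < v
  · refine le_trans (le_of_eq ?_) hRHS
    rw [Nat.cast_eq_zero, pairCount, Finset.card_eq_zero, Finset.filter_eq_empty_iff]
    intro p hp
    rw [Finset.mem_product, mem_dyad hX0.le, mem_dyad hX0.le] at hp
    rw [not_le]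
    have e1 : (p.1 : ℝ) ^ c ≤ 4 * X ^ c := by
      calc (p.1 : ℝ) ^ c ≤ (2 * X) ^ c := Real.rpow_le_rpow (Nat.cast_nonneg _) hp.1.2 (by linarith)
        _ = 2 ^ c * X ^ c := Real.mul_rpow (by norm_num) hX0.le
        _ ≤ 4 * X ^ c := by
          gcongr
          exact (hpow 2 (by norm_num)).trans (by norm_num)
    have e2 : X ^ c ≤ (p.2 : ℝ) ^ c := Real.rpow_le_rpow hX0.le hp.2.1.le (by linarith)
    have e3 : 1 ≤ X ^ c := Real.one_le_rpow hX (by linarith)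
    rw [lt_abs]
    right
    linarith
  push Not at hv5
  set f : ℝ → ℝ := fun y => (y ^ c + v) ^ (1 / c) with hf
  set G := (dyad X).filter (fun n : ℕ => ∃ k : ℕ, k ∈ dyad X ∧ |(k : ℝ) ^ c - (n : ℝ) ^ c - v| ≤ 1) with hG
  have hcard : pairCount c X v ≤ G.card * 3 := by
    rw [pairCount, Finset.card_filter, Finset.sum_product_right, ← smul_eq_mul]
    have e : ∑ n ∈ dyad X, ∑ k ∈ dyad X, (if |(k : ℝ) ^ c - (n : ℝ) ^ c - v| ≤ 1 then 1 else 0) =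
        ∑ n ∈ G, ∑ k ∈ dyad X, (if |(k : ℝ) ^ c - (n : ℝ) ^ c - v| ≤ 1 then 1 else 0) := by
      rw [hG, Finset.sum_filter]
      refine Finset.sum_congr rfl fun n _ => ?_
      split_ifs with h
      · rfl
      · push Not at h
        exact Finset.sum_eq_zero fun k hk => if_neg (not_le.2 (h k hk))
    rw [e]
    refine Finset.sum_le_card_nsmul _ _ _ fun n _ => ?_
    rw [← Finset.card_filter]
    have := card_rpow_near_le hc1 hX ((n : ℝ) ^ c + v)
    simpa only [sub_sub] using this
  have hnear : ∀ n ∈ G, ∃ k : ℤ, |f n - k| ≤ X ^ (1 - c) := by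
    intro n hn
    rw [hG, Finset.mem_filter] at hn
    obtain ⟨hn1, k, hk, hkn⟩ := hn
    rw [mem_dyad hX0.le] at hn1 hk
    refine ⟨k, ?_⟩
    have hnc : 0 < (n : ℝ) ^ c := Real.rpow_pos_of_pos (hX0.trans hn1.1) _
    have e1 : f n ^ c = (n : ℝ) ^ c + v := by
      rw [hf]
      simp only
      rw [← Real.rpow_mul (by positivity), one_div_mul_cancel (by linarith), Real.rpow_one]
    have e2 : X ≤ f n := by
      have : X ^ c ≤ f n ^ c := by
        rw [e1]
        have := Real.rpow_le_rpow hX0.le hn1.1.le (by linarith : 0 ≤ c)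
        linarith
      exact (Real.rpow_le_rpow_iff hX0.le (by positivity) (by linarith)).1 this
    have e3 := abs_sub_mul_le_rpow_sub hc1 hX0 e2 hk.1.le
    rw [e1] at e3
    have e4 : |(n : ℝ) ^ c + v - (k : ℝ) ^ c| ≤ 1 := by
      rw [abs_sub_comm]
      simpa only [sub_sub] using hkn
    rw [show (1 - c) = -(c - 1) by ring, Real.rpow_neg hX0.le, Int.cast_natCast, inv_eq_one_div,
      le_div_iff₀' (by positivity)]
    linarith
  set J := ⌊X ^ (c - 1) / 8⌋₊ with hJ
  have hJle : (J : ℝ) ≤ X ^ (c - 1) / 8 := Nat.floor_le (by positivity)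
  have hJ1 : 1 ≤ J := Nat.le_floor (by rw [Nat.cast_one]; linarith)
  have hJ1' : (1 : ℝ) ≤ J := by exact_mod_cast hJ1
  have hJge : X ^ (c - 1) / 16 ≤ J := by
    have := Nat.lt_floor_add_one (X ^ (c - 1) / 8)
    rw [← hJ] at this
    linarith
  have hJ0 : (0 : ℝ) < J := by linarith
  set l := κ * (v * X ^ (-1 - c)) with hl
  have hl0 : 0 < l := by positivity
  have hyX : ∀ y ∈ Set.Icc ((⌊X⌋₊ : ℝ) + 1) (⌊2 * X⌋₊ + 1), X ≤ y ∧ y ≤ 3 * X := by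
    intro y hy
    have e1 := Nat.lt_floor_add_one X
    have e2 : (⌊2 * X⌋₊ : ℝ) ≤ 2 * X := Nat.floor_le (by linarith)
    exact ⟨by linarith [hy.1], by linarith [hy.2]⟩
  have hsplit : X ^ (-1 - c) = X ^ (c - 2) * X ^ (1 - 2 * c) := by
    rw [← Real.rpow_add hX0]; congr 1; ring
  have hroot : (X ^ c) ^ (1 / c - 2) = X ^ (1 - 2 * c) := by
    rw [← Real.rpow_mul hX0.le]
    congr 1
    field_simp
  have hcexp : 1 / c - 2 ≤ 0 := by
    have : 1 / c ≤ 1 := by rw [div_le_one (by linarith)]; linarith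
    linarith
  have key := card_near_integer_le f (fun y => y ^ (c - 1) * (y ^ c + v) ^ (1 / c - 1))
    (fun y => (c - 1) * v * (y ^ (c - 2) * (y ^ c + v) ^ (1 / c - 2))) ⌊X⌋₊ ⌊2 * X⌋₊
    (Nat.floor_le_floor (by linarith)) l 588 (X ^ (1 - c)) hl0 (by norm_num) J hJ1
    (by
      calc (J : ℝ) * X ^ (1 - c) ≤ X ^ (c - 1) / 8 * X ^ (1 - c) := by gcongr
        _ = X ^ (c - 1) * X ^ (1 - c) / 8 := by ring
        _ = 1 / 8 := by
          rw [← Real.rpow_add hX0]; norm_num)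
    (fun y hy => hasDerivAt_shifted_root hc1 hv0 (hX0.trans_le (hyX y hy).1))
    (fun y hy => hasDerivAt_shifted_root_deriv hv0 hc1 (hX0.trans_le (hyX y hy).1))
    (by
      intro y hy
      obtain ⟨hy1, hy2⟩ := hyX y hy
      have hy0 : 0 < y := hX0.trans_le hy1
      have e1 : X ^ (c - 2) / 3 ≤ y ^ (c - 2) := by
        calc X ^ (c - 2) / 3 ≤ 3 ^ (c - 2) * X ^ (c - 2) := by
              have : (3 : ℝ) ^ (-1 : ℝ) ≤ 3 ^ (c - 2) :=
                Real.rpow_le_rpow_of_exponent_le (by norm_num) (by linarith)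
              rw [Real.rpow_neg_one] at this
              rw [div_eq_inv_mul]
              gcongr
          _ = (3 * X) ^ (c - 2) := (Real.mul_rpow (by norm_num) hX0.le).symm
          _ ≤ y ^ (c - 2) := Real.rpow_le_rpow_of_nonpos hy0 hy2 (by linarith)
      have e2 : X ^ (1 - 2 * c) / 196 ≤ (y ^ c + v) ^ (1 / c - 2) := by
        have e3 : y ^ c + v ≤ 14 * X ^ c := by
          have : y ^ c ≤ 9 * X ^ c := by
            calc y ^ c ≤ (3 * X) ^ c := Real.rpow_le_rpow hy0.le hy2 (by linarith)
              _ = 3 ^ c * X ^ c := Real.mul_rpow (by norm_num) hX0.le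
              _ ≤ 9 * X ^ c := by
                gcongr
                exact (hpow 3 (by norm_num)).trans (by norm_num)
          linarith
        calc X ^ (1 - 2 * c) / 196 ≤ 14 ^ (1 / c - 2) * (X ^ c) ^ (1 / c - 2) := by
              rw [hroot]
              have : (14 : ℝ) ^ (-2 : ℝ) ≤ 14 ^ (1 / c - 2) :=
                Real.rpow_le_rpow_of_exponent_le (by norm_num) (by linarith [show 0 < 1 / c by positivity])
              rw [Real.rpow_neg (by norm_num)] at this
              rw [div_eq_inv_mul]
              gcongr
              refine le_trans (le_of_eq ?_) this
              norm_num
          _ = (14 * X ^ c) ^ (1 / c - 2) := (Real.mul_rpow (by norm_num) (by positivity)).symm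
          _ ≤ _ := Real.rpow_le_rpow_of_nonpos (by positivity) e3 hcexp
      calc l = (c - 1) * v * (X ^ (c - 2) / 3 * (X ^ (1 - 2 * c) / 196)) := by
            rw [hl, hκ, hsplit]; ring
        _ ≤ _ := by
          have : 0 ≤ (c - 1) * v := mul_nonneg (by linarith) hv0.le
          gcongr)
    (by
      intro y hy
      obtain ⟨hy1, hy2⟩ := hyX y hy
      have hy0 : 0 < y := hX0.trans_le hy1
      have e1 : y ^ (c - 2) ≤ X ^ (c - 2) := Real.rpow_le_rpow_of_nonpos hX0 hy1 (by linarith)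
      have e2 : (y ^ c + v) ^ (1 / c - 2) ≤ X ^ (1 - 2 * c) := by
        rw [← hroot]
        refine Real.rpow_le_rpow_of_nonpos (by positivity) ?_ hcexp
        have := Real.rpow_le_rpow hX0.le hy1 (by linarith : 0 ≤ c)
        linarith
      have : 0 ≤ (c - 1) * v := mul_nonneg (by linarith) hv0.le
      calc (c - 1) * v * (y ^ (c - 2) * (y ^ c + v) ^ (1 / c - 2))
          ≤ (c - 1) * v * (X ^ (c - 2) * X ^ (1 - 2 * c)) := by gcongr
        _ = 588 * l := by rw [hl, hκ, hsplit]; ring)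
    G (Finset.filter_subset _ _) hnear
  have hba : (⌊2 * X⌋₊ : ℝ) - ⌊X⌋₊ ≤ 2 * X := by
    have : (⌊2 * X⌋₊ : ℝ) ≤ 2 * X := Nat.floor_le (by linarith)
    have : (0 : ℝ) ≤ ⌊X⌋₊ := Nat.cast_nonneg _
    linarith
  have hba0 : (0 : ℝ) ≤ (⌊2 * X⌋₊ : ℝ) - ⌊X⌋₊ :=
    sub_nonneg.2 (by exact_mod_cast Nat.floor_le_floor (by linarith))
  have t1 : 4 * ((⌊2 * X⌋₊ : ℝ) - ⌊X⌋₊) / J ≤ 128 * X ^ (2 - c) := by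
    calc 4 * ((⌊2 * X⌋₊ : ℝ) - ⌊X⌋₊) / J ≤ 4 * (2 * X) / (X ^ (c - 1) / 16) := by gcongr
      _ = 128 * (X ^ (1 : ℝ) / X ^ (c - 1)) := by rw [Real.rpow_one]; field_simp; ring
      _ = 128 * X ^ (2 - c) := by
        rw [← Real.rpow_sub hX0]; congr 2; ring
  have hJl1 : J * l ≤ (X ^ (c / 2 - 1)) ^ 2 := by
    have hκ1 : κ * 5 ≤ 1 := by rw [hκ]; linarith
    calc J * l ≤ X ^ (c - 1) / 8 * (κ * (5 * X ^ c * X ^ (-1 - c))) := by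
          rw [hl]; gcongr
      _ = (κ * 5) / 8 * (X ^ (c - 1) * X ^ c * X ^ (-1 - c)) := by ring
      _ ≤ 1 * (X ^ (c - 1) * X ^ c * X ^ (-1 - c)) := by gcongr; linarith
      _ = (X ^ (c / 2 - 1)) ^ 2 := by
        rw [one_mul, ← Real.rpow_add hX0, ← Real.rpow_add hX0, ← Real.rpow_natCast, ← Real.rpow_mul hX0.le]
        congr 1
        push_cast
        ring
  have t2 : 64 * 588 * Real.sqrt (J * l) * ((⌊2 * X⌋₊ : ℝ) - ⌊X⌋₊) ≤ 128 * 588 * X ^ (c / 2) := by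
    have e1 : Real.sqrt (J * l) ≤ X ^ (c / 2 - 1) := Real.sqrt_le_iff.2 ⟨by positivity, hJl1⟩
    calc 64 * 588 * Real.sqrt (J * l) * ((⌊2 * X⌋₊ : ℝ) - ⌊X⌋₊)
        ≤ 64 * 588 * X ^ (c / 2 - 1) * (2 * X) := by gcongr
      _ = 128 * 588 * (X ^ (c / 2 - 1) * X ^ (1 : ℝ)) := by rw [Real.rpow_one]; ring
      _ = _ := by rw [← Real.rpow_add hX0]; congr 2; ring
  have t3 : 256 / Real.sqrt (J * l) ≤ 256 / Real.sqrt (κ / 16) * X ^ (7 / 5 - c / 2) := by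
    have e1 : κ / 16 * (X ^ (c / 2 - 7 / 5)) ^ 2 ≤ J * l := by
      calc κ / 16 * (X ^ (c / 2 - 7 / 5)) ^ 2 =
          X ^ (c - 1) / 16 * (κ * (X ^ (c - 1 + 1 / 5) * X ^ (-1 - c))) := by
            rw [← Real.rpow_natCast, ← Real.rpow_mul hX0.le]
            have : X ^ ((c / 2 - 7 / 5) * ((2 : ℕ) : ℝ)) =
                X ^ (c - 1) * (X ^ (c - 1 + 1 / 5) * X ^ (-1 - c)) := by
              rw [← Real.rpow_add hX0, ← Real.rpow_add hX0]
              congr 1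
              push_cast
              ring
            rw [this]
            ring
        _ ≤ J * l := by rw [hl]; gcongr
    have e2 : Real.sqrt (κ / 16) * X ^ (c / 2 - 7 / 5) ≤ Real.sqrt (J * l) := by
      refine Real.le_sqrt_of_sq_le ?_
      rw [mul_pow, Real.sq_sqrt (by positivity)]
      exact e1
    have e3 : X ^ (7 / 5 - c / 2) = (X ^ (c / 2 - 7 / 5))⁻¹ := by
      rw [← Real.rpow_neg hX0.le]; congr 1; ring
    calc 256 / Real.sqrt (J * l) ≤ 256 / (Real.sqrt (κ / 16) * X ^ (c / 2 - 7 / 5)) := by gcongr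
      _ = _ := by rw [e3]; field_simp
  have hG' : (G.card : ℝ) ≤ 128 * X ^ (2 - c) + 128 * 588 * X ^ (c / 2) +
      256 / Real.sqrt (κ / 16) * X ^ (7 / 5 - c / 2) := by linarith
  have p1 : 0 < X ^ (2 - c) := by positivity
  have p2 : 0 < X ^ (c / 2) := by positivity
  have p3 : 0 < X ^ (7 / 5 - c / 2) := by positivity
  have p4 : 0 < 256 / Real.sqrt (κ / 16) := by positivity
  calc (pairCount c X v : ℝ) ≤ G.card * 3 := by exact_mod_cast hcard
    _ ≤ (128 * X ^ (2 - c) + 128 * 588 * X ^ (c / 2) +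
      256 / Real.sqrt (κ / 16) * X ^ (7 / 5 - c / 2)) * 3 := by gcongr
    _ ≤ _ := by
      generalize 256 / Real.sqrt (κ / 16) = D at *
      nlinarith [mul_pos p4 p1, mul_pos p4 p2]

lemma pairCount_le {c : ℝ} (hc1 : 1 < c) (hc2 : c < 3 / 2) : ∃ C : ℝ, 0 < C ∧
    ∀ X v : ℝ, 1 ≤ X → 8 ≤ X ^ (c - 1) → X ^ (c - 1 + 1 / 5) ≤ |v| →
    (pairCount c X v : ℝ) ≤ C * (X ^ (2 - c) + X ^ (c / 2) + X ^ (7 / 5 - c / 2)) := by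
  obtain ⟨C, hC, h⟩ := pairCount_le_of_pos hc1 hc2
  refine ⟨C, hC, fun X v hX hX8 hv => ?_⟩
  rcases le_total 0 v with hv0 | hv0
  · rw [abs_of_nonneg hv0] at hv
    exact h X v hX hX8 hv
  · rw [abs_of_nonpos hv0] at hv
    rw [← pairCount_neg]
    exact h X (-v) hX hX8 hv

/-- The exponential sum with frequencies `f i` and coefficients `a i`. -/
noncomputable def expSum {ι : Type*} (D : Finset ι) (f : ι → ℝ) (a : ι → ℂ) (x : ℝ) : ℂ :=
  ∑ i ∈ D, a i * ee (x * f i)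

lemma continuous_expSum {ι : Type*} (D : Finset ι) (f : ι → ℝ) (a : ι → ℂ) :
    Continuous (expSum D f a) := by
  unfold expSum
  exact continuous_finsetSum _ fun i _ =>
    continuous_const.mul (continuous_ee.comp (continuous_id.mul continuous_const))

lemma norm_expSum_le {ι : Type*} (D : Finset ι) (f : ι → ℝ) (a : ι → ℂ) (x : ℝ) :
    ‖expSum D f a x‖ ≤ ∑ i ∈ D, ‖a i‖ := by
  refine (norm_sum_le _ _).trans (Finset.sum_le_sum fun i _ => ?_)
  rw [norm_mul, norm_ee, mul_one]

lemma expSum_mul_conj {ι κ : Type*} (D : Finset ι) (f : ι → ℝ) (a : ι → ℂ) (E : Finset κ)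
    (g : κ → ℝ) (b : κ → ℂ) (x y : ℝ) :
    expSum D f a x * (starRingEnd ℂ) (expSum E g b y) =
      ∑ i ∈ D, ∑ j ∈ E, a i * (starRingEnd ℂ) (b j) * ee (x * f i - y * g j) := by
  rw [expSum, expSum, map_sum, Finset.sum_mul_sum]
  refine Finset.sum_congr rfl fun i _ => Finset.sum_congr rfl fun j _ => ?_
  rw [map_mul, conj_ee, sub_eq_add_neg, ee_add]
  ring

/-- A Gaussian majorant of the indicator function of `[-K, K]`. -/
noncomputable def gaussMaj (K x : ℝ) : ℝ := Real.exp (Real.pi - Real.pi * (x / K) ^ 2)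

lemma gaussMaj_pos (K x : ℝ) : 0 < gaussMaj K x := Real.exp_pos _

lemma one_le_gaussMaj {K x : ℝ} (hK : 0 < K) (hx : |x| ≤ K) : 1 ≤ gaussMaj K x := by
  rw [gaussMaj]
  refine Real.one_le_exp ?_
  have h : (x / K) ^ 2 ≤ 1 := by
    rw [sq_le_one_iff_abs_le_one, abs_div, abs_of_pos hK]
    exact div_le_one_of_le₀ hx hK.le
  nlinarith [Real.pi_pos]

lemma integrable_mul_ee {h : ℝ → ℝ} {M : ℝ} {ν : MeasureTheory.Measure ℝ}
    [MeasureTheory.IsFiniteMeasure ν] (hhm : Measurable h) (hh0 : ∀ u, 0 ≤ h u)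
    (hhM : ∀ u, h u ≤ M) (t : ℝ) :
    MeasureTheory.Integrable (fun u => (h u : ℂ) * ee (u * t)) ν := by
  refine MeasureTheory.Integrable.of_bound ((Complex.measurable_ofReal.comp hhm).mul
    (continuous_ee.comp (continuous_id.mul continuous_const)).measurable).aestronglyMeasurable M
    (Filter.Eventually.of_forall fun u => ?_)
  rw [norm_mul, norm_ee, mul_one,
    Complex.norm_real, Real.norm_of_nonneg (hh0 u)]
  exact hhM u

lemma gaussMaj_mul_ee (K x t : ℝ) : (gaussMaj K x : ℂ) * ee (x * t) =
    (Real.exp Real.pi : ℂ) * (Complex.exp (Complex.I * ((2 * Real.pi * t : ℝ) : ℂ) * x) *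
      Complex.exp (-((Real.pi / K ^ 2 : ℝ) : ℂ) * (x : ℂ) ^ 2)) := by
  rw [gaussMaj, ee, sub_eq_add_neg, Real.exp_add]
  push_cast
  rw [← Complex.exp_add, ← Complex.exp_add, ← Complex.exp_add, ← Complex.exp_add]
  congr 1
  ring

lemma integrable_gaussMaj_mul_ee {K : ℝ} (hK : 0 < K) (t : ℝ) :
    MeasureTheory.Integrable (fun x : ℝ => (gaussMaj K x : ℂ) * ee (x * t)) := by
  simp_rw [gaussMaj_mul_ee]
  refine MeasureTheory.Integrable.const_mul ?_ _
  have h := integrable_cexp_quadratic (b := ((Real.pi / K ^ 2 : ℝ) : ℂ))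
    (by rw [Complex.ofReal_re]; positivity) (Complex.I * ((2 * Real.pi * t : ℝ) : ℂ)) 0
  refine h.congr (Filter.Eventually.of_forall fun x => ?_)
  simp only
  rw [← Complex.exp_add]
  congr 1
  ring

lemma integral_gaussMaj_mul_ee {K : ℝ} (hK : 0 < K) (t : ℝ) :
    ∫ x : ℝ, (gaussMaj K x : ℂ) * ee (x * t) =
      ((Real.exp Real.pi * K * Real.exp (-Real.pi * (K * t) ^ 2) : ℝ) : ℂ) := by
  simp_rw [gaussMaj_mul_ee]
  have hb : 0 < ((Real.pi / K ^ 2 : ℝ) : ℂ).re := by rw [Complex.ofReal_re]; positivity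
  rw [MeasureTheory.integral_const_mul, fourierIntegral_gaussian hb]
  have e1 : ((Real.pi : ℂ) / ((Real.pi / K ^ 2 : ℝ) : ℂ)) ^ (1 / 2 : ℂ) = (K : ℂ) := by
    rw [← Complex.ofReal_div, show Real.pi / (Real.pi / K ^ 2) = K ^ 2 by field_simp,
      show (1 / 2 : ℂ) = ((1 / 2 : ℝ) : ℂ) by push_cast; rfl,
      ← Complex.ofReal_cpow (by positivity), ← Real.sqrt_eq_rpow, Real.sqrt_sq hK.le]
  rw [e1]
  have hK' : (K : ℂ) ≠ 0 := by exact_mod_cast hK.ne'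
  have e2 : -(((2 * Real.pi * t : ℝ) : ℂ)) ^ 2 / (4 * ((Real.pi / K ^ 2 : ℝ) : ℂ)) =
      -(Real.pi : ℂ) * (K * t) ^ 2 := by
    have : (Real.pi : ℂ) ≠ 0 := by exact_mod_cast Real.pi_ne_zero
    push_cast
    field_simp
    ring
  rw [e2]
  push_cast
  ring

lemma gaussHat_le {K : ℝ} (hK : 0 < K) (t : ℝ) :
    Real.exp Real.pi * K * Real.exp (-Real.pi * (K * t) ^ 2) ≤
      Real.exp Real.pi * K * ((if |t| ≤ 1 then 1 else 0) + Real.exp (-Real.pi * K ^ 2)) := by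
  gcongr
  split_ifs with h
  · have : Real.exp (-Real.pi * (K * t) ^ 2) ≤ 1 := by
      rw [Real.exp_le_one_iff]
      nlinarith [Real.pi_pos, sq_nonneg (K * t)]
    linarith [Real.exp_pos (-Real.pi * K ^ 2)]
  · rw [zero_add, Real.exp_le_exp]
    rw [not_le] at h
    have : 1 ≤ t ^ 2 := by
      rw [← sq_abs]; nlinarith
    have : K ^ 2 ≤ (K * t) ^ 2 := by rw [mul_pow]; nlinarith [sq_nonneg K]
    nlinarith [Real.pi_pos]

lemma sum_gaussHat_le {ι : Type*} (D : Finset ι) (g : ι → ℝ) {K R : ℝ} (hK : 0 < K)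
    (hR : ((D.filter (fun i => |g i| ≤ 1)).card : ℝ) ≤ R) :
    ∑ i ∈ D, Real.exp Real.pi * K * Real.exp (-Real.pi * (K * g i) ^ 2) ≤
      Real.exp Real.pi * K * (R + D.card * Real.exp (-Real.pi * K ^ 2)) := by
  refine (Finset.sum_le_sum fun i _ => gaussHat_le hK (g i)).trans ?_
  rw [← Finset.mul_sum, Finset.sum_add_distrib, Finset.sum_const, nsmul_eq_mul,
    ← Finset.natCast_card_filter]
  gcongr

/-- A mean value estimate for exponential sums. -/
lemma integral_normSq_expSum_le {ι : Type*} (D : Finset ι) (f : ι → ℝ) (a : ι → ℂ) {K R : ℝ}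
    (hK : 0 < K) (hR : ∀ i ∈ D, ((D.filter (fun j => |f i - f j| ≤ 1)).card : ℝ) ≤ R) :
    ∫ x in Set.Icc (-K) K, ‖expSum D f a x‖ ^ 2 ≤
      Real.exp Real.pi * K * (R + D.card * Real.exp (-Real.pi * K ^ 2)) * ∑ i ∈ D, ‖a i‖ ^ 2 := by
  have hexp : ∀ x : ℝ, ((gaussMaj K x * ‖expSum D f a x‖ ^ 2 : ℝ) : ℂ) =
      ∑ i ∈ D, ∑ j ∈ D, a i * (starRingEnd ℂ) (a j) *
        ((gaussMaj K x : ℂ) * ee (x * (f i - f j))) := by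
    intro x
    rw [Complex.ofReal_mul, Complex.ofReal_pow, ← Complex.mul_conj', expSum_mul_conj,
      Finset.mul_sum]
    refine Finset.sum_congr rfl fun i _ => ?_
    rw [Finset.mul_sum]
    refine Finset.sum_congr rfl fun j _ => ?_
    rw [mul_sub]
    ring
  have hint : MeasureTheory.Integrable
      (fun x : ℝ => ((gaussMaj K x * ‖expSum D f a x‖ ^ 2 : ℝ) : ℂ)) := by
    simp_rw [hexp]
    exact MeasureTheory.integrable_finsetSum _ fun i _ =>
      MeasureTheory.integrable_finsetSum _ fun j _ =>
        (integrable_gaussMaj_mul_ee hK _).const_mul _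
  have hint' : MeasureTheory.Integrable (fun x : ℝ => gaussMaj K x * ‖expSum D f a x‖ ^ 2) :=
    hint.re.congr (Filter.Eventually.of_forall fun x => by simp only; exact Complex.ofReal_re _)
  have hcont := continuous_expSum D f a
  have h1 : ∫ x in Set.Icc (-K) K, ‖expSum D f a x‖ ^ 2 ≤
      ∫ x : ℝ, gaussMaj K x * ‖expSum D f a x‖ ^ 2 := by
    refine le_trans (MeasureTheory.setIntegral_mono_on
      ((hcont.norm.pow 2).integrableOn_Icc) hint'.integrableOn measurableSet_Icc ?_)
      (MeasureTheory.setIntegral_le_integral hint'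
        (Filter.Eventually.of_forall fun x => mul_nonneg (gaussMaj_pos _ _).le (sq_nonneg _)))
    intro x hx
    exact le_mul_of_one_le_left (sq_nonneg _) (one_le_gaussMaj hK (abs_le.2 hx))
  have h2 : ((∫ x : ℝ, gaussMaj K x * ‖expSum D f a x‖ ^ 2 : ℝ) : ℂ) =
      ∑ i ∈ D, ∑ j ∈ D, a i * (starRingEnd ℂ) (a j) *
        ((Real.exp Real.pi * K * Real.exp (-Real.pi * (K * (f i - f j)) ^ 2) : ℝ) : ℂ) := by
    rw [← integral_complex_ofReal]
    simp_rw [hexp]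
    rw [MeasureTheory.integral_finsetSum _ fun i _ =>
      MeasureTheory.integrable_finsetSum _ fun j _ =>
        (integrable_gaussMaj_mul_ee hK _).const_mul _]
    refine Finset.sum_congr rfl fun i _ => ?_
    rw [MeasureTheory.integral_finsetSum _ fun j _ =>
        (integrable_gaussMaj_mul_ee hK _).const_mul _]
    refine Finset.sum_congr rfl fun j _ => ?_
    rw [MeasureTheory.integral_const_mul, integral_gaussMaj_mul_ee hK]
  refine h1.trans ?_
  have h3 : ∫ x : ℝ, gaussMaj K x * ‖expSum D f a x‖ ^ 2 ≤
      ∑ i ∈ D, ∑ j ∈ D, ‖a i‖ * ‖a j‖ *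
        (Real.exp Real.pi * K * Real.exp (-Real.pi * (K * (f i - f j)) ^ 2)) := by
    refine (le_abs_self _).trans ?_
    rw [← Real.norm_eq_abs, ← Complex.norm_real, h2]
    refine (norm_sum_le _ _).trans (Finset.sum_le_sum fun i _ => (norm_sum_le _ _).trans
      (Finset.sum_le_sum fun j _ => le_of_eq ?_))
    rw [norm_mul, norm_mul, RCLike.norm_conj, Complex.norm_real, Real.norm_of_nonneg (by positivity)]
  refine h3.trans ((schur_symm D (fun i => ‖a i‖) (fun i j =>
    Real.exp Real.pi * K * Real.exp (-Real.pi * (K * (f i - f j)) ^ 2)) (fun _ _ => by positivity)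
    (fun i j => by rw [← neg_sub (f j) (f i), mul_neg, neg_sq])).trans ?_)
  rw [Finset.mul_sum]
  refine Finset.sum_le_sum fun i hi => ?_
  rw [mul_comm]
  exact mul_le_mul_of_nonneg_right (sum_gaussHat_le D _ hK (hR i hi)) (sq_nonneg _)

lemma sq_integral_fourth_le {ι : Type*} (D : Finset ι) (f : ι → ℝ) (a : ι → ℂ) {A : ℝ}
    (ha : ∀ i ∈ D, ‖a i‖ ≤ A) (μ : MeasureTheory.Measure ℝ)
    [MeasureTheory.IsFiniteMeasure μ] :
    (∫ x, ‖expSum D f a x‖ ^ 4 ∂μ) ^ 2 ≤ A ^ 2 * D.card *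
      ∫ z : ℝ × ℝ, ‖expSum D f a z.1‖ ^ 3 * ‖expSum D f a z.2‖ ^ 3 *
        ‖expSum D f (fun _ => 1) (z.1 - z.2)‖ ∂(μ.prod μ) := by
  set S := expSum D f a with hS
  set B := ∑ i ∈ D, ‖a i‖ with hB
  have hSc : Continuous S := continuous_expSum D f a
  have hSB : ∀ x, ‖S x‖ ≤ B := norm_expSum_le D f a
  set g : ℝ → ℂ := fun x => (starRingEnd ℂ) (S x) * (‖S x‖ : ℂ) ^ 2 with hg
  have hgc : Continuous g :=
    (Complex.continuous_conj.comp hSc).mul ((Complex.continuous_ofReal.comp hSc.norm).pow 2)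
  have hgn : ∀ x, ‖g x‖ = ‖S x‖ ^ 3 := fun x => by
    rw [hg]
    simp only [norm_mul, RCLike.norm_conj, norm_pow, Complex.norm_real, norm_norm]
    ring
  have hgB : ∀ x, ‖g x‖ ≤ B ^ 3 := fun x => by
    rw [hgn]; gcongr; exact hSB x
  set G : ι → ℂ := fun i => ∫ x, g x * ee (x * f i) ∂μ with hG
  have hec : ∀ i, Continuous fun x : ℝ => ee (x * f i) := fun i =>
    continuous_ee.comp (continuous_id.mul continuous_const)
  have hint : ∀ i, MeasureTheory.Integrable (fun x => g x * ee (x * f i)) μ := fun i =>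
    MeasureTheory.Integrable.of_bound (hgc.mul (hec i)).aestronglyMeasurable (B ^ 3)
      (Filter.Eventually.of_forall fun x => by rw [norm_mul, norm_ee, mul_one]; exact hgB x)
  have hJ : ((∫ x, ‖S x‖ ^ 4 ∂μ : ℝ) : ℂ) = ∑ i ∈ D, a i * G i := by
    rw [← integral_complex_ofReal]
    have : ∀ x, ((‖S x‖ ^ 4 : ℝ) : ℂ) = ∑ i ∈ D, a i * (g x * ee (x * f i)) := by
      intro x
      have : ∑ i ∈ D, a i * (g x * ee (x * f i)) = g x * S x := by
        rw [hS, expSum, Finset.mul_sum]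
        exact Finset.sum_congr rfl fun i _ => by ring
      rw [this, hg]
      simp only
      rw [mul_right_comm, Complex.conj_mul']
      push_cast
      ring
    simp_rw [this]
    rw [MeasureTheory.integral_finsetSum _ fun i _ => (hint i).const_mul _]
    exact Finset.sum_congr rfl fun i _ => MeasureTheory.integral_const_mul _ _
  have hJ0 : 0 ≤ ∫ x, ‖S x‖ ^ 4 ∂μ := MeasureTheory.integral_nonneg fun x => by positivity
  have hJle : ∫ x, ‖S x‖ ^ 4 ∂μ ≤ ∑ i ∈ D, A * ‖G i‖ := by
    rw [← Real.norm_of_nonneg hJ0, ← Complex.norm_real, hJ]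
    refine (norm_sum_le _ _).trans (Finset.sum_le_sum fun i hi => ?_)
    rw [norm_mul]
    exact mul_le_mul_of_nonneg_right (ha i hi) (norm_nonneg _)
  have hsum : ∑ i ∈ D, ‖G i‖ ^ 2 ≤ ∫ z : ℝ × ℝ, ‖S z.1‖ ^ 3 * ‖S z.2‖ ^ 3 *
        ‖expSum D f (fun _ => 1) (z.1 - z.2)‖ ∂(μ.prod μ) := by
    have e1 : ((∑ i ∈ D, ‖G i‖ ^ 2 : ℝ) : ℂ) = ∫ z : ℝ × ℝ, g z.1 * (starRingEnd ℂ) (g z.2) *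
        expSum D f (fun _ => 1) (z.1 - z.2) ∂(μ.prod μ) := by
      have : ∀ i, ((‖G i‖ ^ 2 : ℝ) : ℂ) = ∫ z : ℝ × ℝ, (g z.1 * ee (z.1 * f i)) *
          (starRingEnd ℂ) (g z.2 * ee (z.2 * f i)) ∂(μ.prod μ) := by
        intro i
        rw [MeasureTheory.integral_prod_mul (fun x => g x * ee (x * f i))
          (fun x => (starRingEnd ℂ) (g x * ee (x * f i))), integral_conj, Complex.mul_conj']
        push_cast
        rfl
      rw [Complex.ofReal_sum]
      simp_rw [this]
      rw [← MeasureTheory.integral_finsetSum]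
      · refine MeasureTheory.integral_congr_ae (Filter.Eventually.of_forall fun z => ?_)
        simp only
        rw [expSum, Finset.mul_sum]
        refine Finset.sum_congr rfl fun i _ => ?_
        rw [map_mul, conj_ee, sub_mul, sub_eq_add_neg, ee_add]
        ring
      · intro i _
        have hc : Continuous fun z : ℝ × ℝ => (g z.1 * ee (z.1 * f i)) *
          (starRingEnd ℂ) (g z.2 * ee (z.2 * f i)) :=
          ((hgc.mul (hec i)).comp continuous_fst).mul
            (Complex.continuous_conj.comp ((hgc.mul (hec i)).comp continuous_snd))
        refine MeasureTheory.Integrable.of_bound hc.aestronglyMeasurable (B ^ 3 * B ^ 3)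
          (Filter.Eventually.of_forall fun z => ?_)
        have e : ∀ x : ℝ, ‖g x * ee (x * f i)‖ = ‖g x‖ := fun x => by
          rw [norm_mul, norm_ee, mul_one]
        rw [norm_mul, RCLike.norm_conj, e, e]
        exact mul_le_mul (hgB _) (hgB _) (norm_nonneg _) ((norm_nonneg _).trans (hgB z.1))
    have e2 : 0 ≤ ∑ i ∈ D, ‖G i‖ ^ 2 := Finset.sum_nonneg fun i _ => by positivity
    rw [← Real.norm_of_nonneg e2, ← Complex.norm_real, e1]
    refine (MeasureTheory.norm_integral_le_integral_norm _).trans (le_of_eq ?_)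
    refine MeasureTheory.integral_congr_ae (Filter.Eventually.of_forall fun z => ?_)
    simp only [norm_mul, RCLike.norm_conj, hgn]
  calc (∫ x, ‖S x‖ ^ 4 ∂μ) ^ 2 ≤ (∑ i ∈ D, A * ‖G i‖) ^ 2 := by gcongr
    _ ≤ D.card * ∑ i ∈ D, (A * ‖G i‖) ^ 2 := sq_sum_le_card_mul_sum_sq
    _ = A ^ 2 * D.card * ∑ i ∈ D, ‖G i‖ ^ 2 := by
      rw [Finset.mul_sum, Finset.mul_sum]
      exact Finset.sum_congr rfl fun i _ => by ring
    _ ≤ _ := by gcongr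

set_option maxHeartbeats 1000000 in
lemma fourth_moment_le {ι : Type*} (D : Finset ι) (f : ι → ℝ) (a : ι → ℂ) {A H δ τ V : ℝ}
    (ha : ∀ i ∈ D, ‖a i‖ ≤ A) {m : Set ℝ} (hm : MeasurableSet m)
    (hmfin : MeasureTheory.volume m ≠ ⊤) (hH : ∀ x ∈ m, ‖expSum D f a x‖ ≤ H)
    (hτ : ∫ u in Set.Icc (-δ) δ, ‖expSum D f (fun _ => 1) u‖ ≤ τ)
    (hV : ∫ z : ℝ × ℝ, ‖expSum D f a z.1‖ ^ 2 * ‖expSum D f a z.2‖ ^ 2 *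
      (Set.Icc (-δ) δ)ᶜ.indicator (fun u => ‖expSum D f (fun _ => 1) u‖ ^ 2) (z.1 - z.2)
        ∂((MeasureTheory.volume.restrict m).prod (MeasureTheory.volume.restrict m)) ≤ V) :
    ∫ x in m, ‖expSum D f a x‖ ^ 4 ≤
      2 * A ^ 2 * D.card * H ^ 2 * τ + A ^ 2 * D.card * Real.sqrt V := by
  have hfin : MeasureTheory.IsFiniteMeasure (MeasureTheory.volume.restrict m) :=
    ⟨by rw [MeasureTheory.Measure.restrict_apply_univ]; exact lt_top_iff_ne_top.2 hmfin⟩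
  have hmain := sq_integral_fourth_le D f a ha (MeasureTheory.volume.restrict m)
  set μ := MeasureTheory.volume.restrict m with hμ
  set S := expSum D f a with hS
  set T := expSum D f (fun _ => 1) with hT
  set B := ∑ i ∈ D, ‖a i‖ with hB
  set E := ∑ i ∈ D, ‖(1 : ℂ)‖ with hE
  have hSc : Continuous S := continuous_expSum D f a
  have hTc : Continuous T := continuous_expSum D f _
  have hSB : ∀ x, ‖S x‖ ≤ B := norm_expSum_le D f a
  have hTE : ∀ x, ‖T x‖ ≤ E := norm_expSum_le D f _
  have hB0 : 0 ≤ B := Finset.sum_nonneg fun _ _ => norm_nonneg _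
  have hE0 : 0 ≤ E := Finset.sum_nonneg fun _ _ => norm_nonneg _
  set t : ℝ → ℝ := (Set.Icc (-δ) δ).indicator (fun u => ‖T u‖) with ht
  set h : ℝ → ℝ := (Set.Icc (-δ) δ)ᶜ.indicator (fun u => ‖T u‖ ^ 2) with hh
  have htm : Measurable t := hTc.norm.measurable.indicator measurableSet_Icc
  have hhm : Measurable h := (hTc.norm.pow 2).measurable.indicator measurableSet_Icc.compl
  have ht0 : ∀ u, 0 ≤ t u := fun u => Set.indicator_nonneg (fun _ _ => norm_nonneg _) u
  have hh0 : ∀ u, 0 ≤ h u := fun u => Set.indicator_nonneg (fun _ _ => by positivity) u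
  have htE : ∀ u, t u ≤ E := fun u => by
    rw [ht, Set.indicator_apply]; split_ifs
    · exact hTE u
    · exact hE0
  have hhE : ∀ u, h u ≤ E ^ 2 := fun u => by
    rw [hh, Set.indicator_apply]; split_ifs
    · gcongr; exact hTE u
    · positivity
  have htint : MeasureTheory.Integrable t :=
    (MeasureTheory.integrable_indicator_iff measurableSet_Icc).2 hTc.norm.integrableOn_Icc
  have htτ : ∫ u, t u ≤ τ := by
    rw [ht, MeasureTheory.integral_indicator measurableSet_Icc]; exact hτ
  set J := ∫ x, ‖S x‖ ^ 4 ∂μ with hJ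
  have hJ0 : 0 ≤ J := MeasureTheory.integral_nonneg fun x => by positivity
  have hJint : MeasureTheory.Integrable (fun x => ‖S x‖ ^ 4) μ :=
    MeasureTheory.Integrable.of_bound (hSc.norm.pow 4).aestronglyMeasurable (B ^ 4)
      (Filter.Eventually.of_forall fun x => by
        rw [Real.norm_of_nonneg (by positivity)]; gcongr; exact hSB x)
  have hsub : Measurable fun z : ℝ × ℝ => z.1 - z.2 := measurable_fst.sub measurable_snd
  have hS1 : Measurable fun z : ℝ × ℝ => ‖S z.1‖ := hSc.norm.measurable.comp measurable_fst
  have hS2 : Measurable fun z : ℝ × ℝ => ‖S z.2‖ := hSc.norm.measurable.comp measurable_snd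
  have hprod1 : MeasureTheory.Integrable (fun z : ℝ × ℝ => ‖S z.1‖ ^ 4 * t (z.1 - z.2))
      (μ.prod μ) := by
    refine MeasureTheory.Integrable.of_bound
      ((hS1.pow_const 4).mul (htm.comp hsub)).aestronglyMeasurable (B ^ 4 * E)
      (Filter.Eventually.of_forall fun z => ?_)
    rw [Real.norm_of_nonneg (mul_nonneg (by positivity) (ht0 _))]
    exact mul_le_mul (by gcongr; exact hSB _) (htE _) (ht0 _) (by positivity)
  have hprod2 : MeasureTheory.Integrable (fun z : ℝ × ℝ => ‖S z.2‖ ^ 4 * t (z.1 - z.2))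
      (μ.prod μ) := by
    refine MeasureTheory.Integrable.of_bound
      ((hS2.pow_const 4).mul (htm.comp hsub)).aestronglyMeasurable (B ^ 4 * E)
      (Filter.Eventually.of_forall fun z => ?_)
    rw [Real.norm_of_nonneg (mul_nonneg (by positivity) (ht0 _))]
    exact mul_le_mul (by gcongr; exact hSB _) (htE _) (ht0 _) (by positivity)
  have hprod3 : MeasureTheory.Integrable (fun z : ℝ × ℝ => ‖S z.1‖ ^ 4 * ‖S z.2‖ ^ 4)
      (μ.prod μ) := hJint.mul_prod hJint
  have hprod4 : MeasureTheory.Integrable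
      (fun z : ℝ × ℝ => ‖S z.1‖ ^ 2 * ‖S z.2‖ ^ 2 * h (z.1 - z.2)) (μ.prod μ) := by
    refine MeasureTheory.Integrable.of_bound
      (((hS1.pow_const 2).mul (hS2.pow_const 2)).mul (hhm.comp hsub)).aestronglyMeasurable
      (B ^ 2 * B ^ 2 * E ^ 2) (Filter.Eventually.of_forall fun z => ?_)
    rw [Real.norm_of_nonneg (mul_nonneg (by positivity) (hh0 _))]
    exact mul_le_mul (by gcongr <;> exact hSB _) (hhE _) (hh0 _) (by positivity)
  have hnear1 : ∫ z : ℝ × ℝ, ‖S z.1‖ ^ 4 * t (z.1 - z.2) ∂(μ.prod μ) ≤ J * τ := by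
    rw [MeasureTheory.integral_prod _ hprod1]
    rw [hJ, ← MeasureTheory.integral_mul_const]
    refine MeasureTheory.integral_mono hprod1.integral_prod_left (hJint.mul_const _) fun x => ?_
    simp only
    rw [MeasureTheory.integral_const_mul]
    gcongr
    calc ∫ y, t (x - y) ∂μ ≤ ∫ y, t (x - y) :=
          MeasureTheory.setIntegral_le_integral (htint.comp_sub_left x)
            (Filter.Eventually.of_forall fun y => ht0 _)
      _ = ∫ u, t u := MeasureTheory.integral_sub_left_eq_self t _ x
      _ ≤ τ := htτ
  have hnear2 : ∫ z : ℝ × ℝ, ‖S z.2‖ ^ 4 * t (z.1 - z.2) ∂(μ.prod μ) ≤ J * τ := by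
    rw [MeasureTheory.integral_prod_symm _ hprod2]
    rw [hJ, ← MeasureTheory.integral_mul_const]
    refine MeasureTheory.integral_mono hprod2.integral_prod_right (hJint.mul_const _) fun y => ?_
    simp only
    rw [MeasureTheory.integral_const_mul]
    gcongr
    calc ∫ x, t (x - y) ∂μ ≤ ∫ x, t (x - y) :=
          MeasureTheory.setIntegral_le_integral (htint.comp_sub_right y)
            (Filter.Eventually.of_forall fun y => ht0 _)
      _ = ∫ u, t u := MeasureTheory.integral_sub_right_eq_self t y
      _ ≤ τ := htτ
  set Q := A ^ 2 * (D.card : ℝ) with hQ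
  have hQ0 : 0 ≤ Q := by positivity
  have hV0 : 0 ≤ V := le_trans (MeasureTheory.integral_nonneg fun z =>
    mul_nonneg (by positivity) (hh0 _)) hV
  have hτ0 : 0 ≤ τ := le_trans (MeasureTheory.integral_nonneg ht0) htτ
  rcases hQ0.eq_or_lt with hQz | hQpos
  · rw [← hQz, zero_mul] at hmain
    have : J = 0 := by nlinarith [sq_nonneg J]
    rw [this]
    positivity
  have hptw : ∀ᵐ z ∂(μ.prod μ), ‖S z.1‖ ^ 3 * ‖S z.2‖ ^ 3 * ‖T (z.1 - z.2)‖ ≤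
      H ^ 2 / 2 * (‖S z.1‖ ^ 4 * t (z.1 - z.2)) + H ^ 2 / 2 * (‖S z.2‖ ^ 4 * t (z.1 - z.2)) +
      (1 / (2 * Q) * (‖S z.1‖ ^ 4 * ‖S z.2‖ ^ 4) +
        Q / 2 * (‖S z.1‖ ^ 2 * ‖S z.2‖ ^ 2 * h (z.1 - z.2))) := by
    have hm2 : ∀ᵐ z ∂(μ.prod μ), z ∈ m ×ˢ m := by
      rw [hμ, MeasureTheory.Measure.prod_restrict]
      exact MeasureTheory.ae_restrict_mem (hm.prod hm)
    filter_upwards [hm2] with z hz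
    have h1 := hH _ hz.1
    have h2 := hH _ hz.2
    set p := ‖S z.1‖
    set q := ‖S z.2‖
    have hp : 0 ≤ p := norm_nonneg _
    have hq : 0 ≤ q := norm_nonneg _
    by_cases hu : z.1 - z.2 ∈ Set.Icc (-δ) δ
    · have e1 : t (z.1 - z.2) = ‖T (z.1 - z.2)‖ := Set.indicator_of_mem hu _
      have e2 : h (z.1 - z.2) = 0 := Set.indicator_of_notMem (Set.notMem_compl_iff.2 hu) _
      rw [e1, e2]
      set w := ‖T (z.1 - z.2)‖
      have hw : 0 ≤ w := norm_nonneg _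
      have e3 : p * q ≤ H ^ 2 := by rw [pow_two]; exact mul_le_mul h1 h2 hq (hp.trans h1)
      have e4 : p ^ 3 * q ^ 3 ≤ H ^ 2 * ((p ^ 4 + q ^ 4) / 2) := by
        calc p ^ 3 * q ^ 3 = (p * q) * (p * q) ^ 2 := by ring
          _ ≤ H ^ 2 * (p * q) ^ 2 := by gcongr
          _ ≤ _ := by gcongr; nlinarith [sq_nonneg (p ^ 2 - q ^ 2)]
      calc p ^ 3 * q ^ 3 * w ≤ H ^ 2 * ((p ^ 4 + q ^ 4) / 2) * w := by gcongr
        _ = H ^ 2 / 2 * (p ^ 4 * w) + H ^ 2 / 2 * (q ^ 4 * w) := by ring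
        _ ≤ _ := le_add_of_nonneg_right (by positivity)
    · have e1 : t (z.1 - z.2) = 0 := Set.indicator_of_notMem hu _
      have e2 : h (z.1 - z.2) = ‖T (z.1 - z.2)‖ ^ 2 := Set.indicator_of_mem hu _
      rw [e1, e2]
      set w := ‖T (z.1 - z.2)‖
      have hw : 0 ≤ w := norm_nonneg _
      have e3 : 0 ≤ (p ^ 2 * q ^ 2 - Q * (p * q * w)) ^ 2 / (2 * Q) := by positivity
      have e4 : (p ^ 2 * q ^ 2 - Q * (p * q * w)) ^ 2 / (2 * Q) = 1 / (2 * Q) * (p ^ 4 * q ^ 4) +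
          Q / 2 * (p ^ 2 * q ^ 2 * w ^ 2) - p ^ 3 * q ^ 3 * w := by
        field_simp
        ring
      rw [mul_zero, mul_zero, mul_zero, mul_zero, zero_add, zero_add]
      linarith
  have hbound : ∫ z : ℝ × ℝ, ‖S z.1‖ ^ 3 * ‖S z.2‖ ^ 3 * ‖T (z.1 - z.2)‖ ∂(μ.prod μ) ≤
      H ^ 2 * (J * τ) + (1 / (2 * Q) * J ^ 2 + Q / 2 * V) := by
    have i12 := (hprod1.const_mul (H ^ 2 / 2)).add (hprod2.const_mul (H ^ 2 / 2))
    have i34 := (hprod3.const_mul (1 / (2 * Q))).add (hprod4.const_mul (Q / 2))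
    have hR := MeasureTheory.integral_mono_of_nonneg (Filter.Eventually.of_forall fun z => by
      simp only [Pi.zero_apply]; positivity) (i12.add i34) hptw
    refine hR.trans ?_
    rw [MeasureTheory.integral_add' i12 i34, MeasureTheory.integral_add' (hprod1.const_mul _)
      (hprod2.const_mul _), MeasureTheory.integral_add' (hprod3.const_mul _) (hprod4.const_mul _),
      MeasureTheory.integral_const_mul, MeasureTheory.integral_const_mul,
      MeasureTheory.integral_const_mul, MeasureTheory.integral_const_mul,
      MeasureTheory.integral_prod_mul (fun x => ‖S x‖ ^ 4) (fun x => ‖S x‖ ^ 4)]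
    have e1 : H ^ 2 / 2 * ∫ z : ℝ × ℝ, ‖S z.1‖ ^ 4 * t (z.1 - z.2) ∂(μ.prod μ) ≤
      H ^ 2 / 2 * (J * τ) := by gcongr
    have e2 : H ^ 2 / 2 * ∫ z : ℝ × ℝ, ‖S z.2‖ ^ 4 * t (z.1 - z.2) ∂(μ.prod μ) ≤
      H ^ 2 / 2 * (J * τ) := by gcongr
    have e3 : Q / 2 * ∫ z : ℝ × ℝ, ‖S z.1‖ ^ 2 * ‖S z.2‖ ^ 2 * h (z.1 - z.2) ∂(μ.prod μ) ≤
      Q / 2 * V := by gcongr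
    rw [← pow_two J]
    linarith
  have hJ2 : J ^ 2 ≤ 2 * Q * H ^ 2 * τ * J + (Q * Real.sqrt V) ^ 2 := by
    have h1 : J ^ 2 ≤ Q * (H ^ 2 * (J * τ) + (1 / (2 * Q) * J ^ 2 + Q / 2 * V)) :=
      hmain.trans (mul_le_mul_of_nonneg_left hbound hQ0)
    have h2 : Q * (H ^ 2 * (J * τ) + (1 / (2 * Q) * J ^ 2 + Q / 2 * V)) =
        Q * H ^ 2 * τ * J + J ^ 2 / 2 + Q ^ 2 * V / 2 := by
      field_simp
      ring
    rw [mul_pow, Real.sq_sqrt hV0]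
    linarith
  have hP : 0 ≤ 2 * Q * H ^ 2 * τ := by positivity
  have hW : 0 ≤ Q * Real.sqrt V := by positivity
  have hfinal : J ≤ 2 * Q * H ^ 2 * τ + Q * Real.sqrt V := by
    by_contra hc
    push Not at hc
    nlinarith
  calc J ≤ _ := hfinal
    _ = _ := by rw [hQ]; ring

lemma sq_integral_mul_le {α : Type*} [MeasurableSpace α] {μ : MeasureTheory.Measure α}
    {f g : α → ℝ} (hf : MeasureTheory.Integrable (fun x => f x ^ 2) μ)
    (hg : MeasureTheory.Integrable (fun x => g x ^ 2) μ)
    (hfg : MeasureTheory.Integrable (fun x => f x * g x) μ) :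
    (∫ x, f x * g x ∂μ) ^ 2 ≤ (∫ x, f x ^ 2 ∂μ) * ∫ x, g x ^ 2 ∂μ := by
  have h : ∀ t : ℝ, 0 ≤ (∫ x, f x ^ 2 ∂μ) * (t * t) + (-2 * ∫ x, f x * g x ∂μ) * t +
      ∫ x, g x ^ 2 ∂μ := by
    intro t
    have e : ∫ x, (t * f x - g x) ^ 2 ∂μ = (∫ x, f x ^ 2 ∂μ) * (t * t) +
        (-2 * ∫ x, f x * g x ∂μ) * t + ∫ x, g x ^ 2 ∂μ := by
      have : ∀ x, (t * f x - g x) ^ 2 = t * t * f x ^ 2 + (-2 * t) * (f x * g x) + g x ^ 2 :=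
        fun x => by ring
      simp_rw [this]
      have e1 : MeasureTheory.Integrable
          (fun x => t * t * f x ^ 2 + (-2 * t) * (f x * g x)) μ :=
        (hf.const_mul _).add (hfg.const_mul _)
      rw [MeasureTheory.integral_add e1 hg,
        MeasureTheory.integral_add (hf.const_mul _) (hfg.const_mul _),
        MeasureTheory.integral_const_mul, MeasureTheory.integral_const_mul]
      ring
    rw [← e]
    exact MeasureTheory.integral_nonneg fun x => sq_nonneg _
  have := discrim_le_zero h
  rw [discrim] at this
  linarith

lemma correlation_integral_le {ι : Type*} (P : Finset ι) (v : ι → ℝ) (b : ι → ℂ) {B K M : ℝ}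
    (hK : 0 < K) (hb : ∀ i ∈ P, ‖b i‖ ≤ B) (q : ℝ → ℝ) (hqc : Continuous q) (hq0 : ∀ x, 0 ≤ q x)
    (hq : ∀ x, (q x : ℂ) = expSum P v b x) {m : Set ℝ} (hm : MeasurableSet m)
    (hmK : m ⊆ Set.Icc (-K) K) (h : ℝ → ℝ) (hhm : Measurable h) (hh0 : ∀ u, 0 ≤ h u)
    (hhM : ∀ u, h u ≤ M) :
    ∫ z : ℝ × ℝ, q z.1 * q z.2 * h (z.1 - z.2)
        ∂((MeasureTheory.volume.restrict m).prod (MeasureTheory.volume.restrict m)) ≤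
      B ^ 2 * ∑ j ∈ P, (∑ i ∈ P, Real.exp Real.pi * K * Real.exp (-Real.pi * (K * (v i + v j)) ^ 2)) *
        ‖∫ u in Set.Icc (-(2 * K)) (2 * K), (h u : ℂ) * ee (u * -v j)‖ := by
  have hmfin : MeasureTheory.volume m ≠ ⊤ :=
    ((MeasureTheory.measure_mono hmK).trans_lt isCompact_Icc.measure_lt_top).ne
  have hfin : MeasureTheory.IsFiniteMeasure (MeasureTheory.volume.restrict m) :=
    ⟨by rw [MeasureTheory.Measure.restrict_apply_univ]; exact lt_top_iff_ne_top.2 hmfin⟩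
  set μ := MeasureTheory.volume.restrict m with hμ
  set ν := MeasureTheory.volume.restrict (Set.Icc (-(2 * K)) (2 * K)) with hν
  set Q := ∑ i ∈ P, ‖b i‖ with hQ
  have hqQ : ∀ x, q x ≤ Q := fun x => by
    rw [← Real.norm_of_nonneg (hq0 x), ← Complex.norm_real, hq]
    exact norm_expSum_le P v b x
  have hQ0 : 0 ≤ Q := (hq0 0).trans (hqQ 0)
  have hM0 : 0 ≤ M := (hh0 0).trans (hhM 0)
  have hqm := hqc.measurable
  have hI1 : MeasureTheory.Integrable (fun z : ℝ × ℝ => q z.1 * q z.2 * h (z.1 - z.2))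
      (μ.prod μ) := by
    refine MeasureTheory.Integrable.of_bound (((hqm.comp measurable_fst).mul
      (hqm.comp measurable_snd)).mul (hhm.comp (measurable_fst.sub measurable_snd))).aestronglyMeasurable
      (Q * Q * M) (Filter.Eventually.of_forall fun z => ?_)
    rw [Real.norm_of_nonneg (mul_nonneg (mul_nonneg (hq0 _) (hq0 _)) (hh0 _))]
    exact mul_le_mul (mul_le_mul (hqQ _) (hqQ _) (hq0 _) hQ0) (hhM _) (hh0 _) (by positivity)
  have hI2 : MeasureTheory.Integrable (fun z : ℝ × ℝ => q z.1 * (q (z.1 - z.2) * h z.2))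
      (μ.prod ν) := by
    refine MeasureTheory.Integrable.of_bound ((hqm.comp measurable_fst).mul
      ((hqm.comp (measurable_fst.sub measurable_snd)).mul
        (hhm.comp measurable_snd))).aestronglyMeasurable
      (Q * (Q * M)) (Filter.Eventually.of_forall fun z => ?_)
    rw [Real.norm_of_nonneg (mul_nonneg (hq0 _) (mul_nonneg (hq0 _) (hh0 _)))]
    exact mul_le_mul (hqQ _) (mul_le_mul (hqQ _) (hhM _) (hh0 _) hQ0)
      (mul_nonneg (hq0 _) (hh0 _)) (by positivity)
  have hstep1 : ∫ z : ℝ × ℝ, q z.1 * q z.2 * h (z.1 - z.2) ∂(μ.prod μ) ≤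
      ∫ z : ℝ × ℝ, q z.1 * (q (z.1 - z.2) * h z.2) ∂(μ.prod ν) := by
    rw [MeasureTheory.integral_prod _ hI1, MeasureTheory.integral_prod _ hI2]
    refine MeasureTheory.integral_mono_ae hI1.integral_prod_left hI2.integral_prod_left ?_
    rw [hμ]
    filter_upwards [MeasureTheory.ae_restrict_mem hm] with x hx
    have hx' := hmK hx
    rw [← hμ]
    simp only [mul_assoc]
    rw [MeasureTheory.integral_const_mul, MeasureTheory.integral_const_mul]
    refine mul_le_mul_of_nonneg_left ?_ (hq0 x)
    set h' : ℝ → ℝ := (Set.Icc (-(2 * K)) (2 * K)).indicator h with hh'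
    have hh'0 : ∀ u, 0 ≤ h' u := fun u => Set.indicator_nonneg (fun _ _ => hh0 _) u
    have hint' : MeasureTheory.Integrable (fun u => q (x - u) * h' u) := by
      have e : (fun u => q (x - u) * h' u) =
          (Set.Icc (-(2 * K)) (2 * K)).indicator (fun u => q (x - u) * h u) := by
        funext u
        rw [Set.indicator_mul_right]
      rw [e, MeasureTheory.integrable_indicator_iff measurableSet_Icc]
      refine MeasureTheory.Integrable.of_bound (((hqm.comp (measurable_const.sub
        measurable_id)).mul hhm).aestronglyMeasurable) (Q * M) (Filter.Eventually.of_forall fun u => ?_)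
      rw [Real.norm_of_nonneg (mul_nonneg (hq0 _) (hh0 _))]
      exact mul_le_mul (hqQ _) (hhM _) (hh0 _) hQ0
    calc ∫ y, q y * h (x - y) ∂μ = ∫ y in m, q y * h' (x - y) := by
          refine MeasureTheory.setIntegral_congr_fun hm fun y hy => ?_
          have hy' := hmK hy
          rw [hh', Set.indicator_of_mem]
          constructor <;> linarith [hx'.1, hx'.2, hy'.1, hy'.2]
      _ ≤ ∫ y, q y * h' (x - y) := by
          refine MeasureTheory.setIntegral_le_integral ?_
            (Filter.Eventually.of_forall fun y => mul_nonneg (hq0 _) (hh'0 _))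
          have := hint'.comp_sub_left x
          simpa only [sub_sub_cancel] using this
      _ = ∫ u, q (x - u) * h' u := by
          have := MeasureTheory.integral_sub_left_eq_self (fun u => q (x - u) * h' u)
            MeasureTheory.volume x
          simpa only [sub_sub_cancel] using this
      _ = ∫ u, q (x - u) * h u ∂ν := by
          rw [hν, ← MeasureTheory.integral_indicator measurableSet_Icc]
          refine MeasureTheory.integral_congr_ae (Filter.Eventually.of_forall fun u => ?_)
          simp only
          rw [Set.indicator_mul_right]
  have hgi : ∀ t : ℝ, MeasureTheory.Integrable (fun x : ℝ => (gaussMaj K x : ℂ) * ee (x * t)) :=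
    integrable_gaussMaj_mul_ee hK
  set kh : ℝ → ℝ := fun t => Real.exp Real.pi * K * Real.exp (-Real.pi * (K * t) ^ 2) with hk
  have hexp : ∀ x u : ℝ, ((gaussMaj K x * (q x * q (x - u)) : ℝ) : ℂ) =
      ∑ i ∈ P, ∑ j ∈ P, b i * b j * ee (u * -v j) * ((gaussMaj K x : ℂ) * ee (x * (v i + v j))) := by
    intro x u
    rw [Complex.ofReal_mul, Complex.ofReal_mul, hq, hq, expSum, expSum, Finset.sum_mul_sum,
      Finset.mul_sum]
    refine Finset.sum_congr rfl fun i _ => ?_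
    rw [Finset.mul_sum]
    refine Finset.sum_congr rfl fun j _ => ?_
    rw [mul_add x, ee_add, sub_mul, sub_eq_add_neg, ee_add, mul_neg]
    ring
  have hI3 : ∀ u, MeasureTheory.Integrable (fun x : ℝ => gaussMaj K x * (q x * q (x - u))) := by
    intro u
    have : MeasureTheory.Integrable
        (fun x : ℝ => ((gaussMaj K x * (q x * q (x - u)) : ℝ) : ℂ)) := by
      simp_rw [hexp]
      exact MeasureTheory.integrable_finsetSum _ fun i _ =>
        MeasureTheory.integrable_finsetSum _ fun j _ => (hgi _).const_mul _
    exact this.re.congr (Filter.Eventually.of_forall fun x => by simp only; exact Complex.ofReal_re _)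
  have hG : ∀ u, ((∫ x, gaussMaj K x * (q x * q (x - u)) : ℝ) : ℂ) =
      ∑ i ∈ P, ∑ j ∈ P, b i * b j * ee (u * -v j) * (kh (v i + v j) : ℂ) := by
    intro u
    rw [← integral_complex_ofReal]
    simp_rw [hexp]
    rw [MeasureTheory.integral_finsetSum _ fun i _ =>
      MeasureTheory.integrable_finsetSum _ fun j _ => (hgi _).const_mul _]
    refine Finset.sum_congr rfl fun i _ => ?_
    rw [MeasureTheory.integral_finsetSum _ fun j _ => (hgi _).const_mul _]
    refine Finset.sum_congr rfl fun j _ => ?_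
    rw [MeasureTheory.integral_const_mul, integral_gaussMaj_mul_ee hK]
  set G : ℝ → ℝ := fun u => ∫ x, gaussMaj K x * (q x * q (x - u)) with hGdef
  have hhe : ∀ t : ℝ, MeasureTheory.Integrable (fun u => (h u : ℂ) * ee (u * t)) ν :=
    integrable_mul_ee hhm hh0 hhM
  have hhG : ∀ u, ((h u * G u : ℝ) : ℂ) = ∑ i ∈ P, ∑ j ∈ P, b i * b j * (kh (v i + v j) : ℂ) *
      ((h u : ℂ) * ee (u * -v j)) := by
    intro u
    rw [Complex.ofReal_mul, hGdef]
    simp only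
    rw [hG, Finset.mul_sum]
    refine Finset.sum_congr rfl fun i _ => ?_
    rw [Finset.mul_sum]
    exact Finset.sum_congr rfl fun j _ => by ring
  have hI4c : MeasureTheory.Integrable (fun u => ((h u * G u : ℝ) : ℂ)) ν := by
    simp_rw [hhG]
    exact MeasureTheory.integrable_finsetSum _ fun i _ =>
        MeasureTheory.integrable_finsetSum _ fun j _ => (hhe _).const_mul _
  have hI4 : MeasureTheory.Integrable (fun u => h u * G u) ν :=
    hI4c.re.congr (Filter.Eventually.of_forall fun x => by simp only; exact Complex.ofReal_re _)
  have hstep2 : ∫ z : ℝ × ℝ, q z.1 * (q (z.1 - z.2) * h z.2) ∂(μ.prod ν) ≤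
      ∫ u, h u * G u ∂ν := by
    rw [MeasureTheory.integral_prod_symm _ hI2]
    refine MeasureTheory.integral_mono hI2.integral_prod_right hI4 fun u => ?_
    simp only
    have e : ∀ x, q x * (q (x - u) * h u) = h u * (q x * q (x - u)) := fun x => by ring
    simp_rw [e]
    rw [MeasureTheory.integral_const_mul]
    refine mul_le_mul_of_nonneg_left ?_ (hh0 u)
    have hnn : ∀ x, 0 ≤ q x * q (x - u) := fun x => mul_nonneg (hq0 _) (hq0 _)
    refine le_trans (MeasureTheory.setIntegral_mono_on ?_ (hI3 u).integrableOn hm ?_)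
      (MeasureTheory.setIntegral_le_integral (hI3 u)
        (Filter.Eventually.of_forall fun x => mul_nonneg (gaussMaj_pos _ _).le (hnn x)))
    · refine MeasureTheory.Integrable.of_bound (hqc.mul
        (hqc.comp (continuous_id.sub continuous_const))).aestronglyMeasurable (Q * Q)
        (Filter.Eventually.of_forall fun x => ?_)
      have := hnn x
      rw [Real.norm_of_nonneg (by exact this)]
      exact mul_le_mul (hqQ _) (hqQ _) (hq0 _) hQ0
    · intro x hx
      exact le_mul_of_one_le_left (hnn x) (one_le_gaussMaj hK (abs_le.2 (hmK hx)))
  refine hstep1.trans (hstep2.trans ?_)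
  refine (le_abs_self _).trans ?_
  rw [← Real.norm_eq_abs, ← Complex.norm_real, ← integral_complex_ofReal]
  simp_rw [hhG]
  rw [MeasureTheory.integral_finsetSum _ fun i _ =>
        MeasureTheory.integrable_finsetSum _ fun j _ => (hhe _).const_mul _]
  have e1 : ∀ i ∈ P, ∫ u, ∑ j ∈ P, b i * b j * (kh (v i + v j) : ℂ) * ((h u : ℂ) * ee (u * -v j)) ∂ν =
      ∑ j ∈ P, b i * b j * (kh (v i + v j) : ℂ) * ∫ u, (h u : ℂ) * ee (u * -v j) ∂ν := fun i _ => by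
    rw [MeasureTheory.integral_finsetSum _ fun j _ => (hhe _).const_mul _]
    exact Finset.sum_congr rfl fun j _ => MeasureTheory.integral_const_mul _ _
  rw [Finset.sum_congr rfl e1, Finset.sum_comm, Finset.mul_sum]
  refine (norm_sum_le _ _).trans (Finset.sum_le_sum fun j hj => ?_)
  rw [Finset.sum_mul, Finset.mul_sum]
  refine (norm_sum_le _ _).trans (Finset.sum_le_sum fun i hi => ?_)
  have hk0 : 0 ≤ kh (v i + v j) := by rw [hk]; positivity
  rw [norm_mul, norm_mul, norm_mul, Complex.norm_real, Real.norm_of_nonneg hk0, pow_two, mul_assoc]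
  refine mul_le_mul (mul_le_mul (hb i hi) (hb j hj) (norm_nonneg _) ((norm_nonneg _).trans (hb i hi)))
    le_rfl (by positivity) (mul_self_nonneg B)

/-- A dual mean value estimate. -/
lemma sum_norm_fourier_le {ι : Type*} (L : Finset ι) (v : ι → ℝ) {K R M : ℝ} (hK : 0 < K)
    (hR : ∀ i ∈ L, ((L.filter (fun j => |v i - v j| ≤ 1)).card : ℝ) ≤ R)
    (h : ℝ → ℝ) (hhm : Measurable h) (hh0 : ∀ u, 0 ≤ h u) (hhM : ∀ u, h u ≤ M) :
    (∑ j ∈ L, ‖∫ u in Set.Icc (-K) K, (h u : ℂ) * ee (u * -v j)‖) ^ 2 ≤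
      (∫ u in Set.Icc (-K) K, h u ^ 2) *
        (Real.exp Real.pi * K * (R + L.card * Real.exp (-Real.pi * K ^ 2)) * L.card) := by
  set ν := MeasureTheory.volume.restrict (Set.Icc (-K) K) with hν
  have hM0 : 0 ≤ M := (hh0 0).trans (hhM 0)
  set z : ι → ℂ := fun j => ∫ u, (h u : ℂ) * ee (u * -v j) ∂ν with hz
  have hhe : ∀ t : ℝ, MeasureTheory.Integrable (fun u => (h u : ℂ) * ee (u * t)) ν :=
    integrable_mul_ee hhm hh0 hhM
  have hω : ∀ j, ∃ ω : ℂ, ‖ω‖ ≤ 1 ∧ ω * z j = (‖z j‖ : ℂ) := by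
    intro j
    rcases eq_or_ne (z j) 0 with h0 | h0
    · exact ⟨0, by simp, by simp [h0]⟩
    · refine ⟨(‖z j‖ : ℂ) / z j, ?_, div_mul_cancel₀ _ h0⟩
      rw [norm_div, Complex.norm_real, norm_norm, div_self (norm_ne_zero_iff.2 h0)]
  choose ω hω1 hω2 using hω
  set E := expSum L (fun j => -v j) ω with hE
  have hEc : Continuous E := continuous_expSum _ _ _
  set Q := ∑ i ∈ L, ‖ω i‖
  have hEQ : ∀ u, ‖E u‖ ≤ Q := norm_expSum_le _ _ _
  have hQ0 : 0 ≤ Q := (norm_nonneg _).trans (hEQ 0)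
  have hsum : ((∑ j ∈ L, ‖z j‖ : ℝ) : ℂ) = ∫ u, (h u : ℂ) * E u ∂ν := by
    have : ∀ u, (h u : ℂ) * E u = ∑ j ∈ L, ω j * ((h u : ℂ) * ee (u * -v j)) := fun u => by
      rw [hE, expSum, Finset.mul_sum]
      exact Finset.sum_congr rfl fun j _ => by ring
    simp_rw [this]
    rw [MeasureTheory.integral_finsetSum _ fun j _ => (hhe _).const_mul _, Complex.ofReal_sum]
    refine Finset.sum_congr rfl fun j _ => ?_
    rw [MeasureTheory.integral_const_mul, ← hω2]
  have hle : ∑ j ∈ L, ‖z j‖ ≤ ∫ u, h u * ‖E u‖ ∂ν := by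
    rw [← Real.norm_of_nonneg (Finset.sum_nonneg fun j _ => norm_nonneg (z j)),
      ← Complex.norm_real, hsum]
    refine (MeasureTheory.norm_integral_le_integral_norm _).trans (le_of_eq ?_)
    refine MeasureTheory.integral_congr_ae (Filter.Eventually.of_forall fun u => ?_)
    simp only [norm_mul, Complex.norm_real, Real.norm_of_nonneg (hh0 u)]
  have hmean := integral_normSq_expSum_le L (fun j => -v j) ω (R := R) hK (by
    intro i hi
    have : (L.filter (fun j => |-v i - -v j| ≤ 1)) = L.filter (fun j => |v i - v j| ≤ 1) := by
      refine Finset.filter_congr fun j _ => ?_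
      rw [← abs_neg, neg_sub, sub_neg_eq_add, neg_add_eq_sub, abs_sub_comm, abs_sub_comm]
    rw [this]
    exact hR i hi)
  have hRL : (L.card : ℝ) * Real.exp (-Real.pi * K ^ 2) ≥ 0 := by positivity
  calc (∑ j ∈ L, ‖z j‖) ^ 2 ≤ (∫ u, h u * ‖E u‖ ∂ν) ^ 2 := by
        refine pow_le_pow_left₀ (Finset.sum_nonneg fun j _ => norm_nonneg _) hle 2
    _ ≤ (∫ u, h u ^ 2 ∂ν) * ∫ u, ‖E u‖ ^ 2 ∂ν := by
        refine sq_integral_mul_le ?_ ?_ ?_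
        · refine MeasureTheory.Integrable.of_bound (hhm.pow_const 2).aestronglyMeasurable (M ^ 2)
            (Filter.Eventually.of_forall fun u => ?_)
          rw [Real.norm_of_nonneg (sq_nonneg _)]
          exact pow_le_pow_left₀ (hh0 u) (hhM u) 2
        · refine MeasureTheory.Integrable.of_bound (hEc.norm.pow 2).aestronglyMeasurable (Q ^ 2)
            (Filter.Eventually.of_forall fun u => ?_)
          rw [Real.norm_of_nonneg (sq_nonneg _)]
          exact pow_le_pow_left₀ (norm_nonneg _) (hEQ u) 2
        · refine MeasureTheory.Integrable.of_bound
            (hhm.mul hEc.norm.measurable).aestronglyMeasurable (M * Q)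
            (Filter.Eventually.of_forall fun u => ?_)
          rw [Real.norm_of_nonneg (mul_nonneg (hh0 u) (norm_nonneg _))]
          exact mul_le_mul (hhM u) (hEQ u) (norm_nonneg _) hM0
    _ ≤ _ := by
        refine mul_le_mul_of_nonneg_left (hmean.trans ?_)
          (MeasureTheory.integral_nonneg fun u => sq_nonneg _)
        rcases L.eq_empty_or_nonempty with h0 | ⟨i, hi⟩
        · simp [h0]
        have hR0 : 0 ≤ R := (Nat.cast_nonneg _).trans (hR i hi)
        refine mul_le_mul_of_nonneg_left ?_ (by positivity)
        calc ∑ i ∈ L, ‖ω i‖ ^ 2 ≤ ∑ i ∈ L, (1 : ℝ) :=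
              Finset.sum_le_sum fun i _ => pow_le_one₀ (norm_nonneg _) (hω1 i)
          _ = L.card := by simp

/-- The unweighted exponential sum over `(X, 2X]`. -/
noncomputable def powSum (c X u : ℝ) : ℂ :=
  expSum (dyad X) (fun n : ℕ => (n : ℝ) ^ c) (fun _ => 1) u

lemma powSum_eq (c X u : ℝ) :
    powSum c X u = ∑ n ∈ Finset.Ioc ⌊X⌋₊ ⌊2 * X⌋₊, ee (u * (n : ℝ) ^ c) := by
  simp only [powSum, expSum, dyad, one_mul]

lemma continuous_powSum (c X : ℝ) : Continuous (powSum c X) := continuous_expSum _ _ _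

lemma norm_powSum_le_trivial (c : ℝ) {X : ℝ} (hX : 0 ≤ X) (u : ℝ) : ‖powSum c X u‖ ≤ 2 * X := by
  refine (norm_expSum_le _ _ _ _).trans ?_
  simpa using card_dyad_le hX

lemma norm_powSum_le_near {c : ℝ} (hc1 : 1 < c) (hc2 : c < 3 / 2) {X u : ℝ} (hX : 1 ≤ X)
    (hu : |u| ≤ X ^ (1 - c) / 8) : ‖powSum c X u‖ ≤ 4 * X / (1 + X ^ c * |u|) := by
  have hX0 : 0 < X := by linarith
  have hXc : 0 < X ^ c := by positivity
  rw [le_div_iff₀ (by positivity)]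
  have h1 := norm_powSum_le_trivial c hX0.le u
  have h2 : ‖powSum c X u‖ * (X ^ c * |u|) ≤ 2 * X := by
    rcases eq_or_ne u 0 with h0 | h0
    · rw [h0, abs_zero, mul_zero, mul_zero]; linarith
    have hu0 : 0 < |u| := abs_pos.2 h0
    have h := kusmin_landau_power hc1 hc2 X u ⌊X⌋₊ ⌊2 * X⌋₊ hX h0 hu (Nat.lt_floor_add_one _).le
      (Nat.floor_le (by linarith))
    rw [← powSum_eq, le_div_iff₀ hu0] at h
    calc ‖powSum c X u‖ * (X ^ c * |u|) = X ^ c * (‖powSum c X u‖ * |u|) := by ring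
      _ ≤ X ^ c * (2 * X ^ (1 - c)) := by gcongr
      _ = 2 * (X ^ c * X ^ (1 - c)) := by ring
      _ = 2 * X := by
        rw [← Real.rpow_add hX0, show c + (1 - c) = 1 by ring, Real.rpow_one]
  linarith

lemma integral_powSum_near_le {c : ℝ} (hc1 : 1 < c) (hc2 : c < 3 / 2) {X : ℝ} (hX : 2 ≤ X) :
    ∫ u in Set.Icc (-(X ^ (1 - c) / 8)) (X ^ (1 - c) / 8), ‖powSum c X u‖ ≤
      8 * X ^ (1 - c) * Real.log X := by
  have hX0 : 0 < X := by linarith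
  set δ := X ^ (1 - c) / 8 with hδ
  have hδ0 : 0 < δ := by positivity
  have hXc : 0 < X ^ c := by positivity
  have hcont := (continuous_powSum c X).norm
  have hhalf : ∀ s : ℝ, |s| = 1 → ∫ u in (0:ℝ)..δ, ‖powSum c X (s * u)‖ ≤
      4 * X ^ (1 - c) * Real.log X := by
    intro s hs
    have hder : ∀ u ∈ Set.uIcc 0 δ, HasDerivAt (fun u => 4 * X ^ (1 - c) * Real.log (1 + X ^ c * u))
        (4 * X / (1 + X ^ c * u)) u := by
      intro u hu
      rw [Set.uIcc_of_le hδ0.le] at hu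
      have hu0 := hu.1
      have hpos : 0 < 1 + X ^ c * u := by positivity
      have h := (((((hasDerivAt_id u).const_mul (X ^ c)).const_add 1).log hpos.ne')).const_mul
        (4 * X ^ (1 - c))
      refine h.congr_deriv ?_
      have e : X ^ (1 - c) * X ^ c = X := by
        rw [← Real.rpow_add hX0, show 1 - c + c = 1 by ring, Real.rpow_one]
      simp only [id]
      rw [mul_one, mul_div_assoc', mul_assoc, e]
    have hci : ContinuousOn (fun u => 4 * X / (1 + X ^ c * u)) (Set.uIcc 0 δ) := by
      refine ContinuousOn.div (by fun_prop) (by fun_prop) ?_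
      intro u hu
      rw [Set.uIcc_of_le hδ0.le] at hu
      have := hu.1
      positivity
    have hint := intervalIntegral.integral_eq_sub_of_hasDerivAt hder hci.intervalIntegrable
    calc ∫ u in (0:ℝ)..δ, ‖powSum c X (s * u)‖ ≤ ∫ u in (0:ℝ)..δ, 4 * X / (1 + X ^ c * u) := by
          refine intervalIntegral.integral_mono_on hδ0.le
            ((hcont.comp (continuous_const.mul continuous_id)).intervalIntegrable _ _)
            hci.intervalIntegrable ?_
          intro u hu
          have h := norm_powSum_le_near hc1 hc2 (X := X) (u := s * u) (by linarith)
            (by rw [abs_mul, hs, one_mul, abs_of_nonneg hu.1]; exact hu.2)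
          rwa [abs_mul, hs, one_mul, abs_of_nonneg hu.1] at h
      _ = 4 * X ^ (1 - c) * Real.log (1 + X ^ c * δ) := by
          rw [hint]; simp
      _ ≤ _ := by
          have e : X ^ c * δ = X / 8 := by
            rw [hδ, mul_div_assoc', ← Real.rpow_add hX0, show c + (1 - c) = 1 by ring, Real.rpow_one]
          rw [e]
          gcongr
          linarith
  rw [MeasureTheory.integral_Icc_eq_integral_Ioc, ← intervalIntegral.integral_of_le (by linarith),
    ← intervalIntegral.integral_add_adjacent_intervals (b := 0)
      (hcont.intervalIntegrable _ _) (hcont.intervalIntegrable _ _)]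
  have h1 := hhalf 1 (by simp)
  have h2 := hhalf (-1) (by simp)
  simp only [one_mul, neg_one_mul] at h1 h2
  have h3 := intervalIntegral.integral_comp_neg (a := 0) (b := δ) (fun u => ‖powSum c X u‖)
  rw [neg_zero] at h3
  rw [h3] at h2
  linarith

lemma normSq_powSum_le_off {c : ℝ} (hc1 : 1 < c) (hc2 : c < 2) : ∃ C : ℝ, 0 < C ∧
    ∀ X K u : ℝ, 1 ≤ X → 1 ≤ K → X ^ (1 - c) / 8 ≤ |u| → |u| ≤ 2 * K →
      ‖powSum c X u‖ ^ 2 ≤ C * (K * X ^ c) := by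
  obtain ⟨C, hC, h⟩ := vdc_power hc1 hc2
  refine ⟨C ^ 2 * 20, by positivity, fun X K u hX hK hu1 hu2 => ?_⟩
  have hX0 : 0 < X := by linarith
  have hu0 : 0 < |u| := lt_of_lt_of_le (by positivity) hu1
  have hXc : 0 < X ^ c := by positivity
  have h1 := h X u ⌊X⌋₊ ⌊2 * X⌋₊ hX (abs_pos.1 hu0) (Nat.floor_le_floor (by linarith))
    (Nat.lt_floor_add_one _).le (Nat.floor_le (by linarith))
  rw [← powSum_eq] at h1
  set y := |u| * X ^ c with hy
  have hy0 : 0 < y := by positivity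
  have hs : Real.sqrt y ^ 2 = y := Real.sq_sqrt hy0.le
  have hyX : X / 8 ≤ y := by
    calc X / 8 = X ^ (1 - c) / 8 * X ^ c := by
          rw [div_mul_eq_mul_div, ← Real.rpow_add hX0, show 1 - c + c = 1 by ring, Real.rpow_one]
      _ ≤ y := by rw [hy]; gcongr
  have hyK : y ≤ 2 * (K * X ^ c) := by rw [hy, ← mul_assoc]; gcongr
  have hXXc : X ≤ X ^ c := by
    conv_lhs => rw [← Real.rpow_one X]
    exact Real.rpow_le_rpow_of_exponent_le hX hc1.le
  have hXK : X ≤ K * X ^ c := hXXc.trans (le_mul_of_one_le_left hXc.le hK)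
  have hXy : X ^ 2 / y ≤ 8 * X := by
    rw [div_le_iff₀ hy0]; nlinarith
  calc ‖powSum c X u‖ ^ 2 ≤ (C * (Real.sqrt y + X / Real.sqrt y)) ^ 2 := by gcongr
    _ ≤ C ^ 2 * (2 * (Real.sqrt y ^ 2 + (X / Real.sqrt y) ^ 2)) := by
      rw [mul_pow]; gcongr; exact add_sq_le
    _ = C ^ 2 * (2 * (y + X ^ 2 / y)) := by rw [div_pow, hs]
    _ ≤ C ^ 2 * (2 * (2 * (K * X ^ c) + 8 * (K * X ^ c))) := by gcongr; linarith
    _ = _ := by ring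

lemma card_near_pairs_le {c : ℝ} (hc : 1 < c) {X : ℝ} (hX : 1 ≤ X) :
    (((dyad X ×ˢ dyad X).filter (fun p : ℕ × ℕ =>
      |(p.1 : ℝ) ^ c - (p.2 : ℝ) ^ c| < X ^ (c - 1 + 1 / 5))).card : ℝ) ≤ 6 * X ^ (6 / 5 : ℝ) := by
  have hX0 : 0 < X := by linarith
  set r := ⌊X ^ (1 / 5 : ℝ)⌋₊ with hr
  have hr1 : (r : ℝ) ≤ X ^ (1 / 5 : ℝ) := Nat.floor_le (by positivity)
  have h1 : ((dyad X ×ˢ dyad X).filter (fun p : ℕ × ℕ =>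
      |(p.1 : ℝ) ^ c - (p.2 : ℝ) ^ c| < X ^ (c - 1 + 1 / 5))).card ≤
      (dyad X).card * (2 * r + 1) := by
    rw [Finset.card_filter, Finset.sum_product, ← smul_eq_mul]
    refine Finset.sum_le_card_nsmul _ _ _ fun n hn => ?_
    rw [← Finset.card_filter]
    refine le_trans (Finset.card_le_card (t := Finset.Icc (n - r) (n + r)) ?_) ?_
    · intro k hk
      rw [Finset.mem_filter, mem_dyad hX0.le] at hk
      rw [mem_dyad hX0.le] at hn
      have h2 := abs_sub_mul_le_rpow_sub hc hX0 hn.1.le hk.1.1.le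
      have h3 : |(n : ℝ) - k| ≤ X ^ (1 / 5 : ℝ) := by
        have h4 : X ^ (c - 1) * |(n : ℝ) - k| ≤ X ^ (c - 1) * X ^ (1 / 5 : ℝ) := by
          rw [← Real.rpow_add hX0]
          exact h2.trans hk.2.le
        exact le_of_mul_le_mul_left h4 (by positivity)
      rw [abs_le] at h3
      rw [Finset.mem_Icc]
      constructor
      · have : n - k ≤ r := by
          rw [hr, Nat.le_floor_iff (by positivity)]
          rcases le_total k n with h | h
          · rw [Nat.cast_sub h]; exact h3.2
          · rw [Nat.sub_eq_zero_of_le h, Nat.cast_zero]; positivity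
        omega
      · have : k - n ≤ r := by
          rw [hr, Nat.le_floor_iff (by positivity)]
          rcases le_total n k with h | h
          · rw [Nat.cast_sub h]; linarith [h3.1]
          · rw [Nat.sub_eq_zero_of_le h, Nat.cast_zero]; positivity
        omega
    · rw [Nat.card_Icc]; omega
  calc _ ≤ (((dyad X).card * (2 * r + 1) : ℕ) : ℝ) := by exact_mod_cast h1
    _ = (dyad X).card * (2 * r + 1) := by push_cast; ring
    _ ≤ (2 * X) * (2 * X ^ (1 / 5 : ℝ) + X ^ (1 / 5 : ℝ)) := by
      gcongr
      · exact card_dyad_le hX0.le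
      · exact Real.one_le_rpow hX (by norm_num)
    _ = 6 * (X ^ (1 : ℝ) * X ^ (1 / 5 : ℝ)) := by rw [Real.rpow_one]; ring
    _ = _ := by rw [← Real.rpow_add hX0]; norm_num

set_option maxHeartbeats 1000000 in
lemma off_diagonal_correlation_le {c : ℝ} (hc1 : 1 < c) (hc2 : c < 3 / 2) : ∃ C : ℝ, 0 < C ∧
    ∀ (X K R A : ℝ) (a : ℕ → ℂ) (m : Set ℝ), 1 ≤ X → 1 ≤ K → 1 ≤ R →
    (2 * X) ^ 2 * Real.exp (-Real.pi * K ^ 2) ≤ 1 →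
    (∀ v : ℝ, X ^ (c - 1 + 1 / 5) ≤ |v| → (pairCount c X v : ℝ) ≤ R) →
    (∀ n ∈ dyad X, ‖a n‖ ≤ A) → MeasurableSet m → m ⊆ Set.Icc (-K) K →
    ∫ z : ℝ × ℝ, ‖expSum (dyad X) (fun n : ℕ => (n : ℝ) ^ c) a z.1‖ ^ 2 *
      ‖expSum (dyad X) (fun n : ℕ => (n : ℝ) ^ c) a z.2‖ ^ 2 *
      (Set.Icc (-(X ^ (1 - c) / 8)) (X ^ (1 - c) / 8))ᶜ.indicator
        (fun u => ‖powSum c X u‖ ^ 2) (z.1 - z.2)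
      ∂((MeasureTheory.volume.restrict m).prod (MeasureTheory.volume.restrict m)) ≤
    C * A ^ 4 * (K ^ 2 * X ^ (16 / 5 : ℝ) + K * R * √(K ^ 3 * R * X ^ (3 + c))) := by
  obtain ⟨C, hC, hoff⟩ := normSq_powSum_le_off hc1 (by linarith : c < 2)
  set E := Real.exp Real.pi with hE
  have hE0 : 0 < E := Real.exp_pos _
  refine ⟨672 * E ^ 2 + 2 * E * √(256 * C * E ^ 2), by positivity,
    fun X K R A a m hX hK hR hexp hpair ha hm hmK => ?_⟩
  have hX0 : 0 < X := by linarith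
  have hK0 : 0 < K := by linarith
  set D := dyad X with hD
  set f : ℕ → ℝ := fun n => (n : ℝ) ^ c with hf
  set P := D ×ˢ D with hP
  set v : ℕ × ℕ → ℝ := fun p => f p.1 - f p.2 with hv
  set b : ℕ × ℕ → ℂ := fun p => a p.1 * (starRingEnd ℂ) (a p.2) with hb
  set δ := X ^ (1 - c) / 8 with hδ
  set h : ℝ → ℝ := (Set.Icc (-δ) δ)ᶜ.indicator (fun u => ‖powSum c X u‖ ^ 2) with hh
  have hDc : (D.card : ℝ) ≤ 2 * X := card_dyad_le hX0.le
  have hPc : (P.card : ℝ) ≤ (2 * X) ^ 2 := by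
    rw [hP, Finset.card_product]; push_cast; nlinarith [(Nat.cast_nonneg D.card : (0:ℝ) ≤ _)]
  have hcontT : Continuous (fun u => ‖powSum c X u‖ ^ 2) := (continuous_powSum c X).norm.pow 2
  have hhm : Measurable h := hcontT.measurable.indicator measurableSet_Icc.compl
  have hh0 : ∀ u, 0 ≤ h u := fun u => Set.indicator_nonneg (fun _ _ => by positivity) _
  have hhT : ∀ u, h u ≤ ‖powSum c X u‖ ^ 2 := fun u =>
    Set.indicator_le_self' (fun _ _ => by positivity) _
  have hhM : ∀ u, h u ≤ (2 * X) ^ 2 := fun u =>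
    (hhT u).trans (pow_le_pow_left₀ (norm_nonneg _) (norm_powSum_le_trivial c hX0.le u) 2)
  have hhoff : ∀ u, |u| ≤ 2 * K → h u ≤ C * (K * X ^ c) := fun u hu => by
    by_cases hu' : u ∈ Set.Icc (-δ) δ
    · rw [hh, Set.indicator_of_notMem (Set.notMem_compl_iff.2 hu')]; positivity
    · refine (hhT u).trans (hoff X K u hX hK ?_ hu)
      rw [Set.mem_Icc, ← abs_le, not_le] at hu'
      exact hu'.le
  have hexp1 : 2 * X * Real.exp (-Real.pi * (2 * K) ^ 2) ≤ 1 := by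
    have h1 : Real.exp (-Real.pi * (2 * K) ^ 2) ≤ Real.exp (-Real.pi * K ^ 2) :=
      Real.exp_le_exp.2 (by nlinarith [Real.pi_pos, sq_nonneg K])
    have h2 := Real.exp_pos (-Real.pi * K ^ 2)
    nlinarith
  have hexp2 : (2 * X) ^ 2 * Real.exp (-Real.pi * (2 * K) ^ 2) ≤ 1 := by
    have h1 : Real.exp (-Real.pi * (2 * K) ^ 2) ≤ Real.exp (-Real.pi * K ^ 2) :=
      Real.exp_le_exp.2 (by nlinarith [Real.pi_pos, sq_nonneg K])
    exact (mul_le_mul_of_nonneg_left h1 (by positivity)).trans hexp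
  set J := ∫ u in Set.Icc (-(2 * K)) (2 * K), ‖powSum c X u‖ ^ 2 with hJ
  have hJle : J ≤ 16 * E * K * X := by
    have := integral_normSq_expSum_le D f (fun _ => 1) (K := 2 * K) (R := 3) (by positivity)
      (fun i _ => by
        have := card_rpow_near_le hc1 hX (f i)
        simp only [abs_sub_comm (f i)]
        exact_mod_cast this)
    refine this.trans ?_
    simp only [norm_one, one_pow, Finset.sum_const, nsmul_eq_mul, mul_one]
    have h1 : (D.card : ℝ) * Real.exp (-Real.pi * (2 * K) ^ 2) ≤ 1 :=
      (mul_le_mul_of_nonneg_right hDc (Real.exp_pos _).le).trans hexp1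
    calc E * (2 * K) * (3 + D.card * Real.exp (-Real.pi * (2 * K) ^ 2)) * D.card
        ≤ E * (2 * K) * (3 + 1) * (2 * X) := by gcongr
      _ = _ := by ring
  have hIc : MeasureTheory.IntegrableOn (fun u => ‖powSum c X u‖ ^ 2)
      (Set.Icc (-(2 * K)) (2 * K)) := hcontT.continuousOn.integrableOn_compact isCompact_Icc
  have hhint : ∀ j, ‖∫ u in Set.Icc (-(2 * K)) (2 * K), (h u : ℂ) * ee (u * -v j)‖ ≤
      16 * E * K * X := fun j => by
    refine le_trans (MeasureTheory.norm_integral_le_of_norm_le hIc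
      (Filter.Eventually.of_forall fun u => ?_)) hJle
    rw [norm_mul, norm_ee, mul_one, Complex.norm_real, Real.norm_of_nonneg (hh0 u)]
    exact hhT u
  have hsq : ∫ u in Set.Icc (-(2 * K)) (2 * K), h u ^ 2 ≤ 16 * C * E * K ^ 2 * X ^ (1 + c) := by
    have : ∫ u in Set.Icc (-(2 * K)) (2 * K), h u ^ 2 ≤
        ∫ u in Set.Icc (-(2 * K)) (2 * K), C * (K * X ^ c) * ‖powSum c X u‖ ^ 2 := by
      refine MeasureTheory.integral_mono_of_nonneg (Filter.Eventually.of_forall fun u => sq_nonneg _)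
        (hIc.const_mul _) ?_
      refine (MeasureTheory.ae_restrict_iff' measurableSet_Icc).2
        (Filter.Eventually.of_forall fun u hu => ?_)
      have h1 := hhoff u (abs_le.2 hu)
      have h2 := hhT u
      have h3 := hh0 u
      change h u ^ 2 ≤ _
      rw [sq]
      exact mul_le_mul h1 h2 h3 (h3.trans h1)
    refine this.trans ?_
    rw [MeasureTheory.integral_const_mul, Real.rpow_add hX0, Real.rpow_one]
    calc C * (K * X ^ c) * J ≤ C * (K * X ^ c) * (16 * E * K * X) := by gcongr
      _ = _ := by ring
  have hcorr := correlation_integral_le P v b (B := A ^ 2) (K := K) (M := (2 * X) ^ 2) hK0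
    (fun p hp => by
      rw [hP, Finset.mem_product] at hp
      have h1 := ha _ hp.1
      have h2 := ha _ hp.2
      rw [hb]
      simp only [norm_mul, RCLike.norm_conj, sq]
      exact mul_le_mul h1 h2 (norm_nonneg _) ((norm_nonneg _).trans h1))
    (fun x => ‖expSum D f a x‖ ^ 2) ((continuous_expSum D f a).norm.pow 2)
    (fun x => by positivity)
    (fun x => by
      rw [Complex.ofReal_pow, ← Complex.mul_conj', expSum_mul_conj, expSum, hP,
        Finset.sum_product]
      refine Finset.sum_congr rfl fun i _ => Finset.sum_congr rfl fun j _ => ?_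
      simp only [hb, hv, mul_sub])
    hm hmK h hhm hh0 hhM
  refine hcorr.trans ?_
  set z : ℕ × ℕ → ℝ := fun j => ‖∫ u in Set.Icc (-(2 * K)) (2 * K), (h u : ℂ) * ee (u * -v j)‖
    with hz
  have hz0 : ∀ j, 0 ≤ z j := fun j => norm_nonneg _
  set W : ℕ × ℕ → ℝ := fun j => ∑ i ∈ P, E * K * Real.exp (-Real.pi * (K * (v i + v j)) ^ 2) with hW
  have hWle : ∀ (j : ℕ × ℕ) (Q : ℝ), (pairCount c X (-v j) : ℝ) ≤ Q → W j ≤ E * K * (Q + 1) := by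
    intro j Q hQ
    have := sum_gaussHat_le P (fun i => v i + v j) (K := K) (R := Q) hK0 (by
      refine le_trans (le_of_eq ?_) hQ
      rw [pairCount]
      simp only [sub_neg_eq_add, hv, hf, hP, hD])
    refine this.trans ?_
    have h1 : (P.card : ℝ) * Real.exp (-Real.pi * K ^ 2) ≤ 1 :=
      (mul_le_mul_of_nonneg_right hPc (Real.exp_pos _).le).trans hexp
    gcongr
  set T := X ^ (c - 1 + 1 / 5) with hT
  have hnear : ∑ j ∈ P.filter (fun j => |v j| < T), W j * z j ≤
      672 * E ^ 2 * (K ^ 2 * X ^ (16 / 5 : ℝ)) := by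
    have h1 : ∀ j ∈ P.filter (fun j => |v j| < T), W j * z j ≤ 7 * E * K * X * (16 * E * K * X) := by
      intro j _
      refine mul_le_mul ?_ (hhint j) (hz0 j) (by positivity)
      refine (hWle j _ (pairCount_le_trivial hc1 hX _)).trans ?_
      calc E * K * (6 * X + 1) ≤ E * K * (6 * X + X) := by gcongr
        _ = _ := by ring
    refine (Finset.sum_le_card_nsmul _ _ _ h1).trans ?_
    rw [nsmul_eq_mul]
    have h2 := card_near_pairs_le hc1 hX
    calc _ ≤ 6 * X ^ (6 / 5 : ℝ) * (7 * E * K * X * (16 * E * K * X)) := by gcongr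
      _ = 672 * E ^ 2 * (K ^ 2 * (X ^ (6 / 5 : ℝ) * X ^ (2:ℕ))) := by ring
      _ = _ := by
        rw [← Real.rpow_natCast X 2, ← Real.rpow_add hX0]; norm_num
  have hfar : ∑ j ∈ P.filter (fun j => ¬ |v j| < T), W j * z j ≤
      2 * E * √(256 * C * E ^ 2) * (K * R * √(K ^ 3 * R * X ^ (3 + c))) := by
    set L := P.filter (fun j => ¬ |v j| < T) with hL
    have hLT : ∀ j ∈ L, T ≤ |v j| := fun j hj => not_lt.1 (Finset.mem_filter.1 hj).2
    have h1 : ∑ j ∈ L, W j * z j ≤ ∑ j ∈ L, 2 * E * K * R * z j := by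
      refine Finset.sum_le_sum fun j hj => mul_le_mul_of_nonneg_right ?_ (hz0 j)
      refine (hWle j R (hpair _ (by rw [abs_neg]; exact hLT j hj))).trans ?_
      calc E * K * (R + 1) ≤ E * K * (R + R) := by gcongr
        _ = _ := by ring
    have hLc : (L.card : ℝ) ≤ (2 * X) ^ 2 :=
      le_trans (by exact_mod_cast Finset.card_filter_le _ _) hPc
    have h2 := sum_norm_fourier_le L v (K := 2 * K) (R := R) (M := (2 * X) ^ 2) (by positivity)
      (fun i hi => by
        refine le_trans ?_ (hpair (v i) (hLT i hi))
        rw [pairCount]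
        refine Nat.cast_le.2 (Finset.card_le_card fun j hj => ?_)
        rw [Finset.mem_filter] at hj ⊢
        refine ⟨(Finset.mem_filter.1 hj.1).1, ?_⟩
        rw [abs_sub_comm]
        exact hj.2) h hhm hh0 hhM
    have h3 : (∑ j ∈ L, z j) ^ 2 ≤ 256 * C * E ^ 2 * (K ^ 3 * R * X ^ (3 + c)) := by
      refine h2.trans ?_
      have h4 : (L.card : ℝ) * Real.exp (-Real.pi * (2 * K) ^ 2) ≤ 1 :=
        (mul_le_mul_of_nonneg_right hLc (Real.exp_pos _).le).trans hexp2
      calc _ ≤ 16 * C * E * K ^ 2 * X ^ (1 + c) * (E * (2 * K) * (R + R) * (2 * X) ^ 2) := by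
            gcongr
            exact h4.trans hR
        _ = 256 * C * E ^ 2 * (K ^ 3 * R * (X ^ (1 + c) * X ^ (2:ℕ))) := by ring
        _ = _ := by
          rw [← Real.rpow_natCast X 2, ← Real.rpow_add hX0,
            show 1 + c + ((2 : ℕ) : ℝ) = 3 + c by push_cast; ring]
    have h5 : ∑ j ∈ L, z j ≤ √(256 * C * E ^ 2) * √(K ^ 3 * R * X ^ (3 + c)) := by
      rw [← Real.sqrt_mul (by positivity)]
      exact Real.le_sqrt_of_sq_le h3
    refine h1.trans ?_
    rw [← Finset.mul_sum]
    calc 2 * E * K * R * ∑ j ∈ L, z j ≤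
        2 * E * K * R * (√(256 * C * E ^ 2) * √(K ^ 3 * R * X ^ (3 + c))) := by gcongr
      _ = _ := by ring
  have hsplit : ∑ j ∈ P, W j * z j ≤ (672 * E ^ 2 + 2 * E * √(256 * C * E ^ 2)) *
      (K ^ 2 * X ^ (16 / 5 : ℝ) + K * R * √(K ^ 3 * R * X ^ (3 + c))) := by
    rw [← Finset.sum_filter_add_sum_filter_not P (fun j => |v j| < T)]
    refine (add_le_add hnear hfar).trans ?_
    have p1 : 0 ≤ K ^ 2 * X ^ (16 / 5 : ℝ) := by positivity
    have p2 : 0 ≤ K * R * √(K ^ 3 * R * X ^ (3 + c)) := by positivity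
    have p3 : 0 ≤ 2 * E * √(256 * C * E ^ 2) := by positivity
    have p4 : 0 ≤ 672 * E ^ 2 := by positivity
    nlinarith [mul_nonneg p3 p1, mul_nonneg p4 p2]
  refine (mul_le_mul_of_nonneg_left hsplit (by positivity)).trans (le_of_eq ?_)
  ring

set_option maxHeartbeats 1000000 in
/-- Fourth moment of a weighted exponential sum over `n ^ c` on a set of frequencies where it is
small. -/
lemma fourth_moment_minor {c : ℝ} (hc1 : 1 < c) (hc2 : c < 1193 / 889) : ∃ C : ℝ, 0 < C ∧
    ∃ X₀ : ℝ, ∀ X : ℝ, X₀ ≤ X → ∀ (a : ℕ → ℂ) (A H : ℝ) (m : Set ℝ),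
    (∀ n ∈ dyad X, ‖a n‖ ≤ A) → MeasurableSet m →
    m ⊆ Set.Icc (-(X ^ (1 / 1000 : ℝ))) (X ^ (1 / 1000 : ℝ)) →
    (∀ x ∈ m, ‖expSum (dyad X) (fun n : ℕ => (n : ℝ) ^ c) a x‖ ≤ H) →
    ∫ x in m, ‖expSum (dyad X) (fun n : ℕ => (n : ℝ) ^ c) a x‖ ^ 4 ≤
      C * (A ^ 2 * H ^ 2 * X ^ (2 - c) * Real.log X + A ^ 4 * X ^ (4 - c - 1 / 50)) := by
  have hc3 : c < 3 / 2 := by linarith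
  obtain ⟨C₁, hC₁, hoff⟩ := off_diagonal_correlation_le hc1 hc3
  obtain ⟨C₂, hC₂, hpair⟩ := pairCount_le hc1 hc3
  set Q := 3 * C₂ + 1 with hQ
  have hQ1 : 1 ≤ Q := by linarith
  set C₃ := C₁ * (1 + Q * √Q) with hC₃
  have hC₃0 : 0 < C₃ := by positivity
  have hev1 : ∀ᶠ X : ℝ in Filter.atTop, 8 ≤ X ^ (c - 1) :=
    (tendsto_rpow_atTop (by linarith)).eventually_ge_atTop 8
  have hev2 : ∀ᶠ X : ℝ in Filter.atTop,
      (2 * X) ^ 2 * Real.exp (-Real.pi * (X ^ (1 / 1000 : ℝ)) ^ 2) ≤ 1 := by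
    have h1 : Filter.Tendsto (fun t : ℝ => t ^ 2000 * Real.exp (-t)) Filter.atTop (nhds 0) :=
      Real.tendsto_pow_mul_exp_neg_atTop_nhds_zero 2000
    have h2 := (h1.comp (tendsto_rpow_atTop (show (0:ℝ) < 1 / 1000 by norm_num))).eventually_le_const
      (show (0:ℝ) < 1 / 4 by norm_num)
    filter_upwards [h2, Filter.eventually_ge_atTop 1] with X hX hX1
    have hX0 : 0 < X := by linarith
    have hK1 : 1 ≤ X ^ (1 / 1000 : ℝ) := Real.one_le_rpow hX1 (by norm_num)
    have h3 : (X ^ (1 / 1000 : ℝ)) ^ 2000 = X ^ 2 := by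
      rw [← Real.rpow_natCast, ← Real.rpow_mul hX0.le, ← Real.rpow_natCast X 2]; norm_num
    simp only [Function.comp_apply] at hX
    rw [h3] at hX
    have h4 : Real.exp (-Real.pi * (X ^ (1 / 1000 : ℝ)) ^ 2) ≤ Real.exp (-X ^ (1 / 1000 : ℝ)) := by
      refine Real.exp_le_exp.2 ?_
      have h5 := Real.pi_gt_three
      have h6 : X ^ (1 / 1000 : ℝ) ≤ (X ^ (1 / 1000 : ℝ)) ^ 2 := by nlinarith
      nlinarith [sq_nonneg (X ^ (1 / 1000 : ℝ))]
    calc _ ≤ (2 * X) ^ 2 * Real.exp (-X ^ (1 / 1000 : ℝ)) := by gcongr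
      _ = 4 * (X ^ 2 * Real.exp (-X ^ (1 / 1000 : ℝ))) := by ring
      _ ≤ 1 := by linarith
  obtain ⟨X₁, hX₁⟩ := Filter.eventually_atTop.1 (hev1.and hev2)
  refine ⟨32 + 2 * √C₃, by positivity, max X₁ 2, fun X hXX a A H m ha hm hmK hH => ?_⟩
  have hX2 : 2 ≤ X := (le_max_right _ _).trans hXX
  have hX1 : 1 ≤ X := by linarith
  have hX0 : 0 < X := by linarith
  obtain ⟨hX8, hXe⟩ := hX₁ X ((le_max_left _ _).trans hXX)
  set K := X ^ (1 / 1000 : ℝ) with hK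
  have hK1 : 1 ≤ K := Real.one_le_rpow hX1 (by norm_num)
  set ρ := 3 - 5 / 3 * c - 3 / 100 with hρ
  have hρ0 : 1 ≤ X ^ ρ := Real.one_le_rpow hX1 (by rw [hρ]; linarith)
  set R := Q * X ^ ρ with hR
  have hR1 : 1 ≤ R := by nlinarith
  have hRp : ∀ v : ℝ, X ^ (c - 1 + 1 / 5) ≤ |v| → (pairCount c X v : ℝ) ≤ R := by
    intro v hv
    refine (hpair X v hX1 hX8 hv).trans ?_
    have e1 : X ^ (2 - c) ≤ X ^ ρ := Real.rpow_le_rpow_of_exponent_le hX1 (by rw [hρ]; linarith)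
    have e2 : X ^ (c / 2) ≤ X ^ ρ := Real.rpow_le_rpow_of_exponent_le hX1 (by rw [hρ]; linarith)
    have e3 : X ^ (7 / 5 - c / 2) ≤ X ^ ρ :=
      Real.rpow_le_rpow_of_exponent_le hX1 (by rw [hρ]; linarith)
    calc _ ≤ C₂ * (X ^ ρ + X ^ ρ + X ^ ρ) := by gcongr
      _ = 3 * C₂ * X ^ ρ := by ring
      _ ≤ R := by rw [hR, hQ]; gcongr; linarith
  have hV := hoff X K R A a m hX1 hK1 hR1 hXe hRp ha hm hmK
  have hVle : C₁ * A ^ 4 * (K ^ 2 * X ^ (16 / 5 : ℝ) + K * R * √(K ^ 3 * R * X ^ (3 + c))) ≤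
      C₃ * A ^ 4 * X ^ (6 - 2 * c - 1 / 25) := by
    have e1 : K ^ 2 * X ^ (16 / 5 : ℝ) ≤ X ^ (6 - 2 * c - 1 / 25) := by
      rw [hK, ← Real.rpow_natCast, ← Real.rpow_mul hX0.le, ← Real.rpow_add hX0]
      exact Real.rpow_le_rpow_of_exponent_le hX1 (by push_cast; linarith)
    have e2 : √(K ^ 3 * R * X ^ (3 + c)) = √Q * X ^ ((3 / 1000 + ρ + 3 + c) / 2) := by
      have : K ^ 3 * R * X ^ (3 + c) = Q * X ^ (3 / 1000 + ρ + 3 + c) := by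
        rw [hK, hR, ← Real.rpow_natCast, ← Real.rpow_mul hX0.le,
          show 3 / 1000 + ρ + 3 + c = 1 / 1000 * ((3 : ℕ) : ℝ) + ρ + (3 + c) by push_cast; ring,
          Real.rpow_add hX0 _ (3 + c), Real.rpow_add hX0 _ ρ]
        ring
      rw [this, Real.sqrt_mul (by linarith), Real.sqrt_eq_rpow (X ^ _), ← Real.rpow_mul hX0.le]
      congr 2
      ring
    have e3 : K * R * √(K ^ 3 * R * X ^ (3 + c)) ≤ Q * √Q * X ^ (6 - 2 * c - 1 / 25) := by
      rw [e2, hK, hR]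
      calc _ = Q * √Q * (X ^ (1 / 1000 : ℝ) * X ^ ρ * X ^ ((3 / 1000 + ρ + 3 + c) / 2)) := by ring
        _ = Q * √Q * X ^ (1 / 1000 + ρ + (3 / 1000 + ρ + 3 + c) / 2) := by
          rw [Real.rpow_add hX0, Real.rpow_add hX0]
        _ ≤ _ := by
          refine mul_le_mul_of_nonneg_left
            (Real.rpow_le_rpow_of_exponent_le hX1 (by rw [hρ]; linarith)) (by positivity)
    calc _ ≤ C₁ * A ^ 4 * (X ^ (6 - 2 * c - 1 / 25) + Q * √Q * X ^ (6 - 2 * c - 1 / 25)) := by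
          gcongr
      _ = _ := by rw [hC₃]; ring
  have hmfin : MeasureTheory.volume m ≠ ⊤ :=
    ((MeasureTheory.measure_mono hmK).trans_lt isCompact_Icc.measure_lt_top).ne
  refine (fourth_moment_le (dyad X) (fun n : ℕ => (n : ℝ) ^ c) a ha hm hmfin hH
    (integral_powSum_near_le hc1 hc3 hX2) (hV.trans hVle)).trans ?_
  have hs : √(C₃ * A ^ 4 * X ^ (6 - 2 * c - 1 / 25)) = √C₃ * A ^ 2 * X ^ (3 - c - 1 / 50) := by
    rw [Real.sqrt_mul (by positivity), Real.sqrt_mul (by positivity),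
      show A ^ 4 = (A ^ 2) ^ 2 by ring, Real.sqrt_sq (by positivity),
      Real.sqrt_eq_rpow (X ^ _), ← Real.rpow_mul hX0.le]
    congr 2
    ring
  rw [hs]
  have hlog : 0 ≤ Real.log X := Real.log_nonneg hX1
  have hDc : ((dyad X).card : ℝ) ≤ 2 * X := card_dyad_le hX0.le
  have f1 : X * X ^ (1 - c) = X ^ (2 - c) := by
    rw [← Real.rpow_one_add' hX0.le (by linarith)]; ring_nf
  have f2 : X * X ^ (3 - c - 1 / 50) = X ^ (4 - c - 1 / 50) := by
    rw [← Real.rpow_one_add' hX0.le (by linarith)]; ring_nf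
  have g1 : 0 ≤ A ^ 2 * H ^ 2 * X ^ (2 - c) * Real.log X := by positivity
  have g2 : 0 ≤ A ^ 4 * X ^ (4 - c - 1 / 50) := by positivity
  have g3 := Real.sqrt_nonneg C₃
  calc _ ≤ 2 * A ^ 2 * (2 * X) * H ^ 2 * (8 * X ^ (1 - c) * Real.log X) +
        A ^ 2 * (2 * X) * (√C₃ * A ^ 2 * X ^ (3 - c - 1 / 50)) := by gcongr
    _ = 32 * (A ^ 2 * H ^ 2 * (X * X ^ (1 - c)) * Real.log X) +
        2 * √C₃ * (A ^ 4 * (X * X ^ (3 - c - 1 / 50))) := by ring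
    _ = 32 * (A ^ 2 * H ^ 2 * X ^ (2 - c) * Real.log X) +
        2 * √C₃ * (A ^ 4 * X ^ (4 - c - 1 / 50)) := by rw [f1, f2]
    _ ≤ _ := by nlinarith [mul_nonneg g3 g1, mul_nonneg g3 g2]

/-- The `n`-th term of the Euler–Maclaurin series for `ζ(s) - 1 / (s - 1)`. -/
noncomputable def zetaTerm (n : ℕ) (s : ℂ) : ℂ :=
  ((n + 1 : ℝ) : ℂ) ^ (-s) -
    (((n + 2 : ℝ) : ℂ) ^ (1 - s) - ((n + 1 : ℝ) : ℂ) ^ (1 - s)) / (1 - s)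

lemma norm_cpow_neg_sub_le {m u : ℝ} (hm : 0 < m) (hmu : m ≤ u) (hu : u ≤ m + 1) {s : ℂ}
    (hs : 0 < s.re) {τ : ℝ} (hτ0 : 0 ≤ τ) (hτ1 : τ ≤ 1) :
    ‖(m : ℂ) ^ (-s) - (u : ℂ) ^ (-s)‖ ≤ 2 * ‖s‖ ^ τ * m ^ (-s.re - τ) := by
  have hu0 : 0 < u := hm.trans_le hmu
  have hpos : 0 < m ^ (-s.re) := by positivity
  have h1 : ‖(m : ℂ) ^ (-s) - (u : ℂ) ^ (-s)‖ ≤ 2 * m ^ (-s.re) := by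
    refine (norm_sub_le _ _).trans ?_
    rw [Complex.norm_cpow_eq_rpow_re_of_pos hm, Complex.norm_cpow_eq_rpow_re_of_pos hu0,
      Complex.neg_re, two_mul]
    gcongr 1
    exact Real.rpow_le_rpow_of_nonpos hm hmu (by linarith)
  have h2 : ‖(m : ℂ) ^ (-s) - (u : ℂ) ^ (-s)‖ ≤ ‖s‖ / m * m ^ (-s.re) := by
    have hd : ∀ x ∈ Set.Icc m u, HasDerivWithinAt (fun x : ℝ => (x : ℂ) ^ (-s))
        (-s * (x : ℂ) ^ (-s - 1)) (Set.Icc m u) x := by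
      intro x hx
      have hx0 : 0 < x := hm.trans_le hx.1
      have hne : s ≠ 0 := fun h => by rw [h] at hs; simp at hs
      exact (hasDerivAt_ofReal_cpow_const hx0.ne' (neg_ne_zero.2 hne)).hasDerivWithinAt
    have hb : ∀ x ∈ Set.Icc m u, ‖-s * (x : ℂ) ^ (-s - 1)‖ ≤ ‖s‖ / m * m ^ (-s.re) := by
      intro x hx
      have hx0 : 0 < x := hm.trans_le hx.1
      rw [norm_mul, norm_neg, Complex.norm_cpow_eq_rpow_re_of_pos hx0, div_mul_eq_mul_div, mul_div_assoc]
      gcongr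
      rw [← Real.rpow_sub_one hm.ne']
      exact Real.rpow_le_rpow_of_nonpos hm hx.1 (by simp; linarith)
    have := (convex_Icc m u).norm_image_sub_le_of_norm_hasDerivWithin_le hd hb
      (Set.right_mem_Icc.2 hmu) (Set.left_mem_Icc.2 hmu)
    refine this.trans ?_
    rw [Real.norm_eq_abs, abs_sub_comm, abs_of_nonneg (by linarith)]
    exact mul_le_of_le_one_right (by positivity) (by linarith)
  set A := ‖(m : ℂ) ^ (-s) - (u : ℂ) ^ (-s)‖ / m ^ (-s.re) with hA
  have hA0 : 0 ≤ A := by positivity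
  have hA1 : A ≤ 2 := (div_le_iff₀ hpos).2 h1
  have hA2 : A ≤ ‖s‖ / m := (div_le_iff₀ hpos).2 h2
  have hAτ : A ≤ 2 * (‖s‖ / m) ^ τ := by
    have e1 : A = A ^ (1 - τ) * A ^ τ := by
      rw [← Real.rpow_add_of_nonneg hA0 (by linarith) hτ0, sub_add_cancel, Real.rpow_one]
    have e2 : A ^ (1 - τ) ≤ 2 := by
      calc A ^ (1 - τ) ≤ 2 ^ (1 - τ) := by gcongr
        _ ≤ 2 ^ (1:ℝ) := Real.rpow_le_rpow_of_exponent_le (by norm_num) (by linarith)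
        _ = 2 := Real.rpow_one _
    rw [e1]
    gcongr
  have : ‖(m : ℂ) ^ (-s) - (u : ℂ) ^ (-s)‖ = A * m ^ (-s.re) := by
    rw [hA]; field_simp
  rw [this]
  calc A * m ^ (-s.re) ≤ 2 * (‖s‖ / m) ^ τ * m ^ (-s.re) := by gcongr
    _ = _ := by
      rw [Real.div_rpow (norm_nonneg _) hm.le, Real.rpow_sub hm]; ring

lemma norm_zetaTerm_le (n : ℕ) {s : ℂ} (hs : 0 < s.re) (hs1 : s ≠ 1) {τ : ℝ} (hτ0 : 0 ≤ τ)
    (hτ1 : τ ≤ 1) : ‖zetaTerm n s‖ ≤ 2 * ‖s‖ ^ τ * (n + 1 : ℝ) ^ (-s.re - τ) := by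
  have hm : (0:ℝ) < n + 1 := by positivity
  have hne : 1 - s ≠ 0 := sub_ne_zero.2 (Ne.symm hs1)
  have h0 : (0:ℝ) ∉ Set.uIcc (n + 1 : ℝ) (n + 2) := by
    rw [Set.uIcc_of_le (by linarith)]
    exact fun h => absurd h.1 (not_le.2 hm)
  have hI : zetaTerm n s = ∫ u in (n + 1 : ℝ)..(n + 2),
      (((n + 1 : ℝ) : ℂ) ^ (-s) - (u : ℂ) ^ (-s)) := by
    rw [intervalIntegral.integral_sub (by simp)
      (intervalIntegral.intervalIntegrable_cpow (Or.inr h0)), integral_cpow (Or.inr ⟨?_, h0⟩),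
      intervalIntegral.integral_const, zetaTerm]
    · rw [neg_add_eq_sub]
      norm_num
    · intro h
      exact hs1 (neg_injective h)
  rw [hI]
  have := intervalIntegral.norm_integral_le_of_norm_le_const (a := (n + 1 : ℝ)) (b := n + 2)
    (C := 2 * ‖s‖ ^ τ * (n + 1 : ℝ) ^ (-s.re - τ))
    (f := fun u : ℝ => (((n + 1 : ℝ) : ℂ) ^ (-s) - (u : ℂ) ^ (-s))) (fun u hu => by
      rw [Set.uIoc_of_le (by linarith)] at hu
      exact norm_cpow_neg_sub_le hm hu.1.le (by linarith [hu.2]) hs hτ0 hτ1)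
  refine this.trans (le_of_eq ?_)
  rw [show ((n:ℝ) + 2 - (n + 1)) = 1 by ring, abs_one, mul_one]

lemma summable_nat_add_one_rpow {p : ℝ} (hp : p < -1) : Summable fun n : ℕ => (n + 1 : ℝ) ^ p := by
  have := (summable_nat_add_iff 1).2 (Real.summable_nat_rpow.2 hp)
  simpa using this

lemma hasSum_zetaTerm {s : ℂ} (hs : 1 < s.re) :
    HasSum (fun n => zetaTerm n s) (riemannZeta s - 1 / (s - 1)) := by
  have hs1 : s ≠ 1 := fun h => by rw [h] at hs; simp at hs
  have h1 : HasSum (fun n : ℕ => ((n + 1 : ℝ) : ℂ) ^ (-s)) (riemannZeta s) := by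
    have hsum : Summable fun n : ℕ => 1 / ((n : ℂ) + 1) ^ s := by
      have := (summable_nat_add_iff 1).2 (Complex.summable_one_div_nat_cpow.2 hs)
      simpa using this
    have := hsum.hasSum
    rw [← zeta_eq_tsum_one_div_nat_add_one_cpow hs] at this
    convert this using 2 with n
    rw [Complex.cpow_neg, one_div]
    push_cast
    rfl
  have h2 : HasSum (fun n : ℕ => (((n + 2 : ℝ) : ℂ) ^ (1 - s) - ((n + 1 : ℝ) : ℂ) ^ (1 - s)) /
      (1 - s)) (1 / (s - 1)) := by
    have hsum : Summable (fun n : ℕ => (((n + 2 : ℝ) : ℂ) ^ (1 - s) - ((n + 1 : ℝ) : ℂ) ^ (1 - s)) /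
        (1 - s)) := by
      have h3 : Summable (fun n : ℕ => zetaTerm n s) := by
        refine Summable.of_norm_bounded (g := fun n : ℕ => 2 * ‖s‖ ^ (0:ℝ) * (n + 1 : ℝ) ^ (-s.re - 0)) ?_
          (fun n => norm_zetaTerm_le n (by linarith) hs1 le_rfl zero_le_one)
        exact (summable_nat_add_one_rpow (by linarith)).mul_left _
      refine (h1.summable.sub h3).congr fun n => ?_
      rw [zetaTerm]; ring
    refine (hsum.hasSum_iff_tendsto_nat).2 ?_
    have h4 : ∀ N : ℕ, ∑ n ∈ Finset.range N, (((n + 2 : ℝ) : ℂ) ^ (1 - s) -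
        ((n + 1 : ℝ) : ℂ) ^ (1 - s)) / (1 - s) = (((N + 1 : ℝ) : ℂ) ^ (1 - s) - 1) / (1 - s) := by
      intro N
      rw [← Finset.sum_div]
      congr 1
      have := Finset.sum_range_sub (fun n : ℕ => ((n + 1 : ℝ) : ℂ) ^ (1 - s)) N
      simp only [Nat.cast_zero, zero_add, Complex.ofReal_one, Complex.one_cpow] at this
      rw [← this]
      refine Finset.sum_congr rfl fun n _ => ?_
      congr 3
      push_cast; ring
    simp only [h4]
    have h5 : Filter.Tendsto (fun N : ℕ => ((N + 1 : ℝ) : ℂ) ^ (1 - s)) Filter.atTop (nhds 0) := by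
      rw [tendsto_zero_iff_norm_tendsto_zero]
      have h6 : ∀ N : ℕ, ‖((N + 1 : ℝ) : ℂ) ^ (1 - s)‖ = (N + 1 : ℝ) ^ (-(s.re - 1)) := fun N => by
        rw [Complex.norm_cpow_eq_rpow_re_of_pos (by positivity)]
        congr 1
        simp
      simp only [h6]
      exact (tendsto_rpow_neg_atTop (by linarith)).comp
        (Filter.tendsto_atTop_add_const_right _ _ tendsto_natCast_atTop_atTop)
    have h7 := (h5.sub_const 1).div_const (1 - s)
    convert h7 using 2
    have : s - 1 ≠ 0 := sub_ne_zero.2 hs1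
    rw [show (1 - s) = -(s - 1) by ring]
    field_simp
    ring
  refine (h1.sub h2).congr_fun ?_ |> fun h => h
  intro n
  rw [zetaTerm]

lemma riemannZeta_eq_tsum_zetaTerm {s : ℂ} (hs : 0 < s.re) (ht : 0 < s.im) :
    riemannZeta s = 1 / (s - 1) + ∑' n, zetaTerm n s := by
  set U : Set ℂ := {z | 0 < z.re} ∩ {z | 0 < z.im} with hU
  have hUo : IsOpen U := (isOpen_lt continuous_const Complex.continuous_re).inter
    (isOpen_lt continuous_const Complex.continuous_im)
  have hUc : Convex ℝ U := (convex_halfSpace_re_gt 0).inter (convex_halfSpace_im_gt 0)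
  have hne : ∀ z : ℂ, 0 < z.im → z ≠ 1 := fun z hz h => by rw [h] at hz; simp at hz
  have hterm : ∀ n z, 0 < z.im → DifferentiableAt ℂ (zetaTerm n) z := by
    intro n z hz
    have h1 : ((n + 1 : ℝ) : ℂ) ≠ 0 := Complex.ofReal_ne_zero.2 (by positivity)
    have h2 : ((n + 2 : ℝ) : ℂ) ≠ 0 := Complex.ofReal_ne_zero.2 (by positivity)
    have h3 : (1 - z) ≠ 0 := sub_ne_zero.2 (hne z hz).symm
    unfold zetaTerm
    refine DifferentiableAt.sub ?_ (DifferentiableAt.div (DifferentiableAt.sub ?_ ?_) ?_ h3)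
    · exact DifferentiableAt.const_cpow (by fun_prop) (Or.inl h1)
    · exact DifferentiableAt.const_cpow (by fun_prop) (Or.inl h2)
    · exact DifferentiableAt.const_cpow (by fun_prop) (Or.inl h1)
    · fun_prop
  have hg : DifferentiableOn ℂ (fun z => 1 / (z - 1) + ∑' n, zetaTerm n z) U := by
    intro z hz
    refine (DifferentiableAt.add ?_ ?_).differentiableWithinAt
    · exact (differentiableAt_const _).div (by fun_prop) (sub_ne_zero.2 (hne z hz.2))
    · set V : Set ℂ := ({w | z.re / 2 < w.re} ∩ {w | 0 < w.im}) ∩ {w | ‖w‖ < ‖z‖ + 1} with hV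
      have hVo : IsOpen V := ((isOpen_lt continuous_const Complex.continuous_re).inter
        (isOpen_lt continuous_const Complex.continuous_im)).inter
        (isOpen_lt continuous_norm continuous_const)
      have hzr : 0 < z.re := hz.1
      have hzV : z ∈ V := ⟨⟨by simp only [Set.mem_ofPred_eq]; linarith, hz.2⟩,
        by simp only [Set.mem_ofPred_eq]; linarith⟩
      refine (Complex.differentiableOn_tsum_of_summable_norm (u := fun n : ℕ =>
        2 * (‖z‖ + 1) * (n + 1 : ℝ) ^ (-(z.re / 2) - 1))
        ((summable_nat_add_one_rpow (by linarith)).mul_left _)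
        (fun n w hw => (hterm n w hw.1.2).differentiableWithinAt) hVo ?_).differentiableAt
        (hVo.mem_nhds hzV)
      intro n w hw
      have hw1 : z.re / 2 < w.re := hw.1.1
      have hw2 : ‖w‖ < ‖z‖ + 1 := hw.2
      refine (norm_zetaTerm_le n (by linarith) (hne w hw.1.2) zero_le_one le_rfl).trans ?_
      rw [Real.rpow_one]
      have : (n + 1 : ℝ) ^ (-w.re - 1) ≤ (n + 1 : ℝ) ^ (-(z.re / 2) - 1) :=
        Real.rpow_le_rpow_of_exponent_le (by linarith [(Nat.cast_nonneg n : (0:ℝ) ≤ n)])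
          (by linarith)
      gcongr
  have hf : DifferentiableOn ℂ riemannZeta U := fun z hz =>
    (differentiableAt_riemannZeta (hne z hz.2)).differentiableWithinAt
  have hz0 : (2 + Complex.I) ∈ U := ⟨by simp, by simp⟩
  refine (hf.analyticOnNhd hUo).eqOn_of_preconnected_of_eventuallyEq (hg.analyticOnNhd hUo)
    hUc.isPreconnected hz0 ?_ ⟨hs, ht⟩
  have hnear : ∀ᶠ z : ℂ in nhds (2 + Complex.I), 1 < z.re :=
    (isOpen_lt continuous_const Complex.continuous_re).mem_nhds (by simp)
  filter_upwards [hnear] with z hz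
  rw [(hasSum_zetaTerm hz).tsum_eq]
  ring

/-- Subconvexity-free polynomial bound for `ζ` near the line `Re s = 1`. -/
lemma norm_riemannZeta_le {η : ℝ} (hη0 : 0 < η) (hη1 : η ≤ 1 / 2) : ∃ C : ℝ, 0 < C ∧
    ∀ s : ℂ, 1 - η ≤ s.re → s.re ≤ 3 → 1 ≤ |s.im| → ‖riemannZeta s‖ ≤ C * |s.im| ^ (2 * η) := by
  have hsum := summable_nat_add_one_rpow (p := -1 - η) (by linarith)
  set Z := ∑' n : ℕ, (n + 1 : ℝ) ^ (-1 - η) with hZ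
  have hZ0 : 0 ≤ Z := tsum_nonneg fun n => by positivity
  have hpos : ∀ s : ℂ, 1 - η ≤ s.re → s.re ≤ 3 → 1 ≤ s.im →
      ‖riemannZeta s‖ ≤ (1 + 8 * Z) * s.im ^ (2 * η) := by
    intro s h1 h2 h3
    have hs0 : 0 < s.re := by linarith
    have hne : s ≠ 1 := fun h => by rw [h] at h3; simp at h3; linarith
    have hn : ‖s‖ ≤ 4 * s.im := by
      refine (Complex.norm_le_abs_re_add_abs_im s).trans ?_
      rw [abs_of_pos hs0, abs_of_pos (by linarith)]
      linarith
    have hpow : ‖s‖ ^ (2 * η) ≤ 4 * s.im ^ (2 * η) := by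
      calc ‖s‖ ^ (2 * η) ≤ (4 * s.im) ^ (2 * η) := by gcongr
        _ = 4 ^ (2 * η) * s.im ^ (2 * η) := Real.mul_rpow (by norm_num) (by linarith)
        _ ≤ 4 ^ (1:ℝ) * s.im ^ (2 * η) := by gcongr <;> linarith
        _ = _ := by rw [Real.rpow_one]
    have hterm : ∀ n, ‖zetaTerm n s‖ ≤ 8 * s.im ^ (2 * η) * (n + 1 : ℝ) ^ (-1 - η) := by
      intro n
      refine (norm_zetaTerm_le n hs0 hne (τ := 2 * η) (by linarith) (by linarith)).trans ?_
      have : (n + 1 : ℝ) ^ (-s.re - 2 * η) ≤ (n + 1 : ℝ) ^ (-1 - η) :=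
        Real.rpow_le_rpow_of_exponent_le (by linarith [(Nat.cast_nonneg n : (0:ℝ) ≤ n)])
          (by linarith)
      calc 2 * ‖s‖ ^ (2 * η) * (n + 1 : ℝ) ^ (-s.re - 2 * η)
          ≤ 2 * (4 * s.im ^ (2 * η)) * (n + 1 : ℝ) ^ (-1 - η) := by gcongr
        _ = _ := by ring
    have ht := tsum_of_norm_bounded (hsum.hasSum.mul_left (8 * s.im ^ (2 * η))) hterm
    rw [riemannZeta_eq_tsum_zetaTerm hs0 (by linarith)]
    have hinv : ‖1 / (s - 1)‖ ≤ 1 := by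
      rw [norm_div, norm_one]
      refine div_le_one_of_le₀ ?_ (norm_nonneg _)
      have := Complex.abs_im_le_norm (s - 1)
      simp only [Complex.sub_im, Complex.one_im, sub_zero] at this
      exact h3.trans ((le_abs_self _).trans this)
    have h1t : 1 ≤ s.im ^ (2 * η) := Real.one_le_rpow h3 (by linarith)
    calc _ ≤ 1 + 8 * s.im ^ (2 * η) * Z := (norm_add_le _ _).trans (add_le_add hinv ht)
      _ ≤ _ := by nlinarith
  refine ⟨1 + 8 * Z, by positivity, fun s h1 h2 h3 => ?_⟩
  rcases le_total 0 s.im with h | h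
  · rw [abs_of_nonneg h] at h3 ⊢
    exact hpos s h1 h2 h3
  · rw [abs_of_nonpos h] at h3 ⊢
    have := hpos ((starRingEnd ℂ) s) (by simpa using h1) (by simpa using h2) (by simpa using h3)
    rw [riemannZeta_conj, RCLike.norm_conj, Complex.conj_im] at this
    exact this

lemma one_le_norm_riemannZeta_product {x : ℝ} (hx : 0 < x) (y : ℝ) :
    1 ≤ ‖riemannZeta (1 + x)‖ ^ 3 * ‖riemannZeta (1 + x + Complex.I * y)‖ ^ 4 *
      ‖riemannZeta (1 + x + 2 * Complex.I * y)‖ := by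
  have := DirichletCharacter.norm_LFunction_product_ge_one (N := 1) 1 hx y
  rw [DirichletCharacter.LFunctionTrivChar, DirichletCharacter.LFunction_modOne_eq,
    DirichletCharacter.LFunction_modOne_eq] at this
  simpa only [norm_mul, norm_pow] using this

lemma norm_riemannZeta_one_add_le : ∃ C : ℝ, 0 < C ∧ ∀ x : ℝ, 0 < x → x ≤ 2 →
    ‖riemannZeta (1 + x)‖ ≤ C / x := by
  have hcont : ContinuousOn (fun x : ℝ => riemannZeta₀ (1 + x)) (Set.Icc 0 2) := by
    have := differentiable_riemannZeta₀.continuous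
    fun_prop
  obtain ⟨B, hB⟩ := isCompact_Icc.exists_bound_of_continuousOn hcont
  have hB0 : 0 ≤ B := (norm_nonneg _).trans (hB 0 (by simp))
  refine ⟨1 + 2 * B, by positivity, fun x hx hx2 => ?_⟩
  have hne : (1 + x : ℂ) ≠ 1 := by simpa using hx.ne'
  rw [riemannZeta_eq_inv_sub_add hne]
  refine (norm_add_le _ _).trans ?_
  have h1 := hB x ⟨hx.le, hx2⟩
  rw [add_sub_cancel_left, norm_inv, Complex.norm_real, Real.norm_of_nonneg hx.le,
    add_div, one_div]
  gcongr
  rw [le_div_iff₀ hx]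
  nlinarith

lemma norm_deriv_riemannZeta_le {η : ℝ} (hη0 : 0 < η) (hη1 : η ≤ 1 / 2) : ∃ C : ℝ, 0 < C ∧
    ∀ s : ℂ, 1 - η / 2 ≤ s.re → s.re ≤ 5 / 2 → 2 ≤ |s.im| →
      ‖deriv riemannZeta s‖ ≤ C * |s.im| ^ (2 * η) := by
  obtain ⟨C, hC, h⟩ := norm_riemannZeta_le hη0 hη1
  refine ⟨C * 2 / (η / 2), by positivity, fun s h1 h2 h3 => ?_⟩
  have hball : ∀ z ∈ Metric.closedBall s (η / 2), 1 - η ≤ z.re ∧ z.re ≤ 3 ∧ 1 ≤ |z.im| ∧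
      |z.im| ≤ 2 * |s.im| := by
    intro z hz
    rw [Metric.mem_closedBall, dist_eq_norm] at hz
    have hr := (Complex.abs_re_le_norm (z - s)).trans hz
    have hi := (Complex.abs_im_le_norm (z - s)).trans hz
    rw [Complex.sub_re, abs_le] at hr
    rw [Complex.sub_im] at hi
    have h4 := abs_sub_abs_le_abs_sub s.im z.im
    have h5 := abs_sub_abs_le_abs_sub z.im s.im
    rw [abs_sub_comm] at h4
    refine ⟨by linarith, by linarith, by linarith, by linarith⟩
  have hdiff : DiffContOnCl ℂ riemannZeta (Metric.ball s (η / 2)) := by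
    refine DifferentiableOn.diffContOnCl fun z hz => ?_
    have hz' := hball z (Metric.closure_ball_subset_closedBall hz)
    refine (differentiableAt_riemannZeta fun h1 => ?_).differentiableWithinAt
    have h4 := hz'.2.2.1
    rw [h1] at h4
    norm_num at h4
  refine (Complex.norm_deriv_le_of_forall_mem_sphere_norm_le (by positivity) hdiff
    (C := C * 2 * |s.im| ^ (2 * η)) fun z hz => ?_).trans (le_of_eq (by ring))
  obtain ⟨z1, z2, z3, z4⟩ := hball z (Metric.sphere_subset_closedBall hz)
  refine (h z z1 z2 z3).trans ?_
  rw [mul_assoc]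
  gcongr
  calc |z.im| ^ (2 * η) ≤ (2 * |s.im|) ^ (2 * η) := by gcongr
    _ = 2 ^ (2 * η) * |s.im| ^ (2 * η) := Real.mul_rpow (by norm_num) (abs_nonneg _)
    _ ≤ 2 ^ (1:ℝ) * |s.im| ^ (2 * η) := by gcongr <;> linarith
    _ = _ := by rw [Real.rpow_one]

/-- Lower bound for `ζ` and upper bounds for `ζ` and `ζ'` slightly to the left of `Re s = 1`. -/
lemma riemannZeta_near_one_line {a : ℝ} (ha0 : 0 < a) (ha1 : a ≤ 1) : ∃ c C T : ℝ, 0 < c ∧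
    0 < C ∧ 2 ≤ T ∧ ∀ s : ℂ, T ≤ |s.im| → 1 - |s.im| ^ (-a) ≤ s.re → s.re ≤ 5 / 2 →
      c * |s.im| ^ (-a) ≤ ‖riemannZeta s‖ ∧ ‖riemannZeta s‖ ≤ C * |s.im| ^ a ∧
      ‖deriv riemannZeta s‖ ≤ C * |s.im| ^ a := by
  set η := a / 20 with hη
  obtain ⟨C₀, hC₀, hz0⟩ := norm_riemannZeta_one_add_le
  obtain ⟨C₁, hC₁, hz1⟩ := norm_riemannZeta_le (η := η) (by positivity) (by linarith)
  obtain ⟨C₂, hC₂, hz2⟩ := norm_deriv_riemannZeta_le (η := η) (by positivity) (by linarith)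
  set c₁ := (C₀ ^ 3 * (C₁ * 2))⁻¹ with hc₁
  have hc₁0 : 0 < c₁ := by positivity
  set c₂ := c₁ ^ (1 / 4 : ℝ) with hc₂
  have hc₂0 : 0 < c₂ := by positivity
  have hright : ∀ s : ℂ, 1 ≤ |s.im| → 1 + |s.im| ^ (-a) ≤ s.re → s.re ≤ 5 / 2 →
      c₂ * |s.im| ^ (-(31 / 40 * a)) ≤ ‖riemannZeta s‖ := by
    intro s ht h1 h2
    set t := |s.im| with htd
    have ht0 : 0 < t := by linarith
    set x := s.re - 1 with hx
    have hx0 : t ^ (-a) ≤ x := by linarith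
    have hta : 0 < t ^ (-a) := by positivity
    have hxp : 0 < x := by linarith
    have hprod := one_le_norm_riemannZeta_product hxp s.im
    have e1 : (1 + (x : ℂ) + Complex.I * s.im) = s := by
      apply Complex.ext <;> simp [hx]
    rw [e1] at hprod
    have b0 := hz0 x hxp (by linarith)
    have b2 := hz1 (1 + x + 2 * Complex.I * s.im) (by simp; linarith) (by simp; linarith)
      (by simp [abs_mul]; linarith)
    have e2 : |(1 + (x : ℂ) + 2 * Complex.I * s.im).im| = 2 * t := by simp [abs_mul, htd]
    rw [e2] at b2
    have b3 : (2 * t) ^ (2 * η) ≤ 2 * t ^ (2 * η) := by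
      calc (2 * t) ^ (2 * η) = 2 ^ (2 * η) * t ^ (2 * η) := Real.mul_rpow (by norm_num) ht0.le
        _ ≤ 2 ^ (1:ℝ) * t ^ (2 * η) := by gcongr <;> linarith
        _ = _ := by rw [Real.rpow_one]
    have b4 : C₀ / x ≤ C₀ * t ^ a := by
      rw [div_eq_mul_inv]
      gcongr
      calc x⁻¹ ≤ (t ^ (-a))⁻¹ := inv_anti₀ hta hx0
        _ = t ^ a := by rw [Real.rpow_neg ht0.le, inv_inv]
    have b5 : 1 ≤ (C₀ * t ^ a) ^ 3 * ‖riemannZeta s‖ ^ 4 * (C₁ * (2 * t ^ (2 * η))) := by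
      refine hprod.trans ?_
      gcongr
      · exact b0.trans b4
      · exact b2.trans (by gcongr)
    have b6 : c₁ * t ^ (-(31 / 10 * a)) ≤ ‖riemannZeta s‖ ^ 4 := by
      have e3 : t ^ (31 / 10 * a) = (t ^ a) ^ 3 * t ^ (2 * η) := by
        rw [← Real.rpow_natCast, ← Real.rpow_mul ht0.le, ← Real.rpow_add ht0]
        congr 1
        rw [hη]; push_cast; ring
      rw [Real.rpow_neg ht0.le, hc₁, ← mul_inv, inv_le_iff_one_le_mul₀ (by positivity), e3]
      refine b5.trans (le_of_eq ?_)
      ring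
    have b7 : (c₁ * t ^ (-(31 / 10 * a))) ^ (1 / 4 : ℝ) ≤ (‖riemannZeta s‖ ^ 4) ^ (1 / 4 : ℝ) := by
      gcongr
    rw [Real.mul_rpow hc₁0.le (by positivity), ← Real.rpow_mul ht0.le, ← Real.rpow_natCast,
      ← Real.rpow_mul (norm_nonneg _)] at b7
    norm_num at b7
    convert b7 using 3
    ring
  have hev : ∀ᶠ t : ℝ in Filter.atTop, 2 ≤ t ∧ t ^ (-a) ≤ η / 2 ∧
      4 * C₂ / c₂ ≤ t ^ (1 / 8 * a) := by
    have h1 := (tendsto_rpow_neg_atTop ha0).eventually_le_const (show 0 < η / 2 by positivity)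
    have h2 := (tendsto_rpow_atTop (show 0 < 1 / 8 * a by positivity)).eventually_ge_atTop
      (4 * C₂ / c₂)
    filter_upwards [h1, h2, Filter.eventually_ge_atTop 2] with t a1 a2 a3
    exact ⟨a3, a1, a2⟩
  obtain ⟨T, hT⟩ := Filter.eventually_atTop.1 hev
  refine ⟨c₂ / 2, C₁ + C₂, max T 2, by positivity, by positivity, le_max_right _ _,
    fun s hst h1 h2 => ?_⟩
  set t := |s.im| with htd
  obtain ⟨ht2, hta, htC⟩ := hT t ((le_max_left _ _).trans hst)
  have ht0 : 0 < t := by linarith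
  have ht1 : 1 ≤ t := by linarith
  have hpow : t ^ (2 * η) ≤ t ^ a := Real.rpow_le_rpow_of_exponent_le ht1 (by linarith)
  have hta0 : 0 < t ^ (-a) := by positivity
  refine ⟨?_, ?_, ?_⟩
  · have hle : t ^ (-a) ≤ t ^ (-(31 / 40 * a)) := Real.rpow_le_rpow_of_exponent_le ht1 (by linarith)
    rcases le_total (1 + t ^ (-a)) s.re with h3 | h3
    · refine le_trans ?_ (hright s ht1 h3 h2)
      have : 0 < t ^ (-(31 / 40 * a)) := by positivity
      nlinarith
    · set s₀ : ℂ := ⟨1 + t ^ (-a), s.im⟩ with hs₀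
      have hs₀l := hright s₀ ht1 le_rfl (by simp only [hs₀]; linarith)
      set S : Set ℂ := {z | 1 - η / 2 ≤ z.re} ∩ ({z | z.re ≤ 5 / 2} ∩ {z | z.im = s.im}) with hS
      have hSc : Convex ℝ S := by
        refine (convex_halfSpace_re_ge _).inter ((convex_halfSpace_re_le _).inter ?_)
        intro x hx y hy a b _ _ hab
        simp only [Set.mem_ofPred_eq] at hx hy ⊢
        simp only [Complex.add_im, Complex.smul_im, smul_eq_mul, hx, hy]
        rw [← add_mul, hab, one_mul]
      have hsS : s ∈ S := ⟨by simp only [Set.mem_ofPred_eq]; linarith, h2, rfl⟩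
      have hs₀S : s₀ ∈ S := ⟨by simp only [Set.mem_ofPred_eq, hs₀]; linarith,
        by simp only [Set.mem_ofPred_eq, hs₀]; linarith, rfl⟩
      have hmv := hSc.norm_image_sub_le_of_norm_deriv_le (f := riemannZeta) (C := C₂ * t ^ (2 * η))
        (fun z hz => differentiableAt_riemannZeta fun h => by
          have h4 : z.im = s.im := hz.2.2
          rw [h] at h4
          rw [htd, ← h4] at ht0
          simp at ht0)
        (fun z hz => by
          have h4 : z.im = s.im := hz.2.2
          have := hz2 z hz.1 hz.2.1 (by rw [h4]; exact ht2)
          rwa [h4] at this) hsS hs₀S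
      have hd : ‖s₀ - s‖ ≤ 2 * t ^ (-a) := by
        have : s₀ - s = ((1 + t ^ (-a) - s.re : ℝ) : ℂ) := by
          apply Complex.ext <;> simp [hs₀]
        rw [this, Complex.norm_real, Real.norm_of_nonneg (by linarith)]
        linarith
      have h5 : ‖riemannZeta s₀‖ - ‖riemannZeta s‖ ≤ C₂ * t ^ (2 * η) * (2 * t ^ (-a)) :=
        (norm_sub_norm_le _ _).trans (hmv.trans (by gcongr))
      have h6 : C₂ * t ^ (2 * η) * (2 * t ^ (-a)) ≤ c₂ / 2 * t ^ (-(31 / 40 * a)) := by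
        have e1 : t ^ (2 * η) * t ^ (-a) = t ^ (-(9 / 10 * a)) := by
          rw [← Real.rpow_add ht0]; congr 1; rw [hη]; ring
        have e2 : t ^ (-(31 / 40 * a)) = t ^ (-(9 / 10 * a)) * t ^ (1 / 8 * a) := by
          rw [← Real.rpow_add ht0]; congr 1; ring
        rw [e2]
        calc _ = 2 * C₂ * (t ^ (2 * η) * t ^ (-a)) := by ring
          _ = c₂ / 2 * (t ^ (-(9 / 10 * a)) * (4 * C₂ / c₂)) := by rw [e1]; field_simp; ring
          _ ≤ _ := by gcongr
      have h7 : c₂ * t ^ (-(31 / 40 * a)) ≤ ‖riemannZeta s₀‖ := hs₀l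
      have h8 : c₂ / 2 * t ^ (-a) ≤ c₂ / 2 * t ^ (-(31 / 40 * a)) := by gcongr
      linarith
  · refine (hz1 s (by linarith) (by linarith) ht1).trans ?_
    calc C₁ * t ^ (2 * η) ≤ C₁ * t ^ a := by gcongr
      _ ≤ _ := by gcongr; linarith
  · refine (hz2 s (by linarith) h2 ht2).trans ?_
    calc C₂ * t ^ (2 * η) ≤ C₂ * t ^ a := by gcongr
      _ ≤ _ := by gcongr; linarith

/-- The analytic continuation of `-ζ'/ζ - ζ`, regular on `1 ≤ Re s`. -/
noncomputable def mangoldtKernel (s : ℂ) : ℂ :=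
  -(deriv riemannZeta₁ s / riemannZeta₁ s) - riemannZeta₀ s

lemma riemannZeta₁_eq {s : ℂ} (hs : s ≠ 1) : riemannZeta₁ s = (s - 1) * riemannZeta s := by
  rw [riemannZeta_eq_inv_sub_mul hs, mul_inv_cancel_left₀ (sub_ne_zero.2 hs)]

lemma riemannZeta₁_ne_zero {s : ℂ} (hs : 1 ≤ s.re) : riemannZeta₁ s ≠ 0 := by
  rcases eq_or_ne s 1 with rfl | h
  · simp
  · rw [riemannZeta₁_eq h]
    exact mul_ne_zero (sub_ne_zero.2 h) (riemannZeta_ne_zero_of_one_le_re hs)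

lemma mangoldtKernel_eq {s : ℂ} (hs : s ≠ 1) (hz : riemannZeta s ≠ 0) :
    mangoldtKernel s = -(deriv riemannZeta s / riemannZeta s) - riemannZeta s := by
  have h1 : s - 1 ≠ 0 := sub_ne_zero.2 hs
  have h2 := deriv_riemannZeta_eq_neg_inv_sub_sq_mul_add hs
  have h3 := riemannZeta_eq_inv_sub_add hs
  have h4 : deriv riemannZeta₁ s = (s - 1) * deriv riemannZeta s + riemannZeta s := by
    rw [h2, riemannZeta₁_eq hs]
    field_simp
    ring
  have h5 : riemannZeta₀ s = riemannZeta s - (s - 1)⁻¹ := by rw [h3]; ring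
  rw [mangoldtKernel, h4, riemannZeta₁_eq hs, h5]
  field_simp
  ring

lemma differentiableAt_mangoldtKernel {s : ℂ} (hs : riemannZeta₁ s ≠ 0) :
    DifferentiableAt ℂ mangoldtKernel s := by
  unfold mangoldtKernel
  have h1 : DifferentiableAt ℂ (deriv riemannZeta₁) s :=
    (differentiable_riemannZeta₁.analyticAt s).deriv.differentiableAt
  exact ((h1.div (differentiable_riemannZeta₁ s) hs).neg).sub (differentiable_riemannZeta₀ s)

lemma isOpen_riemannZeta₁_ne_zero : IsOpen {s | riemannZeta₁ s ≠ 0} :=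
  isOpen_ne_fun differentiable_riemannZeta₁.continuous continuous_const

lemma continuousOn_iteratedDeriv_mangoldtKernel (k : ℕ) :
    ContinuousOn (iteratedDeriv k mangoldtKernel) {s | riemannZeta₁ s ≠ 0} := by
  have h : AnalyticOnNhd ℂ mangoldtKernel {s | riemannZeta₁ s ≠ 0} :=
    DifferentiableOn.analyticOnNhd
      (fun s hs => (differentiableAt_mangoldtKernel hs).differentiableWithinAt)
      isOpen_riemannZeta₁_ne_zero
  rw [iteratedDeriv_eq_iterate]
  exact (h.iterated_deriv k).continuousOn

lemma norm_iteratedDeriv_mangoldtKernel_le (k : ℕ) : ∃ C : ℝ, 0 < C ∧ ∀ s : ℂ, 1 ≤ s.re →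
    s.re ≤ 2 → ‖iteratedDeriv k mangoldtKernel s‖ ≤ C * (1 + |s.im|) ^ (1 / 2 : ℝ) := by
  set a : ℝ := 1 / (2 * k + 4) with ha
  have hk0 : (0:ℝ) ≤ k := Nat.cast_nonneg k
  have ha0 : 0 < a := by positivity
  have ha1 : a ≤ 1 / 4 := by
    rw [ha]; exact one_div_le_one_div_of_le (by norm_num) (by linarith)
  obtain ⟨c, C, T, hc, hC, hT, hz⟩ := riemannZeta_near_one_line ha0 (by linarith)
  have hcompact : IsCompact (Set.Icc (1:ℝ) 2 ×ℂ Set.Icc (-(2 * T)) (2 * T)) :=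
    isCompact_Icc.reProdIm isCompact_Icc
  obtain ⟨B, hB⟩ := hcompact.exists_bound_of_continuousOn
    ((continuousOn_iteratedDeriv_mangoldtKernel k).mono fun s hs =>
      riemannZeta₁_ne_zero (Complex.mem_reProdIm.1 hs).1.1)
  set M := 4 * (C / c + C) with hM
  have hM0 : 0 < M := by positivity
  refine ⟨|B| + k.factorial * M * 4 ^ k, by positivity, fun s hs1 hs2 => ?_⟩
  have hone : 1 ≤ (1 + |s.im|) ^ (1 / 2 : ℝ) :=
    Real.one_le_rpow (by linarith [abs_nonneg s.im]) (by norm_num)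
  have hfac : 0 ≤ k.factorial * M * 4 ^ k := by positivity
  rcases le_total |s.im| (2 * T) with ht | ht
  · have := hB s (Complex.mem_reProdIm.2 ⟨⟨hs1, hs2⟩, abs_le.1 ht⟩)
    refine this.trans ((le_abs_self B).trans ?_)
    nlinarith [abs_nonneg B]
  · set t := |s.im| with htd
    have ht4 : 4 ≤ t := by linarith
    have ht0 : 0 < t := by linarith
    set r := t ^ (-a) / 4 with hr
    have hta0 : 0 < t ^ (-a) := by positivity
    have hta1 : t ^ (-a) ≤ 1 := Real.rpow_le_one_of_one_le_of_nonpos (by linarith) (by linarith)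
    have hr0 : 0 < r := by positivity
    have hball : ∀ z ∈ Metric.closedBall s r, z ≠ 1 ∧ c * |z.im| ^ (-a) ≤ ‖riemannZeta z‖ ∧
        ‖riemannZeta z‖ ≤ C * |z.im| ^ a ∧ ‖deriv riemannZeta z‖ ≤ C * |z.im| ^ a ∧
        0 < |z.im| ∧ |z.im| ≤ 2 * t := by
      intro z hz'
      rw [Metric.mem_closedBall, dist_eq_norm] at hz'
      have hre := (Complex.abs_re_le_norm (z - s)).trans hz'
      have him := (Complex.abs_im_le_norm (z - s)).trans hz'
      rw [Complex.sub_re, abs_le] at hre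
      rw [Complex.sub_im] at him
      have h4 := abs_sub_abs_le_abs_sub s.im z.im
      have h5 := abs_sub_abs_le_abs_sub z.im s.im
      rw [abs_sub_comm] at h4
      have h6 : |z.im| ≤ 2 * t := by linarith
      have h7 : T ≤ |z.im| := by linarith
      have h8 : 0 < |z.im| := by linarith
      have h9 : t ^ (-a) / 2 ≤ |z.im| ^ (-a) := by
        calc t ^ (-a) / 2 = 2 ^ (-1:ℝ) * t ^ (-a) := by rw [Real.rpow_neg_one]; ring
          _ ≤ 2 ^ (-a) * t ^ (-a) := by gcongr <;> linarith
          _ = (2 * t) ^ (-a) := (Real.mul_rpow (by norm_num) ht0.le).symm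
          _ ≤ |z.im| ^ (-a) := Real.rpow_le_rpow_of_nonpos h8 h6 (by linarith)
      obtain ⟨z1, z2, z3⟩ := hz z h7 (by linarith) (by linarith)
      refine ⟨fun h => ?_, z1, z2, z3, h8, h6⟩
      rw [h] at h8
      simp at h8
    have hne : ∀ z ∈ Metric.closedBall s r, riemannZeta z ≠ 0 := fun z hz' => by
      obtain ⟨-, z1, -, -, z4, -⟩ := hball z hz'
      exact norm_pos_iff.1 (lt_of_lt_of_le (by positivity) z1)
    have hdiff : DiffContOnCl ℂ mangoldtKernel (Metric.ball s r) := by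
      refine DifferentiableOn.diffContOnCl fun z hz' => ?_
      have hz'' := Metric.closure_ball_subset_closedBall hz'
      refine (differentiableAt_mangoldtKernel ?_).differentiableWithinAt
      rw [riemannZeta₁_eq (hball z hz'').1]
      exact mul_ne_zero (sub_ne_zero.2 (hball z hz'').1) (hne z hz'')
    have hbound : ∀ z ∈ Metric.sphere s r, ‖mangoldtKernel z‖ ≤ M * t ^ (2 * a) := by
      intro z hz'
      have hz'' := Metric.sphere_subset_closedBall hz'
      obtain ⟨z0, z1, z2, z3, z4, z5⟩ := hball z hz''
      rw [mangoldtKernel_eq z0 (hne z hz'')]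
      have e1 : ‖deriv riemannZeta z / riemannZeta z‖ ≤ C / c * |z.im| ^ (2 * a) := by
        rw [norm_div]
        calc _ ≤ C * |z.im| ^ a / (c * |z.im| ^ (-a)) := by gcongr
          _ = C / c * |z.im| ^ (2 * a) := by
            rw [Real.rpow_neg z4.le, two_mul a, Real.rpow_add z4]; field_simp
      have e2 : |z.im| ^ a ≤ (2 * t) ^ (2 * a) := by
        calc |z.im| ^ a ≤ (2 * t) ^ a := by gcongr
          _ ≤ _ := Real.rpow_le_rpow_of_exponent_le (by linarith) (by linarith)
      have e3 : |z.im| ^ (2 * a) ≤ (2 * t) ^ (2 * a) := by gcongr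
      have e4 : (2 * t) ^ (2 * a) ≤ 4 * t ^ (2 * a) := by
        rw [Real.mul_rpow (by norm_num) ht0.le]
        gcongr
        calc (2:ℝ) ^ (2 * a) ≤ 2 ^ (2:ℝ) := by gcongr <;> linarith
          _ = 4 := by norm_num
      calc _ ≤ C / c * |z.im| ^ (2 * a) + C * |z.im| ^ a := by
            refine (norm_sub_le _ _).trans ?_
            rw [norm_neg]
            exact add_le_add e1 z2
        _ ≤ C / c * (4 * t ^ (2 * a)) + C * (4 * t ^ (2 * a)) := by
            gcongr
            · exact e3.trans e4
            · exact e2.trans e4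
        _ = _ := by rw [hM]; ring
    refine (Complex.norm_iteratedDeriv_le_of_forall_mem_sphere_norm_le k hr0 hdiff hbound).trans ?_
    have hpow : t ^ (2 * a) / r ^ k = 4 ^ k * t ^ (1 / 2 : ℝ) := by
      rw [hr, div_pow, ← Real.rpow_natCast (t ^ (-a)), ← Real.rpow_mul ht0.le,
        show (1 / 2 : ℝ) = 2 * a + a * k by rw [ha]; field_simp; ring, Real.rpow_add ht0,
        neg_mul, Real.rpow_neg ht0.le]
      field_simp
    calc k.factorial * (M * t ^ (2 * a)) / r ^ k = k.factorial * M * (t ^ (2 * a) / r ^ k) := by ring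
      _ = k.factorial * M * 4 ^ k * t ^ (1 / 2 : ℝ) := by rw [hpow]; ring
      _ ≤ (|B| + k.factorial * M * 4 ^ k) * (1 + t) ^ (1 / 2 : ℝ) := by
        gcongr
        · linarith [abs_nonneg B]
        · linarith

lemma logMul_iterate (f : ℕ → ℂ) (k n : ℕ) :
    LSeries.logMul^[k] f n = Complex.log n ^ k * f n := by
  induction k with
  | zero => simp
  | succ k ih => rw [Function.iterate_succ_apply', LSeries.logMul, ih, pow_succ]; ring

lemma LSeriesHasSum_vonMangoldt_sub_one {s : ℂ} (hs : 1 < s.re) :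
    LSeriesHasSum (fun n => (ArithmeticFunction.vonMangoldt n : ℂ) - 1) s (mangoldtKernel s) := by
  have hs1 : s ≠ 1 := fun h => by rw [h] at hs; simp at hs
  have h1 := (ArithmeticFunction.LSeriesSummable_vonMangoldt hs).LSeriesHasSum
  rw [ArithmeticFunction.LSeries_vonMangoldt_eq_deriv_riemannZeta_div hs] at h1
  have h2 := h1.sub (LSeriesHasSum_one hs)
  rw [mangoldtKernel_eq hs1 (riemannZeta_ne_zero_of_one_le_re hs.le), ← neg_div]
  exact h2

lemma hasSum_log_pow_mul_vonMangoldt_sub_one (k : ℕ) {s : ℂ} (hs : 1 < s.re) :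
    HasSum (fun n : ℕ => ((ArithmeticFunction.vonMangoldt n : ℂ) - 1) * (Real.log n : ℂ) ^ k *
      (n : ℂ) ^ (-s)) ((-1) ^ k * iteratedDeriv k mangoldtKernel s) := by
  set f : ℕ → ℂ := fun n => (ArithmeticFunction.vonMangoldt n : ℂ) - 1 with hf
  have hab : LSeries.abscissaOfAbsConv f < s.re := by
    refine lt_of_le_of_lt (LSeries.abscissaOfAbsConv_le_of_forall_lt_LSeriesSummable'
      (x := 1) fun y hy => ?_) (by exact_mod_cast hs)
    exact (LSeriesHasSum_vonMangoldt_sub_one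
      (by simpa using (show (1 : ℝ) < y by exact_mod_cast hy))).LSeriesSummable
  have h1 : iteratedDeriv k mangoldtKernel s = iteratedDeriv k (LSeries f) s := by
    refine Filter.EventuallyEq.iteratedDeriv_eq k ?_
    have hnear : ∀ᶠ z : ℂ in nhds s, 1 < z.re :=
      (isOpen_lt continuous_const Complex.continuous_re).mem_nhds hs
    filter_upwards [hnear] with z hz
    exact (LSeriesHasSum_vonMangoldt_sub_one hz).LSeries_eq.symm
  rw [h1, LSeries_iteratedDeriv k hab, ← mul_assoc, ← mul_pow]
  simp only [mul_neg, mul_one, neg_neg, one_pow, one_mul]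
  have h2 : LSeriesSummable (LSeries.logMul^[k] f) s :=
    LSeriesSummable_of_abscissaOfAbsConv_lt_re (by rwa [LSeries.absicssaOfAbsConv_logPowMul])
  have h3 := h2.LSeriesHasSum
  rw [LSeriesHasSum] at h3
  refine h3.congr_fun ?_ |> fun h => h
  intro n
  rcases eq_or_ne n 0 with rfl | hn
  · have : s ≠ 0 := fun h => by rw [h] at hs; simp at hs; linarith
    simp [LSeries.term_zero, Complex.zero_cpow (neg_ne_zero.2 this)]
  · rw [LSeries.term_of_ne_zero hn, logMul_iterate, Complex.cpow_neg, div_eq_mul_inv,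
      ← Complex.natCast_log]
    ring

open FourierTransform in
lemma continuous_fourier_of_integrable {f : ℝ → ℂ} (hf : MeasureTheory.Integrable f) :
    Continuous (𝓕 f) :=
  VectorFourier.fourierIntegral_continuous Real.continuous_fourierChar
    (by simpa using (by fun_prop : Continuous fun p : ℝ × ℝ => p.2 * p.1)) hf

open FourierTransform in
lemma norm_fourier_le_integral_norm (f : ℝ → ℂ) (ξ : ℝ) : ‖𝓕 f ξ‖ ≤ ∫ v, ‖f v‖ :=
  VectorFourier.norm_fourierIntegral_le_integral_norm _ _ _ _ _

lemma integrable_of_support_Icc {f : ℝ → ℂ} (hf : Continuous f) {a b : ℝ}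
    (h0 : ∀ v, v ∉ Set.Icc a b → f v = 0) : MeasureTheory.Integrable f :=
  hf.integrable_of_hasCompactSupport (HasCompactSupport.intro isCompact_Icc h0)

lemma integral_norm_le_of_support_Icc {f : ℝ → ℂ} {a b M : ℝ} (hab : a ≤ b)
    (h0 : ∀ v, v ∉ Set.Icc a b → f v = 0) (hM : ∀ v, ‖f v‖ ≤ M) :
    ∫ v, ‖f v‖ ≤ M * (b - a) := by
  rw [← MeasureTheory.setIntegral_eq_integral_of_forall_compl_eq_zero (s := Set.Icc a b)
    (fun v hv => by rw [h0 v hv, norm_zero])]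
  have h1 := MeasureTheory.norm_setIntegral_le_of_norm_le_const (μ := MeasureTheory.volume)
    (s := Set.Icc a b) (f := fun v => ‖f v‖) (C := M) (by simp) (fun v _ => by simpa using hM v)
  refine (le_abs_self _).trans (h1.trans (le_of_eq ?_))
  rw [MeasureTheory.measureReal_def, Real.volume_Icc, ENNReal.toReal_ofReal (by linarith)]

open FourierTransform in
/-- Quadratic decay of the Fourier transform of a `C²` function supported in `[0, 1]`. -/
lemma norm_fourier_le_of_hasDerivAt {H H1 H2 : ℝ → ℂ} {M : ℝ}
    (h1 : ∀ v, HasDerivAt H (H1 v) v) (h2 : ∀ v, HasDerivAt H1 (H2 v) v) (hc : Continuous H2)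
    (hs : ∀ v, v ∉ Set.Icc (0:ℝ) 1 → H v = 0 ∧ H1 v = 0 ∧ H2 v = 0)
    (hM : ∀ v, ‖H v‖ ≤ M) (hM2 : ∀ v, ‖H2 v‖ ≤ M) (ξ : ℝ) :
    ‖𝓕 H ξ‖ ≤ 4 * M * (1 + |ξ|) ^ (-2 : ℝ) := by
  have hd1 : Differentiable ℝ H := fun v => (h1 v).differentiableAt
  have hd2 : Differentiable ℝ H1 := fun v => (h2 v).differentiableAt
  have e1 : deriv H = H1 := funext fun v => (h1 v).deriv
  have e2 : deriv H1 = H2 := funext fun v => (h2 v).deriv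
  have i0 : MeasureTheory.Integrable H :=
    integrable_of_support_Icc hd1.continuous (fun v hv => (hs v hv).1)
  have i1 : MeasureTheory.Integrable H1 :=
    integrable_of_support_Icc hd2.continuous (fun v hv => (hs v hv).2.1)
  have i2 : MeasureTheory.Integrable H2 :=
    integrable_of_support_Icc hc (fun v hv => (hs v hv).2.2)
  have f1 := congrFun (Real.fourier_deriv i0 hd1 (by rwa [e1])) ξ
  have f2 := congrFun (Real.fourier_deriv i1 hd2 (by rwa [e2])) ξ
  rw [e1] at f1
  rw [e2] at f2
  have b0 : ‖𝓕 H ξ‖ ≤ M := (norm_fourier_le_integral_norm H ξ).trans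
    (by simpa using integral_norm_le_of_support_Icc zero_le_one (fun v hv => (hs v hv).1) hM)
  have b2 : ‖𝓕 H2 ξ‖ ≤ M := (norm_fourier_le_integral_norm H2 ξ).trans
    (by simpa using integral_norm_le_of_support_Icc zero_le_one (fun v hv => (hs v hv).2.2) hM2)
  rw [f2, f1] at b2
  simp only [smul_eq_mul, norm_mul, Complex.norm_I, Complex.norm_real, Real.norm_eq_abs,
    Complex.norm_ofNat, mul_one, abs_of_pos Real.pi_pos] at b2
  have hpos : 0 < 1 + |ξ| := by positivity
  rw [Real.rpow_neg hpos.le, Real.rpow_two, ← div_eq_mul_inv, le_div_iff₀ (by positivity)]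
  have h3 : 1 ≤ Real.pi := by linarith [Real.pi_gt_three]
  have h4 : ‖𝓕 H ξ‖ * |ξ| ^ 2 ≤ M := by
    refine le_trans ?_ b2
    have : 2 * Real.pi * |ξ| * (2 * Real.pi * |ξ| * ‖𝓕 H ξ‖) =
      (2 * Real.pi) ^ 2 * (‖𝓕 H ξ‖ * |ξ| ^ 2) := by ring
    rw [this]
    exact le_mul_of_one_le_left (by positivity) (by nlinarith)
  nlinarith [norm_nonneg (𝓕 H ξ), mul_nonneg (norm_nonneg (𝓕 H ξ)) (sq_nonneg (1 - |ξ|))]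

/-- The sums of `(Λ n - 1) (log n)^k n^{-σ} H (log n - L)` over all `n`, uniformly in `σ`, `L`. -/
lemma norm_tsum_vonMangoldt_sub_one_le (k : ℕ) : ∃ C : ℝ, 0 < C ∧ ∀ (σ L M : ℝ)
    (H H1 H2 : ℝ → ℂ), 1 < σ → σ ≤ 2 → 
    (∀ v, HasDerivAt H (H1 v) v) → (∀ v, HasDerivAt H1 (H2 v) v) → Continuous H2 →
    (∀ v, v ∉ Set.Icc (0:ℝ) 1 → H v = 0 ∧ H1 v = 0 ∧ H2 v = 0) →
    (∀ v, ‖H v‖ ≤ M) → (∀ v, ‖H2 v‖ ≤ M) →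
    ‖∑' n : ℕ, ((ArithmeticFunction.vonMangoldt n : ℂ) - 1) * (Real.log n : ℂ) ^ k *
      (n : ℂ) ^ (-(σ : ℂ)) * H (Real.log n - L)‖ ≤ C * M := by
  obtain ⟨C, hC, hker⟩ := norm_iteratedDeriv_mangoldtKernel_le k
  set J : ℝ := ∫ ξ : ℝ, (1 + ‖ξ‖) ^ (-(3 / 2) : ℝ) with hJ
  have hJint : MeasureTheory.Integrable (fun ξ : ℝ => (1 + ‖ξ‖) ^ (-(3 / 2) : ℝ)) :=
    integrable_one_add_norm (by simp; norm_num)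
  have hJ0 : 0 ≤ J := MeasureTheory.integral_nonneg fun ξ => by positivity
  refine ⟨4 * (C * 3) * J + 1, by positivity, ?_⟩
  intro σ L M H H1 H2 hσ hσ2 h1 h2 hc hs hM hM2
  have hM0 : 0 ≤ M := (norm_nonneg _).trans (hM 0)
  have hd1 : Differentiable ℝ H := fun v => (h1 v).differentiableAt
  have i0 : MeasureTheory.Integrable H :=
    integrable_of_support_Icc hd1.continuous (fun v hv => (hs v hv).1)
  open FourierTransform in
  have hdec := norm_fourier_le_of_hasDerivAt h1 h2 hc hs hM hM2
  open FourierTransform in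
  set Hf : ℝ → ℂ := 𝓕 H with hHf
  have hcont : Continuous Hf := continuous_fourier_of_integrable i0
  have hHfint : MeasureTheory.Integrable Hf := by
    refine MeasureTheory.Integrable.mono' (g := fun ξ : ℝ => 4 * M * (1 + ‖ξ‖) ^ (-2 : ℝ))
      ((integrable_one_add_norm (by simp)).const_mul _)
      hcont.aestronglyMeasurable (Filter.Eventually.of_forall fun ξ => hdec ξ)
  have hinv : ∀ v, H v = ∫ ξ : ℝ, ee (ξ * v) * Hf ξ := by
    intro v
    open FourierTransform in
    have := congrFun (Continuous.fourierInv_fourier_eq hd1.continuous i0 hHfint) v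
    rw [← this, Real.fourierInv_eq']
    refine MeasureTheory.integral_congr_ae (Filter.Eventually.of_forall fun ξ => ?_)
    simp only [ee, smul_eq_mul, RCLike.inner_apply, conj_trivial]
    congr 2
    push_cast
    ring
  set w : ℕ → ℂ := fun n => ((ArithmeticFunction.vonMangoldt n : ℂ) - 1) * (Real.log n : ℂ) ^ k *
      (n : ℂ) ^ (-(σ : ℂ)) with hw
  have hsumm : Summable fun n => ‖w n‖ :=
    (hasSum_log_pow_mul_vonMangoldt_sub_one k (s := (σ : ℂ)) (by simpa using hσ)).summable.norm
  have hb : ∀ n (ξ : ℝ), ‖w n * (ee (ξ * (Real.log n - L)) * Hf ξ)‖ = ‖w n‖ * ‖Hf ξ‖ := by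
    intro n ξ
    rw [norm_mul (w n), norm_mul (ee _), norm_ee, one_mul]
  have hint : ∀ n, MeasureTheory.Integrable
      (fun ξ : ℝ => w n * (ee (ξ * (Real.log n - L)) * Hf ξ)) := by
    intro n
    refine MeasureTheory.Integrable.mono' (g := fun ξ : ℝ => ‖w n‖ * ‖Hf ξ‖)
      (hHfint.norm.const_mul _) ?_ (Filter.Eventually.of_forall fun ξ => (hb n ξ).le)
    refine Continuous.aestronglyMeasurable ?_
    have := continuous_ee
    fun_prop
  have hswap := MeasureTheory.hasSum_integral_of_summable_integral_norm hint (by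
    simp only [hb, MeasureTheory.integral_const_mul]
    exact hsumm.mul_right _)
  have hterm : ∀ n, ∫ ξ : ℝ, w n * (ee (ξ * (Real.log n - L)) * Hf ξ) =
      w n * H (Real.log n - L) := by
    intro n
    rw [MeasureTheory.integral_const_mul, hinv]
  simp only [hterm] at hswap
  rw [hswap.tsum_eq]
  have hpt : ∀ ξ : ℝ, ∑' n : ℕ, w n * (ee (ξ * (Real.log n - L)) * Hf ξ) =
      ee (-(ξ * L)) * Hf ξ * ((-1) ^ k * iteratedDeriv k mangoldtKernel
        ((σ : ℂ) - (2 * Real.pi * ξ : ℝ) * Complex.I)) := by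
    intro ξ
    set s : ℂ := (σ : ℂ) - (2 * Real.pi * ξ : ℝ) * Complex.I with hs'
    have hre : s.re = σ := by simp [hs']
    rw [← (hasSum_log_pow_mul_vonMangoldt_sub_one k (s := s) (by rwa [hre])).tsum_eq,
      ← tsum_mul_left]
    refine tsum_congr fun n => ?_
    rcases eq_or_ne n 0 with rfl | hn
    · have hσ0 : (σ : ℂ) ≠ 0 := by
        rw [Complex.ofReal_ne_zero]
        linarith
      have hs0 : s ≠ 0 := fun h => by
        rw [h] at hre
        simp at hre
        linarith
      simp [hw, Complex.zero_cpow (neg_ne_zero.2 hσ0), Complex.zero_cpow (neg_ne_zero.2 hs0)]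
    · have hn' : (n : ℂ) ≠ 0 := by exact_mod_cast hn
      have e1 : (n : ℂ) ^ (-s) = (n : ℂ) ^ (-(σ : ℂ)) * ee (ξ * Real.log n) := by
        rw [show -s = -(σ : ℂ) + (2 * Real.pi * ξ : ℝ) * Complex.I by rw [hs']; ring,
          Complex.cpow_add _ _ hn', ee, Complex.cpow_def_of_ne_zero hn' ((2 * Real.pi * ξ : ℝ) * _),
          ← Complex.natCast_log]
        congr 2
        push_cast
        ring
      rw [e1, mul_sub, sub_eq_add_neg (ξ * _), ee_add]
      simp only [hw]
      ring
  simp only [hpt]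
  refine (MeasureTheory.norm_integral_le_of_norm_le
    (g := fun ξ : ℝ => 4 * (C * 3) * M * (1 + ‖ξ‖) ^ (-(3 / 2) : ℝ)) (hJint.const_mul _)
    (Filter.Eventually.of_forall fun ξ => ?_)).trans ?_
  · have hk := hker ((σ : ℂ) - (2 * Real.pi * ξ : ℝ) * Complex.I) (by simpa using hσ.le)
      (by simpa using hσ2)
    have him : |((σ : ℂ) - (2 * Real.pi * ξ : ℝ) * Complex.I).im| = 2 * Real.pi * |ξ| := by
      simp [abs_mul, abs_of_pos Real.pi_pos]
    rw [him] at hk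
    have h5 : (1 + 2 * Real.pi * |ξ|) ^ (1 / 2 : ℝ) ≤ 3 * (1 + |ξ|) ^ (1 / 2 : ℝ) := by
      have : (9 : ℝ) ^ (1 / 2 : ℝ) = 3 := by
        rw [← Real.sqrt_eq_rpow, show (9 : ℝ) = 3 ^ 2 by norm_num]
        exact Real.sqrt_sq (by norm_num)
      rw [← this, ← Real.mul_rpow (by norm_num) (by positivity)]
      refine Real.rpow_le_rpow (by positivity) ?_ (by norm_num)
      nlinarith [Real.pi_lt_four, abs_nonneg ξ]
    have e3 : (1 + ‖ξ‖) ^ (-(3 / 2) : ℝ) = (1 + |ξ|) ^ (-2 : ℝ) * (1 + |ξ|) ^ (1 / 2 : ℝ) := by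
      rw [← Real.rpow_add (by positivity), Real.norm_eq_abs]
      norm_num
    rw [norm_mul, norm_mul, norm_ee, one_mul, norm_mul, norm_pow, norm_neg, norm_one, one_pow,
      one_mul, e3]
    calc ‖Hf ξ‖ * _ ≤ (4 * M * (1 + |ξ|) ^ (-2 : ℝ)) * (C * (3 * (1 + |ξ|) ^ (1 / 2 : ℝ))) := by
          refine mul_le_mul (hdec ξ) (hk.trans ?_) (norm_nonneg _) (by positivity)
          gcongr
      _ = _ := by ring
  · rw [MeasureTheory.integral_const_mul]
    nlinarith

lemma log_sub_log_nonpos_or_le_of_notMem_dyad {X : ℝ} (hX : 1 ≤ X) {n : ℕ} (hn : n ∉ dyad X) :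
    Real.log n - Real.log X ≤ 0 ∨ Real.log 2 ≤ Real.log n - Real.log X := by
  have hX0 : 0 < X := by linarith
  rw [mem_dyad hX0.le, not_and_or, not_lt, not_le] at hn
  rcases hn with h | h
  · left
    rcases Nat.eq_zero_or_pos n with rfl | hpos
    · simpa using Real.log_nonneg hX
    · have := Real.log_le_log (by exact_mod_cast hpos) h
      linarith
  · right
    have := Real.log_le_log (by linarith) h.le
    rw [Real.log_mul (by norm_num) hX0.ne'] at this
    linarith

lemma hasDerivAt_exp_mul_inv_pow (σ L : ℝ) (k : ℕ) {v : ℝ} (hv : 0 < v + L) :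
    HasDerivAt (fun v : ℝ => Real.exp (σ * v) * ((v + L) ^ k)⁻¹)
      (Real.exp (σ * v) * ((v + L) ^ k)⁻¹ * (σ - k / (v + L))) v := by
  have h1 : HasDerivAt (fun v : ℝ => Real.exp (σ * v)) (Real.exp (σ * v) * σ) v := by
    simpa using ((hasDerivAt_id v).const_mul σ).exp
  have h2 : HasDerivAt (fun v : ℝ => (v + L) ^ k) (k * (v + L) ^ (k - 1)) v := by
    exact (((hasDerivAt_id v).add_const L).pow k).congr_deriv (by simp)
  refine (h1.mul (h2.inv (pow_pos hv k).ne')).congr_deriv ?_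
  rcases Nat.eq_zero_or_pos k with rfl | hk
  · simp
  · have e : (v + L) ^ k = (v + L) ^ (k - 1) * (v + L) := by
      rw [← pow_succ, Nat.sub_add_cancel hk]
    have := pow_pos hv (k - 1)
    simp only [Pi.inv_apply]
    rw [e]
    field_simp
    ring

lemma hasDerivAt_exp_mul_inv_pow_mul (σ L : ℝ) (k : ℕ) {v : ℝ} (hv : 0 < v + L) :
    HasDerivAt (fun v : ℝ => Real.exp (σ * v) * ((v + L) ^ k)⁻¹ * (σ - k / (v + L)))
      (Real.exp (σ * v) * ((v + L) ^ k)⁻¹ * ((σ - k / (v + L)) ^ 2 + k / (v + L) ^ 2)) v := by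
  have h2 : HasDerivAt (fun v : ℝ => σ - k / (v + L)) (k / (v + L) ^ 2) v := by
    refine (((hasDerivAt_const v (k : ℝ)).div ((hasDerivAt_id v).add_const L)
      hv.ne').const_sub σ).congr_deriv ?_
    simp
    ring
  refine ((hasDerivAt_exp_mul_inv_pow σ L k hv).mul h2).congr_deriv ?_
  ring

set_option maxHeartbeats 1000000 in
/-- Prime number theorem for smooth weights, with a saving of any power of the logarithm. -/
lemma vonMangoldt_smooth_sum (k : ℕ) : ∃ C : ℝ, 0 < C ∧ ∀ (X M : ℝ) (F F1 F2 : ℝ → ℂ), 3 ≤ X →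
    (∀ v, HasDerivAt F (F1 v) v) → (∀ v, HasDerivAt F1 (F2 v) v) → Continuous F2 →
    (∀ v, v ≤ 0 ∨ Real.log 2 ≤ v → F v = 0 ∧ F1 v = 0 ∧ F2 v = 0) →
    (∀ v, ‖F v‖ ≤ M ∧ ‖F1 v‖ ≤ M ∧ ‖F2 v‖ ≤ M) →
    ‖∑ n ∈ dyad X, ((ArithmeticFunction.vonMangoldt n : ℂ) - 1) * F (Real.log n - Real.log X)‖ ≤
      C * X * M / Real.log X ^ k := by
  obtain ⟨C, hC, hmain⟩ := norm_tsum_vonMangoldt_sub_one_le k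
  set B : ℝ := ((2 + k) ^ 2 + k) + 2 * (2 + k) + 1 with hB
  have hk0 : (0:ℝ) ≤ k := Nat.cast_nonneg k
  have hB1 : 1 ≤ B := by
    rw [hB]
    nlinarith
  refine ⟨C * (Real.exp 2 * B) * Real.exp 1, by positivity, ?_⟩
  intro X M F F1 F2 hX h1 h2 hc hs hM
  have hX0 : 0 < X := by linarith
  set L := Real.log X with hL
  have hL1 : 1 ≤ L := one_le_log_of_three_le (by linarith)
  have hL0 : 0 < L := by linarith
  have hM0 : 0 ≤ M := (norm_nonneg _).trans (hM 0).1
  set σ : ℝ := 1 + 1 / L with hσ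
  have hσ1 : 1 < σ := by
    rw [hσ]
    have : 0 < 1 / L := by positivity
    linarith
  have hσ2 : σ ≤ 2 := by
    rw [hσ]
    have : 1 / L ≤ 1 := by rw [div_le_one hL0]; exact hL1
    linarith
  set g : ℝ → ℝ := fun v => Real.exp (σ * v) * ((v + L) ^ k)⁻¹ with hg
  set g1 : ℝ → ℝ := fun v => Real.exp (σ * v) * ((v + L) ^ k)⁻¹ * (σ - k / (v + L)) with hg1
  set g2 : ℝ → ℝ := fun v => Real.exp (σ * v) * ((v + L) ^ k)⁻¹ *
    ((σ - k / (v + L)) ^ 2 + k / (v + L) ^ 2) with hg2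
  have dg : ∀ v, 0 < v + L → HasDerivAt (fun v => (g v : ℂ)) (g1 v : ℂ) v := fun v hv =>
    (hasDerivAt_exp_mul_inv_pow σ L k hv).ofReal_comp
  have dg1 : ∀ v, 0 < v + L → HasDerivAt (fun v => (g1 v : ℂ)) (g2 v : ℂ) v := fun v hv =>
    (hasDerivAt_exp_mul_inv_pow_mul σ L k hv).ofReal_comp
  set H : ℝ → ℂ := fun v => g v * F v with hH
  set H1 : ℝ → ℂ := fun v => g1 v * F v + g v * F1 v with hH1
  set H2 : ℝ → ℂ := fun v => (g2 v * F v + g1 v * F1 v) + (g1 v * F1 v + g v * F2 v) with hH2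
  have hlog2 : Real.log 2 < 1 := by linarith [Real.log_two_lt_d9]
  have hneg : ∀ v : ℝ, ¬ 0 < v + L → ∀ᶠ u in nhds v, u ≤ 0 := by
    intro v hv
    filter_upwards [gt_mem_nhds (show v < 0 by linarith)] with u hu using hu.le
  have dH : ∀ v, HasDerivAt H (H1 v) v := by
    intro v
    by_cases hv : 0 < v + L
    · exact (dg v hv).mul (h1 v)
    · have hz := hs v (Or.inl (by linarith))
      have : H1 v = 0 := by simp [hH1, hz.1, hz.2.1]
      rw [this]
      refine (hasDerivAt_const v (0:ℂ)).congr_of_eventuallyEq ?_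
      filter_upwards [hneg v hv] with u hu
      simp [hH, (hs u (Or.inl hu)).1]
  have dH1 : ∀ v, HasDerivAt H1 (H2 v) v := by
    intro v
    by_cases hv : 0 < v + L
    · exact ((dg1 v hv).mul (h1 v)).add ((dg v hv).mul (h2 v))
    · have hz := hs v (Or.inl (by linarith))
      have : H2 v = 0 := by simp [hH2, hz.1, hz.2.1, hz.2.2]
      rw [this]
      refine (hasDerivAt_const v (0:ℂ)).congr_of_eventuallyEq ?_
      filter_upwards [hneg v hv] with u hu
      simp [hH1, (hs u (Or.inl hu)).1, (hs u (Or.inl hu)).2.1]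
  have cF : Continuous F := continuous_iff_continuousAt.2 fun v => (h1 v).continuousAt
  have cF1 : Continuous F1 := continuous_iff_continuousAt.2 fun v => (h2 v).continuousAt
  have cH2 : Continuous H2 := by
    refine continuous_iff_continuousAt.2 fun v => ?_
    by_cases hv : 0 < v + L
    · have c0 := (dg v hv).continuousAt
      have c1 := (dg1 v hv).continuousAt
      have c2 : ContinuousAt (fun v => (g2 v : ℂ)) v := by
        refine Complex.continuous_ofReal.continuousAt.comp ?_
        have hne : v + L ≠ 0 := hv.ne'
        have hnek : (v + L) ^ k ≠ 0 := pow_ne_zero _ hne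
        have hne2 : (v + L) ^ 2 ≠ 0 := pow_ne_zero _ hne
        have ca : ContinuousAt (fun v : ℝ => Real.exp (σ * v)) v := by fun_prop
        have cb : ContinuousAt (fun v : ℝ => ((v + L) ^ k)⁻¹) v :=
          ContinuousAt.inv₀ (by fun_prop) hnek
        have cc : ContinuousAt (fun v : ℝ => k / (v + L)) v :=
          ContinuousAt.div (by fun_prop) (by fun_prop) hne
        have cd : ContinuousAt (fun v : ℝ => k / (v + L) ^ 2) v :=
          ContinuousAt.div (by fun_prop) (by fun_prop) hne2
        exact (ca.mul cb).mul (((continuousAt_const.sub cc).pow 2).add cd)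
      exact ((c2.mul cF.continuousAt).add (c1.mul cF1.continuousAt)).add
        ((c1.mul cF1.continuousAt).add (c0.mul hc.continuousAt))
    · refine (continuousAt_const (y := (0:ℂ))).congr ?_
      filter_upwards [hneg v hv] with u hu
      have hz := hs u (Or.inl hu)
      simp [hH2, hz.1, hz.2.1, hz.2.2]
  have hsupp : ∀ v, v ∉ Set.Icc (0:ℝ) 1 → F v = 0 ∧ F1 v = 0 ∧ F2 v = 0 := by
    intro v hv
    rw [Set.mem_Icc, not_and_or, not_le, not_le] at hv
    exact hs v (hv.imp (fun h => h.le) (fun h => by linarith))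
  have hsH : ∀ v, v ∉ Set.Icc (0:ℝ) 1 → H v = 0 ∧ H1 v = 0 ∧ H2 v = 0 := by
    intro v hv
    obtain ⟨z0, z1, z2⟩ := hsupp v hv
    simp [hH, hH1, hH2, z0, z1, z2]
  set D : ℝ := Real.exp 2 * (L ^ k)⁻¹ with hD
  have hD0 : 0 < D := by positivity
  have bg : ∀ v ∈ Set.Icc (0:ℝ) 1, |g v| ≤ D ∧ |g1 v| ≤ D * (2 + k) ∧
      |g2 v| ≤ D * ((2 + k) ^ 2 + k) := by
    intro v hv
    have hvL : 1 ≤ v + L := by linarith [hv.1]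
    have b0 : |g v| ≤ D := by
      rw [abs_of_nonneg (by positivity)]
      refine mul_le_mul (Real.exp_le_exp.2 ?_) (inv_anti₀ (by positivity)
        (pow_le_pow_left₀ hL0.le (by linarith [hv.1]) k)) (by positivity) (by positivity)
      nlinarith [hv.1, hv.2]
    have hq0 : 0 ≤ k / (v + L) := by positivity
    have hq : k / (v + L) ≤ k := div_le_self hk0 hvL
    have hq2 : k / (v + L) ^ 2 ≤ k := div_le_self hk0 (one_le_pow₀ hvL)
    have hq20 : 0 ≤ k / (v + L) ^ 2 := by positivity
    have b1 : |σ - k / (v + L)| ≤ 2 + k := by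
      rw [abs_le]
      constructor <;> linarith
    refine ⟨b0, ?_, ?_⟩
    · rw [show g1 v = g v * (σ - k / (v + L)) from rfl, abs_mul]
      exact mul_le_mul b0 b1 (abs_nonneg _) hD0.le
    · rw [show g2 v = g v * ((σ - k / (v + L)) ^ 2 + k / (v + L) ^ 2) from rfl, abs_mul]
      refine mul_le_mul b0 ?_ (abs_nonneg _) hD0.le
      rw [abs_of_nonneg (by positivity), ← sq_abs]
      exact add_le_add (pow_le_pow_left₀ (abs_nonneg _) b1 2) hq2
  have bH : ∀ v, ‖H v‖ ≤ D * B * M := by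
    intro v
    by_cases hv : v ∈ Set.Icc (0:ℝ) 1
    · simp only [hH, norm_mul, Complex.norm_real, Real.norm_eq_abs]
      exact mul_le_mul ((bg v hv).1.trans (le_mul_of_one_le_right hD0.le hB1)) (hM v).1
        (norm_nonneg _) (by positivity)
    · rw [(hsH v hv).1, norm_zero]
      positivity
  have bH2 : ∀ v, ‖H2 v‖ ≤ D * B * M := by
    intro v
    by_cases hv : v ∈ Set.Icc (0:ℝ) 1
    · obtain ⟨c0, c1, c2⟩ := bg v hv
      obtain ⟨m0, m1, m2⟩ := hM v
      have t1 : ‖(g2 v : ℂ) * F v‖ ≤ D * ((2 + k) ^ 2 + k) * M := by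
        rw [norm_mul, Complex.norm_real, Real.norm_eq_abs]
        exact mul_le_mul c2 m0 (norm_nonneg _) (by positivity)
      have t2 : ‖(g1 v : ℂ) * F1 v‖ ≤ D * (2 + k) * M := by
        rw [norm_mul, Complex.norm_real, Real.norm_eq_abs]
        exact mul_le_mul c1 m1 (norm_nonneg _) (by positivity)
      have t3 : ‖(g v : ℂ) * F2 v‖ ≤ D * M := by
        rw [norm_mul, Complex.norm_real, Real.norm_eq_abs]
        exact mul_le_mul c0 m2 (norm_nonneg _) (by positivity)
      calc ‖H2 v‖ ≤ (‖(g2 v : ℂ) * F v‖ + ‖(g1 v : ℂ) * F1 v‖) +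
            (‖(g1 v : ℂ) * F1 v‖ + ‖(g v : ℂ) * F2 v‖) :=
            (norm_add_le _ _).trans (add_le_add (norm_add_le _ _) (norm_add_le _ _))
        _ ≤ (D * ((2 + k) ^ 2 + k) * M + D * (2 + k) * M) + (D * (2 + k) * M + D * M) := by
            gcongr
        _ = D * B * M := by rw [hB]; ring
    · rw [(hsH v hv).2.2, norm_zero]
      positivity
  have key := hmain σ L (D * B * M) H H1 H2 hσ1 hσ2 dH dH1 cH2 hsH bH bH2
  have hsum : ∑' n : ℕ, ((ArithmeticFunction.vonMangoldt n : ℂ) - 1) * (Real.log n : ℂ) ^ k *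
      (n : ℂ) ^ (-(σ : ℂ)) * H (Real.log n - L) = (Real.exp (-(σ * L)) : ℂ) *
      ∑ n ∈ dyad X, ((ArithmeticFunction.vonMangoldt n : ℂ) - 1) * F (Real.log n - L) := by
    rw [tsum_eq_sum (s := dyad X), Finset.mul_sum]
    · refine Finset.sum_congr rfl fun n hn => ?_
      have hn' := ((mem_dyad hX0.le).1 hn).1
      have hn0 : (0:ℝ) < n := by linarith
      have hnc : (n : ℂ) ≠ 0 := by exact_mod_cast hn0.ne'
      have hlogn : 0 < Real.log n := Real.log_pos (by linarith)
      have e1 : (n : ℂ) ^ (-(σ : ℂ)) = (Real.exp (-(σ * Real.log n)) : ℂ) := by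
        rw [Complex.cpow_def_of_ne_zero hnc, ← Complex.natCast_log, Complex.ofReal_exp]
        congr 1
        push_cast
        ring
      have e2 : (Real.log n : ℂ) ^ k * (((Real.log n) ^ k)⁻¹ : ℝ) = 1 := by
        push_cast
        exact mul_inv_cancel₀ (pow_ne_zero _ (by exact_mod_cast hlogn.ne'))
      have e3 : Real.exp (-(σ * L)) =
          Real.exp (-(σ * Real.log n)) * Real.exp (σ * (Real.log n - L)) := by
        rw [← Real.exp_add]
        congr 1
        ring
      simp only [hH, hg, sub_add_cancel]
      rw [e1, e3]
      rw [Complex.ofReal_mul (Real.exp _) _, Complex.ofReal_mul (Real.exp _) _]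
      linear_combination ((ArithmeticFunction.vonMangoldt n : ℂ) - 1) *
        (Real.exp (-(σ * Real.log n)) : ℂ) * (Real.exp (σ * (Real.log n - L)) : ℂ) *
        F (Real.log n - L) * e2
    · intro n hn
      have hz := hs _ (log_sub_log_nonpos_or_le_of_notMem_dyad (by linarith) hn)
      simp only [hH]
      rw [hz.1]
      ring
  rw [hsum, norm_mul, Complex.norm_real, Real.norm_eq_abs, abs_of_pos (Real.exp_pos _),
    Real.exp_neg, inv_mul_le_iff₀ (Real.exp_pos _)] at key
  refine key.trans (le_of_eq ?_)
  have e4 : Real.exp (σ * L) = X * Real.exp 1 := by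
    rw [hσ, add_mul, one_mul, one_div, inv_mul_cancel₀ hL0.ne', Real.exp_add, hL,
      Real.exp_log hX0]
  rw [e4, hD]
  field_simp

/-- A twice differentiable weight with values in `[0, 1]`, supported well inside `(1, 2)`. -/
structure IsCutoff (φ : ℝ → ℝ) : Prop where
  contDiff : ContDiff ℝ 2 φ
  nonneg : ∀ t, 0 ≤ φ t
  le_one : ∀ t, φ t ≤ 1
  support : ∃ α β : ℝ, 1 < α ∧ β < 2 ∧ ∀ t, t ∉ Set.Icc α β → φ t = 0

lemma deriv_eq_zero_of_notMem_Icc {f : ℝ → ℝ} {α β : ℝ} (h : ∀ t, t ∉ Set.Icc α β → f t = 0)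
    (t : ℝ) (ht : t ∉ Set.Icc α β) : deriv f t = 0 := by
  have : f =ᶠ[nhds t] fun _ => 0 := by
    filter_upwards [isClosed_Icc.isOpen_compl.mem_nhds (show t ∈ (Set.Icc α β)ᶜ from ht)] with u hu
    exact h u hu
  rw [this.deriv_eq, deriv_const]

lemma exists_bound_of_support_Icc {f : ℝ → ℝ} (hf : Continuous f) {α β : ℝ}
    (h : ∀ t, t ∉ Set.Icc α β → f t = 0) : ∃ B : ℝ, ∀ t, |f t| ≤ B := by
  obtain ⟨B, hB⟩ := hf.bounded_above_of_compact_support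
    (HasCompactSupport.intro isCompact_Icc h)
  exact ⟨B, hB⟩

namespace IsCutoff

variable {φ : ℝ → ℝ}

lemma eq_zero (hφ : IsCutoff φ) {t : ℝ} (ht : t ∉ Set.Ioo (1:ℝ) 2) : φ t = 0 := by
  obtain ⟨α, β, hα, hβ, h⟩ := hφ.support
  exact h t fun h' => ht ⟨hα.trans_le h'.1, h'.2.trans_lt hβ⟩

lemma abs_le_one (hφ : IsCutoff φ) (t : ℝ) : |φ t| ≤ 1 := by
  rw [abs_of_nonneg (hφ.nonneg t)]
  exact hφ.le_one t

lemma exists_derivs (hφ : IsCutoff φ) : ∃ (φ1 φ2 : ℝ → ℝ) (B : ℝ), 1 ≤ B ∧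
    (∀ t, HasDerivAt φ (φ1 t) t) ∧ (∀ t, HasDerivAt φ1 (φ2 t) t) ∧ Continuous φ2 ∧
    (∀ t, t ∉ Set.Ioo (1:ℝ) 2 → φ t = 0 ∧ φ1 t = 0 ∧ φ2 t = 0) ∧
    (∀ t, |φ t| ≤ B ∧ |φ1 t| ≤ B ∧ |φ2 t| ≤ B) := by
  obtain ⟨α, β, hα, hβ, h⟩ := hφ.support
  have hc1 : ContDiff ℝ 1 (deriv φ) :=
    (contDiff_succ_iff_deriv (n := 1)).1 (by rw [one_add_one_eq_two]; exact hφ.contDiff) |>.2.2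
  have hd2 : Continuous (deriv (deriv φ)) := hc1.continuous_deriv le_rfl
  have hd0 : Differentiable ℝ φ := hφ.contDiff.differentiable (by norm_num)
  have hd1 : Differentiable ℝ (deriv φ) := hc1.differentiable (by norm_num)
  have z1 := deriv_eq_zero_of_notMem_Icc h
  have z2 := deriv_eq_zero_of_notMem_Icc z1
  obtain ⟨B1, hB1⟩ := exists_bound_of_support_Icc hd1.continuous z1
  obtain ⟨B2, hB2⟩ := exists_bound_of_support_Icc hd2 z2
  refine ⟨deriv φ, deriv (deriv φ), max 1 (max B1 B2), le_max_left _ _,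
    fun t => (hd0 t).hasDerivAt, fun t => (hd1 t).hasDerivAt, hd2, ?_, ?_⟩
  · intro t ht
    have : t ∉ Set.Icc α β := fun h' => ht ⟨hα.trans_le h'.1, h'.2.trans_lt hβ⟩
    exact ⟨h t this, z1 t this, z2 t this⟩
  · intro t
    exact ⟨(hφ.abs_le_one t).trans (le_max_left _ _),
      (hB1 t).trans ((le_max_left _ _).trans (le_max_right _ _)),
      (hB2 t).trans ((le_max_right _ _).trans (le_max_right _ _))⟩

end IsCutoff

lemma hasDerivAt_ee_comp {f : ℝ → ℝ} {f' t : ℝ} (hf : HasDerivAt f f' t) :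
    HasDerivAt (fun t => ee (f t)) (ee (f t) * (2 * Real.pi * f' * Complex.I)) t := by
  have h1 : HasDerivAt (fun t => (2 * Real.pi * f t * Complex.I : ℂ))
      (2 * Real.pi * f' * Complex.I) t := by
    have := ((hf.ofReal_comp).const_mul (2 * Real.pi : ℂ)).mul_const Complex.I
    simpa using this
  exact h1.cexp

set_option maxHeartbeats 1000000 in
/-- The von Mangoldt exponential sum with a smooth weight near the origin, compared with the
corresponding sum over all integers. -/
lemma vonMangoldt_sub_one_expSum (k : ℕ) {c : ℝ} (hc : 1 < c) (hc2 : c < 2) {φ : ℝ → ℝ}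
    (hφ : IsCutoff φ) : ∃ C : ℝ, 0 < C ∧ ∀ X x : ℝ, 3 ≤ X →
    ‖∑ n ∈ dyad X, ((ArithmeticFunction.vonMangoldt n : ℂ) - 1) *
      ((φ (n / X) : ℂ) * ee (x * (n : ℝ) ^ c))‖ ≤
      C * X * (1 + |x| * X ^ c) ^ 2 / Real.log X ^ k := by
  obtain ⟨C, hC, hmain⟩ := vonMangoldt_smooth_sum k
  obtain ⟨φ1, φ2, B, hB, h1, h2, hcφ, hz, hb⟩ := hφ.exists_derivs
  refine ⟨C * (2000 * B * 10 ^ 4), by positivity, ?_⟩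
  intro X x hX
  have hX0 : 0 < X := by linarith
  set Y : ℝ := x * X ^ c with hY
  have hXc : 0 < X ^ c := Real.rpow_pos_of_pos hX0 c
  have hYabs : |x| * X ^ c = |Y| := by rw [hY, abs_mul, abs_of_pos hXc]
  set q : ℝ → ℝ := fun v => Y * Real.exp (c * v) with hq
  set q1 : ℝ → ℝ := fun v => Y * (Real.exp (c * v) * c) with hq1
  set q2 : ℝ → ℝ := fun v => Y * ((Real.exp (c * v) * c) * c) with hq2
  have dexp : ∀ v, HasDerivAt (fun v : ℝ => Real.exp (c * v)) (Real.exp (c * v) * c) v := by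
    intro v
    simpa using ((hasDerivAt_id v).const_mul c).exp
  have dq : ∀ v, HasDerivAt q (q1 v) v := fun v => (dexp v).const_mul Y
  have dq1 : ∀ v, HasDerivAt q1 (q2 v) v := fun v => ((dexp v).mul_const c).const_mul Y
  set E : ℝ → ℂ := fun v => ee (q v) with hE
  set E1 : ℝ → ℂ := fun v => ee (q v) * (2 * Real.pi * q1 v * Complex.I) with hE1
  set E2 : ℝ → ℂ := fun v => E1 v * (2 * Real.pi * q1 v * Complex.I) +
    ee (q v) * (2 * Real.pi * q2 v * Complex.I) with hE2
  have dE : ∀ v, HasDerivAt E (E1 v) v := fun v => hasDerivAt_ee_comp (dq v)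
  have dE1 : ∀ v, HasDerivAt E1 (E2 v) v := by
    intro v
    refine (dE v).mul ?_
    have := (((dq1 v).ofReal_comp).const_mul (2 * Real.pi : ℂ)).mul_const Complex.I
    simpa using this
  set P : ℝ → ℝ := fun v => φ (Real.exp v) with hP
  set P1 : ℝ → ℝ := fun v => φ1 (Real.exp v) * Real.exp v with hP1
  set P2 : ℝ → ℝ := fun v => (φ2 (Real.exp v) * Real.exp v) * Real.exp v +
    φ1 (Real.exp v) * Real.exp v with hP2
  have dP : ∀ v, HasDerivAt P (P1 v) v := fun v => (h1 _).comp v (Real.hasDerivAt_exp v)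
  have dP1 : ∀ v, HasDerivAt P1 (P2 v) v := fun v =>
    ((h2 _).comp v (Real.hasDerivAt_exp v)).mul (Real.hasDerivAt_exp v)
  set F : ℝ → ℂ := fun v => (P v : ℂ) * E v with hF
  set F1 : ℝ → ℂ := fun v => (P1 v : ℂ) * E v + (P v : ℂ) * E1 v with hF1
  set F2 : ℝ → ℂ := fun v => ((P2 v : ℂ) * E v + (P1 v : ℂ) * E1 v) +
    ((P1 v : ℂ) * E1 v + (P v : ℂ) * E2 v) with hF2
  have dF : ∀ v, HasDerivAt F (F1 v) v := fun v => ((dP v).ofReal_comp).mul (dE v)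
  have dF1 : ∀ v, HasDerivAt F1 (F2 v) v := fun v =>
    (((dP1 v).ofReal_comp).mul (dE v)).add (((dP v).ofReal_comp).mul (dE1 v))
  have cE : Continuous E := continuous_iff_continuousAt.2 fun v => (dE v).continuousAt
  have cE1 : Continuous E1 := continuous_iff_continuousAt.2 fun v => (dE1 v).continuousAt
  have cφ1 : Continuous φ1 := continuous_iff_continuousAt.2 fun v => (h2 v).continuousAt
  have cP : Continuous P := continuous_iff_continuousAt.2 fun v => (dP v).continuousAt
  have cP1 : Continuous P1 := continuous_iff_continuousAt.2 fun v => (dP1 v).continuousAt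
  have cP2 : Continuous P2 := by fun_prop
  have cee := continuous_ee
  have cE2 : Continuous E2 := by fun_prop
  have cF2 : Continuous F2 := by fun_prop
  have zP : ∀ v, v ≤ 0 ∨ Real.log 2 ≤ v → P v = 0 ∧ P1 v = 0 ∧ P2 v = 0 := by
    intro v hv
    have : Real.exp v ∉ Set.Ioo (1:ℝ) 2 := by
      rintro ⟨ha, hb'⟩
      rcases hv with hv | hv
      · exact absurd (Real.exp_le_one_iff.2 hv) (not_le.2 ha)
      · exact absurd ((Real.log_le_iff_le_exp (by norm_num)).1 hv) (not_le.2 hb')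
    obtain ⟨w0, w1, w2⟩ := hz _ this
    simp [hP, hP1, hP2, w0, w1, w2]
  have zF : ∀ v, v ≤ 0 ∨ Real.log 2 ≤ v → F v = 0 ∧ F1 v = 0 ∧ F2 v = 0 := by
    intro v hv
    obtain ⟨w0, w1, w2⟩ := zP v hv
    simp [hF, hF1, hF2, w0, w1, w2]
  have hB0 : 0 ≤ B := by linarith
  have bF : ∀ v, ‖F v‖ ≤ 2000 * B * 10 ^ 4 * (1 + |Y|) ^ 2 ∧
      ‖F1 v‖ ≤ 2000 * B * 10 ^ 4 * (1 + |Y|) ^ 2 ∧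
      ‖F2 v‖ ≤ 2000 * B * 10 ^ 4 * (1 + |Y|) ^ 2 := by
    intro v
    by_cases hv : v ≤ 0 ∨ Real.log 2 ≤ v
    · obtain ⟨w0, w1, w2⟩ := zF v hv
      rw [w0, w1, w2, norm_zero]
      exact ⟨by positivity, by positivity, by positivity⟩
    rw [not_or, not_le, not_le] at hv
    have hexp : Real.exp v ≤ 2 := by
      rw [← Real.exp_log (show (0:ℝ) < 2 by norm_num)]
      exact Real.exp_le_exp.2 hv.2.le
    have hexp0 := Real.exp_pos v
    have hcexp : Real.exp (c * v) ≤ 4 := by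
      calc Real.exp (c * v) ≤ Real.exp (2 * v) := Real.exp_le_exp.2 (by nlinarith [hv.1])
        _ = Real.exp v * Real.exp v := by rw [two_mul, Real.exp_add]
        _ ≤ 4 := by nlinarith
    have hcexp0 := Real.exp_pos (c * v)
    obtain ⟨b0, b1, b2⟩ := hb (Real.exp v)
    set U : ℝ := 1 + |Y| with hU
    have hU1 : 1 ≤ U := by rw [hU]; linarith [abs_nonneg Y]
    have hq1b : |q1 v| ≤ 8 * U := by
      rw [hq1, abs_mul, abs_of_pos (by positivity : 0 < Real.exp (c * v) * c)]
      have : Real.exp (c * v) * c ≤ 8 := by nlinarith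
      nlinarith [abs_nonneg Y]
    have hq2b : |q2 v| ≤ 16 * U := by
      rw [hq2, abs_mul, abs_of_pos (by positivity : 0 < Real.exp (c * v) * c * c)]
      have : Real.exp (c * v) * c ≤ 8 := by nlinarith
      have : Real.exp (c * v) * c * c ≤ 16 := by nlinarith
      nlinarith [abs_nonneg Y]
    have nfac : ∀ r : ℝ, ‖(2 * Real.pi * r * Complex.I : ℂ)‖ ≤ 8 * |r| := by
      intro r
      rw [norm_mul, norm_mul, norm_mul, Complex.norm_I, Complex.norm_real, Complex.norm_real,
        Real.norm_eq_abs, Real.norm_eq_abs, abs_of_pos Real.pi_pos, Complex.norm_ofNat, mul_one]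
      nlinarith [Real.pi_lt_four, abs_nonneg r]
    have nE : ‖E v‖ ≤ 1 := (norm_ee _).le
    have nE1 : ‖E1 v‖ ≤ 64 * U := by
      rw [hE1, norm_mul, norm_ee, one_mul]
      linarith [nfac (q1 v)]
    have nE2 : ‖E2 v‖ ≤ 64 * U * (64 * U) + 128 * U := by
      rw [hE2]
      refine (norm_add_le _ _).trans (add_le_add ?_ ?_)
      · rw [norm_mul]
        exact mul_le_mul nE1 (by linarith [nfac (q1 v)]) (norm_nonneg _) (by positivity)
      · rw [norm_mul, norm_ee, one_mul]
        linarith [nfac (q2 v)]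
    have nP : ‖(P v : ℂ)‖ ≤ B := by rw [Complex.norm_real]; exact b0
    have nP1 : ‖(P1 v : ℂ)‖ ≤ B * 2 := by
      rw [Complex.norm_real, hP1, norm_mul, Real.norm_eq_abs, Real.norm_eq_abs,
        abs_of_pos hexp0]
      exact mul_le_mul b1 hexp hexp0.le hB0
    have nP2 : ‖(P2 v : ℂ)‖ ≤ B * 2 * 2 + B * 2 := by
      rw [Complex.norm_real, hP2]
      refine (norm_add_le _ _).trans (add_le_add ?_ ?_)
      · rw [norm_mul, norm_mul, Real.norm_eq_abs, Real.norm_eq_abs, abs_of_pos hexp0]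
        exact mul_le_mul (mul_le_mul b2 hexp hexp0.le hB0) hexp hexp0.le (by positivity)
      · rw [norm_mul, Real.norm_eq_abs, Real.norm_eq_abs, abs_of_pos hexp0]
        exact mul_le_mul b1 hexp hexp0.le hB0
    have hUU : U ≤ U ^ 2 := by nlinarith
    have hBU : B * U ≤ B * U ^ 2 := mul_le_mul_of_nonneg_left hUU hB0
    have hBU1 : B ≤ B * U := le_mul_of_one_le_right hB0 hU1
    have m1 : ‖(P v : ℂ) * E v‖ ≤ B * 1 := by
      rw [norm_mul]; exact mul_le_mul nP nE (norm_nonneg _) hB0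
    have m2 : ‖(P1 v : ℂ) * E v‖ ≤ B * 2 * 1 := by
      rw [norm_mul]; exact mul_le_mul nP1 nE (norm_nonneg _) (by positivity)
    have m3 : ‖(P v : ℂ) * E1 v‖ ≤ B * (64 * U) := by
      rw [norm_mul]; exact mul_le_mul nP nE1 (norm_nonneg _) hB0
    have m4 : ‖(P2 v : ℂ) * E v‖ ≤ (B * 2 * 2 + B * 2) * 1 := by
      rw [norm_mul]; exact mul_le_mul nP2 nE (norm_nonneg _) (by positivity)
    have m5 : ‖(P1 v : ℂ) * E1 v‖ ≤ B * 2 * (64 * U) := by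
      rw [norm_mul]; exact mul_le_mul nP1 nE1 (norm_nonneg _) (by positivity)
    have m6 : ‖(P v : ℂ) * E2 v‖ ≤ B * (64 * U * (64 * U) + 128 * U) := by
      rw [norm_mul]; exact mul_le_mul nP nE2 (norm_nonneg _) hB0
    refine ⟨by nlinarith, ?_, ?_⟩
    · refine (norm_add_le _ _).trans ?_
      nlinarith
    · refine (norm_add_le _ _).trans ((add_le_add (norm_add_le _ _) (norm_add_le _ _)).trans ?_)
      nlinarith
  have key := hmain X _ F F1 F2 hX dF dF1 cF2 zF bF
  have hsum : ∑ n ∈ dyad X, ((ArithmeticFunction.vonMangoldt n : ℂ) - 1) *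
      ((φ (n / X) : ℂ) * ee (x * (n : ℝ) ^ c)) = ∑ n ∈ dyad X,
      ((ArithmeticFunction.vonMangoldt n : ℂ) - 1) * F (Real.log n - Real.log X) := by
    refine Finset.sum_congr rfl fun n hn => ?_
    have hn' := ((mem_dyad hX0.le).1 hn).1
    have hn0 : (0:ℝ) < n := by linarith
    have e1 : Real.exp (Real.log n - Real.log X) = n / X := by
      rw [Real.exp_sub, Real.exp_log hn0, Real.exp_log hX0]
    have e2 : Y * Real.exp (c * (Real.log n - Real.log X)) = x * (n : ℝ) ^ c := by
      rw [mul_comm c, Real.exp_mul, e1, Real.div_rpow hn0.le hX0.le, hY]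
      field_simp
    simp only [hF, hP, hE, hq]
    rw [e1, e2]
  rw [hsum, hYabs]
  refine key.trans (le_of_eq ?_)
  ring

/-- The weight of an integer in the smoothed sums over primes. -/
noncomputable def primeWeight (φ : ℝ → ℝ) (X : ℝ) (n : ℕ) : ℝ :=
  φ (n / X) * (if n.Prime then Real.log n else 0)

/-- The smoothed exponential sum over primes with phases `x p^c`. -/
noncomputable def primeSum (φ : ℝ → ℝ) (c X x : ℝ) : ℂ :=
  expSum (dyad X) (fun n : ℕ => (n : ℝ) ^ c) (fun n => (primeWeight φ X n : ℂ)) x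

/-- The integral approximating `primeSum` near the origin. -/
noncomputable def smoothInt (φ : ℝ → ℝ) (c X x : ℝ) : ℂ :=
  ∫ t : ℝ, (φ (t / X) : ℂ) * ee (x * t ^ c)

lemma norm_cutoff_mul_ee_le {φ : ℝ → ℝ} (hφ : IsCutoff φ) (s t : ℝ) :
    ‖(φ s : ℂ) * ee t‖ ≤ 1 := by
  rw [norm_mul, norm_ee, mul_one, Complex.norm_real]
  exact hφ.abs_le_one s

lemma continuous_cutoff_mul_ee {φ : ℝ → ℝ} (hφ : IsCutoff φ) {c : ℝ} (hc : 0 ≤ c) (X x : ℝ) :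
    Continuous fun t : ℝ => (φ (t / X) : ℂ) * ee (x * t ^ c) := by
  have h1 := hφ.contDiff.continuous
  have h2 := continuous_ee
  have h3 : Continuous fun t : ℝ => t ^ c := Real.continuous_rpow_const hc
  fun_prop

lemma IsCutoff.eq_zero_div {φ : ℝ → ℝ} (hφ : IsCutoff φ) {X t : ℝ} (hX : 0 < X)
    (ht : t ≤ X ∨ 2 * X ≤ t) : φ (t / X) = 0 := by
  refine hφ.eq_zero ?_
  rintro ⟨h1, h2⟩
  rw [lt_div_iff₀ hX] at h1
  rw [div_lt_iff₀ hX] at h2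
  rcases ht with h | h <;> linarith

lemma integrable_cutoff_mul_ee {φ : ℝ → ℝ} (hφ : IsCutoff φ) {c : ℝ} (hc : 0 ≤ c) {X : ℝ}
    (hX : 0 < X) (x : ℝ) :
    MeasureTheory.Integrable fun t : ℝ => (φ (t / X) : ℂ) * ee (x * t ^ c) := by
  refine integrable_of_support_Icc (continuous_cutoff_mul_ee hφ hc X x) (a := X) (b := 2 * X) ?_
  intro t ht
  rw [Set.mem_Icc, not_and_or, not_le, not_le] at ht
  rw [hφ.eq_zero_div hX (ht.imp le_of_lt le_of_lt), Complex.ofReal_zero, zero_mul]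

lemma norm_smoothInt_le {φ : ℝ → ℝ} (hφ : IsCutoff φ) {c X : ℝ} (hX : 0 < X) (x : ℝ) :
    ‖smoothInt φ c X x‖ ≤ X := by
  refine (MeasureTheory.norm_integral_le_integral_norm _).trans ?_
  refine (integral_norm_le_of_support_Icc (a := X) (b := 2 * X) (M := 1) (by linarith) ?_
    (fun t => norm_cutoff_mul_ee_le hφ _ _)).trans (by linarith)
  intro t ht
  rw [Set.mem_Icc, not_and_or, not_le, not_le] at ht
  rw [hφ.eq_zero_div hX (ht.imp le_of_lt le_of_lt), Complex.ofReal_zero, zero_mul]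

lemma hasDerivAt_cutoff_mul_ee {φ φ1 : ℝ → ℝ} (h1 : ∀ t, HasDerivAt φ (φ1 t) t) (c X x : ℝ)
    {t : ℝ} (ht : 0 < t) : HasDerivAt (fun t : ℝ => (φ (t / X) : ℂ) * ee (x * t ^ c))
      ((φ1 (t / X) / X : ℝ) * ee (x * t ^ c) + (φ (t / X) : ℂ) *
        (ee (x * t ^ c) * (2 * Real.pi * (x * (c * t ^ (c - 1)) : ℝ) * Complex.I))) t := by
  have d1 : HasDerivAt (fun t : ℝ => φ (t / X)) (φ1 (t / X) / X) t := by
    have := (h1 (t / X)).comp t ((hasDerivAt_id t).div_const X)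
    exact this.congr_deriv (by ring)
  have d2 : HasDerivAt (fun t : ℝ => x * t ^ c) (x * (c * t ^ (c - 1))) t :=
    (Real.hasDerivAt_rpow_const (Or.inl ht.ne')).const_mul x
  exact d1.ofReal_comp.mul (hasDerivAt_ee_comp d2)

lemma norm_two_pi_mul_I_le (r : ℝ) : ‖(2 * Real.pi * r * Complex.I : ℂ)‖ ≤ 8 * |r| := by
  rw [norm_mul, norm_mul, norm_mul, Complex.norm_I, Complex.norm_real, Complex.norm_real,
    Real.norm_eq_abs, Real.norm_eq_abs, abs_of_pos Real.pi_pos, Complex.norm_ofNat, mul_one]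
  nlinarith [Real.pi_lt_four, abs_nonneg r]

lemma sum_sub_smoothInt {c : ℝ} (hc : 1 < c) (hc2 : c < 2) {φ : ℝ → ℝ}
    (hφ : IsCutoff φ) : ∃ C : ℝ, 0 < C ∧ ∀ X x : ℝ, 3 ≤ X →
    ‖∑ n ∈ dyad X, (φ (n / X) : ℂ) * ee (x * (n : ℝ) ^ c) - smoothInt φ c X x‖ ≤
      C * (1 + |x| * X ^ c) := by
  obtain ⟨φ1, φ2, B, hB, h1, -, -, -, hb⟩ := hφ.exists_derivs
  refine ⟨2 * (B + 64), by positivity, ?_⟩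
  intro X x hX
  have hX0 : 0 < X := by linarith
  set f : ℝ → ℂ := fun t => (φ (t / X) : ℂ) * ee (x * t ^ c) with hf
  have hfc : Continuous f := continuous_cutoff_mul_ee hφ (by linarith) X x
  have hz : ∀ t, t ≤ X ∨ 2 * X ≤ t → f t = 0 := by
    intro t ht
    simp only [hf]
    rw [hφ.eq_zero_div hX0 ht, Complex.ofReal_zero, zero_mul]
  set a : ℕ := ⌊X⌋₊ with ha
  set b : ℕ := ⌊2 * X⌋₊ + 1 with hbdef
  have ha1 : (a : ℝ) ≤ X := Nat.floor_le hX0.le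
  have ha2 : X < a + 1 := Nat.lt_floor_add_one X
  have hb1 : (b : ℝ) ≤ 2 * X + 1 := by
    rw [hbdef]
    push_cast
    linarith [Nat.floor_le (show 0 ≤ 2 * X by linarith)]
  have hb2 : 2 * X < b := by
    rw [hbdef]
    push_cast
    exact Nat.lt_floor_add_one _
  have hab : a ≤ b := by
    have : (a : ℝ) ≤ b := by linarith
    exact_mod_cast this
  set Y : ℝ := |x| * X ^ c with hY
  have hY0 : 0 ≤ Y := by positivity
  set K : ℝ := (B + 64 * Y) / X with hK
  have hK0 : 0 ≤ K := by positivity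
  have hstep : ∀ k ∈ Finset.Ico a b, ‖f ((k : ℝ) + 1) - ∫ t in (k : ℝ)..((k + 1 : ℕ) : ℝ), f t‖
      ≤ K := by
    intro k hk
    rw [Finset.mem_Ico] at hk
    have hk1 : (a : ℝ) ≤ k := by exact_mod_cast hk.1
    have hk2 : (k : ℝ) + 1 ≤ b := by exact_mod_cast hk.2
    have hlip : ∀ t ∈ Set.Icc (k : ℝ) (k + 1), ‖f (k + 1) - f t‖ ≤ K := by
      intro t ht
      have := Convex.norm_image_sub_le_of_norm_hasDerivWithin_le (f := f) (s := Set.Icc (k : ℝ) (k + 1))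
        (x := t) (y := k + 1) (C := K) (fun u hu =>
          (hasDerivAt_cutoff_mul_ee h1 c X x (by linarith [hu.1])).hasDerivWithinAt) ?_
        (convex_Icc _ _) ht ⟨by linarith, le_rfl⟩
      · refine this.trans ?_
        rw [Real.norm_eq_abs, abs_of_nonneg (by linarith [ht.2])]
        exact mul_le_of_le_one_right hK0 (by linarith [ht.1])
      · intro u hu
        have hu0 : 0 < u := by linarith [hu.1]
        have hu4 : u ≤ 4 * X := by linarith [hu.2]
        have e1 : u ^ (c - 1) ≤ 4 * (X ^ c / X) := by
          calc u ^ (c - 1) ≤ (4 * X) ^ (c - 1) :=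
                Real.rpow_le_rpow hu0.le hu4 (by linarith)
            _ = 4 ^ (c - 1) * X ^ (c - 1) := Real.mul_rpow (by norm_num) hX0.le
            _ ≤ 4 ^ (1:ℝ) * X ^ (c - 1) := by
                gcongr
                · norm_num
                · linarith
            _ = _ := by rw [Real.rpow_one, Real.rpow_sub_one hX0.ne']
        have e0 : 0 ≤ u ^ (c - 1) := by positivity
        have e2 : |x * (c * u ^ (c - 1))| ≤ 8 * Y / X := by
          rw [abs_mul, abs_of_nonneg (by positivity : 0 ≤ c * u ^ (c - 1))]
          calc |x| * (c * u ^ (c - 1)) ≤ |x| * (2 * (4 * (X ^ c / X))) := by gcongr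
            _ = _ := by rw [hY]; ring
        refine (norm_add_le _ _).trans ?_
        rw [norm_mul, norm_mul, norm_mul, norm_ee, mul_one, one_mul, Complex.norm_real,
          Complex.norm_real, Real.norm_eq_abs, Real.norm_eq_abs, abs_div, abs_of_pos hX0, hK,
          add_div]
        refine add_le_add (div_le_div_of_nonneg_right (hb _).2.1 hX0.le) ?_
        calc |φ (u / X)| * ‖_‖ ≤ 1 * (8 * |x * (c * u ^ (c - 1))|) :=
              mul_le_mul (hφ.abs_le_one _) (norm_two_pi_mul_I_le _) (norm_nonneg _) zero_le_one
          _ ≤ 1 * (8 * (8 * Y / X)) := by gcongr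
          _ = _ := by ring
    have hcast : ((k + 1 : ℕ) : ℝ) = k + 1 := by push_cast; ring
    rw [hcast]
    have e3 : f (k + 1) = ∫ t in (k : ℝ)..(k + 1), f (k + 1) := by simp
    rw [e3, ← intervalIntegral.integral_sub (by simp) (hfc.intervalIntegrable _ _)]
    refine (intervalIntegral.norm_integral_le_of_norm_le_const (C := K) fun t ht => ?_).trans
      (by simp)
    rw [Set.uIoc_of_le (by linarith)] at ht
    exact hlip t ⟨ht.1.le, ht.2⟩
  have hint : smoothInt φ c X x = ∑ k ∈ Finset.Ico a b, ∫ t in (k : ℝ)..((k + 1 : ℕ) : ℝ), f t := by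
    rw [intervalIntegral.sum_integral_adjacent_intervals_Ico (a := fun k : ℕ => (k : ℝ)) hab
      (fun k _ => hfc.intervalIntegrable _ _),
      intervalIntegral.integral_eq_integral_of_support_subset]
    · rfl
    · intro t ht
      rw [Function.mem_support] at ht
      by_contra hcon
      rw [Set.mem_Ioc, not_and_or, not_lt, not_le] at hcon
      exact ht (hz t (hcon.imp (fun h => by linarith) (fun h => by linarith)))
  have hsum : ∑ n ∈ dyad X, (φ (n / X) : ℂ) * ee (x * (n : ℝ) ^ c) =
      ∑ k ∈ Finset.Ico a b, f ((k : ℝ) + 1) := by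
    have := Finset.sum_Ico_add' (fun n : ℕ => f (n : ℝ)) a b 1
    push_cast at this
    rw [this]
    refine Finset.sum_subset ?_ ?_
    · intro n hn
      rw [dyad, Finset.mem_Ioc] at hn
      rw [Finset.mem_Ico]
      omega
    · intro n _ hn2
      rw [mem_dyad hX0.le, not_and_or, not_lt, not_le] at hn2
      exact hz n (hn2.imp id le_of_lt)
  rw [hint, hsum, ← Finset.sum_sub_distrib]
  refine (norm_sum_le _ _).trans ((Finset.sum_le_sum hstep).trans ?_)
  rw [Finset.sum_const, Nat.card_Ico, nsmul_eq_mul, Nat.cast_sub hab]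
  calc ((b : ℝ) - a) * K ≤ (2 * X) * K := by
        gcongr
        linarith
    _ = 2 * (B + 64 * Y) := by rw [hK]; field_simp
    _ ≤ 2 * (B + 64) * (1 + Y) := by nlinarith

lemma psi_sub_theta_eq_sum_sub (x : ℝ) : Chebyshev.psi x - Chebyshev.theta x =
    ∑ n ∈ Finset.Ioc 0 ⌊x⌋₊, (ArithmeticFunction.vonMangoldt n -
      (if n.Prime then Real.log n else 0)) := by
  rw [Finset.sum_sub_distrib, ← Finset.sum_filter]
  rfl

lemma vonMangoldt_sub_primeLog_nonneg (n : ℕ) :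
    0 ≤ ArithmeticFunction.vonMangoldt n - (if n.Prime then Real.log n else 0) := by
  split_ifs with h
  · rw [ArithmeticFunction.vonMangoldt_apply_prime h, sub_self]
  · simp

lemma vonMangoldt_sub_prime_sum_le {X : ℝ} (hX : 3 ≤ X) (z : ℕ → ℂ) (hz : ∀ n, ‖z n‖ ≤ 1) :
    ‖∑ n ∈ dyad X, (ArithmeticFunction.vonMangoldt n : ℂ) * z n -
      ∑ n ∈ dyad X, ((if n.Prime then Real.log n else 0 : ℝ) : ℂ) * z n‖ ≤
      8 * √X * Real.log X := by
  rw [← Finset.sum_sub_distrib]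
  calc _ ≤ ∑ n ∈ dyad X, (ArithmeticFunction.vonMangoldt n -
      (if n.Prime then Real.log n else 0)) := by
        refine norm_sum_le_of_le _ fun n _ => ?_
        rw [← sub_mul, ← Complex.ofReal_sub, norm_mul, Complex.norm_real, Real.norm_eq_abs,
          abs_of_nonneg (vonMangoldt_sub_primeLog_nonneg n)]
        exact mul_le_of_le_one_right (vonMangoldt_sub_primeLog_nonneg n) (hz n)
    _ ≤ ∑ n ∈ Finset.Ioc 0 ⌊2 * X⌋₊, (ArithmeticFunction.vonMangoldt n -
      (if n.Prime then Real.log n else 0)) :=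
        Finset.sum_le_sum_of_subset_of_nonneg (Finset.Ioc_subset_Ioc_left (Nat.zero_le _))
          fun n _ _ => vonMangoldt_sub_primeLog_nonneg n
    _ ≤ 2 * √(2 * X) * Real.log (2 * X) := by
        rw [← psi_sub_theta_eq_sum_sub]
        exact Chebyshev.psi_sub_theta_le (by linarith)
    _ ≤ 2 * (2 * √X) * (2 * Real.log X) := by
        have h1 : √(2 * X) ≤ 2 * √X := by
          rw [Real.sqrt_le_left (by positivity), mul_pow, Real.sq_sqrt (by linarith)]
          linarith
        have h2 : Real.log (2 * X) ≤ 2 * Real.log X := by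
          rw [Real.log_mul (by norm_num) (by linarith), two_mul]
          gcongr
          linarith
        have h3 : 0 ≤ Real.log (2 * X) := Real.log_nonneg (by linarith)
        gcongr
    _ = _ := by ring

lemma norm_primeSum_le {φ : ℝ → ℝ} (hφ : IsCutoff φ) {c X : ℝ} (hX : 3 ≤ X) (x : ℝ) :
    ‖primeSum φ c X x‖ ≤ 4 * X := by
  refine (norm_expSum_le _ _ _ _).trans ?_
  calc _ ≤ ∑ n ∈ dyad X, (if n.Prime then Real.log n else 0) := by
        refine Finset.sum_le_sum fun n _ => ?_
        have h0 : (0:ℝ) ≤ if n.Prime then Real.log n else 0 := by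
          split_ifs
          · exact Real.log_natCast_nonneg n
          · exact le_rfl
        rw [Complex.norm_real, primeWeight, norm_mul, Real.norm_eq_abs, Real.norm_eq_abs,
          abs_of_nonneg h0]
        exact mul_le_of_le_one_left h0 (hφ.abs_le_one _)
    _ ≤ ∑ n ∈ Finset.Ioc 0 ⌊2 * X⌋₊, (if n.Prime then Real.log n else 0) := by
        refine Finset.sum_le_sum_of_subset_of_nonneg
          (Finset.Ioc_subset_Ioc_left (Nat.zero_le _)) fun n _ _ => ?_
        split_ifs
        · exact Real.log_natCast_nonneg n
        · exact le_rfl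
    _ = Chebyshev.theta (2 * X) := by rw [← Finset.sum_filter]; rfl
    _ ≤ Real.log 4 * (2 * X) := Chebyshev.theta_le_log4_mul_x (by linarith)
    _ ≤ 4 * X := by
        have : Real.log 4 = 2 * Real.log 2 := by
          rw [show (4:ℝ) = 2 ^ 2 by norm_num, Real.log_pow]
          norm_num
        nlinarith [Real.log_two_lt_d9]

lemma primeSum_eq (φ : ℝ → ℝ) (c X x : ℝ) : primeSum φ c X x =
    ∑ n ∈ dyad X, ((if n.Prime then Real.log n else 0 : ℝ) : ℂ) *
      ((φ (n / X) : ℂ) * ee (x * (n : ℝ) ^ c)) := by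
  rw [primeSum, expSum]
  refine Finset.sum_congr rfl fun n _ => ?_
  rw [primeWeight, Complex.ofReal_mul]
  ring

lemma eventually_pow_log_le_rpow (k : ℕ) {η : ℝ} (hη : 0 < η) :
    ∀ᶠ X : ℝ in Filter.atTop, Real.log X ^ k ≤ X ^ η := by
  have h := (isLittleO_log_rpow_rpow_atTop (k : ℝ) hη).bound (show (0:ℝ) < 1 by norm_num)
  filter_upwards [h, Filter.eventually_ge_atTop 1] with X hX hX1
  rw [one_mul, Real.rpow_natCast, Real.norm_eq_abs, Real.norm_eq_abs,
    abs_of_nonneg (show 0 ≤ X ^ η by positivity)] at hX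
  exact (le_abs_self _).trans hX

lemma eventually_pow_log_le_sqrt (k : ℕ) :
    ∀ᶠ X : ℝ in Filter.atTop, Real.log X ^ k ≤ √X := by
  simpa only [Real.sqrt_eq_rpow] using eventually_pow_log_le_rpow k one_half_pos

/-- The approximation of the exponential sum over primes near the origin. -/
lemma primeSum_sub_smoothInt (k : ℕ) {c : ℝ} (hc : 1 < c) (hc2 : c < 2) {φ : ℝ → ℝ}
    (hφ : IsCutoff φ) : ∃ C : ℝ, 0 < C ∧ ∃ X₀ : ℝ, 3 ≤ X₀ ∧ ∀ X x : ℝ, X₀ ≤ X →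
    ‖primeSum φ c X x - smoothInt φ c X x‖ ≤
      C * X * (1 + |x| * X ^ c) ^ 2 / Real.log X ^ k := by
  obtain ⟨C1, hC1, h1⟩ := vonMangoldt_sub_one_expSum k hc hc2 hφ
  obtain ⟨C2, hC2, h2⟩ := sum_sub_smoothInt hc hc2 hφ
  obtain ⟨X₀, hX₀⟩ := Filter.eventually_atTop.1 (eventually_pow_log_le_sqrt (k + 1))
  refine ⟨C1 + C2 + 8, by positivity, max 3 X₀, le_max_left _ _, ?_⟩
  intro X x hX
  have hX3 : 3 ≤ X := (le_max_left _ _).trans hX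
  have hX0 : 0 < X := by linarith
  have hlog := hX₀ X ((le_max_right _ _).trans hX)
  set L := Real.log X with hL
  have hL1 : 1 ≤ L := one_le_log_of_three_le (by linarith)
  have hLk : 0 < L ^ k := by positivity
  set Y := |x| * X ^ c with hY
  have hY0 : 0 ≤ Y := by positivity
  set z : ℕ → ℂ := fun n => (φ (n / X) : ℂ) * ee (x * (n : ℝ) ^ c) with hz
  have e1 := h1 X x hX3
  have e2 := h2 X x hX3
  have e3 := vonMangoldt_sub_prime_sum_le hX3 z (fun n => norm_cutoff_mul_ee_le hφ _ _)
  rw [← primeSum_eq] at e3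
  have hdecomp : primeSum φ c X x - smoothInt φ c X x =
      (∑ n ∈ dyad X, ((ArithmeticFunction.vonMangoldt n : ℂ) - 1) * z n) +
      (∑ n ∈ dyad X, z n - smoothInt φ c X x) -
      (∑ n ∈ dyad X, (ArithmeticFunction.vonMangoldt n : ℂ) * z n - primeSum φ c X x) := by
    simp only [sub_mul, one_mul, Finset.sum_sub_distrib]
    ring
  have hsq : √X * √X = X := Real.mul_self_sqrt hX0.le
  have hs1 : 1 ≤ √X := Real.one_le_sqrt.2 (by linarith)
  have f2 : √X * L ≤ X / L ^ k := by
    rw [le_div_iff₀ hLk, mul_assoc, ← pow_succ']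
    nlinarith [Real.sqrt_nonneg X]
  have f1 : 1 ≤ X / L ^ k := le_trans (by nlinarith) f2
  have f0 : 0 ≤ X / L ^ k := by positivity
  have f3 : (1:ℝ) ≤ (1 + Y) ^ 2 := one_le_pow₀ (by linarith)
  have f4 : 1 + Y ≤ (1 + Y) ^ 2 := by nlinarith
  rw [hdecomp]
  refine (norm_sub_le _ _).trans ((add_le_add ((norm_add_le _ _).trans (add_le_add e1 e2)) e3).trans ?_)
  calc C1 * X * (1 + Y) ^ 2 / L ^ k + C2 * (1 + Y) + 8 * √X * L
      ≤ C1 * X * (1 + Y) ^ 2 / L ^ k + C2 * ((1 + Y) ^ 2 * (X / L ^ k)) +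
        8 * ((1 + Y) ^ 2 * (X / L ^ k)) := by
        have g1 : 1 + Y ≤ (1 + Y) ^ 2 * (X / L ^ k) :=
          f4.trans (le_mul_of_one_le_right (by positivity) f1)
        have g2 : √X * L ≤ (1 + Y) ^ 2 * (X / L ^ k) :=
          f2.trans (le_mul_of_one_le_left f0 f3)
        nlinarith
    _ = _ := by ring

/-- First derivative bound for the smooth integral. -/
lemma norm_smoothInt_le_div {c : ℝ} (hc : 1 < c) (hc2 : c < 2) {φ : ℝ → ℝ}
    (hφ : IsCutoff φ) : ∃ C : ℝ, 0 < C ∧ ∀ X x : ℝ, 3 ≤ X →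
    ‖smoothInt φ c X x‖ ≤ C * X / (1 + |x| * X ^ c) := by
  obtain ⟨φ1, φ2, B, hB, h1, h2, -, hzero, hb⟩ := hφ.exists_derivs
  refine ⟨B + 2, by positivity, ?_⟩
  intro X x hX
  have hX0 : 0 < X := by linarith
  have hXc : 0 < X ^ c := Real.rpow_pos_of_pos hX0 c
  set f : ℝ → ℂ := fun t => (φ (t / X) : ℂ) * ee (x * t ^ c) with hf
  have hfi : MeasureTheory.Integrable f := integrable_cutoff_mul_ee hφ (by linarith) hX0 x
  set g : ℝ → ℂ := fun t => ((φ1 (t / X) / X * t ^ (1 - c) + φ (t / X) * ((1 - c) * t ^ (-c)) : ℝ) : ℂ)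
    * ee (x * t ^ c) with hg
  set P : ℝ → ℂ := fun t => ((t ^ (1 - c) : ℝ) : ℂ) * f t with hP
  have hz : ∀ t, t ≤ X ∨ 2 * X ≤ t → φ (t / X) = 0 ∧ φ1 (t / X) = 0 := by
    intro t ht
    have := hzero (t / X) (by
      rintro ⟨h1, h2⟩
      rw [lt_div_iff₀ hX0] at h1
      rw [div_lt_iff₀ hX0] at h2
      rcases ht with h | h <;> linarith)
    exact ⟨this.1, this.2.1⟩
  have dP : ∀ t, HasDerivAt P (g t + (2 * Real.pi * c * x : ℝ) * Complex.I * f t) t := by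
    intro t
    by_cases ht : 0 < t
    · have d1 : HasDerivAt (fun t : ℝ => ((t ^ (1 - c) : ℝ) : ℂ))
          (((1 - c) * t ^ (1 - c - 1) : ℝ) : ℂ) t :=
        (Real.hasDerivAt_rpow_const (Or.inl ht.ne')).ofReal_comp
      have d2 := hasDerivAt_cutoff_mul_ee h1 c X x ht
      refine (d1.mul d2).congr_deriv ?_
      have e1 : t ^ (1 - c - 1) = t ^ (-c) := by congr 1; ring
      have e2 : ((t ^ (1 - c) : ℝ) : ℂ) * ((t ^ (c - 1) : ℝ) : ℂ) = 1 := by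
        rw [← Complex.ofReal_mul, ← Real.rpow_add ht]
        norm_num
      simp only [hg, hf, e1]
      push_cast
      linear_combination (2 * Real.pi * x * c * Complex.I * (φ (t / X) : ℂ) * ee (x * t ^ c)) * e2
    · have hz0 : ∀ u, u < X → f u = 0 ∧ g u = 0 := by
        intro u hu
        obtain ⟨w0, w1⟩ := hz u (Or.inl hu.le)
        simp [hf, hg, w0, w1]
      have ht' : t < X := by linarith
      rw [(hz0 t ht').1, (hz0 t ht').2, mul_zero, add_zero]
      refine (hasDerivAt_const t (0:ℂ)).congr_of_eventuallyEq ?_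
      filter_upwards [gt_mem_nhds ht'] with u hu
      simp [hP, (hz0 u hu).1]
  have hcont_on : ∀ p : ℝ, ContinuousOn (fun t : ℝ => t ^ p) (Set.Icc X (2 * X)) := by
    intro p t ht
    exact (Real.continuousAt_rpow_const _ _ (Or.inl (by linarith [ht.1]))).continuousWithinAt
  have cφ : Continuous φ := hφ.contDiff.continuous
  have cφ1 : Continuous φ1 := continuous_iff_continuousAt.2 fun v => (h2 v).continuousAt
  have cE : Continuous fun t : ℝ => ee (x * t ^ c) := by
    have h2 := continuous_ee
    have h3 : Continuous fun t : ℝ => t ^ c := Real.continuous_rpow_const (by linarith)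
    fun_prop
  have hsuppout : ∀ t, t ∉ Set.Icc X (2 * X) → f t = 0 ∧ g t = 0 := by
    intro t ht
    rw [Set.mem_Icc, not_and_or, not_le, not_le] at ht
    obtain ⟨w0, w1⟩ := hz t (ht.imp le_of_lt le_of_lt)
    simp [hf, hg, w0, w1]
  have hgi : MeasureTheory.Integrable g := by
    rw [← MeasureTheory.integrableOn_iff_integrable_of_support_subset (s := Set.Icc X (2 * X))]
    · refine ContinuousOn.integrableOn_compact isCompact_Icc ?_
      refine ContinuousOn.mul ?_ cE.continuousOn
      refine Complex.continuous_ofReal.comp_continuousOn ?_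
      have a1 : ContinuousOn (fun t : ℝ => φ1 (t / X) / X) (Set.Icc X (2 * X)) :=
        (show Continuous fun t : ℝ => φ1 (t / X) / X by fun_prop).continuousOn
      have a2 : ContinuousOn (fun t : ℝ => φ (t / X)) (Set.Icc X (2 * X)) :=
        (show Continuous fun t : ℝ => φ (t / X) by fun_prop).continuousOn
      exact (a1.mul (hcont_on _)).add (a2.mul (continuousOn_const.mul (hcont_on _)))
    · intro t ht
      by_contra hcon
      exact ht (hsuppout t hcon).2
  have hPi : MeasureTheory.Integrable P := by
    rw [← MeasureTheory.integrableOn_iff_integrable_of_support_subset (s := Set.Icc X (2 * X))]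
    · refine ContinuousOn.integrableOn_compact isCompact_Icc ?_
      refine ContinuousOn.mul ?_ (continuous_cutoff_mul_ee hφ (by linarith) X x).continuousOn
      exact Complex.continuous_ofReal.comp_continuousOn (hcont_on _)
    · intro t ht
      by_contra hcon
      exact ht (by simp [hP, (hsuppout t hcon).1])
  have hzeroint := MeasureTheory.integral_eq_zero_of_hasDerivAt_of_integrable dP
    (hgi.add (hfi.const_mul _)) hPi
  rw [MeasureTheory.integral_add hgi (hfi.const_mul _), MeasureTheory.integral_const_mul] at hzeroint
  have hgb : ∀ t, ‖g t‖ ≤ (B + 1) * (X ^ c)⁻¹ := by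
    intro t
    by_cases ht : t ∈ Set.Icc X (2 * X)
    · have ht0 : 0 < t := by linarith [ht.1]
      have p1 : t ^ (-c) ≤ (X ^ c)⁻¹ := by
        rw [Real.rpow_neg ht0.le]
        exact inv_anti₀ hXc (Real.rpow_le_rpow hX0.le ht.1 (by linarith))
      have p2 : t ^ (1 - c) ≤ X * (X ^ c)⁻¹ := by
        calc t ^ (1 - c) ≤ X ^ (1 - c) :=
              Real.rpow_le_rpow_of_nonpos hX0 ht.1 (by linarith)
          _ = _ := by rw [Real.rpow_sub hX0, Real.rpow_one, div_eq_mul_inv]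
      have p10 : 0 ≤ t ^ (-c) := by positivity
      have p20 : 0 ≤ t ^ (1 - c) := by positivity
      rw [hg, norm_mul, norm_ee, mul_one, Complex.norm_real, Real.norm_eq_abs]
      refine (abs_add_le _ _).trans ?_
      rw [abs_mul, abs_mul, abs_mul, abs_div, abs_of_pos hX0, abs_of_nonneg p10,
        abs_of_nonneg p20, abs_of_neg (show 1 - c < 0 by linarith)]
      have q1 : |φ1 (t / X)| / X * t ^ (1 - c) ≤ B / X * (X * (X ^ c)⁻¹) := by
        gcongr
        exact (hb _).2.1
      have q2 : |φ (t / X)| * (-(1 - c) * t ^ (-c)) ≤ 1 * (1 * (X ^ c)⁻¹) := by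
        refine mul_le_mul (hφ.abs_le_one _) ?_ ?_ zero_le_one
        · exact mul_le_mul (by linarith) p1 p10 zero_le_one
        · exact mul_nonneg (by linarith) p10
      have q3 : B / X * (X * (X ^ c)⁻¹) = B * (X ^ c)⁻¹ := by field_simp
      linarith
    · rw [(hsuppout t ht).2, norm_zero]
      positivity
  have hgI : ‖∫ t, g t‖ ≤ (B + 1) * (X ^ c)⁻¹ * X := by
    refine (MeasureTheory.norm_integral_le_integral_norm _).trans ?_
    refine (integral_norm_le_of_support_Icc (a := X) (b := 2 * X) (by linarith)
      (fun t ht => (hsuppout t ht).2) hgb).trans (le_of_eq ?_)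
    ring
  have e1 : (2 * Real.pi * c * x : ℝ) * Complex.I * smoothInt φ c X x = -∫ t, g t :=
    eq_neg_of_add_eq_zero_right hzeroint
  have e2 : ‖smoothInt φ c X x‖ * |x| ≤ (B + 1) * (X ^ c)⁻¹ * X := by
    refine le_trans ?_ hgI
    rw [← norm_neg (∫ t, g t), ← e1, norm_mul, norm_mul, Complex.norm_I, Complex.norm_real,
      Real.norm_eq_abs, abs_mul, mul_one, abs_of_pos (by positivity : 0 < 2 * Real.pi * c)]
    have : 1 ≤ 2 * Real.pi * c := by nlinarith [Real.pi_gt_three]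
    have h0 : 0 ≤ |x| * ‖smoothInt φ c X x‖ := by positivity
    nlinarith
  have e3 := norm_smoothInt_le hφ (c := c) hX0 x
  rw [le_div_iff₀ (by positivity)]
  have e4 : ‖smoothInt φ c X x‖ * |x| * X ^ c ≤ (B + 1) * X := by
    calc _ ≤ (B + 1) * (X ^ c)⁻¹ * X * X ^ c := by gcongr
      _ = _ := by field_simp
  nlinarith

lemma cutoff_variation_le {φ φ1 : ℝ → ℝ} {B X : ℝ} (hφ : IsCutoff φ)
    (h1 : ∀ t, HasDerivAt φ (φ1 t) t) (hb : ∀ t, |φ1 t| ≤ B) (hX : 0 < X) :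
    |φ ((⌊2 * X⌋₊ : ℕ) / X)| + ∑ n ∈ Finset.Ioc ⌊X⌋₊ ⌊2 * X⌋₊,
      |φ ((n : ℕ) / X) - φ ((n - 1 : ℕ) / X)| ≤ 1 + 2 * B := by
  have hB0 : 0 ≤ B := (abs_nonneg _).trans (hb 0)
  refine add_le_add (hφ.abs_le_one _) ?_
  have hterm : ∀ n ∈ Finset.Ioc ⌊X⌋₊ ⌊2 * X⌋₊, |φ ((n : ℕ) / X) - φ ((n - 1 : ℕ) / X)| ≤ B / X := by
    intro n hn
    have hn1 : 1 ≤ n := by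
      have := (Finset.mem_Ioc.1 hn).1
      omega
    have := Convex.norm_image_sub_le_of_norm_hasDerivWithin_le (f := φ) (s := Set.univ)
      (x := ((n - 1 : ℕ) : ℝ) / X) (y := n / X) (C := B) (fun u _ => (h1 u).hasDerivWithinAt)
      (fun u _ => hb u) convex_univ trivial trivial
    refine this.trans (le_of_eq ?_)
    rw [← sub_div, Nat.cast_sub hn1, Nat.cast_one, sub_sub_cancel, Real.norm_eq_abs,
      abs_of_pos (by positivity), mul_one_div]
  refine (Finset.sum_le_sum hterm).trans ?_
  rw [Finset.sum_const, nsmul_eq_mul]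
  calc _ ≤ (2 * X) * (B / X) := by
        gcongr
        exact card_dyad_le hX.le
    _ = _ := by field_simp

/-- The minor arc bound for the smoothed exponential sum over primes. -/
lemma norm_primeSum_minor {c : ℝ} (hc : 1 < c) (hc2 : c < 2) {φ : ℝ → ℝ} (hφ : IsCutoff φ) :
    ∃ C : ℝ, 0 < C ∧ ∃ X₀ : ℝ, 3 ≤ X₀ ∧ ∀ X x : ℝ, X₀ ≤ X → Real.log X ^ 40 ≤ |x| * X ^ c →
      |x| * X ^ c ≤ X ^ (27 / 20 : ℝ) → ‖primeSum φ c X x‖ ≤ C * X / Real.log X ^ 5 := by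
  obtain ⟨C, hC, hmain⟩ := vonMangoldt_sum_minor hc hc2
  obtain ⟨φ1, φ2, B, hB, h1, h2, -, -, hb⟩ := hφ.exists_derivs
  obtain ⟨X₁, hX₁⟩ := Filter.eventually_atTop.1
    (eventually_pow_log_le_rpow 10 (show (0:ℝ) < 1 / 40 by norm_num))
  obtain ⟨X₂, hX₂⟩ := Filter.eventually_atTop.1 (eventually_pow_log_le_sqrt 6)
  refine ⟨(1 + 2 * B) * (C * 32 * 2) + 8, by positivity, max 3 (max X₁ X₂), le_max_left _ _, ?_⟩
  intro X x hX hY1 hY2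
  have hX3 : 3 ≤ X := (le_max_left _ _).trans hX
  have hX0 : 0 < X := by linarith
  have hlog1 := hX₁ X ((le_max_left _ _).trans ((le_max_right _ _).trans hX))
  have hlog2 := hX₂ X ((le_max_right _ _).trans ((le_max_right _ _).trans hX))
  set L := Real.log X with hL
  have hL1 : 1 ≤ L := one_le_log_of_three_le (by linarith)
  set Y := |x| * X ^ c with hY
  have hY0 : 1 ≤ Y := (one_le_pow₀ hL1).trans hY1
  have hx0 : x ≠ 0 := by
    rintro rfl
    rw [hY, abs_zero, zero_mul] at hY0
    linarith
  set θ : ℝ := X ^ (1 / 20 : ℝ) with hθ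
  have hθ1 : 1 ≤ θ := Real.one_le_rpow (by linarith) (by norm_num)
  have hθ20 : θ ^ 20 = X := by
    rw [hθ, ← Real.rpow_natCast, ← Real.rpow_mul hX0.le]
    norm_num
  have hθ27 : θ ^ 27 = X ^ (27 / 20 : ℝ) := by
    rw [hθ, ← Real.rpow_natCast, ← Real.rpow_mul hX0.le]
    norm_num
  have hsθ : L ^ 10 ≤ √θ := by
    rw [Real.sqrt_eq_rpow, hθ, ← Real.rpow_mul hX0.le]
    norm_num at hlog1 ⊢
    exact hlog1
  have hsY : L ^ 10 ≤ √(√Y) := by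
    refine Real.le_sqrt_of_sq_le (Real.le_sqrt_of_sq_le ?_)
    rw [← pow_mul, ← pow_mul]
    exact hY1
  have hL10 : 0 < L ^ 10 := by positivity
  have hsub : (1 + L) ^ 5 * X * (1 / √θ + 1 / √(√Y)) ≤ 32 * 2 * (X / L ^ 5) := by
    have g1 : (1 + L) ^ 5 ≤ (2 * L) ^ 5 := by
      gcongr
      linarith
    have g2 : 1 / √θ + 1 / √(√Y) ≤ 1 / L ^ 10 + 1 / L ^ 10 := by gcongr
    calc _ ≤ (2 * L) ^ 5 * X * (1 / L ^ 10 + 1 / L ^ 10) := by gcongr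
      _ = _ := by
        field_simp
        ring
  set z : ℕ → ℂ := fun n => (φ (n / X) : ℂ) * ee (x * (n : ℝ) ^ c) with hz
  have hΛ : ‖∑ n ∈ dyad X, (ArithmeticFunction.vonMangoldt n : ℂ) * z n‖ ≤
      (1 + 2 * B) * (C * 32 * 2 * (X / L ^ 5)) := by
    have hpart : ∀ t, ⌊X⌋₊ ≤ t → t ≤ ⌊2 * X⌋₊ →
        ‖∑ n ∈ Finset.Ioc ⌊X⌋₊ t, (ArithmeticFunction.vonMangoldt n : ℂ) * ee (x * (n : ℝ) ^ c)‖ ≤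
        C * 32 * 2 * (X / L ^ 5) := by
      intro t ht1 ht2
      have ht2' : (t : ℝ) ≤ 2 * X := (Nat.cast_le.2 ht2).trans (Nat.floor_le (by linarith))
      have := hmain θ x t hθ1 hx0 (by rwa [hθ20]) (by rwa [hθ20]) (by rw [hθ20]; exact hY0)
        (by rw [hθ20, hθ27]; exact hY2)
      rw [hθ20] at this
      refine this.trans ?_
      calc C * (1 + L) ^ 5 * X * (1 / √θ + 1 / √(√Y))
          = C * ((1 + L) ^ 5 * X * (1 / √θ + 1 / √(√Y))) := by ring
        _ ≤ C * (32 * 2 * (X / L ^ 5)) := by gcongr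
        _ = _ := by ring
    have h3 := norm_sum_mul_le_of_partial
      (fun n => (ArithmeticFunction.vonMangoldt n : ℂ) * ee (x * (n : ℝ) ^ c))
      (fun n : ℕ => φ (n / X)) ⌊X⌋₊ ⌊2 * X⌋₊ (Nat.floor_le_floor (by linarith)) _ hpart
    have h4 := cutoff_variation_le hφ h1 (fun t => (hb t).2.1) hX0
    have h5 : ∑ n ∈ dyad X, (ArithmeticFunction.vonMangoldt n : ℂ) * z n =
        ∑ n ∈ Finset.Ioc ⌊X⌋₊ ⌊2 * X⌋₊, (φ (n / X) : ℂ) *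
          ((ArithmeticFunction.vonMangoldt n : ℂ) * ee (x * (n : ℝ) ^ c)) :=
      Finset.sum_congr rfl fun n _ => by simp only [hz]; ring
    rw [h5]
    exact h3.trans (mul_le_mul_of_nonneg_right h4 (by positivity))
  have e3 := vonMangoldt_sub_prime_sum_le hX3 z (fun n => norm_cutoff_mul_ee_le hφ _ _)
  rw [← primeSum_eq] at e3
  have e4 : √X * L ≤ X / L ^ 5 := by
    rw [le_div_iff₀ (by positivity), mul_assoc, show L * L ^ 5 = L ^ 6 by ring]
    calc √X * L ^ 6 ≤ √X * √X := by gcongr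
      _ = X := Real.mul_self_sqrt hX0.le
  have e5 : primeSum φ c X x = ∑ n ∈ dyad X, (ArithmeticFunction.vonMangoldt n : ℂ) * z n -
      (∑ n ∈ dyad X, (ArithmeticFunction.vonMangoldt n : ℂ) * z n - primeSum φ c X x) := by ring
  rw [e5]
  refine (norm_sub_le _ _).trans ((add_le_add hΛ e3).trans ?_)
  calc _ ≤ (1 + 2 * B) * (C * 32 * 2 * (X / L ^ 5)) + 8 * (X / L ^ 5) := by
        rw [mul_assoc 8]
        gcongr
    _ = _ := by ring

/-- A continuous bump function `ψ` on `[-1, 1]`, given as the inverse Fourier transform of a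
rapidly decreasing function `Ψ`. -/
structure IsKernel (ψ : ℝ → ℝ) (Ψ : ℝ → ℂ) : Prop where
  continuous : Continuous ψ
  nonneg : ∀ t, 0 ≤ ψ t
  le_one : ∀ t, ψ t ≤ 1
  eq_zero : ∀ t, 1 ≤ |t| → ψ t = 0
  eq_one : ∀ t, |t| ≤ 1 / 2 → ψ t = 1
  continuous_hat : Continuous Ψ
  integrable_hat : MeasureTheory.Integrable Ψ
  decay : ∀ r : ℕ, ∃ C : ℝ, 0 < C ∧ ∀ ξ, (1 + |ξ|) ^ r * ‖Ψ ξ‖ ≤ C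
  inversion : ∀ t : ℝ, (ψ t : ℂ) = ∫ ξ : ℝ, Ψ ξ * ee (ξ * t)

open FourierTransform ContDiff in
lemma exists_isKernel : ∃ (ψ : ℝ → ℝ) (Ψ : ℝ → ℂ), IsKernel ψ Ψ := by
  let b : ContDiffBump (0 : ℝ) := ⟨1 / 2, 1, by norm_num, by norm_num⟩
  have hsm : ContDiff ℝ ∞ fun t : ℝ => ((b t : ℝ) : ℂ) :=
    Complex.ofRealCLM.contDiff.comp b.contDiff
  have hcs : HasCompactSupport fun t : ℝ => ((b t : ℝ) : ℂ) :=
    b.hasCompactSupport.comp_left (g := fun x : ℝ => (x : ℂ)) Complex.ofReal_zero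
  let f : SchwartzMap ℝ ℂ := hcs.toSchwartzMap hsm
  have hf : ∀ t, f t = ((b t : ℝ) : ℂ) := fun t => rfl
  refine ⟨b, ⇑(𝓕 f : SchwartzMap ℝ ℂ), b.continuous, fun t => b.nonneg, fun t => b.le_one, fun t ht => ?_,
    fun t ht => ?_, (𝓕 f).continuous, (𝓕 f).integrable, fun r => ?_, fun t => ?_⟩
  · exact b.zero_of_le_dist (by simpa [b] using ht)
  · exact b.one_of_mem_closedBall (by simpa [b] using ht)
  · refine ⟨2 ^ r * ((Finset.Iic ((r, 0) : ℕ × ℕ)).sup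
      (fun m => SchwartzMap.seminorm ℝ m.1 m.2)) (𝓕 f) + 1, ?_, fun ξ => ?_⟩
    · positivity
    · have := SchwartzMap.one_add_le_sup_seminorm_apply (𝕜 := ℝ) (m := (r, 0)) le_rfl le_rfl (𝓕 f) ξ
      simp only [norm_iteratedFDeriv_zero, Real.norm_eq_abs] at this
      linarith
  · have h := congrFun (Continuous.fourierInv_fourier_eq f.continuous f.integrable
      (𝓕 f).integrable) t
    rw [← hf, ← h, Real.fourierInv_eq']
    refine MeasureTheory.integral_congr_ae (Filter.Eventually.of_forall fun ξ => ?_)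
    simp only [ee, smul_eq_mul, RCLike.inner_apply, conj_trivial]
    rw [mul_comm, SchwartzMap.fourier_coe]
    congr 2
    push_cast
    ring

namespace IsKernel

variable {ψ : ℝ → ℝ} {Ψ : ℝ → ℂ}

lemma integrable_scaled (h : IsKernel ψ Ψ) {ε : ℝ} (hε : 0 < ε) :
    MeasureTheory.Integrable fun x : ℝ => (ε : ℂ) * Ψ (ε * x) :=
  (h.integrable_hat.comp_mul_left' hε.ne').const_mul _

lemma continuous_scaled (h : IsKernel ψ Ψ) (ε : ℝ) :
    Continuous fun x : ℝ => (ε : ℂ) * Ψ (ε * x) := by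
  have := h.continuous_hat
  fun_prop

lemma inversion_scaled (h : IsKernel ψ Ψ) {ε : ℝ} (hε : 0 < ε) (t : ℝ) :
    (ψ (t / ε) : ℂ) = ∫ x : ℝ, (ε : ℂ) * Ψ (ε * x) * ee (x * t) := by
  rw [h.inversion]
  have h1 := MeasureTheory.Measure.integral_comp_mul_left
    (fun ξ : ℝ => Ψ ξ * ee (ξ * (t / ε))) ε
  have h2 : ∀ x : ℝ, (ε : ℂ) * Ψ (ε * x) * ee (x * t) =
      (ε : ℂ) * (Ψ (ε * x) * ee (ε * x * (t / ε))) := fun x => by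
    rw [show ε * x * (t / ε) = x * t by field_simp, mul_assoc]
  simp only [h2]
  rw [MeasureTheory.integral_const_mul, h1, abs_of_pos (inv_pos.2 hε), Complex.real_smul,
    ← mul_assoc, ← Complex.ofReal_mul, mul_inv_cancel₀ hε.ne', Complex.ofReal_one, one_mul]

lemma exists_norm_scaled_le (h : IsKernel ψ Ψ) (r : ℕ) :
    ∃ C : ℝ, 0 < C ∧ ∀ ε x : ℝ, 0 < ε → ‖(ε : ℂ) * Ψ (ε * x)‖ ≤ C * ε / (1 + ε * |x|) ^ r := by
  obtain ⟨C, hC, hd⟩ := h.decay r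
  refine ⟨C, hC, fun ε x hε => ?_⟩
  have := hd (ε * x)
  rw [abs_mul, abs_of_pos hε] at this
  rw [norm_mul, Complex.norm_real, Real.norm_of_nonneg hε.le, le_div_iff₀ (by positivity)]
  calc ε * ‖Ψ (ε * x)‖ * (1 + ε * |x|) ^ r = ε * ((1 + ε * |x|) ^ r * ‖Ψ (ε * x)‖) := by ring
    _ ≤ ε * C := by gcongr
    _ = C * ε := by ring

end IsKernel

/-- The kernel whose Fourier transform detects values within `ε` of `N`. -/
noncomputable def countKernel (Ψ : ℝ → ℂ) (ε N x : ℝ) : ℂ :=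
  (ε : ℂ) * Ψ (ε * x) * ee (x * -N)

lemma norm_countKernel (Ψ : ℝ → ℂ) (ε N x : ℝ) :
    ‖countKernel Ψ ε N x‖ = ‖(ε : ℂ) * Ψ (ε * x)‖ := by
  rw [countKernel, norm_mul, norm_ee, mul_one]

namespace IsKernel

variable {ψ : ℝ → ℝ} {Ψ : ℝ → ℂ}

lemma continuous_countKernel (h : IsKernel ψ Ψ) (ε N : ℝ) : Continuous (countKernel Ψ ε N) :=
  (h.continuous_scaled ε).mul (continuous_ee.comp (continuous_id.mul continuous_const))

lemma integrable_countKernel (h : IsKernel ψ Ψ) {ε : ℝ} (hε : 0 < ε) (N : ℝ) :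
    MeasureTheory.Integrable (countKernel Ψ ε N) :=
  (h.integrable_scaled hε).mono (h.continuous_countKernel ε N).aestronglyMeasurable
    (Filter.Eventually.of_forall fun x => (norm_countKernel Ψ ε N x).le)

lemma integrable_mul_countKernel (h : IsKernel ψ Ψ) {ε : ℝ} (hε : 0 < ε) (N : ℝ) {F : ℝ → ℂ}
    (hF : Continuous F) {M : ℝ} (hM : ∀ x, ‖F x‖ ≤ M) :
    MeasureTheory.Integrable fun x => F x * countKernel Ψ ε N x :=
  (h.integrable_countKernel hε N).bdd_mul hF.aestronglyMeasurable
    (Filter.Eventually.of_forall hM)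

lemma integral_ee_mul_countKernel (h : IsKernel ψ Ψ) {ε : ℝ} (hε : 0 < ε) (N t : ℝ) :
    ∫ x : ℝ, ee (x * t) * countKernel Ψ ε N x = (ψ ((t - N) / ε) : ℂ) := by
  rw [h.inversion_scaled hε]
  refine MeasureTheory.integral_congr_ae (Filter.Eventually.of_forall fun x => ?_)
  simp only [countKernel]
  rw [show x * (t - N) = x * t + x * -N by ring, ee_add]
  ring

lemma integral_expSum_mul_countKernel (h : IsKernel ψ Ψ) {ε : ℝ} (hε : 0 < ε) (N : ℝ)
    {ι : Type*} (D : Finset ι) (f : ι → ℝ) (a : ι → ℝ) :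
    ∫ x : ℝ, expSum D f (fun i => (a i : ℂ)) x * countKernel Ψ ε N x =
      ((∑ i ∈ D, a i * ψ ((f i - N) / ε) : ℝ) : ℂ) := by
  have hi : ∀ i ∈ D, MeasureTheory.Integrable
      fun x : ℝ => (a i : ℂ) * (ee (x * f i) * countKernel Ψ ε N x) := fun i _ =>
    (h.integrable_mul_countKernel hε N (M := 1)
      (continuous_ee.comp (continuous_id.mul continuous_const))
      fun x => (norm_ee _).le).const_mul _
  simp only [expSum, Finset.sum_mul, mul_assoc]
  rw [MeasureTheory.integral_finsetSum _ hi]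
  push_cast
  refine Finset.sum_congr rfl fun i _ => ?_
  rw [MeasureTheory.integral_const_mul, h.integral_ee_mul_countKernel hε]

end IsKernel

lemma expSum_mul_expSum {ι κ : Type*} (D : Finset ι) (f : ι → ℝ) (a : ι → ℝ) (E : Finset κ)
    (g : κ → ℝ) (b : κ → ℝ) (x : ℝ) :
    expSum D f (fun i => (a i : ℂ)) x * expSum E g (fun i => (b i : ℂ)) x =
      expSum (D ×ˢ E) (fun p => f p.1 + g p.2) (fun p => ((a p.1 * b p.2 : ℝ) : ℂ)) x := by
  rw [expSum, expSum, expSum, Finset.sum_mul_sum, Finset.sum_product]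
  refine Finset.sum_congr rfl fun i _ => Finset.sum_congr rfl fun j _ => ?_
  rw [mul_add x, ee_add]
  push_cast
  ring

lemma primeWeight_nonneg {φ : ℝ → ℝ} (hφ : IsCutoff φ) (X : ℝ) (n : ℕ) :
    0 ≤ primeWeight φ X n := by
  rw [primeWeight]
  split_ifs
  · exact mul_nonneg (hφ.nonneg _) (Real.log_natCast_nonneg n)
  · simp

lemma primeWeight_le_log {φ : ℝ → ℝ} (hφ : IsCutoff φ) (X : ℝ) (n : ℕ) :
    primeWeight φ X n ≤ Real.log n := by
  rw [primeWeight]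
  have := Real.log_natCast_nonneg n
  split_ifs
  · exact mul_le_of_le_one_left this (hφ.le_one _)
  · simpa

lemma mem_primesIn {X : ℝ} {n : ℕ} : n ∈ primesIn X ↔ n.Prime ∧ X < n ∧ (n : ℝ) ≤ 2 * X := by
  rw [primesIn, Finset.mem_filter, and_iff_right_iff_imp, Finset.mem_range]
  rintro ⟨-, -, h⟩
  exact Nat.lt_succ_of_le (Nat.le_floor h)

lemma sum_four_primeWeight_le {ψ : ℝ → ℝ} {Ψ : ℝ → ℂ} (h : IsKernel ψ Ψ) {φ : ℝ → ℝ}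
    (hφ : IsCutoff φ) (c : ℝ) {X ε : ℝ} (hX : 0 ≤ X) (hε : 0 < ε) (N : ℝ) :
    ∑ q ∈ (dyad X ×ˢ dyad X) ×ˢ (dyad X ×ˢ dyad X),
      primeWeight φ X q.1.1 * primeWeight φ X q.1.2 *
        (primeWeight φ X q.2.1 * primeWeight φ X q.2.2) *
        ψ (((q.1.1 : ℝ) ^ c + (q.1.2 : ℝ) ^ c + ((q.2.1 : ℝ) ^ c + (q.2.2 : ℝ) ^ c) - N) / ε) ≤
      B₄ c X ε N := by
  have hsub : primesIn X ⊆ dyad X := fun n hn => by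
    rw [mem_primesIn] at hn
    exact (mem_dyad hX).2 hn.2
  have hz : ∀ n ∈ dyad X, n ∉ primesIn X → primeWeight φ X n = 0 := fun n hn hn' => by
    rw [mem_primesIn, ← mem_dyad hX] at hn'
    rw [primeWeight, if_neg fun hp => hn' ⟨hp, hn⟩, mul_zero]
  rw [← Finset.sum_subset (Finset.product_subset_product
    (Finset.product_subset_product hsub hsub) (Finset.product_subset_product hsub hsub))]
  · rw [Finset.sum_product, Finset.sum_product, B₄]
    refine Finset.sum_le_sum fun p₁ _ => Finset.sum_le_sum fun p₂ _ => ?_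
    rw [Finset.sum_product]
    refine Finset.sum_le_sum fun p₃ _ => Finset.sum_le_sum fun p₄ _ => ?_
    dsimp only
    have hw := primeWeight_nonneg hφ X
    have hl := primeWeight_le_log hφ X
    have hlog := Real.log_natCast_nonneg
    split_ifs with hcond
    · calc _ ≤ primeWeight φ X p₁ * primeWeight φ X p₂ *
            (primeWeight φ X p₃ * primeWeight φ X p₄) * 1 := by
            refine mul_le_mul_of_nonneg_left (h.le_one _) ?_
            have := hw p₁; have := hw p₂; have := hw p₃; have := hw p₄
            positivity
        _ ≤ Real.log p₁ * Real.log p₂ * (Real.log p₃ * Real.log p₄) := by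
            rw [mul_one]
            have h12 := mul_nonneg (hw p₃) (hw p₄)
            have h34 := mul_nonneg (hlog p₁) (hlog p₂)
            exact mul_le_mul (mul_le_mul (hl _) (hl _) (hw _) (hlog _))
              (mul_le_mul (hl _) (hl _) (hw _) (hlog _)) h12 h34
        _ = _ := by ring
    · rw [h.eq_zero, mul_zero]
      rw [abs_div, abs_of_pos hε, le_div_iff₀ hε, one_mul, ← add_assoc]
      exact not_lt.1 hcond
  · intro q hq hq'
    simp only [Finset.mem_product] at hq hq'
    by_cases h1 : q.1.1 ∈ primesIn X
    · by_cases h2 : q.1.2 ∈ primesIn X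
      · by_cases h3 : q.2.1 ∈ primesIn X
        · have h4 : q.2.2 ∉ primesIn X := fun h4 => hq' ⟨⟨h1, h2⟩, h3, h4⟩
          simp [hz _ hq.2.2 h4]
        · simp [hz _ hq.2.1 h3]
      · simp [hz _ hq.1.2 h2]
    · simp [hz _ hq.1.1 h1]

/-- The weighted count dominates the Fourier integral of the smoothed sums. -/
lemma re_integral_primeSum_le {ψ : ℝ → ℝ} {Ψ : ℝ → ℂ} (h : IsKernel ψ Ψ) {φ : ℝ → ℝ}
    (hφ : IsCutoff φ) (c : ℝ) {X ε : ℝ} (hX : 0 ≤ X) (hε : 0 < ε) (N : ℝ) :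
    (∫ x : ℝ, primeSum φ c X x ^ 4 * countKernel Ψ ε N x).re ≤ B₄ c X ε N := by
  have e : ∀ x, primeSum φ c X x ^ 4 = expSum ((dyad X ×ˢ dyad X) ×ˢ (dyad X ×ˢ dyad X))
      (fun q => (q.1.1 : ℝ) ^ c + (q.1.2 : ℝ) ^ c + ((q.2.1 : ℝ) ^ c + (q.2.2 : ℝ) ^ c))
      (fun q => ((primeWeight φ X q.1.1 * primeWeight φ X q.1.2 *
        (primeWeight φ X q.2.1 * primeWeight φ X q.2.2) : ℝ) : ℂ)) x := fun x => by
    rw [show primeSum φ c X x ^ 4 = (primeSum φ c X x * primeSum φ c X x) *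
      (primeSum φ c X x * primeSum φ c X x) by ring, primeSum, expSum_mul_expSum,
      expSum_mul_expSum]
  simp only [e]
  rw [h.integral_expSum_mul_countKernel hε, Complex.ofReal_re]
  exact sum_four_primeWeight_le h hφ c hX hε N

lemma exists_integral_inv_one_add_sq_le : ∃ J : ℝ, 0 < J ∧ ∀ A : ℝ, 0 < A →
    MeasureTheory.Integrable (fun x : ℝ => ((1 + A * |x|) ^ 2)⁻¹) ∧
      ∫ x : ℝ, ((1 + A * |x|) ^ 2)⁻¹ ≤ J / A := by
  have h0 : MeasureTheory.Integrable (fun x : ℝ => ((1 + |x|) ^ 2)⁻¹) := by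
    have := integrable_one_add_norm (E := ℝ) (μ := MeasureTheory.volume) (r := 2) (by simp)
    refine this.congr (Filter.Eventually.of_forall fun x => ?_)
    dsimp only
    rw [Real.rpow_neg (by positivity), Real.norm_eq_abs]
    norm_cast
  have hnn : 0 ≤ ∫ x : ℝ, ((1 + |x|) ^ 2)⁻¹ :=
    MeasureTheory.integral_nonneg fun x => by positivity
  refine ⟨(∫ x : ℝ, ((1 + |x|) ^ 2)⁻¹) + 1, by positivity, fun A hA => ?_⟩
  have e : (fun x : ℝ => ((1 + A * |x|) ^ 2)⁻¹) = fun x : ℝ => ((1 + |A * x|) ^ 2)⁻¹ := by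
    ext x
    rw [abs_mul, abs_of_pos hA]
  rw [e]
  refine ⟨h0.comp_mul_left' hA.ne', ?_⟩
  rw [MeasureTheory.Measure.integral_comp_mul_left (fun x : ℝ => ((1 + |x|) ^ 2)⁻¹),
    abs_of_pos (inv_pos.2 hA), smul_eq_mul, div_eq_inv_mul]
  gcongr
  linarith

lemma IsKernel.norm_setIntegral_tail_le {ψ : ℝ → ℝ} {Ψ : ℝ → ℂ} (h : IsKernel ψ Ψ)
    {c : ℝ} (hc2 : c < 2) {φ : ℝ → ℝ} (hφ : IsCutoff φ) :
    ∃ C : ℝ, 0 < C ∧ ∃ X₀ : ℝ, 3 ≤ X₀ ∧ ∀ X N ε : ℝ, X₀ ≤ X → ε = (Real.log X ^ 2)⁻¹ →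
      ‖∫ x in {x : ℝ | X ^ (1 / 1000 : ℝ) < |x|}, primeSum φ c X x ^ 4 * countKernel Ψ ε N x‖ ≤
        C * (ε * X ^ (4 - c) / Real.log X) := by
  obtain ⟨C, hC, hd⟩ := h.exists_norm_scaled_le 10002
  obtain ⟨J, hJ, hJi⟩ := exists_integral_inv_one_add_sq_le
  obtain ⟨X₁, hX₁⟩ := Filter.eventually_atTop.1
    (eventually_pow_log_le_rpow 3 (η := 1 / 2000) (by norm_num))
  refine ⟨4 ^ 4 * C * J, by positivity, max 3 X₁, le_max_left _ _, fun X N ε hX hε => ?_⟩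
  have hX3 : 3 ≤ X := (le_max_left _ _).trans hX
  have hlog := hX₁ X ((le_max_right _ _).trans hX)
  have hX0 : 0 < X := by linarith
  have hL1 : 1 ≤ Real.log X := one_le_log_of_three_le (by linarith)
  have hL0 : 0 < Real.log X := by linarith
  have hε0 : 0 < ε := by rw [hε]; positivity
  obtain ⟨hi, hJle⟩ := hJi ε hε0
  have hmeas : MeasurableSet {x : ℝ | X ^ (1 / 1000 : ℝ) < |x|} :=
    measurableSet_lt measurable_const continuous_abs.measurable
  have hpt : ∀ x ∈ {x : ℝ | X ^ (1 / 1000 : ℝ) < |x|},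
      ‖primeSum φ c X x ^ 4 * countKernel Ψ ε N x‖ ≤
        4 ^ 4 * C * (X⁻¹ * ε) * ((1 + ε * |x|) ^ 2)⁻¹ := by
    intro x hx
    have hx' : X ^ (1 / 1000 : ℝ) < |x| := hx
    have hb : X ^ (1 / 2000 : ℝ) ≤ 1 + ε * |x| := by
      have e1 : X ^ (1 / 1000 : ℝ) = X ^ (1 / 2000 : ℝ) * X ^ (1 / 2000 : ℝ) := by
        rw [← Real.rpow_add hX0]; norm_num
      have e2 : Real.log X ^ 2 ≤ X ^ (1 / 2000 : ℝ) :=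
        (pow_le_pow_right₀ hL1 (by norm_num)).trans hlog
      have e3 : X ^ (1 / 2000 : ℝ) ≤ ε * X ^ (1 / 1000 : ℝ) := by
        rw [hε, e1, inv_mul_eq_div, le_div_iff₀ (by positivity)]
        gcongr
      nlinarith
    have hb2 : X ^ 5 ≤ (1 + ε * |x|) ^ 10000 := by
      calc X ^ 5 = (X ^ (1 / 2000 : ℝ)) ^ 10000 := by
            rw [← Real.rpow_natCast, ← Real.rpow_natCast, ← Real.rpow_mul hX0.le]
            norm_num
        _ ≤ _ := by gcongr
    rw [norm_mul, norm_pow, norm_countKernel]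
    have hp : 0 < 1 + ε * |x| := by positivity
    calc _ ≤ (4 * X) ^ 4 * (C * ε / (1 + ε * |x|) ^ 10002) := by
          gcongr
          · exact norm_primeSum_le hφ hX3 x
          · exact hd ε x hε0
      _ = (4 * X) ^ 4 * (C * ε / ((1 + ε * |x|) ^ 10000 * (1 + ε * |x|) ^ 2)) := by
          rw [← pow_add]
      _ ≤ (4 * X) ^ 4 * (C * ε / (X ^ 5 * (1 + ε * |x|) ^ 2)) := by gcongr
      _ = _ := by field_simp
  refine (MeasureTheory.norm_integral_le_of_norm_le
    ((hi.const_mul (4 ^ 4 * C * (X⁻¹ * ε))).integrableOn)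
    ((MeasureTheory.ae_restrict_iff' hmeas).2 (Filter.Eventually.of_forall hpt))).trans ?_
  calc _ ≤ ∫ x : ℝ, 4 ^ 4 * C * (X⁻¹ * ε) * ((1 + ε * |x|) ^ 2)⁻¹ :=
        MeasureTheory.setIntegral_le_integral (hi.const_mul _)
          (Filter.Eventually.of_forall fun x => by positivity)
    _ ≤ 4 ^ 4 * C * (X⁻¹ * ε) * (J / ε) := by
        rw [MeasureTheory.integral_const_mul]
        gcongr
    _ = 4 ^ 4 * C * J * X⁻¹ := by field_simp
    _ ≤ _ := by
        gcongr
        have h3 : Real.log X ^ 3 ≤ X := hlog.trans (by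
          conv_rhs => rw [← Real.rpow_one X]
          exact Real.rpow_le_rpow_of_exponent_le (by linarith) (by norm_num))
        have h4 : (1 : ℝ) ≤ X ^ (4 - c) := Real.one_le_rpow (by linarith) (by linarith)
        rw [hε, show (Real.log X ^ 2)⁻¹ * X ^ (4 - c) / Real.log X =
          (Real.log X ^ 3)⁻¹ * X ^ (4 - c) by field_simp]
        calc X⁻¹ ≤ (Real.log X ^ 3)⁻¹ * 1 := by
              rw [mul_one]
              exact inv_anti₀ (by positivity) h3
          _ ≤ _ := by gcongr

lemma IsKernel.norm_setIntegral_minor_le {ψ : ℝ → ℝ} {Ψ : ℝ → ℂ} (h : IsKernel ψ Ψ)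
    {c : ℝ} (hc : 1 < c) (hc2 : c < 1193 / 889) {φ : ℝ → ℝ} (hφ : IsCutoff φ) :
    ∃ C : ℝ, 0 < C ∧ ∃ X₀ : ℝ, 3 ≤ X₀ ∧ ∀ X N ε : ℝ, X₀ ≤ X → 0 < ε →
      ‖∫ x in {x : ℝ | Real.log X ^ 40 < |x| * X ^ c ∧ |x| ≤ X ^ (1 / 1000 : ℝ)},
        primeSum φ c X x ^ 4 * countKernel Ψ ε N x‖ ≤
          C * (ε * X ^ (4 - c) / Real.log X) := by
  obtain ⟨C, hC, hd⟩ := h.exists_norm_scaled_le 0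
  obtain ⟨C1, hC1, X₁, hX₁, hS⟩ := norm_primeSum_minor hc (by linarith) hφ
  obtain ⟨C2, hC2, X₂, h4⟩ := fourth_moment_minor hc hc2
  obtain ⟨X₃, hX₃⟩ := Filter.eventually_atTop.1
    (eventually_pow_log_le_rpow 5 (η := 1 / 50) (by norm_num))
  refine ⟨C * C2 * (4 * C1 ^ 2 + 16), by positivity, max X₁ (max X₂ X₃),
    hX₁.trans (le_max_left _ _), fun X N ε hX hε0 => ?_⟩
  have hXX₁ : X₁ ≤ X := (le_max_left _ _).trans hX
  have hXX₂ : X₂ ≤ X := ((le_max_left _ _).trans (le_max_right _ _)).trans hX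
  have hlog := hX₃ X (((le_max_right _ _).trans (le_max_right _ _)).trans hX)
  have hX3 : 3 ≤ X := hX₁.trans hXX₁
  have hX0 : 0 < X := by linarith
  have hL1 : 1 ≤ Real.log X := one_le_log_of_three_le (by linarith)
  have hL0 : 0 < Real.log X := by linarith
  set m : Set ℝ := {x : ℝ | Real.log X ^ 40 < |x| * X ^ c ∧ |x| ≤ X ^ (1 / 1000 : ℝ)} with hm
  have hmeas : MeasurableSet m :=
    (measurableSet_lt measurable_const (continuous_abs.measurable.mul_const (X ^ c))).inter
      (measurableSet_le continuous_abs.measurable measurable_const)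
  have hmsub : m ⊆ Set.Icc (-(X ^ (1 / 1000 : ℝ))) (X ^ (1 / 1000 : ℝ)) := fun x hx =>
    abs_le.1 hx.2
  have hSm : ∀ x ∈ m, ‖primeSum φ c X x‖ ≤ C1 * X / Real.log X ^ 5 := by
    intro x hx
    refine hS X x hXX₁ hx.1.le ?_
    calc |x| * X ^ c ≤ X ^ (1 / 1000 : ℝ) * X ^ c := by gcongr; exact hx.2
      _ = X ^ (1 / 1000 + c) := by rw [Real.rpow_add hX0]
      _ ≤ _ := Real.rpow_le_rpow_of_exponent_le (by linarith) (by linarith)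
  have hA : ∀ n ∈ dyad X, ‖(primeWeight φ X n : ℂ)‖ ≤ 2 * Real.log X := by
    intro n hn
    rw [mem_dyad hX0.le] at hn
    rw [Complex.norm_real, Real.norm_of_nonneg (primeWeight_nonneg hφ X n)]
    refine (primeWeight_le_log hφ X n).trans ?_
    calc Real.log n ≤ Real.log (X ^ 2) :=
          Real.log_le_log (hX0.trans hn.1) (by nlinarith [hn.2])
      _ = _ := by rw [Real.log_pow]; norm_num
  have hmain := h4 X hXX₂ (fun n => (primeWeight φ X n : ℂ)) (2 * Real.log X)
    (C1 * X / Real.log X ^ 5) m hA hmeas hmsub hSm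
  have hcont : Continuous fun x => ‖primeSum φ c X x‖ ^ 4 :=
    (continuous_expSum _ _ _).norm.pow 4
  have hint : MeasureTheory.IntegrableOn (fun x => ‖primeSum φ c X x‖ ^ 4) m :=
    (hcont.integrableOn_Icc).mono_set hmsub
  have hpt : ∀ x ∈ m, ‖primeSum φ c X x ^ 4 * countKernel Ψ ε N x‖ ≤
      C * ε * ‖primeSum φ c X x‖ ^ 4 := by
    intro x _
    rw [norm_mul, norm_pow, norm_countKernel, mul_comm]
    gcongr
    simpa using hd ε x hε0
  refine (MeasureTheory.norm_integral_le_of_norm_le (hint.const_mul (C * ε))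
    ((MeasureTheory.ae_restrict_iff' hmeas).2 (Filter.Eventually.of_forall hpt))).trans ?_
  rw [MeasureTheory.integral_const_mul]
  refine (mul_le_mul_of_nonneg_left hmain (by positivity)).trans ?_
  have e1 : (2 * Real.log X) ^ 2 * (C1 * X / Real.log X ^ 5) ^ 2 * X ^ (2 - c) * Real.log X ≤
      4 * C1 ^ 2 * (X ^ (4 - c) / Real.log X) := by
    have : X ^ (4 - c) = X ^ 2 * X ^ (2 - c) := by
      rw [← Real.rpow_natCast, ← Real.rpow_add hX0]; congr 1; push_cast; ring
    rw [this, show (2 * Real.log X) ^ 2 * (C1 * X / Real.log X ^ 5) ^ 2 * X ^ (2 - c) *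
      Real.log X = 4 * C1 ^ 2 * (X ^ 2 * X ^ (2 - c) / Real.log X ^ 7) by field_simp; ring]
    gcongr
    exact le_self_pow₀ hL1 (by norm_num)
  have e2 : (2 * Real.log X) ^ 4 * X ^ (4 - c - 1 / 50) ≤ 16 * (X ^ (4 - c) / Real.log X) := by
    rw [Real.rpow_sub hX0 (4 - c), mul_pow, mul_div_assoc', div_le_iff₀ (by positivity)]
    calc 2 ^ 4 * Real.log X ^ 4 * X ^ (4 - c) =
          16 * (X ^ (4 - c) / Real.log X) * Real.log X ^ 5 := by field_simp; norm_num
      _ ≤ _ := by gcongr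
  calc C * ε * (C2 * _) ≤ C * ε * (C2 * (4 * C1 ^ 2 * (X ^ (4 - c) / Real.log X) +
        16 * (X ^ (4 - c) / Real.log X))) := by gcongr
    _ = _ := by ring

lemma continuous_smoothInt {φ : ℝ → ℝ} (hφ : IsCutoff φ) {c : ℝ} (hc : 0 ≤ c) {X : ℝ}
    (hX : 0 < X) : Continuous (smoothInt φ c X) := by
  refine MeasureTheory.continuous_of_dominated
    (bound := fun t => ‖(φ (t / X) : ℂ) * ee (0 * t ^ c)‖)
    (fun x => (integrable_cutoff_mul_ee hφ hc hX x).aestronglyMeasurable)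
    (fun x => Filter.Eventually.of_forall fun t => ?_)
    (integrable_cutoff_mul_ee hφ hc hX 0).norm
    (Filter.Eventually.of_forall fun t => ?_)
  · simp only [norm_mul, norm_ee, le_refl]
  · exact continuous_const.mul (continuous_ee.comp (continuous_id.mul continuous_const))

lemma continuous_primeSum (φ : ℝ → ℝ) (c X : ℝ) : Continuous (primeSum φ c X) :=
  continuous_expSum _ _ _

lemma IsKernel.norm_setIntegral_major_le {ψ : ℝ → ℝ} {Ψ : ℝ → ℂ} (h : IsKernel ψ Ψ)
    {c : ℝ} (hc : 1 < c) (hc2 : c < 2) {φ : ℝ → ℝ} (hφ : IsCutoff φ) :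
    ∃ C : ℝ, 0 < C ∧ ∃ X₀ : ℝ, 3 ≤ X₀ ∧ ∀ X N ε : ℝ, X₀ ≤ X → 0 < ε →
      ‖∫ x in {x : ℝ | |x| * X ^ c ≤ Real.log X ^ 40},
        (primeSum φ c X x ^ 4 - smoothInt φ c X x ^ 4) * countKernel Ψ ε N x‖ ≤
          C * (ε * X ^ (4 - c) / Real.log X) := by
  obtain ⟨C, hC, hd⟩ := h.exists_norm_scaled_le 0
  obtain ⟨C1, hC1, X₁, hX₁, hS⟩ := primeSum_sub_smoothInt 130 hc hc2 hφ
  refine ⟨4 * C1 * 5 * 17 * C * 2, by positivity, X₁, hX₁, fun X N ε hX hε0 => ?_⟩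
  have hX3 : 3 ≤ X := hX₁.trans hX
  have hX0 : 0 < X := by linarith
  have hL1 : 1 ≤ Real.log X := one_le_log_of_three_le (by linarith)
  have hL0 : 0 < Real.log X := by linarith
  have hXc : 0 < X ^ c := Real.rpow_pos_of_pos hX0 c
  have hset : {x : ℝ | |x| * X ^ c ≤ Real.log X ^ 40} =
      Set.Icc (-(Real.log X ^ 40 / X ^ c)) (Real.log X ^ 40 / X ^ c) := by
    ext x
    rw [Set.mem_Icc, ← abs_le, le_div_iff₀ hXc]
    rfl
  rw [hset]
  have hvol : (MeasureTheory.volume : MeasureTheory.Measure ℝ).real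
      (Set.Icc (-(Real.log X ^ 40 / X ^ c)) (Real.log X ^ 40 / X ^ c)) =
        2 * (Real.log X ^ 40 / X ^ c) := by
    rw [Real.volume_real_Icc_of_le (by linarith [show 0 ≤ Real.log X ^ 40 / X ^ c by positivity])]
    ring
  have hpt : ∀ x ∈ Set.Icc (-(Real.log X ^ 40 / X ^ c)) (Real.log X ^ 40 / X ^ c),
      ‖(primeSum φ c X x ^ 4 - smoothInt φ c X x ^ 4) * countKernel Ψ ε N x‖ ≤
        (4 * C1 * X / Real.log X ^ 50) * (5 * X) * (17 * X ^ 2) * (C * ε) := by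
    intro x hx
    rw [← hset] at hx
    have hx' : |x| * X ^ c ≤ Real.log X ^ 40 := hx
    have hδ : ‖primeSum φ c X x - smoothInt φ c X x‖ ≤ 4 * C1 * X / Real.log X ^ 50 := by
      refine (hS X x hX).trans ?_
      have h40 : (1 : ℝ) ≤ Real.log X ^ 40 := one_le_pow₀ hL1
      calc C1 * X * (1 + |x| * X ^ c) ^ 2 / Real.log X ^ 130 ≤
            C1 * X * (2 * Real.log X ^ 40) ^ 2 / Real.log X ^ 130 := by
            gcongr
            linarith
        _ = _ := by field_simp; norm_num
    have hs := norm_primeSum_le hφ (c := c) hX3 x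
    have hI := norm_smoothInt_le hφ (c := c) hX0 x
    have h5 : ‖primeSum φ c X x + smoothInt φ c X x‖ ≤ 5 * X :=
      (norm_add_le _ _).trans (by linarith)
    have h17 : ‖primeSum φ c X x ^ 2 + smoothInt φ c X x ^ 2‖ ≤ 17 * X ^ 2 := by
      refine (norm_add_le _ _).trans ?_
      rw [norm_pow, norm_pow]
      calc _ ≤ (4 * X) ^ 2 + X ^ 2 := by gcongr
        _ = _ := by ring
    rw [show primeSum φ c X x ^ 4 - smoothInt φ c X x ^ 4 =
      (primeSum φ c X x - smoothInt φ c X x) * (primeSum φ c X x + smoothInt φ c X x) *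
        (primeSum φ c X x ^ 2 + smoothInt φ c X x ^ 2) by ring, norm_mul, norm_mul, norm_mul,
      norm_countKernel]
    gcongr
    simpa using hd ε x hε0
  refine (MeasureTheory.norm_setIntegral_le_of_norm_le_const
    measure_Icc_lt_top hpt).trans ?_
  rw [hvol]
  have e : X ^ (4 - c) = X ^ 4 / X ^ c := by
    rw [Real.rpow_sub hX0]; norm_cast
  rw [e]
  calc _ = 4 * C1 * 5 * 17 * C * 2 * (ε * (X ^ 4 / X ^ c) / Real.log X ^ 10) := by
        field_simp
    _ ≤ _ := by
        gcongr
        exact le_self_pow₀ hL1 (by norm_num)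

lemma IsKernel.norm_setIntegral_smoothInt_le {ψ : ℝ → ℝ} {Ψ : ℝ → ℂ} (h : IsKernel ψ Ψ)
    {c : ℝ} (hc : 1 < c) (hc2 : c < 2) {φ : ℝ → ℝ} (hφ : IsCutoff φ) :
    ∃ C : ℝ, 0 < C ∧ ∀ X N ε : ℝ, 3 ≤ X → 0 < ε →
      ‖∫ x in {x : ℝ | |x| * X ^ c ≤ Real.log X ^ 40}ᶜ,
        smoothInt φ c X x ^ 4 * countKernel Ψ ε N x‖ ≤
          C * (ε * X ^ (4 - c) / Real.log X) := by
  obtain ⟨C, hC, hd⟩ := h.exists_norm_scaled_le 0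
  obtain ⟨C1, hC1, hI⟩ := norm_smoothInt_le_div hc hc2 hφ
  obtain ⟨J, hJ, hJi⟩ := exists_integral_inv_one_add_sq_le
  refine ⟨C1 ^ 4 * C * J, by positivity, fun X N ε hX3 hε0 => ?_⟩
  have hX0 : 0 < X := by linarith
  have hL1 : 1 ≤ Real.log X := one_le_log_of_three_le (by linarith)
  have hL0 : 0 < Real.log X := by linarith
  have hXc : 0 < X ^ c := Real.rpow_pos_of_pos hX0 c
  obtain ⟨hi, hJle⟩ := hJi (X ^ c) hXc
  have hmeas : MeasurableSet {x : ℝ | |x| * X ^ c ≤ Real.log X ^ 40}ᶜ :=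
    (measurableSet_le (continuous_abs.measurable.mul_const (X ^ c)) measurable_const).compl
  have hpt : ∀ x ∈ {x : ℝ | |x| * X ^ c ≤ Real.log X ^ 40}ᶜ,
      ‖smoothInt φ c X x ^ 4 * countKernel Ψ ε N x‖ ≤
        (C1 ^ 4 * X ^ 4 / Real.log X) * (C * ε) * ((1 + X ^ c * |x|) ^ 2)⁻¹ := by
    intro x hx
    have hx' : Real.log X ^ 40 < |x| * X ^ c := not_le.1 hx
    have hle : Real.log X ≤ (1 + X ^ c * |x|) ^ 2 := by
      have h1 : Real.log X ≤ Real.log X ^ 40 := le_self_pow₀ hL1 (by norm_num)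
      have h2 : Real.log X ≤ 1 + X ^ c * |x| := by linarith [mul_comm (X ^ c) |x|]
      exact h2.trans (le_self_pow₀ (hL1.trans h2) (by norm_num))
    rw [norm_mul, norm_pow, norm_countKernel]
    calc _ ≤ (C1 * X / (1 + |x| * X ^ c)) ^ 4 * (C * ε) := by
          gcongr
          · exact hI X x hX3
          · simpa using hd ε x hε0
      _ = C1 ^ 4 * X ^ 4 / (1 + X ^ c * |x|) ^ 2 * (C * ε) * ((1 + X ^ c * |x|) ^ 2)⁻¹ := by
          rw [mul_comm |x|]
          have : 0 < 1 + X ^ c * |x| := by positivity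
          field_simp
      _ ≤ _ := by gcongr
  refine (MeasureTheory.norm_integral_le_of_norm_le
    ((hi.const_mul ((C1 ^ 4 * X ^ 4 / Real.log X) * (C * ε))).integrableOn)
    ((MeasureTheory.ae_restrict_iff' hmeas).2 (Filter.Eventually.of_forall hpt))).trans ?_
  have e : X ^ (4 - c) = X ^ 4 / X ^ c := by
    rw [Real.rpow_sub hX0]; norm_cast
  calc _ ≤ ∫ x : ℝ, (C1 ^ 4 * X ^ 4 / Real.log X) * (C * ε) * ((1 + X ^ c * |x|) ^ 2)⁻¹ :=
        MeasureTheory.setIntegral_le_integral (hi.const_mul _)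
          (Filter.Eventually.of_forall fun x => by positivity)
    _ ≤ (C1 ^ 4 * X ^ 4 / Real.log X) * (C * ε) * (J / X ^ c) := by
        rw [MeasureTheory.integral_const_mul]
        gcongr
    _ = _ := by
        rw [e]
        field_simp

/-- The Fourier integral over primes agrees with its continuous analogue up to a logarithm. -/
lemma IsKernel.norm_integral_primeSum_sub_smoothInt_le {ψ : ℝ → ℝ} {Ψ : ℝ → ℂ}
    (h : IsKernel ψ Ψ) {c : ℝ} (hc : 1 < c) (hc2 : c < 1193 / 889) {φ : ℝ → ℝ}
    (hφ : IsCutoff φ) :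
    ∃ C : ℝ, 0 < C ∧ ∃ X₀ : ℝ, 3 ≤ X₀ ∧ ∀ X N ε : ℝ, X₀ ≤ X → ε = (Real.log X ^ 2)⁻¹ →
      ‖(∫ x : ℝ, primeSum φ c X x ^ 4 * countKernel Ψ ε N x) -
        ∫ x : ℝ, smoothInt φ c X x ^ 4 * countKernel Ψ ε N x‖ ≤
          C * (ε * X ^ (4 - c) / Real.log X) := by
  have hc2' : c < 2 := by linarith
  obtain ⟨C₁, hC₁, X₁, hX₁, h1⟩ := h.norm_setIntegral_tail_le hc2' hφ
  obtain ⟨C₂, hC₂, X₂, hX₂, h2⟩ := h.norm_setIntegral_minor_le hc hc2 hφ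
  obtain ⟨C₃, hC₃, X₃, hX₃, h3⟩ := h.norm_setIntegral_major_le hc hc2' hφ
  obtain ⟨C₄, hC₄, h4⟩ := h.norm_setIntegral_smoothInt_le hc hc2' hφ
  obtain ⟨X₅, hX₅⟩ := Filter.eventually_atTop.1
    (eventually_pow_log_le_rpow 40 (η := 1 / 1000) (by norm_num))
  refine ⟨C₁ + C₂ + C₃ + C₄, by positivity, max X₁ (max X₂ (max X₃ X₅)),
    hX₁.trans (le_max_left _ _), fun X N ε hX hε => ?_⟩
  simp only [max_le_iff] at hX
  obtain ⟨hX1, hX2, hX3', hX5⟩ := hX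
  have hX3 : 3 ≤ X := hX₁.trans hX1
  have hX0 : 0 < X := by linarith
  have hL0 : 0 < Real.log X := Real.log_pos (by linarith)
  have hε0 : 0 < ε := by rw [hε]; positivity
  set M : Set ℝ := {x : ℝ | |x| * X ^ c ≤ Real.log X ^ 40} with hM
  set m : Set ℝ := {x : ℝ | Real.log X ^ 40 < |x| * X ^ c ∧ |x| ≤ X ^ (1 / 1000 : ℝ)} with hm
  set T : Set ℝ := {x : ℝ | X ^ (1 / 1000 : ℝ) < |x|} with hT
  have hMmeas : MeasurableSet M :=
    measurableSet_le (continuous_abs.measurable.mul_const (X ^ c)) measurable_const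
  have hTmeas : MeasurableSet T := measurableSet_lt measurable_const continuous_abs.measurable
  have hcompl : Mᶜ = m ∪ T := by
    ext x
    simp only [hM, hm, hT, Set.mem_compl_iff, Set.mem_ofPred_eq, Set.mem_union, not_le]
    refine ⟨fun hx => ?_, ?_⟩
    · rcases le_or_gt |x| (X ^ (1 / 1000 : ℝ)) with h | h
      · exact Or.inl ⟨hx, h⟩
      · exact Or.inr h
    · rintro (hx | hx)
      · exact hx.1
      · calc Real.log X ^ 40 ≤ X ^ (1 / 1000 : ℝ) := hX₅ X hX5
          _ < |x| := hx
          _ ≤ |x| * X ^ c := le_mul_of_one_le_right (abs_nonneg x)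
            (Real.one_le_rpow (by linarith) (by linarith))
  have hdisj : Disjoint m T := by
    rw [Set.disjoint_left]
    intro x hx hx'
    exact absurd hx' (not_lt.2 hx.2)
  have hiS : MeasureTheory.Integrable fun x => primeSum φ c X x ^ 4 * countKernel Ψ ε N x :=
    h.integrable_mul_countKernel hε0 N ((continuous_primeSum φ c X).pow 4) (M := (4 * X) ^ 4)
      fun x => by
        rw [norm_pow]
        gcongr
        exact norm_primeSum_le hφ hX3 x
  have hiI : MeasureTheory.Integrable fun x => smoothInt φ c X x ^ 4 * countKernel Ψ ε N x :=
    h.integrable_mul_countKernel hε0 N ((continuous_smoothInt hφ (by linarith) hX0).pow 4)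
      (M := X ^ 4) fun x => by
        rw [norm_pow]
        gcongr
        exact norm_smoothInt_le hφ hX0 x
  have hsub : ∫ x in M, (primeSum φ c X x ^ 4 - smoothInt φ c X x ^ 4) * countKernel Ψ ε N x =
      (∫ x in M, primeSum φ c X x ^ 4 * countKernel Ψ ε N x) -
        ∫ x in M, smoothInt φ c X x ^ 4 * countKernel Ψ ε N x := by
    rw [← MeasureTheory.integral_sub hiS.integrableOn hiI.integrableOn]
    simp only [sub_mul]
  have hdec : (∫ x : ℝ, primeSum φ c X x ^ 4 * countKernel Ψ ε N x) -
      ∫ x : ℝ, smoothInt φ c X x ^ 4 * countKernel Ψ ε N x =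
      (∫ x in M, (primeSum φ c X x ^ 4 - smoothInt φ c X x ^ 4) * countKernel Ψ ε N x) +
      (∫ x in m, primeSum φ c X x ^ 4 * countKernel Ψ ε N x) +
      (∫ x in T, primeSum φ c X x ^ 4 * countKernel Ψ ε N x) -
      ∫ x in Mᶜ, smoothInt φ c X x ^ 4 * countKernel Ψ ε N x := by
    rw [← MeasureTheory.integral_add_compl hMmeas hiS, ← MeasureTheory.integral_add_compl hMmeas hiI,
      hsub, hcompl,
      MeasureTheory.setIntegral_union hdisj hTmeas hiS.integrableOn hiS.integrableOn]
    ring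
  rw [hdec]
  calc _ ≤ C₃ * (ε * X ^ (4 - c) / Real.log X) + C₂ * (ε * X ^ (4 - c) / Real.log X) +
        C₁ * (ε * X ^ (4 - c) / Real.log X) + C₄ * (ε * X ^ (4 - c) / Real.log X) :=
      (norm_sub_le _ _).trans (add_le_add ((norm_add_le _ _).trans (add_le_add
        ((norm_add_le _ _).trans (add_le_add (h3 X N ε hX3' hε0) (h2 X N ε hX2 hε0)))
        (h1 X N ε hX1 hε))) (h4 X N ε hX3 hε0))
    _ = _ := by ring

lemma integral_ee_mul_integral_ee {α β : Type*} [MeasurableSpace α] [MeasurableSpace β]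
    (μ : MeasureTheory.Measure α) (ν : MeasureTheory.Measure β) [MeasureTheory.SFinite μ]
    [MeasureTheory.SFinite ν] (W G : α → ℝ) (w g : β → ℝ) (x : ℝ) :
    (∫ a, (W a : ℂ) * ee (x * G a) ∂μ) * (∫ b, (w b : ℂ) * ee (x * g b) ∂ν) =
      ∫ z : α × β, ((W z.1 * w z.2 : ℝ) : ℂ) * ee (x * (G z.1 + g z.2)) ∂(μ.prod ν) := by
  rw [← MeasureTheory.integral_prod_mul]
  refine MeasureTheory.integral_congr_ae (Filter.Eventually.of_forall fun z => ?_)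
  simp only
  rw [mul_add x, ee_add]
  push_cast
  ring

lemma IsKernel.integral_integral_mul_countKernel {ψ : ℝ → ℝ} {Ψ : ℝ → ℂ} (h : IsKernel ψ Ψ)
    {α : Type*} [MeasurableSpace α] (μ : MeasureTheory.Measure α) [MeasureTheory.SFinite μ]
    {W G : α → ℝ} (hW : MeasureTheory.Integrable W μ) (hG : Measurable G) {ε : ℝ} (hε : 0 < ε)
    (N : ℝ) :
    ∫ x : ℝ, (∫ a, (W a : ℂ) * ee (x * G a) ∂μ) * countKernel Ψ ε N x =
      ((∫ a, W a * ψ ((G a - N) / ε) ∂μ : ℝ) : ℂ) := by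
  have hint : MeasureTheory.Integrable (Function.uncurry fun (x : ℝ) (a : α) =>
      ee (x * G a) * (countKernel Ψ ε N x * (W a : ℂ))) (MeasureTheory.volume.prod μ) := by
    refine ((h.integrable_countKernel hε N).mul_prod hW.ofReal).bdd_mul (c := 1)
      (f := fun z : ℝ × α => ee (z.1 * G z.2)) ?_
      (Filter.Eventually.of_forall fun z => (norm_ee _).le)
    exact (continuous_ee.measurable.comp
      (measurable_fst.mul (hG.comp measurable_snd))).aestronglyMeasurable
  calc _ = ∫ x : ℝ, ∫ a, ee (x * G a) * (countKernel Ψ ε N x * (W a : ℂ)) ∂μ := by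
        refine MeasureTheory.integral_congr_ae (Filter.Eventually.of_forall fun x => ?_)
        simp only
        rw [← MeasureTheory.integral_mul_const]
        refine MeasureTheory.integral_congr_ae (Filter.Eventually.of_forall fun a => ?_)
        simp only
        ring
    _ = ∫ a, (∫ x : ℝ, ee (x * G a) * (countKernel Ψ ε N x * (W a : ℂ))) ∂μ :=
        MeasureTheory.integral_integral_swap hint
    _ = ∫ a, ((W a * ψ ((G a - N) / ε) : ℝ) : ℂ) ∂μ := by
        refine MeasureTheory.integral_congr_ae (Filter.Eventually.of_forall fun a => ?_)
        simp only
        rw [Complex.ofReal_mul, ← h.integral_ee_mul_countKernel hε, mul_comm,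
          ← MeasureTheory.integral_mul_const]
        refine MeasureTheory.integral_congr_ae (Filter.Eventually.of_forall fun x => ?_)
        simp only
        ring
    _ = _ := integral_complex_ofReal

lemma abs_rpow_sub_rpow_le {c : ℝ} (hc : 1 < c) (hc2 : c < 2) {X x y : ℝ} (hX : 0 < X)
    (hx : X ≤ x) (hx2 : x ≤ 2 * X) (hy : X ≤ y) (hy2 : y ≤ 2 * X) :
    |x ^ c - y ^ c| ≤ 4 * X ^ (c - 1) * |x - y| := by
  have key : ∀ u v : ℝ, X ≤ u → u ≤ v → v ≤ 2 * X →
      |u ^ c - v ^ c| ≤ 4 * X ^ (c - 1) * |u - v| := by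
    intro u v hu huv hv
    have hu0 : 0 < u := hX.trans_le hu
    rw [abs_sub_comm u, abs_of_nonneg (sub_nonneg.2 huv), abs_sub_comm,
      abs_of_nonneg (sub_nonneg.2 (Real.rpow_le_rpow hu0.le huv (by linarith)))]
    refine (rpow_sub_rpow_upper hc hu0 huv).trans ?_
    have h1 : v ^ (c - 1) ≤ 2 * X ^ (c - 1) := by
      calc v ^ (c - 1) ≤ (2 * X) ^ (c - 1) :=
            Real.rpow_le_rpow (by linarith) hv (by linarith)
        _ = 2 ^ (c - 1) * X ^ (c - 1) := Real.mul_rpow (by norm_num) hX.le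
        _ ≤ 2 ^ (1 : ℝ) * X ^ (c - 1) := by
            gcongr
            · norm_num
            · linarith
        _ = _ := by rw [Real.rpow_one]
    have h2 : c * v ^ (c - 1) ≤ 4 * X ^ (c - 1) := by
      have : 0 ≤ v ^ (c - 1) := Real.rpow_nonneg (by linarith) _
      nlinarith
    exact mul_le_mul_of_nonneg_right h2 (sub_nonneg.2 huv)
  rcases le_total x y with hxy | hxy
  · exact key x y hx hxy hy2
  · rw [abs_sub_comm, abs_sub_comm x]
    exact key y x hy hxy hx2

lemma IsKernel.integrable_cutoff_mul {ψ : ℝ → ℝ} {Ψ : ℝ → ℂ} (h : IsKernel ψ Ψ) {φ : ℝ → ℝ}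
    (hφ : IsCutoff φ) {c : ℝ} (hc : 0 ≤ c) {X : ℝ} (hX : 0 < X) (ε s : ℝ) :
    MeasureTheory.Integrable fun t : ℝ => φ (t / X) * ψ ((t ^ c - s) / ε) := by
  have h1 := hφ.contDiff.continuous
  have h2 := h.continuous
  have h3 : Continuous fun t : ℝ => t ^ c := Real.continuous_rpow_const hc
  refine (by fun_prop : Continuous _).integrable_of_hasCompactSupport ?_
  refine HasCompactSupport.intro (isCompact_Icc (a := X) (b := 2 * X)) fun t ht => ?_
  rw [Set.mem_Icc, not_and_or, not_le, not_le] at ht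
  rw [hφ.eq_zero_div hX (ht.imp le_of_lt le_of_lt), zero_mul]

lemma IsKernel.le_integral_cutoff_mul {ψ : ℝ → ℝ} {Ψ : ℝ → ℂ} (h : IsKernel ψ Ψ) {φ : ℝ → ℝ}
    (hφ : IsCutoff φ) {c : ℝ} (hc : 1 < c) (hc2 : c < 2) {τ η X ε s : ℝ} (hη : 0 < η)
    (hτ : 1 + η ≤ τ) (hτ2 : τ + η ≤ 2) (h1 : ∀ u, |u - τ| ≤ η → φ u = 1) (hX : 0 < X)
    (hε : 0 < ε) (hεX : ε * X ^ (1 - c) / 8 ≤ η / 2 * X)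
    (hs : |s - (τ * X) ^ c| ≤ η / 2 * X ^ c) :
    ε * X ^ (1 - c) / 8 ≤ ∫ t : ℝ, φ (t / X) * ψ ((t ^ c - s) / ε) := by
  set κ := ε * X ^ (1 - c) / 8 with hκ
  have hκ0 : 0 < κ := by positivity
  have hXc : X ^ c = X ^ (c - 1) * X := by
    rw [← Real.rpow_add_one hX.ne', sub_add_cancel]
  have hXc0 : 0 < X ^ (c - 1) := Real.rpow_pos_of_pos hX _
  have hτX : X ≤ τ * X := le_mul_of_one_le_left hX.le (by linarith)
  have hsX : X ^ c ≤ s := by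
    have := rpow_sub_rpow_lower hc hX le_rfl hτX
    have h2 := (abs_le.1 hs).1
    have h3 : η * X ^ c ≤ X ^ (c - 1) * (τ * X - X) := by
      rw [hXc]
      have : 0 ≤ X ^ (c - 1) * X * (τ - 1 - η) := by
        have : 0 ≤ τ - 1 - η := by linarith
        positivity
      linarith
    have : 0 < η * X ^ c := by positivity
    linarith
  have hs0 : 0 < s := (Real.rpow_pos_of_pos hX c).trans_le hsX
  set T := s ^ c⁻¹ with hT
  have hTc : T ^ c = s := Real.rpow_inv_rpow hs0.le (by linarith)
  have hTX : X ≤ T := (Real.le_rpow_inv_iff_of_pos hX.le hs0.le (by linarith)).2 hsX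
  have hTτ : |T - τ * X| ≤ η / 2 * X := by
    have := abs_sub_mul_le_rpow_sub hc hX hTX hτX
    rw [hTc] at this
    have h3 := this.trans hs
    rw [hXc] at h3
    refine le_of_mul_le_mul_left (h3.trans_eq ?_) hXc0
    ring
  have hval : ∀ t ∈ Set.Icc T (T + κ), 1 ≤ φ (t / X) * ψ ((t ^ c - s) / ε) := by
    intro t ht
    have hd := abs_le.1 hTτ
    have ht1 : |t - τ * X| ≤ η * X := abs_le.2 ⟨by linarith [ht.1], by linarith [ht.2]⟩
    have hφ1 : φ (t / X) = 1 := by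
      refine h1 _ ?_
      rw [show t / X - τ = (t - τ * X) / X by field_simp, abs_div, abs_of_pos hX,
        div_le_iff₀ hX]
      exact ht1
    have ht2 : t ≤ 2 * X := by
      have := (abs_le.1 ht1).2
      nlinarith
    have hT2 : T ≤ 2 * X := ht.1.trans ht2
    have hψ : ψ ((t ^ c - s) / ε) = 1 := by
      refine h.eq_one _ ?_
      rw [abs_div, abs_of_pos hε, div_le_iff₀ hε, ← hTc]
      refine (abs_rpow_sub_rpow_le hc hc2 hX (hTX.trans ht.1) ht2 hTX hT2).trans ?_
      have h4 : |t - T| ≤ κ := by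
        rw [abs_of_nonneg (by linarith [ht.1])]
        linarith [ht.2]
      calc 4 * X ^ (c - 1) * |t - T| ≤ 4 * X ^ (c - 1) * κ := by gcongr
        _ = ε * (X ^ (c - 1) * X ^ (1 - c)) / 2 := by rw [hκ]; ring
        _ = 1 / 2 * ε := by
            rw [← Real.rpow_add hX]
            simp
            ring
    rw [hφ1, hψ, mul_one]
  have hint := h.integrable_cutoff_mul hφ (by linarith : 0 ≤ c) hX ε s
  have hge := MeasureTheory.setIntegral_ge_of_const_le_real measurableSet_Icc
    (measure_Icc_lt_top (a := T) (b := T + κ)).ne hval hint.integrableOn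
  rw [Real.volume_real_Icc_of_le (by linarith), one_mul, add_sub_cancel_left] at hge
  exact hge.trans (MeasureTheory.setIntegral_le_integral hint
    (Filter.Eventually.of_forall fun t => mul_nonneg (hφ.nonneg _) (h.nonneg _)))

/-- Lower bound for the main term. -/
lemma IsKernel.le_integral_smoothInt {ψ : ℝ → ℝ} {Ψ : ℝ → ℂ} (h : IsKernel ψ Ψ) {φ : ℝ → ℝ}
    (hφ : IsCutoff φ) {c : ℝ} (hc : 1 < c) (hc2 : c < 2) {τ η : ℝ} (hη : 0 < η)
    (hτ : 1 + η ≤ τ) (hτ2 : τ + η ≤ 2) (h1 : ∀ u, |u - τ| ≤ η → φ u = 1) {X ε : ℝ}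
    (hX : 1 ≤ X) (hXη : 1 / η ≤ X) (hε : 0 < ε) (hε1 : ε ≤ 1) :
    (η / 12) ^ 3 / 8 * (ε * X ^ (4 - c)) ≤
      (∫ x : ℝ, smoothInt φ c X x ^ 4 * countKernel Ψ ε (4 * (τ * X) ^ c) x).re := by
  have hX0 : 0 < X := by linarith
  have hc0 : 0 ≤ c := by linarith
  set N := 4 * (τ * X) ^ c with hN
  let w : ℝ → ℝ := fun t => φ (t / X)
  let W : (ℝ × ℝ) × ℝ → ℝ := fun r => w r.1.1 * w r.1.2 * w r.2
  let G : (ℝ × ℝ) × ℝ → ℝ := fun r => r.1.1 ^ c + r.1.2 ^ c + r.2 ^ c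
  let μ : MeasureTheory.Measure ((ℝ × ℝ) × ℝ) :=
    (MeasureTheory.volume.prod MeasureTheory.volume).prod MeasureTheory.volume
  have hrpow : Continuous fun t : ℝ => t ^ c := Real.continuous_rpow_const hc0
  have hwc : Continuous w := hφ.contDiff.continuous.comp (continuous_id.div_const X)
  have hw : MeasureTheory.Integrable w := by
    refine hwc.integrable_of_hasCompactSupport ?_
    refine HasCompactSupport.intro (isCompact_Icc (a := X) (b := 2 * X)) fun t ht => ?_
    rw [Set.mem_Icc, not_and_or, not_le, not_le] at ht
    exact hφ.eq_zero_div hX0 (ht.imp le_of_lt le_of_lt)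
  have hWi : MeasureTheory.Integrable W μ := (hw.mul_prod hw).mul_prod hw
  have hW4 : MeasureTheory.Integrable (fun z : ((ℝ × ℝ) × ℝ) × ℝ => W z.1 * w z.2)
      (μ.prod MeasureTheory.volume) := hWi.mul_prod hw
  have hGc : Continuous G := by fun_prop
  have hG4 : Continuous fun z : ((ℝ × ℝ) × ℝ) × ℝ => G z.1 + z.2 ^ c :=
    (hGc.comp continuous_fst).add (hrpow.comp continuous_snd)
  have hI4 : ∀ x, smoothInt φ c X x ^ 4 = ∫ z, ((W z.1 * w z.2 : ℝ) : ℂ) *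
      ee (x * (G z.1 + z.2 ^ c)) ∂(μ.prod MeasureTheory.volume) := by
    intro x
    rw [← integral_ee_mul_integral_ee μ MeasureTheory.volume W G w (fun t => t ^ c),
      ← integral_ee_mul_integral_ee (MeasureTheory.volume.prod MeasureTheory.volume)
        MeasureTheory.volume (fun p : ℝ × ℝ => w p.1 * w p.2) (fun p => p.1 ^ c + p.2 ^ c) w
        (fun t => t ^ c),
      ← integral_ee_mul_integral_ee MeasureTheory.volume MeasureTheory.volume w
        (fun t => t ^ c) w (fun t => t ^ c)]
    simp only [smoothInt, w]
    ring
  simp only [hI4]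
  rw [h.integral_integral_mul_countKernel (μ.prod MeasureTheory.volume) hW4 hG4.measurable hε,
    Complex.ofReal_re]
  have hF : MeasureTheory.Integrable (fun z : ((ℝ × ℝ) × ℝ) × ℝ =>
      W z.1 * w z.2 * ψ ((G z.1 + z.2 ^ c - N) / ε)) (μ.prod MeasureTheory.volume) := by
    refine hW4.mul_bdd (c := 1) ?_ (Filter.Eventually.of_forall fun z => ?_)
    · exact (h.continuous.comp ((hG4.sub continuous_const).div_const ε)).aestronglyMeasurable
    · rw [Real.norm_of_nonneg (h.nonneg _)]
      exact h.le_one _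
  rw [MeasureTheory.integral_prod _ hF]
  have hnn : ∀ r, 0 ≤ ∫ t, W r * w t * ψ ((G r + t ^ c - N) / ε) := fun r =>
    MeasureTheory.integral_nonneg fun t => mul_nonneg (mul_nonneg (mul_nonneg (mul_nonneg
      (hφ.nonneg _) (hφ.nonneg _)) (hφ.nonneg _)) (hφ.nonneg _)) (h.nonneg _)
  set J := Set.Icc (τ * X - η / 24 * X) (τ * X + η / 24 * X) with hJ
  set B : Set ((ℝ × ℝ) × ℝ) := (J ×ˢ J) ×ˢ J with hB
  have hJvol : (MeasureTheory.volume : MeasureTheory.Measure ℝ).real J = η / 12 * X := by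
    rw [hJ, Real.volume_real_Icc_of_le (by linarith [show 0 ≤ η / 24 * X by positivity])]
    ring
  have hBvol : μ.real B = (η / 12 * X) ^ 3 := by
    rw [hB, MeasureTheory.measureReal_prod_prod, MeasureTheory.measureReal_prod_prod, hJvol]
    ring
  have hBne : μ B ≠ ⊤ := by
    rw [hB, MeasureTheory.Measure.prod_prod, MeasureTheory.Measure.prod_prod]
    have : (MeasureTheory.volume : MeasureTheory.Measure ℝ) J ≠ ⊤ := measure_Icc_lt_top.ne
    exact ENNReal.mul_ne_top (ENNReal.mul_ne_top this this) this
  have hBmeas : MeasurableSet B := (measurableSet_Icc.prod measurableSet_Icc).prod measurableSet_Icc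
  have hJw : ∀ t ∈ J, w t = 1 := by
    intro t ht
    refine h1 _ ?_
    have : |t - τ * X| ≤ η / 24 * X := abs_le.2 ⟨by linarith [ht.1], by linarith [ht.2]⟩
    rw [show t / X - τ = (t - τ * X) / X by field_simp, abs_div, abs_of_pos hX0,
      div_le_iff₀ hX0]
    nlinarith
  have hJc : ∀ t ∈ J, |t ^ c - (τ * X) ^ c| ≤ η / 6 * X ^ c := by
    intro t ht
    have h2 : |t - τ * X| ≤ η / 24 * X := abs_le.2 ⟨by linarith [ht.1], by linarith [ht.2]⟩
    have hXc : X ^ c = X ^ (c - 1) * X := by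
      rw [← Real.rpow_add_one hX0.ne', sub_add_cancel]
    calc |t ^ c - (τ * X) ^ c| ≤ 4 * X ^ (c - 1) * |t - τ * X| :=
          abs_rpow_sub_rpow_le hc hc2 hX0 (by nlinarith [ht.1]) (by nlinarith [ht.2])
            (by nlinarith) (by nlinarith)
      _ ≤ 4 * X ^ (c - 1) * (η / 24 * X) := by gcongr
      _ = _ := by rw [hXc]; ring
  have hinner : ∀ r ∈ B, ε * X ^ (1 - c) / 8 ≤ ∫ t, W r * w t * ψ ((G r + t ^ c - N) / ε) := by
    rintro ⟨⟨t₁, t₂⟩, t₃⟩ ⟨⟨ht₁, ht₂⟩, ht₃⟩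
    have hW1 : W ((t₁, t₂), t₃) = 1 := by
      simp only [W]
      rw [hJw t₁ ht₁, hJw t₂ ht₂, hJw t₃ ht₃]
      norm_num
    have key := h.le_integral_cutoff_mul hφ hc hc2 (τ := τ) (η := η) (X := X) (ε := ε)
      (s := N - G ((t₁, t₂), t₃)) hη hτ hτ2 h1 hX0 hε ?_ ?_
    · refine key.trans_eq (MeasureTheory.integral_congr_ae (Filter.Eventually.of_forall fun t => ?_))
      simp only [hW1, one_mul, w]
      congr 3
      ring
    · have e1 : X ^ (1 - c) ≤ 1 := Real.rpow_le_one_of_one_le_of_nonpos hX (by linarith)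
      have e2 : ε * X ^ (1 - c) ≤ 1 := mul_le_one₀ hε1 (by positivity) e1
      rw [div_le_iff₀ hη] at hXη
      nlinarith
    · have a1 := abs_le.1 (hJc t₁ ht₁)
      have a2 := abs_le.1 (hJc t₂ ht₂)
      have a3 := abs_le.1 (hJc t₃ ht₃)
      simp only [G, hN]
      rw [abs_le]
      constructor <;> linarith [a1.1, a1.2, a2.1, a2.2, a3.1, a3.2]
  have hge := MeasureTheory.setIntegral_ge_of_const_le_real hBmeas hBne hinner
    hF.integral_prod_left.integrableOn
  refine (le_of_eq ?_).trans (hge.trans (MeasureTheory.setIntegral_le_integral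
    hF.integral_prod_left (Filter.Eventually.of_forall hnn)))
  rw [hBvol, show (4 - c : ℝ) = (1 - c) + (3 : ℕ) by push_cast; ring, Real.rpow_add hX0,
    Real.rpow_natCast]
  ring

lemma exists_isCutoff {τ : ℝ} (h1 : 1 < τ) (h2 : τ < 2) : ∃ (φ : ℝ → ℝ) (η : ℝ), IsCutoff φ ∧
    0 < η ∧ 1 + η ≤ τ ∧ τ + η ≤ 2 ∧ ∀ u, |u - τ| ≤ η → φ u = 1 := by
  set η := min (τ - 1) (2 - τ) / 4 with hη
  have hη0 : 0 < η := by
    have : 0 < min (τ - 1) (2 - τ) := lt_min (by linarith) (by linarith)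
    positivity
  have ha : 4 * η ≤ τ - 1 := by
    rw [hη]
    linarith [min_le_left (τ - 1) (2 - τ)]
  have hb : 4 * η ≤ 2 - τ := by
    rw [hη]
    linarith [min_le_right (τ - 1) (2 - τ)]
  let b : ContDiffBump τ := ⟨η, 2 * η, hη0, by linarith⟩
  refine ⟨b, η, ⟨b.contDiff, fun t => b.nonneg, fun t => b.le_one, τ - 2 * η, τ + 2 * η,
    by linarith, by linarith, fun t ht => b.zero_of_le_dist ?_⟩, hη0, by linarith, by linarith,
    fun u hu => b.one_of_mem_closedBall (by simpa [b, Real.dist_eq] using hu)⟩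
  change 2 * η ≤ dist t τ
  rw [Real.dist_eq]
  by_contra hcon
  rw [not_le, abs_lt] at hcon
  exact ht ⟨by linarith [hcon.1], by linarith [hcon.2]⟩

theorem weighted_count_lower_bound
    (c : ℝ) (hc1 : 1 < c) (hc2 : c < 1193 / 889) :
    ∃ C : ℝ, 0 < C ∧ ∃ N₀ : ℝ, 0 < N₀ ∧ ∀ N : ℝ, N₀ ≤ N →
      ∀ X ε : ℝ, X = (1 / 2) * (2 * N / 5) ^ (1 / c) → ε = ((Real.log X) ^ 2)⁻¹ →
        C * X ^ (4 - c) * ((Real.log X) ^ 2)⁻¹ ≤ B₄ c X ε N := by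
  have hc0 : 0 < c := by linarith
  set τ : ℝ := 2 * (5 / 8) ^ c⁻¹ with hτ
  have hτ0 : 0 < τ := by positivity
  have hτc : τ ^ c = 2 ^ c * (5 / 8) := by
    rw [hτ, Real.mul_rpow (by norm_num) (by positivity), Real.rpow_inv_rpow (by norm_num) hc0.ne']
  have h2c : (2 : ℝ) < 2 ^ c := by
    conv_lhs => rw [← Real.rpow_one 2]
    exact Real.rpow_lt_rpow_of_exponent_lt (by norm_num) hc1
  have hτ1 : 1 < τ := by
    rw [← Real.rpow_lt_rpow_iff zero_le_one hτ0.le hc0, hτc, Real.one_rpow]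
    linarith
  have hτ2 : τ < 2 := by
    rw [← Real.rpow_lt_rpow_iff hτ0.le zero_le_two hc0, hτc]
    linarith
  obtain ⟨φ, η, hφ, hη, hη1, hη2, hone⟩ := exists_isCutoff hτ1 hτ2
  obtain ⟨ψ, Ψ, hK⟩ := exists_isKernel
  obtain ⟨E, hE, X₁, hX₁, herr⟩ := hK.norm_integral_primeSum_sub_smoothInt_le hc1 hc2 hφ
  set C₀ := (η / 12) ^ 3 / 8 with hC₀
  have hC₀0 : 0 < C₀ := by positivity
  set X₀ := max X₁ (max (1 / η) (Real.exp (2 * E / C₀))) with hX₀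
  have hX₀0 : 0 < X₀ := by linarith [le_max_left X₁ (max (1 / η) (Real.exp (2 * E / C₀)))]
  refine ⟨C₀ / 2, by positivity, 5 / 2 * (2 * X₀) ^ c, by positivity, fun N hN X ε hX hε => ?_⟩
  have hN0 : 0 < N := lt_of_lt_of_le (by positivity) hN
  have hXX₀ : X₀ ≤ X := by
    have : 2 * X₀ ≤ (2 * N / 5) ^ c⁻¹ :=
      (Real.le_rpow_inv_iff_of_pos (by positivity) (by positivity) hc0).2 (by linarith)
    rw [hX, one_div c]
    linarith
  have hX0 : 0 < X := hX₀0.trans_le hXX₀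
  have hNX : N = 4 * (τ * X) ^ c := by
    have h2X : (2 * X) ^ c = 2 * N / 5 := by
      rw [hX, one_div c, ← mul_assoc, mul_one_div_cancel two_ne_zero, one_mul,
        Real.rpow_inv_rpow (by positivity) hc0.ne']
    rw [Real.mul_rpow hτ0.le hX0.le, hτc, mul_right_comm, ← Real.mul_rpow zero_le_two hX0.le, h2X]
    ring
  simp only [hX₀, max_le_iff] at hXX₀
  obtain ⟨hXX₁, hXη, hXE⟩ := hXX₀
  have hX3 : 3 ≤ X := hX₁.trans hXX₁
  have hL1 : 1 ≤ Real.log X := one_le_log_of_three_le (by linarith)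
  have hL0 : 0 < Real.log X := by linarith
  have hLE : E / Real.log X ≤ C₀ / 2 := by
    rw [← Real.le_log_iff_exp_le hX0, div_le_iff₀ hC₀0] at hXE
    rw [div_le_iff₀ hL0]
    linarith
  have hε0 : 0 < ε := by rw [hε]; positivity
  have hε1 : ε ≤ 1 := by rw [hε]; exact inv_le_one_of_one_le₀ (one_le_pow₀ hL1)
  have hmain := hK.le_integral_smoothInt hφ hc1 (by linarith : c < 2) hη hη1 hη2 hone
    (by linarith : 1 ≤ X) hXη hε0 hε1
  rw [← hNX, ← hC₀] at hmain
  have hcount := re_integral_primeSum_le hK hφ c hX0.le hε0 N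
  have hdiff := (Complex.abs_re_le_norm _).trans (herr X N ε hXX₁ hε)
  rw [Complex.sub_re] at hdiff
  have hfin : E * (ε * X ^ (4 - c) / Real.log X) ≤ C₀ / 2 * (ε * X ^ (4 - c)) := by
    calc _ = E / Real.log X * (ε * X ^ (4 - c)) := by ring
      _ ≤ _ := by gcongr
  rw [← hε]
  have := (abs_le.1 hdiff).1
  linarith
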